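/- Suppose H contains a sub-Hopf algebra T isomorphic to a Taft algebra T_{q′} of dimension p², and suppose there is a surjective Hopf algebra map π: H → T_q onto a Taft algebra of dimension p². Then H contains no simple subcoalgebra of dimension 4. -/

import Mathlib

open TensorProduct

namespace HopfClass

variable (k : Type*) [Field k]

section Wrt

variable {M : Type*} [AddCommGroup M] [Module k M]

/-- A subspace `C` is a subcoalgebra with respect to a comultiplication-like map `Δ`
if `Δ` maps `C` into the image of `C ⊗ C` in `M ⊗ M`. -/
def IsSubcoalgWrt (Δ : M →ₗ[k] M ⊗[k] M) (C : Submodule k M) : Prop :=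
  ∀ x ∈ C, Δ x ∈ LinearMap.range (TensorProduct.map C.subtype C.subtype)

/-- A simple subcoalgebra: a nonzero subcoalgebra with no nonzero proper subcoalgebras. -/
def IsSimpleSubcoalgWrt (Δ : M →ₗ[k] M ⊗[k] M) (C : Submodule k M) : Prop :=
  IsSubcoalgWrt k Δ C ∧ C ≠ ⊥ ∧
    ∀ D : Submodule k M, IsSubcoalgWrt k Δ D → D < C → D = ⊥

/-- Pointedness: every simple subcoalgebra is one-dimensional. -/
def IsPointedWrt (Δ : M →ₗ[k] M ⊗[k] M) : Prop :=
  ∀ C : Submodule k M, IsSimpleSubcoalgWrt k Δ C → Module.finrank k C = 1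

/-- Grouplike element with respect to `Δ`. -/
def IsGrouplikeWrt (Δ : M →ₗ[k] M ⊗[k] M) (g : M) : Prop :=
  g ≠ 0 ∧ Δ g = g ⊗ₜ[k] g

/-- `y` is a `(h, g)`-skew-primitive with respect to `Δ`, i.e. `Δ y = g ⊗ y + y ⊗ h`. -/
def IsSkewPrimitiveWrt (Δ : M →ₗ[k] M ⊗[k] M) (g h y : M) : Prop :=
  Δ y = g ⊗ₜ[k] y + y ⊗ₜ[k] h

/-- There are no nontrivial skew-primitive elements: every skew-primitive between grouplikes
is a scalar multiple of the difference of the grouplikes. -/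
def HasNoNontrivialSkewPrimitivesWrt (Δ : M →ₗ[k] M ⊗[k] M) : Prop :=
  ∀ g h y : M, IsGrouplikeWrt k Δ g → IsGrouplikeWrt k Δ h →
    IsSkewPrimitiveWrt k Δ g h y → ∃ c : k, y = c • (g - h)

end Wrt

section Coalg

variable (H : Type*) [AddCommGroup H] [Module k H] [Coalgebra k H]

/-- The comultiplication of a coalgebra, as a linear map. -/
noncomputable abbrev comulL : H →ₗ[k] H ⊗[k] H := CoalgebraStruct.comul

/-- The coradical of a coalgebra: the sum of all its simple subcoalgebras. -/
noncomputable def coradical : Submodule k H :=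
  sSup {C : Submodule k H | IsSimpleSubcoalgWrt k (comulL k H) C}

/-- A coalgebra is cosemisimple if it equals its coradical. -/
def IsCosemisimple : Prop := coradical k H = ⊤

/-- A coalgebra is pointed if all its simple subcoalgebras are one-dimensional. -/
def IsPointed : Prop := IsPointedWrt k (comulL k H)

/-- The set of grouplike elements. -/
def grouplikes : Set H := {g : H | IsGrouplikeWrt k (comulL k H) g}

/-- `e` is a multiplicative matrix of size `n` spanning the subspace `C`, i.e. a
linearly independent family with `Δ(e i j) = ∑ l, e i l ⊗ e l j` and `ε(e i j) = δ_ij`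
whose span is `C`; this says precisely that `C` is a simple matrix subcoalgebra
isomorphic to `M*(n,k)`, the dual of the `n × n` matrix algebra. -/
def IsMultMatrix (n : ℕ) (C : Submodule k H) (e : Fin n → Fin n → H) : Prop :=
  LinearIndependent k (fun p : Fin n × Fin n => e p.1 p.2) ∧
  C = Submodule.span k (Set.range fun p : Fin n × Fin n => e p.1 p.2) ∧
  (∀ i j, CoalgebraStruct.comul (R := k) (e i j) = ∑ l : Fin n, e i l ⊗ₜ[k] e l j) ∧
  (∀ i j, Coalgebra.counit (R := k) (e i j) = if i = j then (1 : k) else 0)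

/-- `C` is a (simple matrix) subcoalgebra isomorphic to the matrix coalgebra `M*(n,k)`. -/
def IsMatrixSubcoalg (n : ℕ) (C : Submodule k H) : Prop :=
  ∃ e : Fin n → Fin n → H, IsMultMatrix k H n C e

end Coalg

section Dual

variable (H : Type*) [Ring H] [Algebra k H] [FiniteDimensional k H]

/-- The comultiplication on the dual of a finite-dimensional algebra:
the dual map of the multiplication, composed with the canonical identification
`(H ⊗ H)* ≃ H* ⊗ H*`. -/
noncomputable def dualComul :
    Module.Dual k H →ₗ[k] Module.Dual k H ⊗[k] Module.Dual k H :=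
  (TensorProduct.dualDistribEquiv k H H).symm.toLinearMap ∘ₗ
    (LinearMap.mul' k H).dualMap

/-- A finite-dimensional Hopf algebra is copointed if its dual is pointed. -/
def IsCopointed : Prop := IsPointedWrt k (dualComul k H)

/-- The grouplike elements of the dual Hopf algebra. -/
def dualGrouplikes : Set (Module.Dual k H) :=
  {f : Module.Dual k H | IsGrouplikeWrt k (dualComul k H) f}

end Dual

section Taft

variable (p : ℕ) (q : k)

/-- `B` is (isomorphic to) the Taft Hopf algebra `T_q` of dimension `p²`: `q` is a primitive
`p`-th root of unity, `B` has dimension `p²` and is generated as an algebra by a grouplike `g`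
and a `(1,g)`-skew-primitive `x` with `g^p = 1`, `x^p = 0` and `g x = q x g`. -/
def IsTaftAlgebra (B : Type*) [Ring B] [Bialgebra k B] : Prop :=
  IsPrimitiveRoot q p ∧ Module.finrank k B = p ^ 2 ∧
  ∃ g x : B,
    IsGrouplikeWrt k (comulL k B) g ∧
    CoalgebraStruct.comul (R := k) x = x ⊗ₜ[k] (1 : B) + g ⊗ₜ[k] x ∧
    g ^ p = 1 ∧ x ^ p = 0 ∧ g * x = q • (x * g) ∧
    Algebra.adjoin k {g, x} = (⊤ : Subalgebra k B)

variable {H : Type*} [Ring H] [Bialgebra k H]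

/-- The subalgebra `T` of `H` is a sub-Hopf algebra isomorphic to the Taft algebra `T_q` of
dimension `p²`, generated by a grouplike `g` and a `(1,g)`-skew-primitive `x` satisfying the
Taft relations. -/
def IsTaftSubalgebra (T : Subalgebra k H) : Prop :=
  IsPrimitiveRoot q p ∧ Module.finrank k T = p ^ 2 ∧
  ∃ g x : H,
    IsGrouplikeWrt k (comulL k H) g ∧
    CoalgebraStruct.comul (R := k) x = x ⊗ₜ[k] (1 : H) + g ⊗ₜ[k] x ∧
    g ^ p = 1 ∧ x ^ p = 0 ∧ g * x = q • (x * g) ∧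
    Algebra.adjoin k {g, x} = T

/-- The right coinvariants `H^{co π}` of a linear map `π : H → B` on a bialgebra `H`:
elements `h` with `(id ⊗ π)(Δ h) = h ⊗ 1`. -/
def rightCoinvariants {B : Type*} [Ring B] [Bialgebra k B] (π : H →ₗ[k] B) : Set H :=
  {h : H | (TensorProduct.map LinearMap.id π) (CoalgebraStruct.comul (R := k) h)
      = h ⊗ₜ[k] (1 : B)}

end Taft

end HopfClass

set_option linter.unusedSectionVars false

namespace HopfFour

section Coalg

variable {k : Type*} [Field k] {C : Type*} [AddCommGroup C] [Module k C] [Coalgebra k C]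

/-- The right convolution operator `h ↦ h₁ φ(h₂)`. -/
noncomputable def rc (φ : C →ₗ[k] k) : C →ₗ[k] C :=
  (TensorProduct.rid k C).toLinearMap ∘ₗ φ.lTensor C ∘ₗ Coalgebra.comul

/-- The left convolution operator `h ↦ φ(h₁) h₂`. -/
noncomputable def lc (φ : C →ₗ[k] k) : C →ₗ[k] C :=
  (TensorProduct.lid k C).toLinearMap ∘ₗ φ.rTensor C ∘ₗ Coalgebra.comul

theorem rc_of_comul {ι : Type*} {s : Finset ι} {h : C} {x y : ι → C}
    (e : Coalgebra.comul (R := k) h = ∑ i ∈ s, x i ⊗ₜ[k] y i) (φ : C →ₗ[k] k) :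
    rc φ h = ∑ i ∈ s, φ (y i) • x i := by
  simp [rc, e]

theorem lc_of_comul {ι : Type*} {s : Finset ι} {h : C} {x y : ι → C}
    (e : Coalgebra.comul (R := k) h = ∑ i ∈ s, x i ⊗ₜ[k] y i) (φ : C →ₗ[k] k) :
    lc φ h = ∑ i ∈ s, φ (x i) • y i := by
  simp [lc, e]

theorem exists_comul (h : C) : ∃ (s : Finset (C × C)),
    Coalgebra.comul (R := k) h = ∑ i ∈ s, i.1 ⊗ₜ[k] i.2 :=
  TensorProduct.exists_finset _

theorem rc_lc (φ ψ : C →ₗ[k] k) (h : C) : rc φ (lc ψ h) = lc ψ (rc φ h) := by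
  have key := Coalgebra.coassoc_apply (R := k) h
  let G : C ⊗[k] (C ⊗[k] C) →ₗ[k] C :=
    TensorProduct.lift ((LinearMap.lsmul k (C ⊗[k] C →ₗ[k] C)).flip
      ((TensorProduct.rid k C).toLinearMap ∘ₗ φ.lTensor C) ∘ₗ ψ)
  have hG : ∀ a b c, G (a ⊗ₜ (b ⊗ₜ c)) = (ψ a * φ c) • b := by
    intro a b c; simp [G, mul_smul]
  obtain ⟨s, e⟩ := exists_comul (k := k) h
  have h1 : rc φ (lc ψ h) = G (Coalgebra.comul.lTensor C (Coalgebra.comul (R := k) h)) := by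
    rw [lc_of_comul e, e]
    simp only [map_sum, map_smul, LinearMap.lTensor_tmul]
    rfl
  have h2 : lc ψ (rc φ h) = G ((TensorProduct.assoc k C C C)
      (Coalgebra.comul.rTensor C (Coalgebra.comul (R := k) h))) := by
    rw [rc_of_comul e, e]
    simp only [map_sum, map_smul, LinearMap.rTensor_tmul]
    refine Finset.sum_congr rfl fun i _ => ?_
    obtain ⟨t, e'⟩ := exists_comul (k := k) i.1
    rw [lc_of_comul e', e']
    simp [TensorProduct.sum_tmul, hG, Finset.smul_sum, smul_smul, mul_comm]
  rw [h1, h2, key]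

@[simp] theorem rc_counit (h : C) : rc (Coalgebra.counit (R := k)) h = h := by
  simp [rc]

@[simp] theorem lc_counit (h : C) : lc (Coalgebra.counit (R := k)) h = h := by
  simp [lc]

theorem apply_rc (φ ψ : C →ₗ[k] k) (h : C) : φ (rc ψ h) = ψ (lc φ h) := by
  obtain ⟨s, e⟩ := exists_comul (k := k) h
  simp [rc_of_comul e, lc_of_comul e, mul_comm]

@[simp] theorem counit_rc (φ : C →ₗ[k] k) (h : C) : Coalgebra.counit (R := k) (rc φ h) = φ h := by
  rw [apply_rc, lc_counit]

@[simp] theorem counit_lc (φ : C →ₗ[k] k) (h : C) : Coalgebra.counit (R := k) (lc φ h) = φ h := by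
  rw [← apply_rc, rc_counit]

/-- The convolution product of functionals. -/
noncomputable def conv (φ ψ : C →ₗ[k] k) : C →ₗ[k] k := φ ∘ₗ rc ψ

theorem conv_apply (φ ψ : C →ₗ[k] k) (h : C) : conv φ ψ h = φ (rc ψ h) := rfl

theorem conv_apply' (φ ψ : C →ₗ[k] k) (h : C) : conv φ ψ h = ψ (lc φ h) := apply_rc _ _ _

theorem eq_of_forall_dual {V : Type*} [AddCommGroup V] [Module k V] {x y : V}
    (h : ∀ φ : V →ₗ[k] k, φ x = φ y) : x = y := by
  rw [← sub_eq_zero, ← Module.forall_dual_apply_eq_zero_iff k]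
  intro φ
  rw [map_sub, h, sub_self]

theorem rc_rc (φ ψ : C →ₗ[k] k) (h : C) : rc φ (rc ψ h) = rc (conv φ ψ) h := by
  refine eq_of_forall_dual (k := k) fun θ => ?_
  rw [apply_rc, ← rc_lc, apply_rc θ, conv_apply]

theorem lc_lc (φ ψ : C →ₗ[k] k) (h : C) : lc φ (lc ψ h) = lc (conv ψ φ) h := by
  refine eq_of_forall_dual (k := k) fun θ => ?_
  rw [← apply_rc, rc_lc, ← apply_rc (conv ψ φ) θ, conv_apply']

theorem conv_assoc (φ ψ θ : C →ₗ[k] k) : conv (conv φ ψ) θ = conv φ (conv ψ θ) := by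
  ext h
  simp only [conv_apply, ← rc_rc]

@[simp] theorem conv_counit (φ : C →ₗ[k] k) : conv φ Coalgebra.counit = φ := by
  ext h; simp [conv_apply]

@[simp] theorem counit_conv (φ : C →ₗ[k] k) : conv Coalgebra.counit φ = φ := by
  ext h; simp [conv_apply]

theorem rc_add (φ ψ : C →ₗ[k] k) (h : C) : rc (φ + ψ) h = rc φ h + rc ψ h := by
  simp [rc, LinearMap.lTensor_add]

theorem lc_add (φ ψ : C →ₗ[k] k) (h : C) : lc (φ + ψ) h = lc φ h + lc ψ h := by
  simp [lc, LinearMap.rTensor_add]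

theorem rc_smul (c : k) (φ : C →ₗ[k] k) (h : C) : rc (c • φ) h = c • rc φ h := by
  simp [rc, LinearMap.lTensor_smul]

theorem lc_smul (c : k) (φ : C →ₗ[k] k) (h : C) : lc (c • φ) h = c • lc φ h := by
  simp [lc, LinearMap.rTensor_smul]

@[simp] theorem rc_zero (h : C) : rc (0 : C →ₗ[k] k) h = 0 := by simp [rc]

@[simp] theorem lc_zero (h : C) : lc (0 : C →ₗ[k] k) h = 0 := by simp [lc]

/-- Elements of `V ⊗ W` are separated by applying functionals on the first factor. -/
theorem tensor_eq_of_forall {V W : Type*} [AddCommGroup V] [Module k V] [AddCommGroup W]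
    [Module k W] {x y : V ⊗[k] W}
    (h : ∀ φ : V →ₗ[k] k, TensorProduct.lid k W (φ.rTensor W x) =
      TensorProduct.lid k W (φ.rTensor W y)) : x = y := by
  rw [← sub_eq_zero]
  set z := x - y with hz
  have h0 : ∀ φ : V →ₗ[k] k, TensorProduct.lid k W (φ.rTensor W z) = 0 := by
    intro φ; rw [hz, map_sub, map_sub, h, sub_self]
  classical
  let b := Module.Basis.ofVectorSpace k V
  refine (TensorProduct.equivFinsuppOfBasisLeft (N := W) b).map_eq_zero_iff.mp ?_
  refine Finsupp.ext fun i => ?_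
  rw [TensorProduct.equivFinsuppOfBasisLeft_apply]
  exact h0 (b.coord i)

theorem comul_eq_iff_lc {ι : Type*} {s : Finset ι} {h : C} {x y : ι → C} :
    Coalgebra.comul (R := k) h = ∑ i ∈ s, x i ⊗ₜ[k] y i ↔
      ∀ φ : C →ₗ[k] k, lc φ h = ∑ i ∈ s, φ (x i) • y i := by
  refine ⟨fun e φ => lc_of_comul e φ, fun H => tensor_eq_of_forall fun φ => ?_⟩
  have := H φ
  simp only [lc, LinearMap.comp_apply, LinearEquiv.coe_coe] at this
  rw [this]
  simp

/-- A left coideal. -/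
def IsLC (V : Submodule k C) : Prop := ∀ (φ : C →ₗ[k] k), ∀ v ∈ V, lc φ v ∈ V

/-- A subspace stable under all `rc φ`. -/
def IsRC (V : Submodule k C) : Prop := ∀ (φ : C →ₗ[k] k), ∀ v ∈ V, rc φ v ∈ V

variable {ι : Type*} [Fintype ι] [DecidableEq ι]

variable (k) in
/-- A matrix corepresentation. -/
structure IsCorep (u : Matrix ι ι C) : Prop where
  comul_apply : ∀ i j, Coalgebra.comul (R := k) (u i j) = ∑ l, u i l ⊗ₜ[k] u l j
  counit_apply : ∀ i j, Coalgebra.counit (R := k) (u i j) = if i = j then 1 else 0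

theorem IsCorep.rc {u : Matrix ι ι C} (hu : IsCorep k u) (φ : C →ₗ[k] k) (i j : ι) :
    rc φ (u i j) = ∑ l, φ (u l j) • u i l := rc_of_comul (hu.comul_apply i j) φ

theorem IsCorep.lc {u : Matrix ι ι C} (hu : IsCorep k u) (φ : C →ₗ[k] k) (i j : ι) :
    lc φ (u i j) = ∑ l, φ (u i l) • u l j := lc_of_comul (hu.comul_apply i j) φ

omit [Fintype ι] in
theorem exists_dual_family {V : Type*} [AddCommGroup V] [Module k V] {b : ι → V}
    (hb : LinearIndependent k b) :
    ∃ f : ι → V →ₗ[k] k, ∀ i j, f i (b j) = if i = j then 1 else 0 := by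
  let B := Module.Basis.span hb
  have : ∀ i, ∃ g : V →ₗ[k] k, g ∘ₗ (Submodule.span k (Set.range b)).subtype = B.coord i :=
    fun i => LinearMap.exists_extend _
  choose f hf using this
  refine ⟨f, fun i j => ?_⟩
  have h1 := LinearMap.congr_fun (hf i) (B j)
  simp only [LinearMap.comp_apply, Submodule.subtype_apply, B, Module.Basis.span_apply] at h1
  rw [h1]
  simp [Finsupp.single_apply, eq_comm]

theorem sum_dual_family {V : Type*} [AddCommGroup V] [Module k V] {b : ι → V}
    {f : ι → V →ₗ[k] k} (hf : ∀ i j, f i (b j) = if i = j then 1 else 0) {v : V}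
    (hv : v ∈ Submodule.span k (Set.range b)) : ∑ i, f i v • b i = v := by
  rw [Submodule.mem_span_range_iff_exists_fun] at hv
  obtain ⟨c, rfl⟩ := hv
  simp [hf]

/-- A basis of a left coideal determines a matrix corepresentation. -/
theorem exists_corep {b : ι → C} (hb : LinearIndependent k b)
    (hlc : ∀ (φ : C →ₗ[k] k) i, lc φ (b i) ∈ Submodule.span k (Set.range b)) :
    ∃ u : Matrix ι ι C, IsCorep k u ∧
      (∀ i, Coalgebra.comul (R := k) (b i) = ∑ j, u i j ⊗ₜ[k] b j) ∧
      (∀ (φ : C →ₗ[k] k) i, lc φ (b i) = ∑ j, φ (u i j) • b j) ∧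
      ∀ i, ∑ j, Coalgebra.counit (R := k) (b j) • u i j = b i := by
  obtain ⟨f, hf⟩ := exists_dual_family hb
  have h1 : ∀ (φ : C →ₗ[k] k) i,
      HopfFour.lc φ (b i) = ∑ j, φ (HopfFour.rc (f j) (b i)) • b j := by
    intro φ i
    rw [← sum_dual_family hf (hlc φ i)]
    simp only [apply_rc]
  have h2 : ∀ i, Coalgebra.comul (R := k) (b i) = ∑ j, HopfFour.rc (f j) (b i) ⊗ₜ[k] b j :=
    fun i => comul_eq_iff_lc.2 fun φ => h1 φ i
  refine ⟨Matrix.of fun i j => HopfFour.rc (f j) (b i), ⟨fun i j => ?_, fun i j => ?_⟩,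
    h2, h1, fun i => ?_⟩
  · refine comul_eq_iff_lc.2 fun φ => ?_
    simp only [Matrix.of_apply]
    rw [← rc_lc, h1, map_sum]
    simp
  · simp [hf, eq_comm]
  · have := rc_of_comul (h2 i) (Coalgebra.counit (R := k))
    rw [rc_counit] at this
    exact this.symm

theorem exists_corep_of_basis (b : Module.Basis ι k C) :
    ∃ u : Matrix ι ι C, IsCorep k u ∧
      (∀ i, Coalgebra.comul (R := k) (b i) = ∑ j, u i j ⊗ₜ[k] b j) ∧
      (∀ (φ : C →ₗ[k] k) i, lc φ (b i) = ∑ j, φ (u i j) • b j) ∧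
      ∀ i, ∑ j, Coalgebra.counit (R := k) (b j) • u i j = b i :=
  exists_corep b.linearIndependent fun φ i => by rw [b.span_eq]; trivial

/-- Induction on matrix coefficients. -/
theorem corep_induction [FiniteDimensional k C] {P : C → Prop} (h0 : P 0)
    (hadd : ∀ x y, P x → P y → P (x + y)) (hsmul : ∀ (c : k) x, P x → P (c • x))
    (hu : ∀ (n : ℕ) (u : Matrix (Fin n) (Fin n) C), IsCorep k u → ∀ i j, P (u i j)) (h : C) :
    P h := by
  let b := Module.finBasis k C
  obtain ⟨u, hu', -, -, h3⟩ := exists_corep_of_basis b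
  have hsum : ∀ (s : Finset (Fin (Module.finrank k C))) (f : Fin (Module.finrank k C) → C),
      (∀ i, P (f i)) → P (∑ i ∈ s, f i) := by
    intro s f hf
    exact Finset.sum_induction f P hadd h0 fun i _ => hf i
  rw [← b.sum_repr h]
  refine hsum _ _ fun i => hsmul _ _ ?_
  rw [← h3]
  exact hsum _ _ fun j => hsmul _ _ (hu _ u hu' _ _)

end Coalg

section Bialg

variable {k : Type*} [Field k] {H : Type*} [Ring H] [Bialgebra k H]

theorem comul_mul_sum {ι κ : Type*} {s : Finset ι} {t : Finset κ} {h b : H} {x y : ι → H}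
    {z w : κ → H} (e : Coalgebra.comul (R := k) h = ∑ i ∈ s, x i ⊗ₜ[k] y i)
    (e' : Coalgebra.comul (R := k) b = ∑ i ∈ t, z i ⊗ₜ[k] w i) :
    Coalgebra.comul (R := k) (h * b) = ∑ i ∈ s ×ˢ t, (x i.1 * z i.2) ⊗ₜ[k] (y i.1 * w i.2) := by
  rw [Bialgebra.comul_mul, e, e', Finset.sum_mul_sum, Finset.sum_product]
  simp

theorem rc_mul_left {ι : Type*} {s : Finset ι} {h : H} {x y : ι → H}
    (e : Coalgebra.comul (R := k) h = ∑ i ∈ s, x i ⊗ₜ[k] y i) (φ : H →ₗ[k] k) (b : H) :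
    rc φ (h * b) = ∑ i ∈ s, x i * rc (φ ∘ₗ LinearMap.mulLeft k (y i)) b := by
  obtain ⟨t, e'⟩ := exists_comul (k := k) b
  rw [rc_of_comul (comul_mul_sum e e'), Finset.sum_product]
  simp [rc_of_comul e', Finset.mul_sum]

theorem rc_mul_right {ι : Type*} {s : Finset ι} {h : H} {x y : ι → H}
    (e : Coalgebra.comul (R := k) h = ∑ i ∈ s, x i ⊗ₜ[k] y i) (φ : H →ₗ[k] k) (b : H) :
    rc φ (b * h) = ∑ i ∈ s, rc (φ ∘ₗ LinearMap.mulRight k (y i)) b * x i := by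
  obtain ⟨t, e'⟩ := exists_comul (k := k) b
  rw [rc_of_comul (comul_mul_sum e' e), Finset.sum_product_right]
  simp [rc_of_comul e', Finset.sum_mul]

theorem lc_mul_left {ι : Type*} {s : Finset ι} {h : H} {x y : ι → H}
    (e : Coalgebra.comul (R := k) h = ∑ i ∈ s, x i ⊗ₜ[k] y i) (φ : H →ₗ[k] k) (b : H) :
    lc φ (h * b) = ∑ i ∈ s, y i * lc (φ ∘ₗ LinearMap.mulLeft k (x i)) b := by
  obtain ⟨t, e'⟩ := exists_comul (k := k) b
  rw [lc_of_comul (comul_mul_sum e e'), Finset.sum_product]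
  simp [lc_of_comul e', Finset.mul_sum]

theorem lc_mul_right {ι : Type*} {s : Finset ι} {h : H} {x y : ι → H}
    (e : Coalgebra.comul (R := k) h = ∑ i ∈ s, x i ⊗ₜ[k] y i) (φ : H →ₗ[k] k) (b : H) :
    lc φ (b * h) = ∑ i ∈ s, lc (φ ∘ₗ LinearMap.mulRight k (x i)) b * y i := by
  obtain ⟨t, e'⟩ := exists_comul (k := k) b
  rw [lc_of_comul (comul_mul_sum e' e), Finset.sum_product_right]
  simp [lc_of_comul e', Finset.sum_mul]

@[simp] theorem rc_one (φ : H →ₗ[k] k) : rc φ (1 : H) = φ 1 • 1 := by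
  simp [rc, Algebra.TensorProduct.one_def]

@[simp] theorem lc_one (φ : H →ₗ[k] k) : lc φ (1 : H) = φ 1 • 1 := by
  simp [lc, Algebra.TensorProduct.one_def]

variable (k) in
/-- `g` is group-like. -/
def IsGL (g : H) : Prop :=
  Coalgebra.comul (R := k) g = g ⊗ₜ[k] g ∧ Coalgebra.counit (R := k) g = 1

theorem IsGL.sum {g : H} (hg : IsGL k g) :
    Coalgebra.comul (R := k) g = ∑ _i ∈ {()}, g ⊗ₜ[k] g := by simp [hg.1]

theorem IsGL.rc {g : H} (hg : IsGL k g) (φ : H →ₗ[k] k) : rc φ g = φ g • g := by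
  simpa using rc_of_comul hg.sum φ

theorem IsGL.lc {g : H} (hg : IsGL k g) (φ : H →ₗ[k] k) : lc φ g = φ g • g := by
  simpa using lc_of_comul hg.sum φ

theorem IsGL.rc_mul' {g : H} (hg : IsGL k g) (φ : H →ₗ[k] k) (b : H) :
    HopfFour.rc φ (b * g) = HopfFour.rc (φ ∘ₗ LinearMap.mulRight k g) b * g := by
  simpa using rc_mul_right hg.sum φ b

theorem IsGL.one : IsGL k (1 : H) := by
  simp [IsGL, Algebra.TensorProduct.one_def]

theorem IsGL.mul {g h : H} (hg : IsGL k g) (hh : IsGL k h) : IsGL k (g * h) := by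
  simp [IsGL, hg.1, hg.2, hh.1, hh.2]

theorem IsGL.pow {g : H} (hg : IsGL k g) (n : ℕ) : IsGL k (g ^ n) := by
  induction n with
  | zero => simpa using IsGL.one
  | succ n ih => rw [pow_succ]; exact ih.mul hg

variable {ι κ : Type*} [Fintype ι] [DecidableEq ι] [Fintype κ] [DecidableEq κ]

theorem IsCorep.mul {u : Matrix ι ι H} (hu : IsCorep k u) {v : Matrix κ κ H} (hv : IsCorep k v) :
    IsCorep k (Matrix.of fun (i j : ι × κ) => u i.1 j.1 * v i.2 j.2) where
  comul_apply i j := by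
    simp only [Matrix.of_apply]
    rw [comul_mul_sum (hu.comul_apply _ _) (hv.comul_apply _ _)]
    rfl
  counit_apply i j := by
    simp only [Matrix.of_apply, Bialgebra.counit_mul, hu.counit_apply, hv.counit_apply, Prod.ext_iff]
    by_cases h1 : i.1 = j.1 <;> by_cases h2 : i.2 = j.2 <;> simp [h1, h2]

theorem IsCorep.mul_gl {u : Matrix ι ι H} (hu : IsCorep k u) {g : H} (hg : IsGL k g) :
    IsCorep k (Matrix.of fun i j : ι => u i j * g) where
  comul_apply i j := by
    simp [hu.comul_apply, hg.1, Finset.sum_mul]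
  counit_apply i j := by
    simp [hu.counit_apply, hg.2]

end Bialg

section Hopf

variable {k : Type*} [Field k] {H : Type*} [Ring H] [HopfAlgebra k H]

open HopfAlgebra

variable {ι κ : Type*} [Fintype ι] [DecidableEq ι] [Fintype κ] [DecidableEq κ]

theorem IsCorep.antipode_mul {u : Matrix ι ι H} (hu : IsCorep k u) :
    u.map (antipode k) * u = 1 := by
  ext i j
  have := mul_antipode_rTensor_comul_apply (R := k) (u i j)
  rw [hu.comul_apply, hu.counit_apply] at this
  simp only [map_sum, LinearMap.rTensor_tmul, LinearMap.mul'_apply] at this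
  rw [Matrix.mul_apply, Matrix.one_apply]
  simp only [Matrix.map_apply]
  rw [this]
  split_ifs <;> simp

theorem IsCorep.mul_antipode {u : Matrix ι ι H} (hu : IsCorep k u) :
    u * u.map (antipode k) = 1 := by
  ext i j
  have := mul_antipode_lTensor_comul_apply (R := k) (u i j)
  rw [hu.comul_apply, hu.counit_apply] at this
  simp only [map_sum, LinearMap.lTensor_tmul, LinearMap.mul'_apply] at this
  rw [Matrix.mul_apply, Matrix.one_apply]
  simp only [Matrix.map_apply]
  rw [this]
  split_ifs <;> simp

theorem IsCorep.sum_antipode_mul {u : Matrix ι ι H} (hu : IsCorep k u) (i j : ι) :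
    ∑ l, antipode k (u i l) * u l j = if i = j then 1 else 0 := by
  have := congr_fun (congr_fun hu.antipode_mul i) j
  simpa [Matrix.mul_apply, Matrix.one_apply] using this

theorem IsCorep.sum_mul_antipode {u : Matrix ι ι H} (hu : IsCorep k u) (i j : ι) :
    ∑ l, u i l * antipode k (u l j) = if i = j then 1 else 0 := by
  have := congr_fun (congr_fun hu.mul_antipode i) j
  simpa [Matrix.mul_apply, Matrix.one_apply] using this

theorem IsCorep.antipode {u : Matrix ι ι H} (hu : IsCorep k u) :
    IsCorep k (Matrix.of fun i j => antipode k (u j i)) where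
  comul_apply i j := by
    let Δ : H →+* H ⊗[k] H := (Bialgebra.comulAlgHom k H : H →+* H ⊗[k] H)
    let l : H →+* H ⊗[k] H := (Algebra.TensorProduct.includeLeft : H →ₐ[k] H ⊗[k] H)
    let r : H →+* H ⊗[k] H := (Algebra.TensorProduct.includeRight : H →ₐ[k] H ⊗[k] H)
    have hmap : ∀ (f : H →+* H ⊗[k] H), f.mapMatrix u * f.mapMatrix (u.map (HopfAlgebra.antipode k)) = 1 ∧
        f.mapMatrix (u.map (HopfAlgebra.antipode k)) * f.mapMatrix u = 1 := fun f => by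
      rw [← map_mul, ← map_mul, hu.mul_antipode, hu.antipode_mul, map_one]; exact ⟨rfl, rfl⟩
    have h1 : Δ.mapMatrix u = l.mapMatrix u * r.mapMatrix u := by
      ext i j
      simp only [RingHom.mapMatrix_apply, Matrix.map_apply, Matrix.mul_apply]
      have := hu.comul_apply i j
      simp only [Δ, l, r]
      simpa using this
    have h2 : Δ.mapMatrix (u.map (HopfAlgebra.antipode k)) =
        r.mapMatrix (u.map (HopfAlgebra.antipode k)) * l.mapMatrix (u.map (HopfAlgebra.antipode k)) := by
      refine left_inv_eq_right_inv (a := Δ.mapMatrix u) (hmap Δ).2 ?_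
      rw [h1, mul_assoc, ← mul_assoc (r.mapMatrix u), (hmap r).1, one_mul, (hmap l).1]
    have h3 := congr_fun (congr_fun h2 j) i
    simp only [RingHom.mapMatrix_apply, Matrix.map_apply, Matrix.mul_apply, Δ, l, r] at h3
    simpa using h3
  counit_apply i j := by
    simp [hu.counit_apply, eq_comm]

theorem IsCorep.antipode_sq {u : Matrix ι ι H} (hu : IsCorep k u) :
    IsCorep k (Matrix.of fun i j => HopfAlgebra.antipode k (HopfAlgebra.antipode k (u i j))) :=
  hu.antipode.antipode

theorem IsGL.antipode_mul {g : H} (hg : IsGL k g) : HopfAlgebra.antipode k g * g = 1 := by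
  have := mul_antipode_rTensor_comul_apply (R := k) g
  simpa [hg.1, hg.2] using this

theorem IsGL.mul_antipode {g : H} (hg : IsGL k g) : g * HopfAlgebra.antipode k g = 1 := by
  have := mul_antipode_lTensor_comul_apply (R := k) g
  simpa [hg.1, hg.2] using this

end Hopf

end HopfFour

namespace HopfFour

section Integral

variable {k : Type*} [Field k] {H : Type*} [Ring H] [HopfAlgebra k H]

open HopfAlgebra

/-- A nonzero left coideal stable under left multiplication by antipodes contains `1`. -/
theorem one_mem_of_isLC [FiniteDimensional k H] {V : Submodule k H} (hV : IsLC V) (h0 : V ≠ ⊥)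
    (hmul : ∀ (h : H), ∀ v ∈ V, h * v ∈ V) : (1 : H) ∈ V := by
  let b := Module.finBasis k V
  have hli : LinearIndependent k (fun i => (b i : H)) :=
    b.linearIndependent.map' V.subtype (Submodule.ker_subtype V)
  have hsp : Submodule.span k (Set.range fun i => (b i : H)) = V := by
    have := congr_arg (Submodule.map V.subtype) b.span_eq
    rw [Submodule.map_span, ← Set.range_comp, Submodule.map_top, Submodule.range_subtype] at this
    exact this
  obtain ⟨u, hu, h1, -, h3⟩ := exists_corep hli fun φ i => by
    rw [hsp]; exact hV φ _ (b i).2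
  have h4 : ∀ i, Coalgebra.counit (R := k) (b i : H) • (1 : H) ∈ V := by
    intro i
    have := mul_antipode_rTensor_comul_apply (R := k) (b i : H)
    rw [h1] at this
    simp only [map_sum, LinearMap.rTensor_tmul, LinearMap.mul'_apply] at this
    rw [Algebra.algebraMap_eq_smul_one] at this
    rw [← this]
    exact V.sum_mem fun j _ => hmul _ _ (b j).2
  by_cases h5 : ∀ i, Coalgebra.counit (R := k) (b i : H) = 0
  · exfalso
    apply h0
    rw [← hsp, Submodule.span_eq_bot]
    rintro _ ⟨i, rfl⟩
    change (b i : H) = 0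
    rw [← h3 i]
    simp [h5]
  · push Not at h5
    obtain ⟨i, hi⟩ := h5
    have := V.smul_mem (Coalgebra.counit (R := k) (b i : H))⁻¹ (h4 i)
    rwa [smul_smul, inv_mul_cancel₀ hi, one_smul] at this

/-- `lam` is a left invariant functional: `h₁ lam(h₂) = lam(h) 1`. -/
def IsLeftInt (lam : H →ₗ[k] k) : Prop := ∀ h, rc lam h = lam h • (1 : H)

variable (k H) in
theorem exists_isLeftInt [FiniteDimensional k H] :
    ∃ lam : H →ₗ[k] k, lam ≠ 0 ∧ IsLeftInt lam := by
  let e := Module.finBasis k H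
  obtain ⟨u, hu, h1, -, -⟩ := exists_corep_of_basis e
  let S := antipode k (A := H)
  let ρ : Fin _ → Fin _ → H →ₗ[k] k := fun j m => e.coord m ∘ₗ LinearMap.mulLeft k (e j)
  have hexp : ∀ h : H, ∑ m, e.coord m h • e m = h := fun h => e.sum_repr h
  have hrc : ∀ i m, rc (e.coord m) (e i) = u i m := by
    intro i m
    rw [rc_of_comul (h1 i)]
    simp [Finsupp.single_apply]
  have key : ∀ i m a, ∑ n, ρ i n a • u n m = ∑ j, u i j * rc (ρ j m) a := by
    intro i m a
    have h2 := rc_mul_left (h1 i) (e.coord m) a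
    have h3 : rc (e.coord m) (e i * a) = ∑ n, ρ i n a • u n m := by
      conv_lhs => rw [← hexp (e i * a), map_sum]
      refine Finset.sum_congr rfl fun n _ => ?_
      rw [map_smul, hrc]
      rfl
    rw [← h3, h2]
  have hS2 : ∀ m t, ∑ n, S (S (u n t)) * S (u m n) = if m = t then 1 else 0 := by
    intro m t
    have := congr_arg S (hu.sum_mul_antipode m t)
    simp only [S, map_sum, antipode_mul_antidistrib] at this
    rw [this]
    split_ifs <;> simp
  let lam : Fin _ → H →ₗ[k] k := fun l =>
    ∑ n, e.coord n ∘ₗ LinearMap.mulRight k (S (S (u n l)))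
  have hlam : ∀ l h, lam l h = ∑ n, e.coord n (h * S (S (u n l))) := by
    intro l h; simp [lam, LinearMap.sum_apply]
  have hlame : ∀ l i, lam l (e i) = ∑ n, ρ i n (S (S (u n l))) := fun l i => hlam l (e i)
  have hinv : ∀ l i, ∑ j, lam l (e j) • u i j = lam l (e i) • (1 : H) := by
    intro l i
    have h2 : ∑ m, ∑ n, (∑ n', ρ i n' (S (S (u n l))) • u n' m) * S (u m n) =
        lam l (e i) • (1 : H) := by
      rw [Finset.sum_comm, hlame, Finset.sum_smul]
      refine Finset.sum_congr rfl fun n _ => ?_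
      simp_rw [Finset.sum_mul, smul_mul_assoc]
      rw [Finset.sum_comm]
      simp_rw [← Finset.smul_sum]
      simp only [S, hu.sum_mul_antipode]
      simp
    rw [← h2]
    have h4 : ∀ n m, ∑ n', ρ i n' (S (S (u n l))) • u n' m =
        ∑ j, ∑ t, ρ j m (S (S (u t l))) • (u i j * S (S (u n t))) := by
      intro n m
      rw [key]
      refine Finset.sum_congr rfl fun j _ => ?_
      have := hu.antipode_sq.rc (ρ j m) n l
      simp only [Matrix.of_apply] at this
      simp only [S]
      rw [this, Finset.mul_sum]
      simp
    simp_rw [h4, Finset.sum_mul, smul_mul_assoc, mul_assoc]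
    have h5 : ∀ m, ∑ n, ∑ j, ∑ t, ρ j m (S (S (u t l))) • (u i j * (S (S (u n t)) * S (u m n))) =
        ∑ j, ρ j m (S (S (u m l))) • u i j := by
      intro m
      rw [Finset.sum_comm]
      refine Finset.sum_congr rfl fun j _ => ?_
      rw [Finset.sum_comm]
      simp_rw [← Finset.smul_sum, ← Finset.mul_sum, hS2]
      simp
    simp_rw [h5]
    rw [Finset.sum_comm]
    simp_rw [hlame, Finset.sum_smul]
  have hleft : ∀ l, IsLeftInt (lam l) := by
    intro l h
    have h6 : rc (lam l) = (lam l).smulRight (1 : H) := by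
      refine e.ext fun i => ?_
      rw [rc_of_comul (h1 i), hinv]
      rfl
    rw [h6]; rfl
  by_contra hcon
  push Not at hcon
  have hz : ∀ l, lam l = 0 := by
    intro l
    by_contra hl
    exact hcon _ hl (hleft l)
  have h7 : ∀ j (b : H), e.coord j b = 0 := by
    intro j b
    have h8 : ∑ l, lam l (b * S (u l j)) = 0 := by simp [hz]
    simp_rw [hlam, mul_assoc] at h8
    rw [Finset.sum_comm] at h8
    have h9 : ∀ n, ∑ l, S (u l j) * S (S (u n l)) = if n = j then 1 else 0 := by
      intro n
      have := congr_arg S (hu.sum_antipode_mul n j)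
      simp only [S, map_sum, antipode_mul_antidistrib] at this
      rw [this]
      split_ifs <;> simp
    simp_rw [← map_sum, ← Finset.mul_sum, h9] at h8
    rw [Finset.sum_eq_single j (fun n _ hn => by simp [hn]) (by simp)] at h8
    simpa using h8
  have h10 : (1 : H) = 0 := by
    rw [← hexp 1]
    simp [h7]
  have := congr_arg (Coalgebra.counit (R := k)) h10
  simp at this

variable {lam : H →ₗ[k] k}

theorem IsLeftInt.rc_mulLeft [FiniteDimensional k H] (hl : IsLeftInt lam) (x y : H) :
    rc (lam ∘ₗ LinearMap.mulLeft k x) y = antipode k (rc (lam ∘ₗ LinearMap.mulRight k y) x) := by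
  have hL : ∀ a b : H, lam ∘ₗ LinearMap.mulLeft k (a + b) =
      lam ∘ₗ LinearMap.mulLeft k a + lam ∘ₗ LinearMap.mulLeft k b := by
    intro a b; ext; simp [add_mul]
  have hL' : ∀ (c : k) (b : H), lam ∘ₗ LinearMap.mulLeft k (c • b) =
      c • (lam ∘ₗ LinearMap.mulLeft k b) := by
    intro a b; ext; simp
  refine corep_induction (k := k) (P := fun x => rc (lam ∘ₗ LinearMap.mulLeft k x) y =
    antipode k (rc (lam ∘ₗ LinearMap.mulRight k y) x)) (by simp) (fun a b ha hb => ?_)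
    (fun c a ha => ?_) (fun n u hu i j => ?_) x
  · rw [hL, rc_add, ha, hb, map_add, map_add]
  · rw [hL', rc_smul, ha, map_smul, map_smul]
  · have h1 : ∀ l, ∑ m, u l m * rc (lam ∘ₗ LinearMap.mulLeft k (u m j)) y = lam (u l j * y) • 1 := by
      intro l
      rw [← rc_mul_left (hu.comul_apply l j), hl]
    have h2 : ∑ l, antipode k (u i l) * (lam (u l j * y) • (1 : H)) =
        rc (lam ∘ₗ LinearMap.mulLeft k (u i j)) y := by
      simp_rw [← h1, Finset.mul_sum, ← mul_assoc]
      rw [Finset.sum_comm]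
      simp_rw [← Finset.sum_mul, hu.sum_antipode_mul]
      simp
    rw [← h2, hu.rc, map_sum]
    simp

theorem IsLeftInt.nondeg [FiniteDimensional k H] (hl : IsLeftInt lam) (h0 : lam ≠ 0) {s : H}
    (hs : ∀ h, lam (h * s) = 0) : s = 0 := by
  let N : Submodule k H :=
    { carrier := {s | ∀ h, lam (h * s) = 0}
      add_mem' := fun {a b} ha hb h => by rw [mul_add, map_add, ha, hb, add_zero]
      zero_mem' := fun h => by simp
      smul_mem' := fun c a ha h => by rw [mul_smul_comm, map_smul, ha, smul_zero] }
  have hN : IsLC N := by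
    intro φ v hv h
    have h1 : lam ∘ₗ LinearMap.mulRight k v = 0 := by
      ext x; exact hv x
    have h2 := hl.rc_mulLeft h v
    rw [h1] at h2
    have h3 := apply_rc φ (lam ∘ₗ LinearMap.mulLeft k h) v
    rw [h2] at h3
    simpa [rc] using h3.symm
  by_contra hne
  have h1 : (1 : H) ∈ N := by
    refine one_mem_of_isLC hN ?_ fun h v hv h' => ?_
    · intro hb
      have : s ∈ N := hs
      rw [hb] at this
      exact hne (by simpa using this)
    · rw [← mul_assoc]; exact hv _
  apply h0
  ext h
  simpa using h1 h

/-- The isomorphism `r ↦ lam(· r)`. -/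
theorem IsLeftInt.exists_mulRight [FiniteDimensional k H] (hl : IsLeftInt lam) (h0 : lam ≠ 0) :
    ∃ θ : H ≃ₗ[k] (H →ₗ[k] k), ∀ r h, θ r h = lam (h * r) := by
  let f : H →ₗ[k] (H →ₗ[k] k) := (LinearMap.mul k H).flip.compr₂ lam
  have hf : Function.Injective f := by
    rw [injective_iff_map_eq_zero]
    intro s hs
    exact hl.nondeg h0 fun h => LinearMap.congr_fun hs h
  exact ⟨LinearEquiv.ofInjectiveOfFinrankEq f hf (by simp), fun r h => rfl⟩

theorem IsLeftInt.exists_mulLeft [FiniteDimensional k H] (hl : IsLeftInt lam) (h0 : lam ≠ 0)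
    (φ : H →ₗ[k] k) : ∃ x, φ = lam ∘ₗ LinearMap.mulLeft k x := by
  let f : H →ₗ[k] (H →ₗ[k] k) := (LinearMap.mul k H).compr₂ lam
  have hf : Function.Injective f := by
    rw [injective_iff_map_eq_zero]
    intro s hs
    obtain ⟨θ, hθ⟩ := hl.exists_mulRight h0
    refine eq_of_forall_dual (k := k) fun φ => ?_
    have := LinearMap.congr_fun hs (θ.symm φ)
    have h2 := hθ (θ.symm φ) s
    rw [LinearEquiv.apply_symm_apply] at h2
    rw [h2, map_zero]
    exact this
  let e := LinearEquiv.ofInjectiveOfFinrankEq f hf (by simp)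
  refine ⟨e.symm φ, ?_⟩
  ext h
  exact (LinearMap.congr_fun (e.apply_symm_apply φ) h).symm

theorem IsLeftInt.unique [FiniteDimensional k H] (hl : IsLeftInt lam) (h0 : lam ≠ 0)
    {mu : H →ₗ[k] k} (hm : IsLeftInt mu) : ∃ c : k, mu = c • lam := by
  obtain ⟨θ, hθ⟩ := hl.exists_mulRight h0
  set y := θ.symm mu with hy
  have hmu : ∀ h, mu h = lam (h * y) := by
    intro h; rw [← hθ, hy, LinearEquiv.apply_symm_apply]
  have hmu' : lam ∘ₗ LinearMap.mulRight k y = mu := by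
    ext h; exact (hmu h).symm
  have h1 : ∀ (φ : H →ₗ[k] k), lc φ y = φ 1 • y := by
    intro φ
    rw [← sub_eq_zero]
    refine hl.nondeg h0 fun h => ?_
    have h2 := apply_rc φ (lam ∘ₗ LinearMap.mulLeft k h) y
    rw [hl.rc_mulLeft, hmu', hm h] at h2
    simp only [map_smul, antipode_one, LinearMap.comp_apply, LinearMap.mulLeft_apply,
      smul_eq_mul] at h2
    rw [mul_sub, map_sub, ← h2, hmu, mul_smul_comm, map_smul, smul_eq_mul, mul_comm, sub_self]
  have h2 : y = Coalgebra.counit (R := k) y • (1 : H) := by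
    refine eq_of_forall_dual (k := k) fun φ => ?_
    have := congr_arg (Coalgebra.counit (R := k)) (h1 φ)
    rw [counit_lc] at this
    rw [this]
    simp [mul_comm]
  refine ⟨Coalgebra.counit (R := k) y, ?_⟩
  ext h
  rw [hmu, h2]
  simp

theorem IsLeftInt.exists_distinguished [FiniteDimensional k H] (hl : IsLeftInt lam) (h0 : lam ≠ 0) :
    ∃ a : H, IsGL k a ∧ ∀ h, lc lam h = lam h • a := by
  have h1 : ∀ ψ : H →ₗ[k] k, ∃ c : k, conv lam ψ = c • lam := by
    intro ψ
    refine hl.unique h0 fun h => ?_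
    rw [← rc_rc, hl]; rfl
  choose c hc using h1
  obtain ⟨h₁, hh₁⟩ : ∃ h, lam h ≠ 0 := by
    by_contra hcon
    push Not at hcon
    exact h0 (LinearMap.ext hcon)
  set h₀ := (lam h₁)⁻¹ • h₁ with hh₀
  have hlam : lam h₀ = 1 := by rw [hh₀, map_smul, smul_eq_mul, inv_mul_cancel₀ hh₁]
  set a := lc lam h₀ with ha
  have hca : ∀ ψ, c ψ = ψ a := by
    intro ψ
    have := LinearMap.congr_fun (hc ψ) h₀
    rw [conv_apply'] at this
    simp [hlam] at this
    rw [← this]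
  have hlc : ∀ h, lc lam h = lam h • a := by
    intro h
    refine eq_of_forall_dual (k := k) fun ψ => ?_
    rw [← conv_apply', hc, hca]
    simp [mul_comm]
  refine ⟨a, ⟨?_, ?_⟩, hlc⟩
  · have : Coalgebra.comul (R := k) a = ∑ _i ∈ {()}, a ⊗ₜ[k] a := by
      refine comul_eq_iff_lc.2 fun ψ => ?_
      rw [ha, lc_lc, hc, lc_smul, hca, ← ha]
      simp
    simpa using this
  · rw [ha, counit_lc, hlam]

theorem IsLeftInt.lc_mulRight [FiniteDimensional k H] {a : H} (hla : ∀ h, lc lam h = lam h • a)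
    (r s : H) : lc (lam ∘ₗ LinearMap.mulRight k r) s =
      a * antipode k (lc (lam ∘ₗ LinearMap.mulLeft k s) r) := by
  have hL : ∀ a b : H, lam ∘ₗ LinearMap.mulRight k (a + b) =
      lam ∘ₗ LinearMap.mulRight k a + lam ∘ₗ LinearMap.mulRight k b := by
    intro a b; ext; simp [mul_add]
  have hL' : ∀ (c : k) (b : H), lam ∘ₗ LinearMap.mulRight k (c • b) =
      c • (lam ∘ₗ LinearMap.mulRight k b) := by
    intro a b; ext; simp
  refine corep_induction (k := k) (P := fun r => lc (lam ∘ₗ LinearMap.mulRight k r) s =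
    a * antipode k (lc (lam ∘ₗ LinearMap.mulLeft k s) r)) (by simp) (fun x y hx hy => ?_)
    (fun c x hx => ?_) (fun n u hu i j => ?_) r
  · rw [hL, lc_add, hx, hy, map_add, map_add, mul_add]
  · rw [hL', lc_smul, hx, map_smul, map_smul, mul_smul_comm]
  · have h1 : ∀ l, ∑ m, lc (lam ∘ₗ LinearMap.mulRight k (u i m)) s * u m l = lam (s * u i l) • a := by
      intro l
      rw [← lc_mul_right (hu.comul_apply i l), hla]
    have h2 : ∑ l, (lam (s * u i l) • a) * antipode k (u l j) =
        lc (lam ∘ₗ LinearMap.mulRight k (u i j)) s := by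
      simp_rw [← h1, Finset.sum_mul, mul_assoc]
      rw [Finset.sum_comm]
      simp_rw [← Finset.mul_sum, hu.sum_mul_antipode]
      simp
    rw [← h2, hu.lc, map_sum, Finset.mul_sum]
    simp

/-- Radford's formula for the fourth power of the antipode. -/
theorem radford [FiniteDimensional k H] (hl : IsLeftInt lam) (h0 : lam ≠ 0) :
    ∃ (η : H →ₐ[k] H) (a : H), IsGL k a ∧ (∀ h, lc lam h = lam h • a) ∧
      (∀ x y, lam (x * y) = lam (y * η x)) ∧
      ∀ (α : H →ₐ[k] k), (∀ h, α h = Coalgebra.counit (R := k) (η h)) → ∀ r,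
      antipode k (antipode k (antipode k (antipode k (rc α.toLinearMap r)))) =
        antipode k a * lc α.toLinearMap r * a := by
  obtain ⟨θ, hθ⟩ := hl.exists_mulRight h0
  obtain ⟨a, ha, hla⟩ := hl.exists_distinguished h0
  let η₀ : H →ₗ[k] H := θ.symm.toLinearMap ∘ₗ (LinearMap.mul k H).compr₂ lam
  have hη₀ : ∀ x y, lam (x * y) = lam (y * η₀ x) := by
    intro x y
    rw [← hθ (η₀ x) y]
    simp [η₀]
  have hinj : ∀ r s, (∀ y, lam (y * r) = lam (y * s)) → r = s := by
    intro r s h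
    rw [← sub_eq_zero]
    exact hl.nondeg h0 fun y => by rw [mul_sub, map_sub, h, sub_self]
  let η : H →ₐ[k] H := AlgHom.ofLinearMap η₀
    (hinj _ _ fun y => by rw [← hη₀, one_mul, mul_one])
    (fun x x' => hinj _ _ fun y => by
      rw [← hη₀, mul_assoc, hη₀, mul_assoc, hη₀, mul_assoc])
  have hη : ∀ x y, lam (x * y) = lam (y * η x) := hη₀
  refine ⟨η, a, ha, hla, hη, fun α hα r => ?_⟩
  have e1 : ∀ s, lam ∘ₗ LinearMap.mulRight k (η s) = lam ∘ₗ LinearMap.mulLeft k s := by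
    intro s; ext y; simp [hη s y]
  have e2 : ∀ s, lam ∘ₗ LinearMap.mulRight k s = (lam ∘ₗ LinearMap.mulLeft k s) ∘ₗ η.toLinearMap := by
    intro s; ext y; simp [hη y s]
  obtain ⟨x, hx⟩ := hl.exists_mulLeft h0 (Coalgebra.counit (R := k))
  have hα' : α.toLinearMap = lam ∘ₗ LinearMap.mulRight k x := by
    rw [e2, ← hx]; ext y; simp [hα]
  have h1 : η r = antipode k (antipode k (rc α.toLinearMap r)) := by
    rw [hα', ← hl.rc_mulLeft, ← e1, ← hl.rc_mulLeft, ← hx, rc_counit]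
  have h2 : lc α.toLinearMap r = a * antipode k (antipode k (η r)) * antipode k a := by
    rw [hα', IsLeftInt.lc_mulRight hla, ← e1, IsLeftInt.lc_mulRight hla, ← hx, lc_counit,
      antipode_mul_antidistrib, mul_assoc]
  rw [← h1, h2]
  simp only [← mul_assoc]
  rw [ha.antipode_mul, one_mul, mul_assoc, ha.antipode_mul, mul_one]

end Integral

end HopfFour

namespace HopfFour

section Galois

variable {k : Type*} [Field k] {H : Type*} [Ring H] [HopfAlgebra k H]

open HopfAlgebra

/-- The Galois map `a ⊗ b ↦ a₁ ⊗ a₂ b`. -/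
noncomputable def galois : H ⊗[k] H →ₗ[k] H ⊗[k] H :=
  TensorProduct.lift (((LinearMap.mul k (H ⊗[k] H)) ∘ₗ Coalgebra.comul).compl₂
    (Algebra.TensorProduct.includeRight : H →ₐ[k] H ⊗[k] H).toLinearMap)

theorem galois_tmul (a b : H) :
    galois (k := k) (a ⊗ₜ b) = Coalgebra.comul (R := k) a * (1 ⊗ₜ b) := rfl

theorem galois_of_comul {ι : Type*} {s : Finset ι} {h : H} {x y : ι → H}
    (e : Coalgebra.comul (R := k) h = ∑ i ∈ s, x i ⊗ₜ[k] y i) (b : H) :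
    galois (k := k) (h ⊗ₜ b) = ∑ i ∈ s, x i ⊗ₜ[k] (y i * b) := by
  rw [galois_tmul, e, Finset.sum_mul]
  simp

theorem galois_surjective [FiniteDimensional k H] :
    Function.Surjective (galois (k := k) (H := H)) := by
  rw [← LinearMap.range_eq_top, eq_top_iff, ← TensorProduct.span_tmul_eq_top, Submodule.span_le]
  rintro _ ⟨a, b, rfl⟩
  refine corep_induction (k := k)
    (P := fun a => ∀ b, a ⊗ₜ[k] b ∈ LinearMap.range (galois (k := k) (H := H)))
    (fun b => by simp) (fun x y hx hy b => ?_) (fun c x hx b => ?_) (fun n u hu i j b => ?_) a b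
  · rw [TensorProduct.add_tmul]; exact add_mem (hx b) (hy b)
  · rw [← TensorProduct.smul_tmul']; exact Submodule.smul_mem _ _ (hx b)
  · refine ⟨∑ l, u i l ⊗ₜ[k] (antipode k (u l j) * b), ?_⟩
    rw [map_sum]
    simp_rw [galois_of_comul (hu.comul_apply _ _), ← mul_assoc]
    rw [Finset.sum_comm]
    simp_rw [← TensorProduct.tmul_sum, ← Finset.sum_mul, hu.sum_mul_antipode]
    simp [ite_mul, TensorProduct.tmul_ite]

variable (k H) in
/-- The Galois map as a linear equivalence. -/
noncomputable def galoisEquiv [FiniteDimensional k H] : H ⊗[k] H ≃ₗ[k] H ⊗[k] H :=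
  LinearEquiv.ofBijective galois
    ⟨LinearMap.injective_iff_surjective.2 galois_surjective, galois_surjective⟩

@[simp] theorem galoisEquiv_apply [FiniteDimensional k H] (t : H ⊗[k] H) :
    galoisEquiv k H t = galois (k := k) t := rfl

variable [FiniteDimensional k H]

theorem trace_eq_of_galois {f g : H ⊗[k] H →ₗ[k] H ⊗[k] H}
    (h : ∀ a b, galois (k := k) (f (a ⊗ₜ b)) = g (galois (k := k) (a ⊗ₜ b))) :
    LinearMap.trace k _ f = LinearMap.trace k _ g := by
  have : g = (galoisEquiv k H).conj f := by
    refine LinearMap.ext fun t => ?_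
    obtain ⟨s, rfl⟩ := (galoisEquiv k H).surjective t
    rw [LinearEquiv.conj_apply_apply, LinearEquiv.symm_apply_apply]
    simp only [galoisEquiv_apply]
    induction s using TensorProduct.induction_on with
    | zero => simp
    | tmul a b => exact (h a b).symm
    | add x y hx hy => simp only [map_add, hx, hy]
  rw [this, LinearMap.trace_conj']

/-- The left multiplication trace `Tr(L_a)`. -/
noncomputable def trL : H →ₗ[k] k := LinearMap.trace k H ∘ₗ LinearMap.mul k H

theorem trL_apply (a : H) : trL (k := k) a = LinearMap.trace k H (LinearMap.mulLeft k a) := rfl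

theorem IsCorep.trL {n : Type*} [Fintype n] [DecidableEq n] {u : Matrix n n H} (hu : IsCorep k u)
    (i j : n) : ∑ l, trL (k := k) (u i l) * trL (k := k) (u l j) =
      Module.finrank k H * trL (k := k) (u i j) := by
  have h := trace_eq_of_galois (k := k) (H := H)
    (f := TensorProduct.map (LinearMap.mulLeft k (u i j)) LinearMap.id)
    (g := ∑ l, TensorProduct.map (LinearMap.mulLeft k (u i l)) (LinearMap.mulLeft k (u l j)))
    (fun a b => by
      obtain ⟨s, e⟩ := exists_comul (k := k) a
      simp only [TensorProduct.map_tmul, LinearMap.mulLeft_apply, LinearMap.id_apply, galois_tmul,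
        Bialgebra.comul_mul, hu.comul_apply, e, LinearMap.sum_apply, map_sum, Finset.sum_mul,
        Algebra.TensorProduct.tmul_mul_tmul, mul_one]
      simp_rw [Finset.mul_sum, Finset.sum_mul, Algebra.TensorProduct.tmul_mul_tmul, mul_one, mul_assoc]
      rw [Finset.sum_comm])
  rw [map_sum] at h
  simp_rw [LinearMap.trace_tensorProduct'] at h
  simp_rw [trL_apply, ← h]
  simp [mul_comm]

theorem trace_rc_sq (α : H →ₐ[k] k) :
    LinearMap.trace k H (rc α.toLinearMap) * LinearMap.trace k H (rc α.toLinearMap) =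
      Module.finrank k H * LinearMap.trace k H (rc α.toLinearMap) := by
  have h := trace_eq_of_galois (k := k) (H := H)
    (f := TensorProduct.map (rc α.toLinearMap) (rc α.toLinearMap))
    (g := TensorProduct.map LinearMap.id (rc α.toLinearMap))
    (fun a b => by
      refine corep_induction (k := k) (P := fun a => galois (k := k)
        (TensorProduct.map (rc α.toLinearMap) (rc α.toLinearMap) (a ⊗ₜ[k] b)) =
        TensorProduct.map LinearMap.id (rc α.toLinearMap) (galois (k := k) (a ⊗ₜ[k] b)))
        (by simp) (fun x y hx hy => ?_) (fun c x hx => ?_) (fun n u hu i j => ?_) a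
      · simp only [TensorProduct.add_tmul, map_add, hx, hy]
      · simp only [← TensorProduct.smul_tmul', map_smul, hx]
      · rw [galois_of_comul (hu.comul_apply i j), map_sum]
        simp only [TensorProduct.map_tmul, LinearMap.id_apply]
        rw [hu.rc, TensorProduct.sum_tmul, map_sum]
        simp_rw [← TensorProduct.smul_tmul', map_smul, galois_of_comul (hu.comul_apply _ _)]
        obtain ⟨t, e⟩ := exists_comul (k := k) b
        simp_rw [rc_mul_right e]
        have : ∀ y : H, α.toLinearMap ∘ₗ LinearMap.mulRight k y = α y • α.toLinearMap := by
          intro y; ext x; simp [mul_comm]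
        simp_rw [this, rc_smul, smul_mul_assoc, ← mul_smul_comm, ← Finset.mul_sum]
        rw [show ∑ i ∈ t, α i.2 • i.1 = rc α.toLinearMap b from
          (rc_of_comul e α.toLinearMap).symm]
        simp_rw [hu.rc, Finset.sum_mul, Finset.smul_sum, TensorProduct.tmul_sum, smul_mul_assoc,
          TensorProduct.tmul_smul]
        rw [Finset.sum_comm])
  rw [LinearMap.trace_tensorProduct', LinearMap.trace_tensorProduct'] at h
  simpa using h

end Galois

section Order

variable {k : Type*} [Field k] [CharZero k] {V : Type*} [AddCommGroup V] [Module k V]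
  [FiniteDimensional k V]

/-- The average of a cyclic group of operators is a projection. -/
theorem eq_one_of_trace_sq {U : V →ₗ[k] V} {m : ℕ} (hm : 0 < m) (hU : U ^ m = 1)
    (htr : ∀ i, LinearMap.trace k V (U ^ i) * LinearMap.trace k V (U ^ i) =
      Module.finrank k V * LinearMap.trace k V (U ^ i))
    (hcop : Nat.Coprime m (Module.finrank k V)) : U = 1 := by
  classical
  have hm0 : (m : k) ≠ 0 := by exact_mod_cast hm.ne'
  set s : V →ₗ[k] V := ∑ i ∈ Finset.range m, U ^ i with hs
  have h1 : U * s = s := by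
    rw [hs, Finset.mul_sum]
    simp_rw [← pow_succ']
    have := (Finset.sum_range_succ' (fun i => U ^ i) m).symm.trans (Finset.sum_range_succ _ m)
    rw [hU, pow_zero] at this
    exact add_right_cancel this
  have h2 : ∀ i, U ^ i * s = s := by
    intro i
    induction i with
    | zero => simp
    | succ i ih => rw [pow_succ, mul_assoc, h1, ih]
  set A : V →ₗ[k] V := (m : k)⁻¹ • s with hA
  have h3 : A * A = A := by
    rw [hA, smul_mul_smul_comm]
    conv_lhs => rw [hs, Finset.sum_mul]
    rw [Finset.sum_congr rfl fun i _ => h2 i]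
    rw [Finset.sum_const, Finset.card_range, ← Nat.cast_smul_eq_nsmul k, smul_smul]
    congr 1
    field_simp
  have h4 : LinearMap.trace k V A = Module.finrank k (LinearMap.range A) :=
    ((LinearMap.isProj_range_iff_isIdempotentElem A).2 h3).trace
  set J := (Finset.range m).filter fun i => LinearMap.trace k V (U ^ i) ≠ 0 with hJ
  have h5 : LinearMap.trace k V s = Module.finrank k V * J.card := by
    rw [hs, map_sum, ← Finset.sum_filter_ne_zero, ← hJ]
    rw [Finset.sum_congr rfl (g := fun _ => (Module.finrank k V : k)), Finset.sum_const,
      nsmul_eq_mul, mul_comm]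
    intro i hi
    exact mul_right_cancel₀ (Finset.mem_filter.1 hi).2 (htr i)
  have h6 : Module.finrank k V * J.card = m * Module.finrank k (LinearMap.range A) := by
    have : LinearMap.trace k V s = m * LinearMap.trace k V A := by
      rw [hA, map_smul, smul_eq_mul, mul_inv_cancel_left₀ hm0]
    rw [h5, h4] at this
    exact_mod_cast this
  have h7 : m ∣ J.card := by
    exact hcop.dvd_of_dvd_mul_left ⟨_, h6⟩
  have h8 : J.card ≤ m := (Finset.card_filter_le _ _).trans (by simp)
  rcases Nat.eq_zero_or_pos (Module.finrank k V) with hn | hn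
  · rw [hn, Nat.coprime_zero_right] at hcop
    rw [hcop, pow_one] at hU
    exact hU
  have h9 : 0 < J.card := by
    refine Finset.card_pos.2 ⟨0, Finset.mem_filter.2 ⟨Finset.mem_range.2 hm, ?_⟩⟩
    rw [pow_zero, LinearMap.trace_one]
    exact_mod_cast hn.ne'
  have h10 : J.card = m := le_antisymm h8 (Nat.le_of_dvd h9 h7)
  have h11 : LinearMap.range A = ⊤ := by
    refine Submodule.eq_top_of_finrank_eq ?_
    rw [h10, mul_comm] at h6
    exact (Nat.eq_of_mul_eq_mul_left hm h6).symm
  have h12 : A = 1 := by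
    refine LinearMap.ext fun v => ?_
    obtain ⟨w, rfl⟩ := LinearMap.range_eq_top.1 h11 v
    exact LinearMap.congr_fun h3 w
  have h13 : U * A = A := by rw [hA, mul_smul_comm, h1]
  rw [h12, mul_one] at h13
  exact h13

theorem exists_pow_eq_one_of_trace_sq {U : V →ₗ[k] V} {m p a : ℕ} (hp : p.Prime)
    (hn : Module.finrank k V = p ^ a) (hm : 0 < m) (hU : U ^ m = 1)
    (htr : ∀ i, LinearMap.trace k V (U ^ i) * LinearMap.trace k V (U ^ i) =
      Module.finrank k V * LinearMap.trace k V (U ^ i)) : ∃ s, U ^ p ^ s = 1 := by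
  obtain ⟨s, m', hm', rfl⟩ := Nat.exists_eq_pow_mul_and_not_dvd hm.ne' p hp.ne_one
  refine ⟨s, eq_one_of_trace_sq (m := m') ?_ ?_ ?_ ?_⟩
  · exact Nat.pos_of_ne_zero fun h => hm' (h ▸ dvd_zero p)
  · rw [← pow_mul, hU]
  · intro i; rw [← pow_mul]; exact htr _
  · rw [hn]
    exact ((Nat.Prime.coprime_iff_not_dvd hp).2 hm').symm.pow_right a

end Order

section AntipodeOrder

variable {k : Type*} [Field k] {H : Type*} [Ring H] [HopfAlgebra k H] [FiniteDimensional k H]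

open HopfAlgebra

theorem IsGL.isGroupLike {g : H} (hg : IsGL k g) : IsGroupLikeElem k g := ⟨hg.2, hg.1⟩

theorem IsGL.exists_pow_eq_one {g : H} (hg : IsGL k g) : ∃ m, 0 < m ∧ g ^ m = 1 := by
  have hfin : {a : H | IsGroupLikeElem k a}.Finite := by
    have : Finite {a : H | IsGroupLikeElem k a} :=
      LinearIndependent.finite (linearIndepOn_isGroupLikeElem (R := k) (A := H))
    exact Set.toFinite _
  have : ¬ Function.Injective fun n : ℕ => g ^ n := by
    intro hinj
    refine (Set.infinite_range_of_injective hinj) (hfin.subset ?_)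
    rintro _ ⟨n, rfl⟩
    exact (hg.pow n).isGroupLike
  simp only [Function.Injective, not_forall] at this
  obtain ⟨a, b, hab, hne⟩ := this
  wlog hlt : a < b generalizing a b
  · exact this b a hab.symm (Ne.symm hne) (lt_of_le_of_ne (not_lt.1 hlt) (Ne.symm hne))
  refine ⟨b - a, by omega, ?_⟩
  have hu : IsUnit (g ^ a) := (hg.pow a).isGroupLike.isUnit
  apply hu.mul_left_cancel
  rw [← pow_add, mul_one, hab]
  congr 1
  omega

theorem IsGL.trL_sq {g : H} (hg : IsGL k g) :
    trL (k := k) g * trL (k := k) g = Module.finrank k H * trL (k := k) g := by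
  have : IsCorep k (Matrix.of fun _ _ : Unit => g) :=
    ⟨fun _ _ => by simp [hg.1], fun _ _ => by simp [hg.2]⟩
  simpa using this.trL () ()

theorem IsGL.exists_prime_pow [CharZero k] {p a : ℕ} (hp : p.Prime)
    (hn : Module.finrank k H = p ^ a) {g : H} (hg : IsGL k g) : ∃ s, g ^ p ^ s = 1 := by
  obtain ⟨m, hm, hgm⟩ := hg.exists_pow_eq_one
  obtain ⟨s, hs⟩ := exists_pow_eq_one_of_trace_sq (U := LinearMap.mulLeft k g) hp hn hm
    (by rw [LinearMap.pow_mulLeft, hgm]; ext; simp)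
    (fun i => by rw [LinearMap.pow_mulLeft]; exact (hg.pow i).trL_sq)
  refine ⟨s, ?_⟩
  rw [LinearMap.pow_mulLeft] at hs
  simpa using LinearMap.congr_fun hs 1

theorem rc_algHom_mul (α : H →ₐ[k] k) (x y : H) :
    rc α.toLinearMap (x * y) = rc α.toLinearMap x * rc α.toLinearMap y := by
  obtain ⟨s, e⟩ := exists_comul (k := k) x
  have : ∀ z : H, α.toLinearMap ∘ₗ LinearMap.mulLeft k z = α z • α.toLinearMap := by
    intro z; ext x; simp
  rw [rc_mul_left e, rc_of_comul e, Finset.sum_mul]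
  simp_rw [this, rc_smul]
  simp

theorem lc_algHom_mul (α : H →ₐ[k] k) (x y : H) :
    lc α.toLinearMap (x * y) = lc α.toLinearMap x * lc α.toLinearMap y := by
  obtain ⟨s, e⟩ := exists_comul (k := k) x
  have : ∀ z : H, α.toLinearMap ∘ₗ LinearMap.mulLeft k z = α z • α.toLinearMap := by
    intro z; ext x; simp
  rw [lc_mul_left e, lc_of_comul e, Finset.sum_mul]
  simp_rw [this, lc_smul]
  simp

theorem IsGL.antipode {g : H} (hg : IsGL k g) : IsGL k (antipode k g) := by
  have : IsCorep k (Matrix.of fun _ _ : Unit => g) :=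
    ⟨fun _ _ => by simp [hg.1], fun _ _ => by simp [hg.2]⟩
  have h := this.antipode
  exact ⟨by simpa using h.comul_apply () (), by simpa using h.counit_apply () ()⟩

/-- The convolution product of characters. -/
theorem exists_conv_algHom (α β : H →ₐ[k] k) :
    ∃ γ : H →ₐ[k] k, γ.toLinearMap = conv α.toLinearMap β.toLinearMap := by
  refine ⟨AlgHom.ofLinearMap (conv α.toLinearMap β.toLinearMap) (by simp [conv_apply]) ?_, rfl⟩
  intro x y
  simp [conv_apply, rc_algHom_mul]

theorem conv_antipode (α : H →ₐ[k] k) :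
    conv α.toLinearMap (α.toLinearMap ∘ₗ antipode k) = Coalgebra.counit := by
  ext h
  obtain ⟨s, e⟩ := exists_comul (k := k) h
  have := congr_arg α (mul_antipode_lTensor_comul_apply (R := k) h)
  rw [e] at this
  rw [conv_apply, rc_of_comul e]
  simpa [mul_comm] using this

theorem antipode_conv (α : H →ₐ[k] k) :
    conv (α.toLinearMap ∘ₗ antipode k) α.toLinearMap = Coalgebra.counit := by
  ext h
  obtain ⟨s, e⟩ := exists_comul (k := k) h
  have := congr_arg α (mul_antipode_rTensor_comul_apply (R := k) h)
  rw [e] at this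
  rw [conv_apply, rc_of_comul e]
  simpa [mul_comm] using this

theorem exists_rc_pow (α : H →ₐ[k] k) (n : ℕ) : ∃ γ : H →ₐ[k] k,
    (rc α.toLinearMap) ^ n = rc γ.toLinearMap ∧ (lc α.toLinearMap) ^ n = lc γ.toLinearMap := by
  induction n with
  | zero =>
    refine ⟨Bialgebra.counitAlgHom k H, ?_, ?_⟩ <;> ext h <;> simp
  | succ n ih =>
    obtain ⟨γ, hγ, hγ'⟩ := ih
    obtain ⟨δ, hδ⟩ := exists_conv_algHom γ α
    refine ⟨δ, ?_, ?_⟩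
    · ext h
      rw [pow_succ, hγ, hδ, ← rc_rc]; rfl
    · ext h
      rw [pow_succ', hγ', hδ, ← lc_lc]; rfl

theorem exists_rc_pow_eq_one (α : H →ₐ[k] k) : ∃ m, 0 < m ∧ (rc α.toLinearMap) ^ m = 1 := by
  choose γ hγ _ using exists_rc_pow α
  have hfin : Finite (H →ₐ[k] k) := by
    have h1 := linearIndependent_toLinearMap k H k
    exact h1.finite
  have : ¬ Function.Injective fun n : ℕ => (rc α.toLinearMap) ^ n := by
    intro hinj
    refine not_injective_infinite_finite γ fun a b hab => hinj ?_
    simp only [hγ, hab]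
  simp only [Function.Injective, not_forall] at this
  obtain ⟨a, b, hab, hne⟩ := this
  wlog hlt : a < b generalizing a b
  · exact this b a hab.symm (Ne.symm hne) (lt_of_le_of_ne (not_lt.1 hlt) (Ne.symm hne))
  refine ⟨b - a, by omega, ?_⟩
  have hu : IsUnit (rc α.toLinearMap) := by
    refine ⟨⟨rc α.toLinearMap, rc (α.toLinearMap ∘ₗ antipode k), ?_, ?_⟩, rfl⟩
    · ext h; simp [rc_rc, conv_antipode]
    · ext h; simp [rc_rc, antipode_conv]
  apply (hu.pow a).mul_left_cancel
  rw [← pow_add, mul_one, hab]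
  congr 1
  omega

theorem exists_rc_prime_pow [CharZero k] {p a : ℕ} (hp : p.Prime)
    (hn : Module.finrank k H = p ^ a) (α : H →ₐ[k] k) :
    ∃ s, (rc α.toLinearMap) ^ p ^ s = 1 := by
  obtain ⟨m, hm, hgm⟩ := exists_rc_pow_eq_one α
  refine exists_pow_eq_one_of_trace_sq hp hn hm hgm fun i => ?_
  obtain ⟨γ, hγ, -⟩ := exists_rc_pow α i
  rw [hγ, trace_rc_sq]

/-- In a Hopf algebra of dimension `p ^ a` a power of the antipode, with exponent four times a
power of `p`, is trivial. -/
theorem exists_antipode_pow_eq_one [CharZero k] {p a : ℕ} (hp : p.Prime)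
    (hn : Module.finrank k H = p ^ a) : ∃ s, (antipode k (A := H)) ^ (4 * p ^ s) = 1 := by
  obtain ⟨lam, h0, hl⟩ := exists_isLeftInt k H
  obtain ⟨η, a', ha, -, -, hr⟩ := radford hl h0
  let α : H →ₐ[k] k := (Bialgebra.counitAlgHom k H).comp η
  have hS := hr α fun h => rfl
  obtain ⟨s, hs⟩ := exists_rc_prime_pow hp hn α
  obtain ⟨t, ht⟩ := ha.exists_prime_pow hp hn
  have hsl : (lc α.toLinearMap) ^ p ^ s = 1 := by
    obtain ⟨γ, hγ, hγ'⟩ := exists_rc_pow α (p ^ s)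
    have : γ.toLinearMap = Coalgebra.counit := by
      ext h
      have := LinearMap.congr_fun (hγ.symm.trans hs) h
      rw [← counit_rc γ.toLinearMap, this]; rfl
    rw [hγ', this]; ext h; simp
  set U := rc α.toLinearMap with hU
  set W := lc α.toLinearMap with hW
  set C : H →ₗ[k] H := LinearMap.mulLeft k (antipode k a') ∘ₗ LinearMap.mulRight k a' with hC
  have hCU : ∀ r, C r = antipode k a' * r * a' := fun r => by simp [hC, mul_assoc]
  set F := (antipode k (A := H)) ^ 4 with hF
  have hFU : F * U = C * W := by
    ext r
    rw [Module.End.mul_apply, Module.End.mul_apply, hCU, ← hS r]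
    rfl
  have hscal : α (antipode k a') * α a' = 1 := by
    rw [← map_mul, ha.antipode_mul, map_one]
  have hUC : Commute U C := by
    ext r
    rw [Module.End.mul_apply, Module.End.mul_apply, hCU, hCU, hU, rc_algHom_mul, rc_algHom_mul,
      ha.rc, ha.antipode.rc]
    simp only [AlgHom.toLinearMap_apply, smul_mul_assoc, mul_smul_comm, smul_smul]
    rw [mul_comm, hscal, one_smul]
  have hWC : Commute W C := by
    ext r
    rw [Module.End.mul_apply, Module.End.mul_apply, hCU, hCU, hW, lc_algHom_mul, lc_algHom_mul,
      ha.lc, ha.antipode.lc]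
    simp only [AlgHom.toLinearMap_apply, smul_mul_assoc, mul_smul_comm, smul_smul]
    rw [mul_comm, hscal, one_smul]
  have hUW : Commute U W := by
    ext r
    exact rc_lc _ _ _
  set V := U ^ (p ^ s - 1) with hV
  have hUV : U * V = 1 := by
    rw [hV, ← pow_succ', Nat.sub_add_cancel (Nat.one_le_pow _ _ hp.pos), hs]
  have hF' : F = C * W * V := by rw [← hFU, mul_assoc, hUV, mul_one]
  refine ⟨s + t, ?_⟩
  have hCp : C ^ p ^ t = 1 := by
    have : ∀ n r, (C ^ n) r = antipode k (a' ^ n) * r * a' ^ n := by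
      intro n
      induction n with
      | zero => simp
      | succ n ih =>
        intro r
        rw [pow_succ', Module.End.mul_apply, hCU, ih]
        conv_rhs => rw [pow_succ a', antipode_mul_antidistrib]
        simp only [mul_assoc]
    ext r
    rw [this, ht]; simp
  have hVp : V ^ p ^ s = 1 := by
    rw [hV, ← pow_mul, mul_comm, pow_mul, hs, one_pow]
  rw [pow_mul, ← hF, hF', ((hUC.symm.pow_right _).mul_left (hUW.symm.pow_right _)).mul_pow,
    hWC.symm.mul_pow]
  have e1 : C ^ p ^ (s + t) = 1 := by rw [pow_add, mul_comm, pow_mul, hCp, one_pow]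
  have e2 : W ^ p ^ (s + t) = 1 := by rw [pow_add, pow_mul, hsl, one_pow]
  have e3 : V ^ p ^ (s + t) = 1 := by rw [pow_add, pow_mul, hVp, one_pow]
  rw [e1, e2, e3]
  rfl

end AntipodeOrder

end HopfFour

namespace HopfFour

section RootsOfUnity

open Polynomial

variable {k : Type*} [Field k] [CharZero k]

theorem sum_signs_ne {p m N : ℕ} (hp : p.Prime) {ζ : k} (hN : N = p ^ (m + 1))
    (hζ : IsPrimitiveRoot ζ N) (M : Multiset (ℤ × ℕ))
    (hM : ∀ x ∈ M, (x.1 = 1 ∨ x.1 = -1) ∧ x.2 < N) (hodd : Odd p) (hcard : M.card = p)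
    (h2 : 2 ≤ M.count (1, 0)) (hsum : (M.map fun x => (x.1 : k) * ζ ^ x.2).sum = 0) : False := by
  classical
  have hN0 : 0 < N := hN ▸ pow_pos hp.pos _
  have : Fact p.Prime := ⟨hp⟩
  set F : ℤ[X] := (M.map fun x => C x.1 * X ^ x.2).sum with hF
  have hFζ : aeval ζ F = 0 := by
    rw [hF, map_multiset_sum, Multiset.map_map, ← hsum]
    simp
  have hdvd : cyclotomic N ℤ ∣ F := by
    rw [cyclotomic_eq_minpoly hζ hN0]
    exact minpoly.isIntegrallyClosed_dvd (hζ.isIntegral hN0) hFζ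
  obtain ⟨G, hG⟩ := hdvd
  have hF1 : F.eval 1 = (M.map fun x => x.1).sum := by
    rw [hF, ← coe_evalRingHom, map_multiset_sum, Multiset.map_map]
    simp
  have hF1' : F.eval 1 = p * G.eval 1 := by
    rw [hG, eval_mul, hN, eval_one_cyclotomic_prime_pow]
  -- all signs are positive
  have hsgn : ∀ L : Multiset (ℤ × ℕ), (∀ x ∈ L, x.1 = 1 ∨ x.1 = -1) →
      (L.map fun x => x.1).sum = L.card - 2 * L.countP (fun x => x.1 = -1) := by
    intro L
    induction L using Multiset.induction_on with
    | empty => simp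
    | cons x L ih =>
      intro h
      have := ih fun y hy => h y (Multiset.mem_cons_of_mem hy)
      rw [Multiset.map_cons, Multiset.sum_cons, this, Multiset.card_cons, Multiset.countP_cons]
      rcases h x (Multiset.mem_cons_self _ _) with h | h <;> rw [h] <;> simp <;> ring
  have h3 := hsgn M fun x hx => (hM x hx).1
  set c := M.countP (fun x => x.1 = -1) with hc
  have hcount : c + M.count (1, 0) ≤ p := by
    rw [← hcard, Multiset.card_eq_countP_add_countP (fun x : ℤ × ℕ => x.1 = -1), hc]
    gcongr
    rw [Multiset.count, Multiset.countP_eq_card_filter, Multiset.countP_eq_card_filter]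
    refine Multiset.card_le_card (Multiset.monotone_filter_right _ ?_)
    rintro x h
    rw [← h]; norm_num
  have hpc : (p : ℤ) ∣ 2 * c := by
    refine ⟨1 - G.eval 1, ?_⟩
    rw [mul_sub, ← hF1', hF1, h3, hcard]; ring
  have hpc' : p ∣ c := by
    have h4 : p ∣ 2 * c := by exact_mod_cast hpc
    refine Nat.Coprime.dvd_of_dvd_mul_left ?_ h4
    exact hodd.coprime_two_right
  have hc0 : c = 0 := by
    refine Nat.eq_zero_of_dvd_of_lt hpc' ?_
    omega
  have hone : ∀ x ∈ M, x.1 = 1 := by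
    intro x hx
    refine ((hM x hx).1).resolve_right fun h => ?_
    exact (Multiset.countP_eq_zero.1 hc0) x hx h
  -- coefficients
  have hcoef : ∀ j, F.coeff j = M.countP (fun x => x.2 = j) := by
    intro j
    rw [hF]
    clear_value F
    clear hF hcount h2 hcard hM hsum hF1 h3 hc hc0
    clear_value c
    induction M using Multiset.induction_on with
    | empty => simp
    | cons x L ih =>
      have := ih fun y hy => hone y (Multiset.mem_cons_of_mem hy)
      rw [Multiset.map_cons, Multiset.sum_cons, coeff_add, this, Multiset.countP_cons,
        hone x (Multiset.mem_cons_self _ _)]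
      simp only [map_one, one_mul, coeff_X_pow]
      by_cases h : x.2 = j
      · simp [h]; ring
      · simp [h, Ne.symm h]
  have hF1'' : F.eval 1 = p := by
    rw [hF1, h3, hcard, hc0]; simp
  have hG1 : G.eval 1 = 1 := by
    have hp0 : (p : ℤ) ≠ 0 := by exact_mod_cast hp.ne_zero
    exact mul_left_cancel₀ hp0 (by rw [← hF1', hF1'', mul_one])
  have hG0 : G ≠ 0 := by
    rintro rfl
    simp at hG1
  have hdegF : F.degree < N := by
    rw [degree_lt_iff_coeff_zero]
    intro j hj
    rw [hcoef, Nat.cast_eq_zero, Multiset.countP_eq_zero]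
    rintro x hx rfl
    exact absurd (hM x hx).2 (not_lt.2 hj)
  have hdegG : G.natDegree < p ^ m := by
    have h5 := (natDegree_lt_iff_degree_lt (by rw [hG]; exact mul_ne_zero (cyclotomic_ne_zero _ _) hG0)).2
      hdegF
    rw [hG, natDegree_mul (cyclotomic_ne_zero _ _) hG0, natDegree_cyclotomic, hN,
      Nat.totient_prime_pow_succ hp, pow_succ] at h5
    have : p ^ m * p = p ^ m * (p - 1) + p ^ m := by
      rw [← Nat.mul_succ, Nat.succ_eq_add_one, Nat.sub_add_cancel hp.one_le]
    omega
  have hGc : ∀ j < p ^ m, G.coeff j = F.coeff j := by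
    intro j hj
    rw [hG, hN, cyclotomic_prime_pow_eq_geom_sum hp, Finset.sum_mul, finsetSum_coeff,
      Finset.sum_eq_single_of_mem 0 (Finset.mem_range.2 hp.pos)]
    · simp
    · intro i _ hi
      rw [← pow_mul, coeff_X_pow_mul', if_neg]
      have : p ^ m * 1 ≤ p ^ m * i := Nat.mul_le_mul_left _ (Nat.pos_of_ne_zero hi)
      omega
  have hGn : ∀ j, 0 ≤ G.coeff j := by
    intro j
    by_cases hj : j < p ^ m
    · rw [hGc j hj, hcoef]; positivity
    · rw [coeff_eq_zero_of_natDegree_lt (by omega)]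
  have hG00 : 2 ≤ G.coeff 0 := by
    rw [hGc 0 (pow_pos hp.pos _), hcoef]
    refine (Nat.cast_le (α := ℤ)).2 (h2.trans ?_)
    rw [Multiset.count, Multiset.countP_eq_card_filter, Multiset.countP_eq_card_filter]
    refine Multiset.card_le_card (Multiset.monotone_filter_right _ ?_)
    rintro x h
    rw [← h]
  have : G.coeff 0 ≤ G.eval 1 := by
    rw [eval_eq_sum_range]
    simp only [one_pow, mul_one]
    exact Finset.single_le_sum (f := fun i => G.coeff i) (fun i _ => hGn i) (by simp)
  omega

/-- An odd prime number of `2 * p ^ t`-th roots of unity containing `1` twice cannot sum to zero. -/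
theorem sum_roots_of_unity_ne [IsAlgClosed k] {p t : ℕ} (hp : p.Prime) (hodd : Odd p)
    {M : Multiset k} (hM : ∀ μ ∈ M, μ ^ (2 * p ^ t) = 1) (hcard : M.card = p)
    (h2 : ∀ [DecidableEq k], 2 ≤ M.count 1) (hsum : M.sum = 0) : False := by
  classical
  set N := p ^ (t + 1) with hN
  have hN0 : 0 < N := pow_pos hp.pos _
  have hNo : Odd N := hodd.pow
  have : NeZero (N : k) := ⟨by exact_mod_cast hN0.ne'⟩
  have : NeZero N := ⟨hN0.ne'⟩
  obtain ⟨ζ, hζ⟩ := HasEnoughRootsOfUnity.exists_primitiveRoot k N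
  have key : ∀ μ ∈ M, ∃ x : ℤ × ℕ, (x.1 = 1 ∨ x.1 = -1) ∧ x.2 < N ∧ (x.1 : k) * ζ ^ x.2 = μ ∧
      (μ = 1 → x = (1, 0)) := by
    intro μ hμ
    by_cases h1 : μ = 1
    · exact ⟨(1, 0), by simp, hN0, by simp [h1], fun _ => rfl⟩
    have h3 : (μ ^ N) ^ 2 = 1 := by
      rw [hN, ← pow_mul, pow_succ, show p ^ t * p * 2 = (2 * p ^ t) * p by ring, pow_mul, hM μ hμ,
        one_pow]
    rcases sq_eq_one_iff.1 h3 with h | h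
    · obtain ⟨j, hj, rfl⟩ := hζ.eq_pow_of_pow_eq_one h
      exact ⟨(1, j), by simp, hj, by simp, fun h => absurd h h1⟩
    · obtain ⟨j, hj, hj'⟩ := hζ.eq_pow_of_pow_eq_one (ξ := -μ) (by rw [hNo.neg_pow, h, neg_neg])
      exact ⟨(-1, j), by simp, hj, by simp [hj'], fun h => absurd h h1⟩
  have key' : ∀ μ, ∃ x : ℤ × ℕ, μ ∈ M → (x.1 = 1 ∨ x.1 = -1) ∧ x.2 < N ∧
      (x.1 : k) * ζ ^ x.2 = μ ∧ (μ = 1 → x = (1, 0)) := by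
    intro μ
    by_cases hμ : μ ∈ M
    · obtain ⟨x, hx⟩ := key μ hμ
      exact ⟨x, fun _ => hx⟩
    · exact ⟨(1, 0), fun h => absurd h hμ⟩
  choose e he using key'
  have h1M : (1 : k) ∈ M := Multiset.count_pos.1 (lt_of_lt_of_le two_pos h2)
  refine sum_signs_ne hp hN hζ (M.map e) ?_ hodd (by rw [Multiset.card_map, hcard]) ?_ ?_
  · intro x hx
    obtain ⟨μ, hμ, rfl⟩ := Multiset.mem_map.1 hx
    exact ⟨(he μ hμ).1, (he μ hμ).2.1⟩
  · refine (h2 ).trans ?_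
    rw [← (he 1 h1M).2.2.2 rfl, Multiset.count_map, Multiset.count, Multiset.countP_eq_card_filter]
    refine Multiset.card_le_card (Multiset.monotone_filter_right _ ?_)
    rintro x rfl
    rfl
  · rw [Multiset.map_map, ← hsum]
    conv_rhs => rw [← Multiset.map_id M]
    refine congr_arg _ (Multiset.map_congr rfl fun μ hμ => (he μ hμ).2.2.1)

end RootsOfUnity

section TraceLemmas

variable {k : Type*} [Field k] {V : Type*} [AddCommGroup V] [Module k V] [FiniteDimensional k V]

theorem trace_ne_zero_of_pow_eq_one [CharZero k] [IsAlgClosed k] {p t : ℕ} (hp : p.Prime)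
    (hodd : Odd p) (hV : Module.finrank k V = p) {θ : V →ₗ[k] V} (hθ : θ ^ (2 * p ^ t) = 1)
    {x y : V} (hx : θ x = x) (hy : θ y = y) (hxy : LinearIndependent k ![x, y]) :
    LinearMap.trace k V θ ≠ 0 := by
  intro h0
  have hs : θ.charpoly.Splits := IsAlgClosed.splits _
  rw [Module.End.trace_eq_sum_roots_charpoly_of_splits hs] at h0
  refine sum_roots_of_unity_ne (t := t) hp hodd ?_ ?_ ?_ h0
  · intro μ hμ
    have h1 : Module.End.HasEigenvalue θ μ := by
      rw [Module.End.hasEigenvalue_iff_isRoot_charpoly]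
      exact Polynomial.isRoot_of_mem_roots hμ
    obtain ⟨v, hv⟩ := h1.exists_hasEigenvector
    have h2 := hv.pow_apply (2 * p ^ t)
    rw [hθ] at h2
    have h3 : (μ ^ (2 * p ^ t) - 1) • v = 0 := by rw [sub_smul, ← h2]; simp
    exact sub_eq_zero.1 ((smul_eq_zero.1 h3).resolve_right hv.2)
  · rw [← hs.natDegree_eq_card_roots, LinearMap.charpoly_natDegree, hV]
  · intro _
    rw [Polynomial.count_roots]
    refine le_trans ?_ (LinearMap.finrank_eigenspace_le θ 1)
    have hle : Submodule.span k (Set.range ![x, y]) ≤ Module.End.eigenspace θ 1 := by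
      rw [Submodule.span_le]
      rintro _ ⟨i, rfl⟩
      rw [SetLike.mem_coe, Module.End.mem_eigenspace_iff]
      fin_cases i
      · simpa using hx
      · simpa using hy
    have := Submodule.finrank_mono hle
    rwa [finrank_span_eq_card hxy, Fintype.card_fin] at this

theorem trace_eq_sum_of_frame {ι : Type*} [Fintype ι] (f : V →ₗ[k] V) (d : ι → V)
    (φ : ι → V →ₗ[k] k) (h : ∀ v, ∑ i, φ i v • d i = v) :
    LinearMap.trace k V f = ∑ i, φ i (f (d i)) := by
  have : f = ∑ i, (φ i).smulRight (f (d i)) := by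
    ext v
    conv_lhs => rw [← h v]
    simp
  conv_lhs => rw [this]
  rw [map_sum]
  simp

end TraceLemmas

section CoidealSubalgebra

variable {k : Type*} [Field k] {H : Type*} [Ring H] [HopfAlgebra k H] [FiniteDimensional k H]

open HopfAlgebra

/-- The trace formula for a left coideal subalgebra with a nondegenerate relative integral. -/
theorem exists_integral_trace {R : Submodule k H} (h1 : (1 : H) ∈ R)
    (hmul : ∀ r ∈ R, ∀ s ∈ R, r * s ∈ R) (hlc : IsLC (k := k) R)
    (hS : ∀ r ∈ R, antipode k (antipode k r) ∈ R) {ℓ : H →ₗ[k] k} {a : H} (ha : IsGL k a)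
    (hl : ∀ r ∈ R, rc ℓ r = ℓ r • a) (hnd : ∀ s ∈ R, (∀ r ∈ R, ℓ (r * s) = 0) → s = 0) :
    ∃ Λ ∈ R, (∀ r ∈ R, r * Λ = Coalgebra.counit (R := k) r • Λ) ∧
      (∀ r ∈ R, ℓ (r * Λ) = Coalgebra.counit (R := k) r) ∧
      (Coalgebra.counit (R := k) Λ ≠ 0 → a ∈ R) ∧
      ∀ s (f : R →ₗ[k] R), (∀ r, (f r : H) = s * antipode k (antipode k (r : H))) →
        LinearMap.trace k R f = Coalgebra.counit (R := k) Λ * ℓ (s * a) := by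
  classical
  -- the pairing
  let β : R →ₗ[k] R →ₗ[k] k :=
    LinearMap.mk₂ k (fun r s : R => ℓ ((r : H) * s)) (by simp [add_mul]) (by simp) (by simp [mul_add])
      (by simp)
  have hβ : ∀ r s : R, β r s = ℓ ((r : H) * s) := fun _ _ => rfl
  have hinj : Function.Injective β.flip := by
    rw [injective_iff_map_eq_zero]
    intro s hs
    refine Subtype.ext (hnd s s.2 fun r hr => ?_)
    exact LinearMap.congr_fun hs ⟨r, hr⟩
  have hfr : Module.finrank k R = Module.finrank k (R →ₗ[k] k) := by
    simp
  have hsurj : Function.Surjective β.flip :=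
    (LinearMap.injective_iff_surjective_of_finrank_eq_finrank hfr).1 hinj
  have hinj' : Function.Injective β := by
    rw [injective_iff_map_eq_zero]
    intro r hr
    refine eq_of_forall_dual (k := k) fun φ => ?_
    obtain ⟨s, rfl⟩ := hsurj φ
    rw [map_zero, LinearMap.flip_apply, hr]; rfl
  have hsurj' : Function.Surjective β :=
    (LinearMap.injective_iff_surjective_of_finrank_eq_finrank hfr).1 hinj'
  obtain ⟨Λ, hΛ⟩ := hsurj (Coalgebra.counit ∘ₗ R.subtype)
  have hΛ1 : ∀ r ∈ R, ℓ (r * Λ) = Coalgebra.counit (R := k) r := fun r hr =>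
    LinearMap.congr_fun hΛ ⟨r, hr⟩
  have hΛ2 : ∀ r ∈ R, r * (Λ : H) = Coalgebra.counit (R := k) r • (Λ : H) := by
    intro r hr
    rw [← sub_eq_zero]
    refine hnd _ (sub_mem (hmul _ hr _ Λ.2) (R.smul_mem _ Λ.2)) fun s hs => ?_
    rw [mul_sub, ← mul_assoc, mul_smul_comm, map_sub, map_smul, hΛ1 _ (hmul _ hs _ hr), hΛ1 _ hs]
    simp [mul_comm]
  -- dual bases
  let b := Module.finBasis k R
  have hbLI : LinearIndependent k (fun i => (b i : H)) :=
    b.linearIndependent.map' R.subtype (Submodule.ker_subtype R)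
  have hspan : Submodule.span k (Set.range fun i => (b i : H)) = R := by
    have : (Set.range fun i => (b i : H)) = R.subtype '' Set.range b := by
      rw [← Set.range_comp]; rfl
    rw [this, ← Submodule.map_span, b.span_eq, Submodule.map_top, Submodule.range_subtype]
  choose d hd using fun i => hsurj' (b.coord i)
  have hdb : ∀ r : R, ∑ i, ℓ ((d i : H) * r) • (b i : H) = r := by
    intro r
    have h3 : ∀ i, ℓ ((d i : H) * r) = b.coord i r := fun i => LinearMap.congr_fun (hd i) r
    simp_rw [h3]
    conv_rhs => rw [← b.sum_repr r, AddSubmonoidClass.coe_finsetSum]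
    rfl
  have hbd : ∀ r : R, ∑ i, ℓ ((r : H) * b i) • (d i : H) = r := by
    intro r
    have h3 : ∑ i, ℓ ((r : H) * b i) • d i = r := by
      apply hinj'
      refine b.ext fun j => ?_
      rw [map_sum, LinearMap.sum_apply, Finset.sum_eq_single j]
      · rw [map_smul, hd]; simp [hβ]
      · intro i _ hij
        rw [map_smul, hd]; simp [hij.symm]
      · simp
    conv_rhs => rw [← h3]
    simp
  obtain ⟨f, hf⟩ := exists_dual_family hbLI
  have hfs : ∀ r ∈ R, ∑ i, f i r • (b i : H) = r := fun r hr =>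
    sum_dual_family hf (by rw [hspan]; exact hr)
  set L : Fin (Module.finrank k R) → H := fun i => rc (f i) (Λ : H) with hL
  have hcomul : Coalgebra.comul (R := k) (Λ : H) = ∑ i, L i ⊗ₜ[k] (b i : H) := by
    refine comul_eq_iff_lc.2 fun φ => ?_
    rw [← hfs _ (hlc φ _ Λ.2)]
    simp only [hL, apply_rc]
  obtain ⟨u, hu, hub, -, hus⟩ := exists_corep hbLI
    (fun φ i => by rw [hspan]; exact hlc φ _ (b i).2)
  have hkey : ∀ i, ∑ j, u i j * ∑ m, ℓ ((b j : H) * b m) • L m =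
      Coalgebra.counit (R := k) (b i : H) • a := by
    intro i
    have h5 := rc_mul_left (hub i) ℓ (Λ : H)
    rw [hΛ2 _ (b i).2, map_smul, hl _ Λ.2] at h5
    have h6 : ℓ (Λ : H) = 1 := by
      have := hΛ1 1 h1
      rwa [one_mul, Bialgebra.counit_one] at this
    rw [h6, one_smul] at h5
    rw [h5]
    refine Finset.sum_congr rfl fun j _ => ?_
    rw [rc_of_comul hcomul]
    rfl
  have hy : ∀ l, ∑ m, ℓ ((b l : H) * b m) • L m = antipode k (b l : H) * a := by
    intro l
    have h7 : ∑ i, antipode k (u l i) * ∑ j, u i j * ∑ m, ℓ ((b j : H) * b m) • L m =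
        ∑ m, ℓ ((b l : H) * b m) • L m := by
      have h10 : ∀ i, antipode k (u l i) * ∑ j, u i j * ∑ m, ℓ ((b j : H) * b m) • L m =
          ∑ j, antipode k (u l i) * u i j * ∑ m, ℓ ((b j : H) * b m) • L m := fun i => by
        rw [Finset.mul_sum]; simp_rw [mul_assoc]
      rw [Finset.sum_congr rfl fun i _ => h10 i, Finset.sum_comm]
      simp_rw [← Finset.sum_mul, hu.sum_antipode_mul]
      simp [ite_mul]
    rw [← h7]
    simp_rw [hkey, mul_smul_comm, ← smul_mul_assoc]
    rw [← Finset.sum_mul, ← hus l, map_sum]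
    simp
  have hy' : ∀ r : R, ∑ m, ℓ ((r : H) * b m) • L m = antipode k (r : H) * a := by
    intro r
    rw [← hfs _ r.2]
    simp_rw [Finset.sum_mul, map_sum, Finset.sum_smul]
    rw [Finset.sum_comm, Finset.sum_mul]
    refine Finset.sum_congr rfl fun i _ => ?_
    simp_rw [smul_mul_assoc, map_smul, smul_assoc, ← Finset.smul_sum, hy, smul_mul_assoc]
  have hLd : ∀ m, L m = antipode k (d m : H) * a := by
    intro m
    rw [← hy' (d m), Finset.sum_eq_single m]
    · have h3 : ℓ ((d m : H) * b m) = b.coord m (b m) := LinearMap.congr_fun (hd m) (b m)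
      rw [h3]; simp
    · intro i _ hi
      have h3 : ℓ ((d m : H) * b i) = b.coord m (b i) := LinearMap.congr_fun (hd m) (b i)
      rw [h3]; simp [hi]
    · simp
  have hfin : ∑ i, antipode k (antipode k (d i : H)) * b i = Coalgebra.counit (R := k) (Λ : H) • a := by
    have h8 := mul_antipode_rTensor_comul_apply (R := k) (Λ : H)
    rw [hcomul] at h8
    simp only [map_sum, LinearMap.rTensor_tmul, LinearMap.mul'_apply, hLd,
      antipode_mul_antidistrib, mul_assoc] at h8
    rw [← Finset.mul_sum] at h8
    have h9 := congr_arg (fun z => a * z) h8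
    simp only [← mul_assoc, ha.mul_antipode, one_mul] at h9
    rw [h9, Algebra.algebraMap_eq_smul_one, mul_smul_comm, mul_one]
  refine ⟨Λ, Λ.2, hΛ2, hΛ1, fun h0 => ?_, fun s g hg => ?_⟩
  · have : a = (Coalgebra.counit (R := k) (Λ : H))⁻¹ •
        ∑ i, antipode k (antipode k (d i : H)) * b i := by
      rw [hfin, smul_smul, inv_mul_cancel₀ h0, one_smul]
    rw [this]
    exact R.smul_mem _ (R.sum_mem fun i _ => hmul _ (hS _ (d i).2) _ (b i).2)
  · rw [trace_eq_sum_of_frame g d (fun i => β.flip (b i)) fun r => Subtype.ext (by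
      simpa [hβ] using hbd r)]
    simp only [LinearMap.flip_apply, hβ, hg, mul_assoc]
    rw [← map_sum, ← Finset.mul_sum, hfin, mul_smul_comm, map_smul, smul_eq_mul]

end CoidealSubalgebra

end HopfFour

namespace HopfFour

section QuantumPlane

variable {k : Type*} [Field k] {B : Type*} [Ring B] [Algebra k B]

theorem mul_pow_of_comm {q : k} (hq : q ≠ 0) {g x : B} (h : g * x = q • (x * g)) (i : ℕ) :
    x * g ^ i = (q⁻¹) ^ i • (g ^ i * x) := by
  have h' : x * g = q⁻¹ • (g * x) := by rw [h, smul_smul, inv_mul_cancel₀ hq, one_smul]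
  induction i with
  | zero => simp
  | succ i ih =>
    rw [pow_succ g, ← mul_assoc, ih, smul_mul_assoc, mul_assoc, h', mul_smul_comm, smul_smul,
      ← pow_succ, mul_assoc]

/-- Monomials in `q`-commuting elements span the algebra they generate. -/
theorem adjoin_le_span {q : k} (hq : q ≠ 0) {g x : B} (h : g * x = q • (x * g)) :
    Subalgebra.toSubmodule (Algebra.adjoin k {g, x}) ≤
      Submodule.span k (Set.range fun a : ℕ × ℕ => g ^ a.1 * x ^ a.2) := by
  set V := Submodule.span k (Set.range fun a : ℕ × ℕ => g ^ a.1 * x ^ a.2) with hV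
  have hmem : ∀ i j, g ^ i * x ^ j ∈ V := fun i j => Submodule.subset_span ⟨(i, j), rfl⟩
  have hgen : ∀ y ∈ ({g, x} : Set B), ∀ v ∈ V, y * v ∈ V := by
    intro y hy v hv
    induction hv using Submodule.span_induction with
    | zero => simp
    | add v w _ _ hv hw => rw [mul_add]; exact add_mem hv hw
    | smul c v _ hv => rw [mul_smul_comm]; exact V.smul_mem _ hv
    | mem v hv =>
      obtain ⟨⟨i, j⟩, rfl⟩ := hv
      rcases hy with rfl | rfl
      · rw [← mul_assoc, ← pow_succ']; exact hmem _ _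
      · rw [← mul_assoc, mul_pow_of_comm hq h, smul_mul_assoc, mul_assoc, ← pow_succ']
        exact V.smul_mem _ (hmem _ _)
  intro y hy
  have : ∀ v ∈ V, y * v ∈ V := by
    refine Algebra.adjoin_induction (p := fun y _ => ∀ v ∈ V, y * v ∈ V) hgen ?_ ?_ ?_ hy
    · intro r v hv
      rw [← Algebra.smul_def]; exact V.smul_mem _ hv
    · intro a b _ _ ha hb v hv
      rw [add_mul]; exact add_mem (ha v hv) (hb v hv)
    · intro a b _ _ ha hb v hv
      rw [mul_assoc]; exact ha _ (hb _ hv)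
  simpa using this 1 (by simpa using hmem 0 0)

theorem span_le_span_fin {p : ℕ} (hp : 0 < p) {g x : B} (hg : g ^ p = 1) (hx : x ^ p = 0) :
    Submodule.span k (Set.range fun a : ℕ × ℕ => g ^ a.1 * x ^ a.2) ≤
      Submodule.span k (Set.range fun a : Fin p × Fin p => g ^ (a.1 : ℕ) * x ^ (a.2 : ℕ)) := by
  rw [Submodule.span_le]
  rintro _ ⟨⟨i, j⟩, rfl⟩
  by_cases hj : j < p
  · refine Submodule.subset_span ⟨(⟨i % p, Nat.mod_lt _ hp⟩, ⟨j, hj⟩), ?_⟩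
    show g ^ (i % p) * x ^ j = g ^ i * x ^ j
    rw [← pow_eq_pow_mod i hg]
  · show g ^ i * x ^ j ∈ _
    rw [← Nat.sub_add_cancel (not_lt.1 hj), pow_add, hx, mul_zero, mul_zero]
    exact zero_mem _

end QuantumPlane

section TaftFunctionals

variable {k : Type*} [Field k] {H : Type*} [Ring H] [HopfAlgebra k H]

/-- A character and a skew derivation generating a Taft algebra inside the dual. -/
structure TaftFun (p : ℕ) (q : k) (χ : H →ₐ[k] k) (f : H →ₗ[k] k) : Prop where
  map_mul : ∀ a b, f (a * b) = f a * Coalgebra.counit (R := k) b + χ a * f b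
  rc_pow : rc χ.toLinearMap ^ p = 1
  rc_pow_zero : rc f ^ p = 0
  rc_pow_ne_zero : rc f ^ (p - 1) ≠ 0
  conv_comm : conv χ.toLinearMap f = q • conv f χ.toLinearMap

variable {p : ℕ} {q : k} {χ : H →ₐ[k] k} {f : H →ₗ[k] k}

theorem rc_mul_of_skew (hmul : ∀ a b, f (a * b) = f a * Coalgebra.counit (R := k) b + χ a * f b)
    (a b : H) : rc f (a * b) = rc f a * b + rc χ.toLinearMap a * rc f b := by
  obtain ⟨s, e⟩ := exists_comul (k := k) a
  have : ∀ z : H, f ∘ₗ LinearMap.mulLeft k z = f z • Coalgebra.counit + χ z • f := by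
    intro z; ext y; simp [hmul]
  rw [rc_mul_left e, rc_of_comul e, rc_of_comul e, Finset.sum_mul, Finset.sum_mul,
    ← Finset.sum_add_distrib]
  refine Finset.sum_congr rfl fun i _ => ?_
  rw [this, rc_add, rc_smul, rc_smul, rc_counit, mul_add]
  simp

theorem TaftFun.rc_mul (h : TaftFun p q χ f) (a b : H) :
    rc f (a * b) = rc f a * b + rc χ.toLinearMap a * rc f b := rc_mul_of_skew h.map_mul a b

theorem TaftFun.map_one (h : TaftFun p q χ f) : f 1 = 0 := by
  have := h.map_mul 1 1
  simpa using this

theorem TaftFun.rc_comm (h : TaftFun p q χ f) (a : H) :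
    rc χ.toLinearMap (rc f a) = q • rc f (rc χ.toLinearMap a) := by
  rw [rc_rc, rc_rc, h.conv_comm, rc_smul]

open HopfAlgebra

theorem TaftFun.comp_antipode (h : TaftFun p q χ f) :
    f ∘ₗ antipode k = - conv (χ.toLinearMap ∘ₗ antipode k) f := by
  ext a
  obtain ⟨s, e⟩ := exists_comul (k := k) a
  have h1 := congr_arg f (mul_antipode_rTensor_comul_apply (R := k) a)
  rw [e, Algebra.algebraMap_eq_smul_one, map_smul, h.map_one, smul_zero] at h1
  simp only [map_sum, LinearMap.rTensor_tmul, LinearMap.mul'_apply, h.map_mul,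
    Finset.sum_add_distrib] at h1
  rw [LinearMap.neg_apply, conv_apply, rc_of_comul e, eq_neg_iff_add_eq_zero, ← h1]
  congr 1
  · have h2 := rc_of_comul e (Coalgebra.counit (R := k))
    rw [rc_counit] at h2
    conv_lhs => rw [h2]
    simp [mul_comm]
  · simp [mul_comm]

theorem algHom_antipode_antipode [FiniteDimensional k H] (χ : H →ₐ[k] k) (a : H) :
    χ (antipode k (antipode k a)) = χ a := by
  refine corep_induction (k := k) (P := fun a => χ (antipode k (antipode k a)) = χ a)
    (by simp) (fun x y hx hy => by simp [hx, hy]) (fun c x hx => by simp [hx])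
    (fun n u hu i j => ?_) a
  let M : Matrix (Fin n) (Fin n) k := Matrix.of fun i j => χ (u i j)
  let N : Matrix (Fin n) (Fin n) k := Matrix.of fun i j => χ (antipode k (u i j))
  let P : Matrix (Fin n) (Fin n) k := Matrix.of fun i j => χ (antipode k (antipode k (u i j)))
  have h1 : N * M = 1 := by
    ext i j
    have := congr_arg χ (hu.sum_antipode_mul i j)
    simpa [Matrix.mul_apply, Matrix.one_apply, N, M, apply_ite χ] using this
  have h2 : P * N = 1 := by
    ext i j
    have := congr_arg χ (hu.antipode.sum_mul_antipode j i)
    simpa [Matrix.mul_apply, Matrix.one_apply, N, P, apply_ite χ, mul_comm, eq_comm] using this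
  have h3 : P = M := left_inv_eq_right_inv h2 h1
  exact congr_fun (congr_fun h3 i) j

theorem TaftFun.antipode_sq [FiniteDimensional k H] (h : TaftFun p q χ f) (hq : q ≠ 0) (a : H) :
    f (antipode k (antipode k a)) = q⁻¹ * f a := by
  have h1 : conv (conv (χ.toLinearMap ∘ₗ antipode k) f) χ.toLinearMap = q⁻¹ • f := by
    have h2 : conv f χ.toLinearMap = q⁻¹ • conv χ.toLinearMap f := by
      rw [h.conv_comm, smul_smul, inv_mul_cancel₀ hq, one_smul]
    ext a
    rw [conv_assoc, h2, conv_apply, rc_smul, map_smul, ← conv_apply, ← conv_assoc, antipode_conv,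
      counit_conv]
    rfl
  rw [← smul_eq_mul, ← LinearMap.smul_apply, ← h1]
  refine corep_induction (k := k) (P := fun a => f (antipode k (antipode k a)) =
    conv (conv (χ.toLinearMap ∘ₗ antipode k) f) χ.toLinearMap a)
    (by simp) (fun x y hx hy => by simp [hx, hy]) (fun c x hx => by simp [hx])
    (fun n u hu i j => ?_) a
  have h3 : ∀ a, f (antipode k a) = - conv (χ.toLinearMap ∘ₗ antipode k) f a := fun a =>
    LinearMap.congr_fun h.comp_antipode a
  rw [h3, conv_apply, conv_apply, hu.rc]
  have h4 := hu.antipode.rc f j i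
  simp only [Matrix.of_apply] at h4
  rw [h4]
  simp only [map_sum, map_smul, LinearMap.comp_apply, AlgHom.toLinearMap_apply,
    algHom_antipode_antipode, smul_eq_mul, h3]
  rw [← Finset.sum_neg_distrib]
  refine Finset.sum_congr rfl fun l _ => ?_
  ring

end TaftFunctionals

section TaftAlgebra

variable {k : Type*} [Field k] {B : Type*} [Ring B] [HopfAlgebra k B]

theorem quantum_sum_ne_zero {p : ℕ} {q : k} (hq : IsPrimitiveRoot q p) {j : ℕ} (h0 : 0 < j)
    (hj : j < p) : ∑ i ∈ Finset.range j, q ^ i ≠ 0 := by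
  intro h
  have h1 := geom_sum_mul q j
  rw [h, zero_mul] at h1
  exact hq.pow_ne_one_of_pos_of_lt h0.ne' hj (sub_eq_zero.1 h1.symm)

theorem exists_taftFun_self {p : ℕ} {q : k} (hp : p.Prime) (hq : IsPrimitiveRoot q p)
    (hdim : Module.finrank k B = p ^ 2) {g x : B} (hg : IsGL k g)
    (hx : Coalgebra.comul (R := k) x = x ⊗ₜ[k] (1 : B) + g ⊗ₜ[k] x) (hgp : g ^ p = 1)
    (hxp : x ^ p = 0) (hgx : g * x = q • (x * g)) (hadj : Algebra.adjoin k {g, x} = ⊤) :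
    ∃ (χ : B →ₐ[k] k) (f : B →ₗ[k] k), TaftFun p q χ f := by
  have hq0 : q ≠ 0 := hq.ne_zero hp.ne_zero
  have : FiniteDimensional k B := Module.finite_of_finrank_pos (by rw [hdim]; exact pow_pos hp.pos 2)
  have hspan : ⊤ ≤ Submodule.span k
      (Set.range fun a : Fin p × Fin p => g ^ (a.1 : ℕ) * x ^ (a.2 : ℕ)) := by
    refine le_trans ?_ (span_le_span_fin hp.pos hgp hxp)
    refine le_trans ?_ (adjoin_le_span hq0 hgx)
    rw [hadj]; simp
  have hLI : LinearIndependent k fun a : Fin p × Fin p => g ^ (a.1 : ℕ) * x ^ (a.2 : ℕ) := by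
    refine linearIndependent_of_top_le_span_of_card_eq_finrank hspan ?_
    rw [hdim]; simp [sq]
  let b : Module.Basis (Fin p × Fin p) k B := Module.Basis.mk hLI hspan
  have hb : ∀ a, b a = g ^ (a.1 : ℕ) * x ^ (a.2 : ℕ) := fun a => Module.Basis.mk_apply _ _ a
  -- functionals concentrated in a fixed degree
  have hF : ∀ m < p, ∃ F : B →ₗ[k] k, ∀ i j, F (g ^ i * x ^ j) = if j = m then q ^ i else 0 := by
    intro m hm
    refine ⟨b.constr k fun a => if (a.2 : ℕ) = m then q ^ (a.1 : ℕ) else 0, fun i j => ?_⟩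
    by_cases hj : j < p
    · have h1 : g ^ i * x ^ j = b (⟨i % p, Nat.mod_lt _ hp.pos⟩, ⟨j, hj⟩) := by
        rw [hb, ← pow_eq_pow_mod i hgp]
      rw [h1, Module.Basis.constr_basis, pow_eq_pow_mod i hq.pow_eq_one]
    · rw [← Nat.sub_add_cancel (not_lt.1 hj), pow_add, hxp, mul_zero, mul_zero, map_zero,
        if_neg (by omega)]
  have hind : ∀ {P : B → Prop}, P 0 → (∀ a b, P a → P b → P (a + b)) → (∀ (c : k) a, P a → P (c • a)) →
      (∀ i j, P (g ^ i * x ^ j)) → ∀ a, P a := by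
    intro P h0 ha hs hm a
    have : a ∈ Submodule.span k (Set.range fun a : Fin p × Fin p => g ^ (a.1 : ℕ) * x ^ (a.2 : ℕ)) :=
      hspan trivial
    induction this using Submodule.span_induction with
    | zero => exact h0
    | add v w _ _ hv hw => exact ha _ _ hv hw
    | smul c v _ hv => exact hs _ _ hv
    | mem v hv => obtain ⟨a, rfl⟩ := hv; exact hm _ _
  obtain ⟨c, hc⟩ := hF 0 hp.pos
  obtain ⟨f, hf⟩ := hF 1 hp.one_lt
  have hprod : ∀ i j m n, g ^ i * x ^ j * (g ^ m * x ^ n) =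
      (q⁻¹ ^ (j * m)) • (g ^ (i + m) * x ^ (j + n)) := by
    have h1 : ∀ j m, x ^ j * g ^ m = (q⁻¹ ^ (j * m)) • (g ^ m * x ^ j) := by
      intro j m
      induction j with
      | zero => simp
      | succ j ih =>
        rw [pow_succ', mul_assoc, ih, mul_smul_comm, ← mul_assoc, mul_pow_of_comm hq0 hgx,
          smul_mul_assoc, smul_smul, ← pow_add, mul_assoc]
        congr 2; ring
    intro i j m n
    rw [mul_assoc, ← mul_assoc (x ^ j), h1, smul_mul_assoc, mul_smul_comm, pow_add, pow_add]
    simp only [mul_assoc]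
  have hx0 : Coalgebra.counit (R := k) x = 0 := by
    have h1 := rc_of_comul (k := k) (s := Finset.univ) (x := ![x, g]) (y := ![1, x]) (h := x)
      (by simp [hx]) Coalgebra.counit
    have h2 : Coalgebra.counit (R := k) x • g = 0 := by simpa using h1
    have := congr_arg (Coalgebra.counit (R := k)) h2
    simpa [hg.2] using this
  have hε : ∀ i j, Coalgebra.counit (R := k) (g ^ i * x ^ j) = if j = 0 then 1 else 0 := by
    intro i j
    simp only [Bialgebra.counit_mul, Bialgebra.counit_pow, hg.2, hx0]
    by_cases h : j = 0 <;> simp [h]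
  have hc1 : c 1 = 1 := by simpa using hc 0 0
  have hcm : ∀ a b, c (a * b) = c a * c b := by
    intro a b
    refine hind (P := fun a => c (a * b) = c a * c b) (by simp) (fun x y hx hy => by
      rw [add_mul, map_add, hx, hy, map_add, add_mul]) (fun r x hx => by
      rw [smul_mul_assoc, map_smul, hx, map_smul, smul_mul_assoc]) (fun i j => ?_) a
    refine hind (P := fun b => c (g ^ i * x ^ j * b) = c (g ^ i * x ^ j) * c b) (by simp)
      (fun x y hx hy => by rw [mul_add, map_add, hx, hy, map_add, mul_add]) (fun r x hx => by
      rw [mul_smul_comm, map_smul, hx, map_smul, mul_smul_comm]) (fun m n => ?_) b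
    rw [hprod, map_smul, hc, hc, hc]
    rcases Nat.eq_zero_or_pos j with rfl | hj
    · by_cases hn : n = 0 <;> simp [hn, pow_add]
    · simp [hj.ne']
  let χ : B →ₐ[k] k := AlgHom.ofLinearMap c hc1 hcm
  have hχ : ∀ i j, χ (g ^ i * x ^ j) = if j = 0 then q ^ i else 0 := hc
  have hfm : ∀ a b, f (a * b) = f a * Coalgebra.counit (R := k) b + χ a * f b := by
    intro a b
    refine hind (P := fun a => f (a * b) = f a * Coalgebra.counit (R := k) b + χ a * f b) (by simp)
      (fun x y hx hy => by rw [add_mul, map_add, hx, hy, map_add, map_add]; ring) (fun r x hx => by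
      rw [smul_mul_assoc, map_smul, hx, map_smul, map_smul]; simp only [smul_eq_mul]; ring)
      (fun i j => ?_) a
    refine hind (P := fun b => f (g ^ i * x ^ j * b) =
      f (g ^ i * x ^ j) * Coalgebra.counit (R := k) b + χ (g ^ i * x ^ j) * f b) (by simp)
      (fun x y hx hy => by rw [mul_add, map_add, hx, hy, map_add, map_add]; ring) (fun r x hx => by
      rw [mul_smul_comm, map_smul, hx, map_smul, map_smul]; simp only [smul_eq_mul]; ring)
      (fun m n => ?_) b
    rw [hprod, map_smul, hf, hf, hf, hχ, hε, smul_eq_mul]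
    rcases Nat.eq_zero_or_pos j with rfl | hj
    · by_cases hn : n = 1 <;> simp [hn, pow_add]
    · by_cases hj1 : j = 1
      · subst hj1
        rcases Nat.eq_zero_or_pos n with rfl | hn
        · simp [pow_add]
          field_simp
        · simp [hn.ne']
      · simp [hj.ne', hj1, show j + n ≠ 1 by omega]
  -- the operators
  have hfg : f g = 0 := by simpa using hf 1 0
  have hfx : f x = 1 := by simpa using hf 0 1
  have hf1 : f 1 = 0 := by simpa using hf 0 0
  have hχg : χ g = q := by simpa using hχ 1 0
  have hχx : χ x = 0 := by simpa using hχ 0 1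
  have hrcx : ∀ φ : B →ₗ[k] k, rc φ x = φ 1 • x + φ x • g := by
    intro φ
    have h1 := rc_of_comul (k := k) (s := Finset.univ) (x := ![x, g]) (y := ![1, x]) (h := x)
      (by simp [hx]) φ
    simpa using h1
  have hXx : rc f x = g := by rw [hrcx, hf1, hfx]; simp
  have hGx : rc χ.toLinearMap x = x := by rw [hrcx]; simp [hχx]
  have hGg : ∀ i, rc χ.toLinearMap (g ^ i) = q ^ i • g ^ i := by
    intro i
    rw [(hg.pow i).rc, AlgHom.toLinearMap_apply, map_pow, hχg]
  have hXg : ∀ i, rc f (g ^ i) = 0 := by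
    intro i
    have : f (g ^ i) = 0 := by simpa using hf i 0
    rw [(hg.pow i).rc, this, zero_smul]
  have hGxj : ∀ j, rc χ.toLinearMap (x ^ j) = x ^ j := by
    intro j
    induction j with
    | zero => simp
    | succ j ih => rw [pow_succ, rc_algHom_mul, ih, hGx]
  have hXxj : ∀ j, rc f (x ^ j) = (∑ i ∈ Finset.range j, q⁻¹ ^ i) • (g * x ^ (j - 1)) := by
    intro j
    induction j with
    | zero => simp [hf1]
    | succ j ih =>
      rw [pow_succ', rc_mul_of_skew hfm, hXx, hGx, ih, Nat.add_sub_cancel, geom_sum_succ]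
      rcases Nat.eq_zero_or_pos j with rfl | hj
      · simp
      · have h1 := mul_pow_of_comm hq0 hgx 1
        rw [pow_one, pow_one] at h1
        rw [mul_smul_comm, ← mul_assoc, h1, smul_mul_assoc, smul_smul, mul_assoc, ← pow_succ',
          Nat.sub_add_cancel hj, add_smul, one_smul, add_comm, mul_comm q⁻¹]
  have hX : ∀ i j, rc f (g ^ i * x ^ j) =
      (q ^ i * ∑ l ∈ Finset.range j, q⁻¹ ^ l) • (g ^ (i + 1) * x ^ (j - 1)) := by
    intro i j
    rw [rc_mul_of_skew hfm, hXg, zero_mul, zero_add, hGg, hXxj, smul_mul_smul_comm, ← mul_assoc,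
      ← pow_succ]
  have hG : ∀ i j, rc χ.toLinearMap (g ^ i * x ^ j) = q ^ i • (g ^ i * x ^ j) := by
    intro i j
    rw [rc_algHom_mul, hGg, hGxj, smul_mul_assoc]
  have hXm : ∀ m i j, j < m → (rc f ^ m) (g ^ i * x ^ j) = 0 := by
    intro m
    induction m with
    | zero => intro i j h; omega
    | succ m ih =>
      intro i j h
      rw [pow_succ, Module.End.mul_apply, hX, map_smul]
      rcases Nat.eq_zero_or_pos j with rfl | hj
      · simp
      · rw [ih _ _ (by omega), smul_zero]
  have hXtop : ∀ m j i, m ≤ j → j < p → ∃ c : k, c ≠ 0 ∧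
      (rc f ^ m) (g ^ i * x ^ j) = c • (g ^ (i + m) * x ^ (j - m)) := by
    intro m
    induction m with
    | zero => intro j i _ _; exact ⟨1, one_ne_zero, by simp⟩
    | succ m ih =>
      intro j i hm hj
      obtain ⟨c, hc0, hc⟩ := ih (j - 1) (i + 1) (by omega) (by omega)
      refine ⟨q ^ i * (∑ l ∈ Finset.range j, q⁻¹ ^ l) * c, mul_ne_zero (mul_ne_zero
        (pow_ne_zero _ hq0) (quantum_sum_ne_zero hq.inv (by omega) hj)) hc0, ?_⟩
      rw [pow_succ, Module.End.mul_apply, hX, map_smul, hc, smul_smul]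
      rw [show i + 1 + m = i + (m + 1) by omega, show j - 1 - m = j - (m + 1) by omega]
  refine ⟨χ, f, hfm, ?_, ?_, ?_, ?_⟩
  · have h1 : ∀ m i j, (rc χ.toLinearMap ^ m) (g ^ i * x ^ j) = (q ^ i) ^ m • (g ^ i * x ^ j) := by
      intro m i j
      induction m with
      | zero => simp
      | succ m ih => rw [pow_succ', Module.End.mul_apply, ih, map_smul, hG, smul_smul, ← pow_succ]
    refine LinearMap.ext fun a => ?_
    refine hind (P := fun a => (rc χ.toLinearMap ^ p) a = (1 : B →ₗ[k] B) a) (by simp)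
      (fun x y hx hy => by rw [map_add, map_add, hx, hy]) (fun r x hx => by
      rw [map_smul, map_smul, hx]) (fun i j => ?_) a
    rw [h1, ← pow_mul, mul_comm, pow_mul, hq.pow_eq_one, one_pow, one_smul]
    rfl
  · refine LinearMap.ext fun a => ?_
    refine hind (P := fun a => (rc f ^ p) a = (0 : B →ₗ[k] B) a) (by simp)
      (fun x y hx hy => by rw [map_add, map_add, hx, hy]) (fun r x hx => by
      rw [map_smul, map_smul, hx]) (fun i j => ?_) a
    by_cases hj : j < p
    · rw [hXm _ _ _ hj]; rfl
    · rw [← Nat.sub_add_cancel (not_lt.1 hj), pow_add, hxp, mul_zero, mul_zero, map_zero, map_zero]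
  · intro h
    obtain ⟨c, hc0, hc⟩ := hXtop (p - 1) (p - 1) 0 le_rfl (Nat.sub_lt hp.pos one_pos)
    rw [h, LinearMap.zero_apply, Nat.sub_self, zero_add, pow_zero x, mul_one] at hc
    have := congr_arg (Coalgebra.counit (R := k)) hc
    simp [Bialgebra.counit_pow, hg.2] at this
    exact hc0 this.symm
  · refine LinearMap.ext fun a => ?_
    refine hind (P := fun a => conv χ.toLinearMap f a = (q • conv f χ.toLinearMap) a) (by simp)
      (fun x y hx hy => by rw [map_add, map_add, hx, hy]) (fun r x hx => by
      rw [map_smul, map_smul, hx]) (fun i j => ?_) a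
    rw [LinearMap.smul_apply, conv_apply, conv_apply, hX, hG, map_smul, map_smul,
      AlgHom.toLinearMap_apply, hχ, hf]
    by_cases hj : j = 1
    · subst hj; simp [pow_succ]; ring
    · rcases Nat.eq_zero_or_pos j with rfl | hj0
      · simp
      · simp [hj, show j - 1 ≠ 0 by omega]

/-- Pulling functionals back along a coalgebra map intertwines the right hit actions. -/
theorem map_rc_comp {H : Type*} [Ring H] [HopfAlgebra k H] (π : H →ₐc[k] B) (φ : B →ₗ[k] k)
    (h : H) : π (rc (φ ∘ₗ (π : H →ₗc[k] B).toLinearMap) h) = rc φ (π h) := by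
  obtain ⟨s, e⟩ := exists_comul (k := k) h
  have h1 : Coalgebra.comul (R := k) (π h) = ∑ i ∈ s, π i.1 ⊗ₜ[k] π i.2 := by
    rw [← CoalgHomClass.map_comp_comul_apply, e]
    simp
  rw [rc_of_comul e, rc_of_comul h1]
  simp

end TaftAlgebra

end HopfFour

namespace HopfFour

section Pullback

variable {k : Type*} [Field k]

theorem rc_pow_eq {C : Type*} [AddCommGroup C] [Module k C] [Coalgebra k C] (φ : C →ₗ[k] k)
    (m : ℕ) : rc φ ^ m = rc (Coalgebra.counit ∘ₗ (rc φ ^ m)) := by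
  induction m with
  | zero =>
    refine LinearMap.ext fun h => ?_
    rw [pow_zero, Module.End.one_eq_id, LinearMap.comp_id, rc_counit]
    rfl
  | succ m ih =>
    refine LinearMap.ext fun h => ?_
    have h1 : (rc φ ^ (m + 1)) h = (rc φ ^ m) (rc φ h) := by rw [pow_succ]; rfl
    rw [h1, ih, rc_rc, pow_succ]
    rfl

variable {H B : Type*} [Ring H] [HopfAlgebra k H] [Ring B] [HopfAlgebra k B]

theorem rc_pow_comp (π : H →ₐc[k] B) (φ : B →ₗ[k] k) (m : ℕ) :
    rc (φ ∘ₗ (π : H →ₗc[k] B).toLinearMap) ^ m =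
      rc ((Coalgebra.counit ∘ₗ (rc φ ^ m)) ∘ₗ (π : H →ₗc[k] B).toLinearMap) := by
  have h1 : ∀ h, π ((rc (φ ∘ₗ (π : H →ₗc[k] B).toLinearMap) ^ m) h) = (rc φ ^ m) (π h) := by
    induction m with
    | zero => intro h; rfl
    | succ m ih => intro h; rw [pow_succ', pow_succ', Module.End.mul_apply, map_rc_comp, ih]; rfl
  rw [rc_pow_eq]
  congr 1
  refine LinearMap.ext fun h => ?_
  have h2 : ∀ a : H, Coalgebra.counit (R := k) (π a) = Coalgebra.counit (R := k) a := fun a => by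
    simp
  simp only [LinearMap.comp_apply]
  rw [← h2, h1]
  rfl

theorem TaftFun.comp {p : ℕ} {q : k} {χ : B →ₐ[k] k} {f : B →ₗ[k] k} (h : TaftFun p q χ f)
    (π : H →ₐc[k] B) (hπ : Function.Surjective π) :
    TaftFun p q (χ.comp (π : H →ₐ[k] B)) (f ∘ₗ (π : H →ₗc[k] B).toLinearMap) := by
  have hε : ∀ a : H, Coalgebra.counit (R := k) (π a) = Coalgebra.counit (R := k) a := fun a => by
    simp
  have hχ : (χ.comp (π : H →ₐ[k] B)).toLinearMap =
    χ.toLinearMap ∘ₗ (π : H →ₗc[k] B).toLinearMap := rfl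
  constructor
  · intro a b
    have := h.map_mul (π a) (π b)
    rw [hε] at this
    simp only [LinearMap.comp_apply]
    change f (π (a * b)) = _
    rw [_root_.map_mul π]
    exact this
  · rw [hχ, rc_pow_comp, h.rc_pow]
    refine LinearMap.ext fun a => ?_
    rw [show ((Coalgebra.counit ∘ₗ (1 : B →ₗ[k] B)) ∘ₗ (π : H →ₗc[k] B).toLinearMap) =
      Coalgebra.counit (R := k) (A := H) from LinearMap.ext hε]
    simp
  · rw [rc_pow_comp, h.rc_pow_zero]
    ext; simp
  · intro h0
    apply h.rc_pow_ne_zero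
    rw [rc_pow_comp] at h0
    rw [rc_pow_eq]
    have h1 : (Coalgebra.counit (R := k) ∘ₗ rc f ^ (p - 1)) = 0 := by
      refine LinearMap.ext fun b => ?_
      obtain ⟨a, rfl⟩ := hπ b
      have := congr_arg (Coalgebra.counit (R := k)) (LinearMap.congr_fun h0 a)
      rw [counit_rc] at this
      simpa using this
    rw [h1]; ext; simp
  · have := h.conv_comm
    refine LinearMap.ext fun a => ?_
    rw [hχ, LinearMap.smul_apply, conv_apply, conv_apply]
    have h2 := LinearMap.congr_fun this (π a)
    rw [LinearMap.smul_apply, conv_apply, conv_apply] at h2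
    have h3 := map_rc_comp π f a
    have h4 := map_rc_comp π χ.toLinearMap a
    simp only [LinearMap.comp_apply]
    change χ (π _) = q • f (π _)
    rw [h3, h4]; exact h2

end Pullback

section Grouplike

variable {k : Type*} [Field k] {C : Type*} [AddCommGroup C] [Module k C] [Coalgebra k C]

theorem isGL_of_comul {C : Type*} [Ring C] [Bialgebra k C] {g : C} (h0 : g ≠ 0)
    (h : Coalgebra.comul (R := k) g = g ⊗ₜ[k] g) :
    IsGL k g := by
  refine ⟨h, ?_⟩
  have h1 := rc_of_comul (k := k) (s := Finset.univ) (x := fun _ : Unit => g) (y := fun _ => g)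
    (h := g) (by simp [h]) Coalgebra.counit
  have h2 : g = Coalgebra.counit (R := k) g • g := by simpa using h1
  have h3 : (Coalgebra.counit (R := k) g - 1) • g = 0 := by rw [sub_smul, ← h2, one_smul, sub_self]
  exact sub_eq_zero.1 ((smul_eq_zero.1 h3).resolve_right h0)

end Grouplike

end HopfFour

namespace HopfFour

section Subcoalgebra

variable {k : Type*} [Field k] {C : Type*} [AddCommGroup C] [Module k C] [Coalgebra k C]

theorem exists_comul_of_isSubcoalg {D : Submodule k C}
    (hD : HopfClass.IsSubcoalgWrt k (HopfClass.comulL k C) D) {x : C} (hx : x ∈ D) :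
    ∃ s : Finset (D × D), Coalgebra.comul (R := k) x = ∑ i ∈ s, (i.1 : C) ⊗ₜ[k] (i.2 : C) := by
  obtain ⟨t, ht⟩ := hD x hx
  obtain ⟨s, rfl⟩ := TensorProduct.exists_finset t
  refine ⟨s, ?_⟩
  rw [← ht]
  simp

theorem isLC_of_isSubcoalg {D : Submodule k C}
    (hD : HopfClass.IsSubcoalgWrt k (HopfClass.comulL k C) D) : IsLC D := by
  intro φ x hx
  obtain ⟨s, e⟩ := exists_comul_of_isSubcoalg hD hx
  rw [lc_of_comul e]
  exact sum_mem fun i _ => D.smul_mem _ i.2.2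

theorem isRC_of_isSubcoalg {D : Submodule k C}
    (hD : HopfClass.IsSubcoalgWrt k (HopfClass.comulL k C) D) : IsRC D := by
  intro φ x hx
  obtain ⟨s, e⟩ := exists_comul_of_isSubcoalg hD hx
  rw [rc_of_comul e]
  exact sum_mem fun i _ => D.smul_mem _ i.1.2

theorem isSubcoalg_of_isLC_isRC {D : Submodule k C} (hl : IsLC D) (hr : IsRC D) :
    HopfClass.IsSubcoalgWrt k (HopfClass.comulL k C) D := by
  intro x hx
  obtain ⟨P, hP⟩ := LinearMap.exists_extend (p := D) (LinearMap.id : D →ₗ[k] D)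
  have hP' : ∀ v (hv : v ∈ D), P v = ⟨v, hv⟩ := fun v hv => LinearMap.congr_fun hP ⟨v, hv⟩
  obtain ⟨s, e⟩ := exists_comul (k := k) x
  refine ⟨∑ i ∈ s, P i.1 ⊗ₜ[k] P i.2, ?_⟩
  have e' : Coalgebra.comul (R := k) x = ∑ i ∈ s, (P i.1 : C) ⊗ₜ[k] (P i.2 : C) := by
    rw [comul_eq_iff_lc]
    intro φ
    have h1 := congr_arg (fun v => (P v : C)) (lc_of_comul e (φ ∘ₗ D.subtype ∘ₗ P))
    simp only [map_sum, map_smul, AddSubmonoidClass.coe_finsetSum, Submodule.coe_smul,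
      LinearMap.comp_apply, Submodule.subtype_apply] at h1
    rw [← h1, hP' _ (hl _ x hx)]
    refine eq_of_forall_dual (k := k) fun ψ => ?_
    rw [← apply_rc, ← apply_rc]
    simp [hP' _ (hr _ x hx)]
  rw [show HopfClass.comulL k C x = _ from e']
  simp

theorem eq_of_isSimple {D : Submodule k C}
    (hD : HopfClass.IsSimpleSubcoalgWrt k (HopfClass.comulL k C) D) {E : Submodule k C}
    (hl : IsLC E) (hr : IsRC E) (hED : E ≤ D) (h0 : E ≠ ⊥) : E = D := by
  by_contra h
  exact h0 (hD.2.2 E (isSubcoalg_of_isLC_isRC hl hr) (lt_of_le_of_ne hED h))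

end Subcoalgebra

section Twisted

variable {k V W : Type*} [Field k] [AddCommGroup V] [Module k V] [AddCommGroup W] [Module k W]

/-- The linear maps `A` with `X A + G A N = 0` that vanish on `U`. -/
def twistedHom (X G : V →ₗ[k] V) (N : W →ₗ[k] W) (U : Submodule k W) :
    Submodule k (W →ₗ[k] V) where
  carrier := {A | (∀ w, X (A w) + G (A (N w)) = 0) ∧ ∀ u ∈ U, A u = 0}
  zero_mem' := by simp
  add_mem' := by
    rintro A B ⟨h1, h2⟩ ⟨h3, h4⟩
    refine ⟨fun w => ?_, fun u hu => by simp [h2 u hu, h4 u hu]⟩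
    have := congr_arg₂ (· + ·) (h1 w) (h3 w)
    simp only [add_zero] at this
    rw [← this]
    simp only [LinearMap.add_apply, map_add]
    abel
  smul_mem' := by
    rintro c A ⟨h1, h2⟩
    refine ⟨fun w => ?_, fun u hu => by simp [h2 u hu]⟩
    have := congr_arg (c • ·) (h1 w)
    simpa using this

variable [FiniteDimensional k V] [FiniteDimensional k W]

theorem finrank_twistedHom_le {X G : V →ₗ[k] V} {N : W →ₗ[k] W} (w : W) (U U' : Submodule k W)
    (R : Submodule k V) (hR : ∀ A ∈ twistedHom X G N U, A w ∈ R)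
    (hU' : ∀ A ∈ twistedHom X G N U, A w = 0 → ∀ u ∈ U', A u = 0) :
    Module.finrank k (twistedHom X G N U) ≤
      Module.finrank k R + Module.finrank k (twistedHom X G N U') := by
  set K := twistedHom X G N U
  let ev : K →ₗ[k] V := (LinearMap.applyₗ w).domRestrict K
  rw [← LinearMap.finrank_range_add_finrank_ker ev]
  refine Nat.add_le_add (Submodule.finrank_mono ?_) ?_
  · rintro _ ⟨A, rfl⟩
    exact hR A A.2
  · rw [← Submodule.finrank_map_subtype_eq]
    refine Submodule.finrank_mono ?_
    rintro _ ⟨A, hA, rfl⟩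
    exact ⟨A.2.1, hU' A A.2 hA⟩

theorem finrank_twistedHom_le_mul {X G : V →ₗ[k] V} {N : W →ₗ[k] W} {m : ℕ} (hN : N ^ m = 0) (d : ℕ) :
    ∀ U : Submodule k W, (∀ u ∈ U, N u ∈ U) → Module.finrank k W ≤ Module.finrank k U + d →
      Module.finrank k (twistedHom X G N U) ≤ Module.finrank k (LinearMap.ker X) * d := by
  have h0 : Module.finrank k (twistedHom X G N (⊤ : Submodule k W)) = 0 := by
    rw [show twistedHom X G N (⊤ : Submodule k W) = ⊥ from
      (Submodule.eq_bot_iff _).2 fun A hA => LinearMap.ext fun w => hA.2 w trivial]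
    simp
  induction d with
  | zero =>
    intro U hU h
    rw [Submodule.eq_top_of_finrank_eq (le_antisymm (Submodule.finrank_le U) h), h0]
    simp
  | succ d ih =>
    intro U hU h
    by_cases hT : U = ⊤
    · rw [hT, h0]; simp
    obtain ⟨w, hw, hNw⟩ : ∃ w, w ∉ U ∧ N w ∈ U := by
      by_contra! hcon
      obtain ⟨w, hw⟩ : ∃ w, w ∉ U := by
        by_contra! h'; exact hT (eq_top_iff.2 fun w _ => h' w)
      have : ∀ i, (N ^ i) w ∉ U := by
        intro i
        induction i with
        | zero => exact hw
        | succ i ih => rw [pow_succ']; exact hcon _ ih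
      exact this m (by rw [hN]; exact zero_mem U)
    have hlt : U < U ⊔ Submodule.span k {w} := by
      refine lt_of_le_of_ne le_sup_left fun h' => hw ?_
      rw [h']; exact (le_sup_right : _ ≤ U ⊔ _) (Submodule.mem_span_singleton_self w)
    have h1 := Submodule.finrank_lt_finrank_of_lt hlt
    have h2 := finrank_twistedHom_le (X := X) (G := G) (N := N) w U (U ⊔ Submodule.span k {w})
      (LinearMap.ker X) (fun A hA => by
        have := hA.1 w
        rwa [hA.2 _ hNw, map_zero, add_zero] at this) (fun A hA h' u hu => by
        obtain ⟨u, hu', v, hv, rfl⟩ := Submodule.mem_sup.1 hu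
        obtain ⟨c, rfl⟩ := Submodule.mem_span_singleton.1 hv
        rw [map_add, map_smul, h', hA.2 u hu']; simp)
    have h3 := ih (U ⊔ Submodule.span k {w}) (fun u hu => by
        obtain ⟨u, hu', v, hv, rfl⟩ := Submodule.mem_sup.1 hu
        obtain ⟨c, rfl⟩ := Submodule.mem_span_singleton.1 hv
        rw [map_add, map_smul]
        exact (le_sup_left : U ≤ _) (add_mem (hU u hu') (U.smul_mem _ hNw))) (by omega)
    rw [Nat.mul_succ]
    omega

theorem linearIndependent_pow_apply {N : W →ₗ[k] W} {m : ℕ} (hN : N ^ m = 0) {w : W}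
    (hw : (N ^ (m - 1)) w ≠ 0) : LinearIndependent k fun i : Fin m => (N ^ (i : ℕ)) w := by
  rw [Fintype.linearIndependent_iff]
  intro c hc
  have : ∀ j : ℕ, ∀ i : Fin m, (i : ℕ) = j → c i = 0 := by
    intro j
    induction j using Nat.strong_induction_on with
    | _ j ih =>
      intro i hij
      have h1 := congr_arg (N ^ (m - 1 - j)) hc
      rw [map_sum, map_zero, Finset.sum_eq_single i] at h1
      · rw [map_smul, ← Module.End.mul_apply, ← pow_add, show m - 1 - j + (i : ℕ) = m - 1 by omega] at h1
        exact (smul_eq_zero.1 h1).resolve_right hw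
      · intro l _ hl
        rcases lt_or_ge (l : ℕ) j with h | h
        · rw [ih l h l rfl, zero_smul, map_zero]
        · have h2 : (l : ℕ) ≠ j := fun h' => hl (Fin.ext (h'.trans hij.symm))
          rw [map_smul, ← Module.End.mul_apply, ← pow_add,
            show m - 1 - j + (l : ℕ) = (m - 1 - j + l - m) + m by omega, pow_add, hN, mul_zero,
            LinearMap.zero_apply, smul_zero]
      · simp
  exact fun i => this i i rfl

theorem finrank_twistedHom_bot_le {X G : V →ₗ[k] V} {N : W →ₗ[k] W}
    (hG : Function.Injective G) {m : ℕ} (hN : N ^ m = 0) (hN' : N ^ (m - 1) ≠ 0) :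
    Module.finrank k (twistedHom X G N (⊥ : Submodule k W)) ≤
      Module.finrank k V + Module.finrank k (LinearMap.ker X) * (Module.finrank k W - m) := by
  obtain ⟨w, hw⟩ : ∃ w, (N ^ (m - 1)) w ≠ 0 := by
    by_contra! h; exact hN' (LinearMap.ext h)
  have hLI := linearIndependent_pow_apply hN hw
  set U := Submodule.span k (Set.range fun i : Fin m => (N ^ (i : ℕ)) w) with hU
  have hUm : Module.finrank k U = m := by rw [finrank_span_eq_card hLI]; simp
  have h1 := finrank_twistedHom_le (X := X) (G := G) (N := N) w ⊥ U ⊤ (fun _ _ => trivial) (by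
    intro A hA h0 u hu
    have h2 : ∀ i, A ((N ^ i) w) = 0 := by
      intro i
      induction i with
      | zero => exact h0
      | succ i ih =>
        have := hA.1 ((N ^ i) w)
        rw [ih, map_zero, zero_add] at this
        rw [pow_succ']
        exact hG (by rw [map_zero]; exact this)
    induction hu using Submodule.span_induction with
    | zero => simp
    | add x y _ _ hx hy => rw [map_add, hx, hy, add_zero]
    | smul c x _ hx => rw [map_smul, hx, smul_zero]
    | mem x hx => obtain ⟨i, rfl⟩ := hx; exact h2 i)
  have hW : m ≤ Module.finrank k W := by rw [← hUm]; exact Submodule.finrank_le U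
  have h3 := finrank_twistedHom_le_mul (X := X) (G := G) hN (Module.finrank k W - m) U (by
    intro u hu
    induction hu using Submodule.span_induction with
    | zero => simp
    | add x y _ _ hx hy => rw [map_add]; exact add_mem hx hy
    | smul c x _ hx => rw [map_smul]; exact Submodule.smul_mem _ _ hx
    | mem x hx =>
      obtain ⟨i, rfl⟩ := hx
      show N ((N ^ (i : ℕ)) w) ∈ U
      rw [← Module.End.mul_apply, ← pow_succ']
      by_cases hi : (i : ℕ) + 1 < m
      · exact Submodule.subset_span ⟨⟨i + 1, hi⟩, rfl⟩
      · rw [show (i : ℕ) + 1 = m by omega, hN]; exact zero_mem U) (by omega)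
  rw [finrank_top] at h1
  omega

end Twisted

section Freeness

variable {k : Type*} [Field k] {H : Type*} [Ring H] [HopfAlgebra k H]

theorem comul_rc {ι : Type*} {s : Finset ι} {h : H} {x y : ι → H}
    (e : Coalgebra.comul (R := k) h = ∑ i ∈ s, x i ⊗ₜ[k] y i) (φ : H →ₗ[k] k) :
    Coalgebra.comul (R := k) (rc φ h) = ∑ i ∈ s, x i ⊗ₜ[k] rc φ (y i) := by
  rw [comul_eq_iff_lc]
  intro ψ
  rw [← rc_lc, lc_of_comul e]
  simp

variable (k H) in
/-- Contraction of the second tensor factor against functionals. -/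
noncomputable def contractRight : H ⊗[k] H →ₗ[k] ((H →ₗ[k] k) →ₗ[k] H) :=
  TensorProduct.lift (LinearMap.mk₂ k (fun a b => (LinearMap.applyₗ b).smulRight a)
    (by intros; ext; simp) (by intros; ext; exact smul_comm _ _ _)
    (by intros; ext; simp only [LinearMap.smulRight_apply, LinearMap.add_apply, map_add, add_smul])
    (by intros; ext; simp only [LinearMap.smulRight_apply, LinearMap.smul_apply, map_smul, smul_assoc]))

@[simp] theorem contractRight_tmul (a b : H) (φ : H →ₗ[k] k) :
    contractRight k H (a ⊗ₜ b) φ = φ b • a := rfl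

theorem contractRight_injective : Function.Injective (contractRight k H) := by
  rw [← LinearMap.ker_eq_bot, LinearMap.ker_eq_bot']
  intro t ht
  apply (TensorProduct.comm k H H).injective
  rw [map_zero]
  refine tensor_eq_of_forall fun φ => ?_
  have : ∀ t : H ⊗[k] H, TensorProduct.lid k H (φ.rTensor H (TensorProduct.comm k H H t)) =
      contractRight k H t φ := by
    intro t
    induction t using TensorProduct.induction_on with
    | zero => simp
    | tmul a b => simp
    | add x y hx hy => simp only [map_add, hx, hy, LinearMap.add_apply]
  rw [this, ht]
  simp

variable [FiniteDimensional k H] {p : ℕ} {q : k} {χ : H →ₐ[k] k} {f : H →ₗ[k] k}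

theorem TaftFun.rc_char_injective (h : TaftFun p q χ f) (hp : 0 < p) :
    Function.Injective (rc χ.toLinearMap) := by
  have h1 : Function.Injective (rc χ.toLinearMap ^ p) := by rw [h.rc_pow]; exact fun _ _ h => h
  rw [← Nat.sub_add_cancel hp, pow_succ] at h1
  exact Function.Injective.of_comp h1

theorem TaftFun.galois_twist (h : TaftFun p q χ f) (t : H ⊗[k] H) :
    galois (k := k) ((rc f).rTensor H t + TensorProduct.map (rc χ.toLinearMap) (rc f) t) =
      (rc f).lTensor H (galois (k := k) t) := by
  induction t using TensorProduct.induction_on with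
  | zero => simp
  | add x y hx hy =>
    simp only [map_add] at hx hy ⊢
    rw [← hx, ← hy]; abel
  | tmul a b =>
    obtain ⟨s, e⟩ := exists_comul (k := k) a
    rw [LinearMap.rTensor_tmul, TensorProduct.map_tmul, map_add, galois_of_comul e,
      galois_of_comul (comul_rc e f), galois_of_comul (comul_rc e χ.toLinearMap), map_sum,
      ← Finset.sum_add_distrib]
    refine Finset.sum_congr rfl fun i _ => ?_
    rw [LinearMap.lTensor_tmul, h.rc_mul, TensorProduct.tmul_add]

/-- `H` is free over the nilpotent part of the Taft algebra acting on it. -/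
theorem TaftFun.mul_finrank_ker_le (h : TaftFun p q χ f) :
    p * Module.finrank k (LinearMap.ker (rc f)) ≤ Module.finrank k H := by
  set κ := Module.finrank k (LinearMap.ker (rc f)) with hκ
  set n := Module.finrank k H with hn
  let N : (H →ₗ[k] k) →ₗ[k] (H →ₗ[k] k) := LinearMap.lcomp k k (rc f)
  have hNm : ∀ m φ, (N ^ m) φ = φ ∘ₗ (rc f ^ m) := by
    intro m
    induction m with
    | zero => intro φ; rfl
    | succ m ih => intro φ; rw [pow_succ, Module.End.mul_apply, ih, pow_succ']; rfl
  have hN : N ^ p = 0 := by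
    refine LinearMap.ext fun φ => ?_
    rw [hNm, h.rc_pow_zero]; simp
  have hN' : N ^ (p - 1) ≠ 0 := by
    intro h0
    refine h.rc_pow_ne_zero (LinearMap.ext fun a => eq_of_forall_dual (k := k) fun φ => ?_)
    have := LinearMap.congr_fun (LinearMap.congr_fun h0 φ) a
    rw [hNm] at this
    simpa using this
  have hp : 0 < p := by
    rcases Nat.eq_zero_or_pos p with rfl | hp
    · exact absurd (h.rc_pow_zero) (by simpa using h.rc_pow_ne_zero)
    · exact hp
  have h1 := finrank_twistedHom_bot_le (X := rc f) (G := rc χ.toLinearMap)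
    (h.rc_char_injective hp) hN hN'
  have h2 : n * κ ≤ Module.finrank k (twistedHom (rc f) (rc χ.toLinearMap) N ⊥) := by
    let J : H ⊗[k] LinearMap.ker (rc f) →ₗ[k] ((H →ₗ[k] k) →ₗ[k] H) :=
      contractRight k H ∘ₗ (galoisEquiv k H).symm.toLinearMap ∘ₗ
        (LinearMap.ker (rc f)).subtype.lTensor H
    have hJ : Function.Injective J :=
      contractRight_injective.comp ((galoisEquiv k H).symm.injective.comp
        (Module.Flat.lTensor_preserves_injective_linearMap _ (Submodule.subtype_injective _)))
    rw [hn, hκ, ← Module.finrank_tensorProduct, ← LinearMap.finrank_range_of_inj hJ]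
    refine Submodule.finrank_mono ?_
    rintro _ ⟨t, rfl⟩
    refine ⟨fun φ => ?_, fun u hu => by rw [(Submodule.mem_bot k).1 hu, map_zero]⟩
    set s := (galoisEquiv k H).symm ((LinearMap.ker (rc f)).subtype.lTensor H t) with hs
    have hs' : galois (k := k) s = (LinearMap.ker (rc f)).subtype.lTensor H t := by
      rw [← galoisEquiv_apply, hs, LinearEquiv.apply_symm_apply]
    have h3 := h.galois_twist s
    rw [hs', ← LinearMap.comp_apply, ← LinearMap.lTensor_comp,
      show rc f ∘ₗ (LinearMap.ker (rc f)).subtype = 0 from LinearMap.ext fun v => v.2,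
      LinearMap.lTensor_zero, LinearMap.zero_apply] at h3
    have h4 : (rc f).rTensor H s + TensorProduct.map (rc χ.toLinearMap) (rc f) s = 0 :=
      (galoisEquiv k H).injective (by rw [galoisEquiv_apply, h3, map_zero])
    have h5 : ∀ s : H ⊗[k] H, rc f (contractRight k H s φ) + rc χ.toLinearMap
        (contractRight k H s (N φ)) = contractRight k H ((rc f).rTensor H s +
          TensorProduct.map (rc χ.toLinearMap) (rc f) s) φ := by
      intro s
      induction s using TensorProduct.induction_on with
      | zero => simp
      | tmul a b => simp [N]
      | add x y hx hy =>
        simp only [map_add, LinearMap.add_apply] at hx hy ⊢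
        rw [add_add_add_comm, hx, hy]; abel
    show rc f (contractRight k H s φ) + rc χ.toLinearMap (contractRight k H s (N φ)) = 0
    rw [h5, h4, map_zero, LinearMap.zero_apply]
  have h6 : p ≤ n := by
    obtain ⟨a, ha⟩ : ∃ a, (rc f ^ (p - 1)) a ≠ 0 := by
      by_contra! h'; exact h.rc_pow_ne_zero (LinearMap.ext h')
    simpa using (linearIndependent_pow_apply h.rc_pow_zero ha).fintype_card_le_finrank
  have h7 : Module.finrank k (H →ₗ[k] k) = n := Subspace.dual_finrank_eq
  rw [h7] at h1
  have h8 : n * κ ≤ n + κ * (n - p) := h2.trans h1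
  obtain ⟨m, hm⟩ := Nat.exists_eq_add_of_le h6
  rw [hm, Nat.add_sub_cancel_left] at h8
  rw [hm]
  nlinarith

end Freeness

end HopfFour

namespace HopfFour

section Taylor

variable {k : Type*} [Field k] {V : Type*} [AddCommGroup V] [Module k V]

/-- If every element of `ker X` is an `X ^ j`-image of some `M j z` with `z ∈ ker X`, then the
images of `ker X` under the `M j` span. -/
theorem taylor_top {X : V →ₗ[k] V} {p : ℕ} (hX : X ^ p = 0) {M : ℕ → V → V}
    (hM : ∀ j < p, ∀ y, X y = 0 → ∃ z, X z = 0 ∧ (X ^ j) (M j z) = y) {U : Submodule k V}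
    (hU : ∀ j < p, ∀ z, X z = 0 → M j z ∈ U) : U = ⊤ := by
  have key : ∀ m ≤ p, ∀ h, (X ^ m) h = 0 → h ∈ U := by
    intro m
    induction m with
    | zero => intro _ h hh; rw [pow_zero] at hh; rw [show h = 0 from hh]; exact zero_mem U
    | succ m ih =>
      intro hm h hh
      obtain ⟨z, hz, hz'⟩ := hM m hm ((X ^ m) h) (by
        rw [← Module.End.mul_apply, ← pow_succ']; exact hh)
      have := ih (by omega) (h - M m z) (by rw [map_sub, hz', sub_self])
      rw [← sub_add_cancel h (M m z)]
      exact add_mem this (hU m hm z hz)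
  exact eq_top_iff.2 fun h _ => key p le_rfl h (by rw [hX]; rfl)

end Taylor

section Pair

variable {k : Type*} [Field k] {H : Type*} [Ring H] [HopfAlgebra k H]

/-- A Taft pair inside `H` together with a Taft pair of functionals on `H` which are dual to each
other. -/
structure TaftPair (p : ℕ) (q : k) (g x : H) (χ : H →ₐ[k] k) (f : H →ₗ[k] k) : Prop where
  prime : p.Prime
  prim : IsPrimitiveRoot q p
  taftFun : TaftFun p q χ f
  gl : IsGL k g
  comul_x : Coalgebra.comul (R := k) x = x ⊗ₜ[k] (1 : H) + g ⊗ₜ[k] x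
  g_pow : g ^ p = 1
  comm : g * x = q • (x * g)
  f_x : f x = 1
  f_g : f g = 0
  χ_g : χ g = q
  χ_x : χ x = 0
  finrank_eq : Module.finrank k H = p ^ 3

theorem rc_skew {g x : H} (hx : Coalgebra.comul (R := k) x = x ⊗ₜ[k] (1 : H) + g ⊗ₜ[k] x)
    (φ : H →ₗ[k] k) : rc φ x = φ 1 • x + φ x • g := by
  have h1 := rc_of_comul (k := k) (s := Finset.univ) (x := ![x, g]) (y := ![1, x]) (h := x)
    (by simp [hx]) φ
  simpa using h1

theorem rc_mul_skew {g x : H} (hx : Coalgebra.comul (R := k) x = x ⊗ₜ[k] (1 : H) + g ⊗ₜ[k] x)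
    (φ : H →ₗ[k] k) (b : H) :
    rc φ (b * x) = rc φ b * x + rc (φ ∘ₗ LinearMap.mulRight k x) b * g := by
  have h1 := rc_mul_right (k := k) (s := Finset.univ) (x := ![x, g]) (y := ![1, x]) (h := x)
    (by simp [hx]) φ b
  simpa using h1

namespace TaftPair

variable {p : ℕ} {q : k} {g x : H} {χ : H →ₐ[k] k} {f : H →ₗ[k] k}
  (h : TaftPair p q g x χ f)
include h

theorem q_ne_zero : q ≠ 0 := h.prim.ne_zero h.prime.ne_zero

theorem g_mul_g_pow : g * g ^ (p - 1) = 1 := by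
  rw [← pow_succ', Nat.sub_add_cancel h.prime.pos, h.g_pow]

theorem g_pow_mul_g : g ^ (p - 1) * g = 1 := by
  rw [← pow_succ, Nat.sub_add_cancel h.prime.pos, h.g_pow]

theorem finiteDimensional : FiniteDimensional k H :=
  Module.finite_of_finrank_pos (by rw [h.finrank_eq]; exact pow_pos h.prime.pos 3)

theorem X_mul (a b : H) : rc f (a * b) = rc f a * b + rc χ.toLinearMap a * rc f b :=
  h.taftFun.rc_mul a b

theorem X_comm (a : H) : rc χ.toLinearMap (rc f a) = q • rc f (rc χ.toLinearMap a) :=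
  h.taftFun.rc_comm a

theorem G_pow (a : H) : (rc χ.toLinearMap ^ p) a = a := by rw [h.taftFun.rc_pow]; rfl

theorem G_mul (a b : H) :
    rc χ.toLinearMap (a * b) = rc χ.toLinearMap a * rc χ.toLinearMap b := by
  have := h.finiteDimensional
  exact rc_algHom_mul χ a b

theorem G_one : rc χ.toLinearMap (1 : H) = 1 := by simp

theorem X_one : rc f (1 : H) = 0 := by rw [rc_one, h.taftFun.map_one, zero_smul]

theorem G_x : rc χ.toLinearMap x = x := by rw [rc_skew h.comul_x]; simp [h.χ_x]

theorem X_x : rc f x = g := by rw [rc_skew h.comul_x, h.f_x, h.taftFun.map_one]; simp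

theorem G_g_pow (i : ℕ) : rc χ.toLinearMap (g ^ i) = q ^ i • g ^ i := by
  rw [(h.gl.pow i).rc, AlgHom.toLinearMap_apply, map_pow, h.χ_g]

theorem X_g_pow (i : ℕ) : rc f (g ^ i) = 0 := by
  induction i with
  | zero => simpa using h.X_one
  | succ i ih => rw [pow_succ, h.X_mul, ih, h.gl.rc, h.f_g]; simp

theorem X_x_pow (j : ℕ) :
    rc f (x ^ (j + 1)) = (∑ i ∈ Finset.range (j + 1), q⁻¹ ^ i) • (g * x ^ j) := by
  induction j with
  | zero => simp [h.X_x]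
  | succ j ih =>
    rw [pow_succ', h.X_mul, h.X_x, h.G_x, ih, geom_sum_succ (n := j + 1)]
    have h1 := mul_pow_of_comm h.q_ne_zero h.comm 1
    rw [pow_one, pow_one] at h1
    rw [mul_smul_comm, ← mul_assoc, h1, smul_mul_assoc, smul_smul, mul_assoc, ← pow_succ',
      add_smul, one_smul, add_comm, mul_comm q⁻¹]

theorem G_mem_ker {z : H} (hz : rc f z = 0) : rc f (rc χ.toLinearMap z) = 0 := by
  have := h.X_comm z
  rw [hz, map_zero] at this
  exact (smul_eq_zero.1 this.symm).resolve_left h.q_ne_zero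

theorem G_pow_mem_ker {z : H} (hz : rc f z = 0) (s : ℕ) :
    rc f ((rc χ.toLinearMap ^ s) z) = 0 := by
  induction s with
  | zero => exact hz
  | succ s ih => rw [pow_succ', Module.End.mul_apply]; exact h.G_mem_ker ih

theorem mul_mem_ker {y z : H} (hy : rc f y = 0) (hz : rc f z = 0) : rc f (y * z) = 0 := by
  rw [h.X_mul, hy, hz]; simp

theorem exists_left {m : ℕ} (hm : m < p) : ∀ y, rc f y = 0 →
    ∃ z, rc f z = 0 ∧ (rc f ^ m) (x ^ m * z) = y := by
  induction m with
  | zero => intro y hy; exact ⟨y, hy, by simp⟩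
  | succ m ih =>
    intro y hy
    obtain ⟨z, hz, hz'⟩ := ih (by omega) y hy
    set c := ∑ i ∈ Finset.range (m + 1), q⁻¹ ^ i with hc
    have hc0 : c ≠ 0 := quantum_sum_ne_zero h.prim.inv (by omega) hm
    have hgx : ∀ j, g * x ^ j = q ^ j • (x ^ j * g) := by
      intro j
      induction j with
      | zero => simp
      | succ j ih =>
        rw [pow_succ, ← mul_assoc, ih, smul_mul_assoc, mul_assoc, h.comm, mul_smul_comm, smul_smul,
          mul_assoc, ← pow_succ]
    refine ⟨(c * q ^ m)⁻¹ • (g ^ (p - 1) * z), ?_, ?_⟩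
    · rw [map_smul, h.mul_mem_ker (h.X_g_pow _) hz, smul_zero]
    · have h1 : rc f (x ^ (m + 1) * ((c * q ^ m)⁻¹ • (g ^ (p - 1) * z))) = x ^ m * z := by
        rw [mul_smul_comm, map_smul, h.X_mul, h.mul_mem_ker (h.X_g_pow _) hz, mul_zero, add_zero,
          h.X_x_pow, ← hc, hgx, smul_smul, smul_mul_assoc, smul_smul, inv_mul_cancel₀
          (mul_ne_zero hc0 (pow_ne_zero _ h.q_ne_zero)), one_smul, mul_assoc, ← mul_assoc g,
          h.g_mul_g_pow, one_mul]
      rw [pow_succ, Module.End.mul_apply, h1, hz']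

theorem exists_right {m : ℕ} (hm : m < p) : ∀ y, rc f y = 0 →
    ∃ z, rc f z = 0 ∧ (rc f ^ m) (z * x ^ m) = y := by
  induction m with
  | zero => intro y hy; exact ⟨y, hy, by simp⟩
  | succ m ih =>
    intro y hy
    obtain ⟨z, hz, hz'⟩ := ih (by omega) y hy
    set c := ∑ i ∈ Finset.range (m + 1), q⁻¹ ^ i with hc
    have hc0 : c ≠ 0 := quantum_sum_ne_zero h.prim.inv (by omega) hm
    have hw : rc f (z * g ^ (p - 1)) = 0 := h.mul_mem_ker hz (h.X_g_pow _)
    refine ⟨c⁻¹ • (rc χ.toLinearMap ^ (p - 1)) (z * g ^ (p - 1)), ?_, ?_⟩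
    · rw [map_smul, h.G_pow_mem_ker hw, smul_zero]
    · have h1 : rc f (c⁻¹ • (rc χ.toLinearMap ^ (p - 1)) (z * g ^ (p - 1)) * x ^ (m + 1)) =
          z * x ^ m := by
        rw [smul_mul_assoc, map_smul, h.X_mul, h.G_pow_mem_ker hw, zero_mul, zero_add,
          ← Module.End.mul_apply, ← pow_succ', Nat.sub_add_cancel h.prime.pos, h.G_pow, h.X_x_pow,
          ← hc, mul_smul_comm, smul_smul, inv_mul_cancel₀ hc0, one_smul, mul_assoc, ← mul_assoc _ g,
          h.g_pow_mul_g, one_mul]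
      rw [pow_succ, Module.End.mul_apply, h1, hz']

end TaftPair

variable (χ : H →ₐ[k] k) (f : H →ₗ[k] k) in
/-- The simultaneous invariants of the functionals `χ` and `f`. -/
noncomputable def inv : Submodule k H where
  carrier := {a | rc f a = 0 ∧ rc χ.toLinearMap a = a}
  zero_mem' := by simp
  add_mem' := by rintro a b ⟨h1, h2⟩ ⟨h3, h4⟩; simp [h1, h2, h3, h4]
  smul_mem' := by rintro c a ⟨h1, h2⟩; simp [h1, h2]

namespace TaftPair

variable {p : ℕ} {q : k} {g x : H} {χ : H →ₐ[k] k} {f : H →ₗ[k] k}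
  (h : TaftPair p q g x χ f)
include h

theorem isLC_inv : IsLC (inv χ f) := by
  rintro φ a ⟨h1, h2⟩
  refine ⟨?_, ?_⟩
  · rw [rc_lc, h1, map_zero]
  · rw [rc_lc, h2]

theorem isLC_ker : IsLC (LinearMap.ker (rc f)) := by
  intro φ a h1
  rw [LinearMap.mem_ker] at *
  rw [rc_lc, h1, map_zero]

theorem one_mem_inv : (1 : H) ∈ inv χ f := ⟨h.X_one, h.G_one⟩

theorem mul_mem_inv {a b : H} (ha : a ∈ inv χ f) (hb : b ∈ inv χ f) : a * b ∈ inv χ f :=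
  ⟨h.mul_mem_ker ha.1 hb.1, by rw [h.G_mul, ha.2, hb.2]⟩

/-- Projection to the `q ^ i`-eigenspace. -/
theorem sum_pow_smul_G [CharZero k] {a : H} : a = ∑ i ∈ Finset.range p,
    ((p : k)⁻¹ • ∑ s ∈ Finset.range p, (q⁻¹ ^ i) ^ s • (rc χ.toLinearMap ^ s) a) := by
  have hp0 : (p : k) ≠ 0 := Nat.cast_ne_zero.2 h.prime.ne_zero
  rw [← Finset.smul_sum, Finset.sum_comm, Finset.sum_eq_single_of_mem 0
    (Finset.mem_range.2 h.prime.pos)]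
  · simp [← Nat.cast_smul_eq_nsmul k, smul_smul, hp0]
  · intro s hs hs0
    rw [← Finset.sum_smul]
    have h1 : ∑ i ∈ Finset.range p, (q⁻¹ ^ i) ^ s = 0 := by
      have h2 := geom_sum_mul (q⁻¹ ^ s) p
      rw [← pow_mul, mul_comm s, pow_mul, h.prim.inv.pow_eq_one, one_pow, sub_self] at h2
      have h3 : q⁻¹ ^ s ≠ 1 := h.prim.inv.pow_ne_one_of_pos_of_lt hs0 (Finset.mem_range.1 hs)
      have h4 := (mul_eq_zero.1 h2).resolve_right (sub_ne_zero.2 h3)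
      rw [← h4]
      exact Finset.sum_congr rfl fun i _ => by rw [← pow_mul, ← pow_mul, mul_comm]
    rw [h1, zero_smul]

theorem G_proj (i : ℕ) (a : H) :
    rc χ.toLinearMap (∑ s ∈ Finset.range p, (q⁻¹ ^ i) ^ s • (rc χ.toLinearMap ^ s) a) =
      q ^ i • ∑ s ∈ Finset.range p, (q⁻¹ ^ i) ^ s • (rc χ.toLinearMap ^ s) a := by
  have hq : q ^ i ≠ 0 := pow_ne_zero _ h.q_ne_zero
  rw [map_sum, Finset.smul_sum]
  obtain ⟨m, rfl⟩ : ∃ m, p = m + 1 := ⟨p - 1, (Nat.sub_add_cancel h.prime.pos).symm⟩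
  rw [Finset.sum_range_succ, Finset.sum_range_succ']
  congr 1
  · refine Finset.sum_congr rfl fun s _ => ?_
    rw [map_smul, ← Module.End.mul_apply, ← pow_succ', smul_smul]
    congr 1
    rw [pow_succ, mul_comm (q ^ i), mul_assoc, ← mul_pow, inv_mul_cancel₀ h.q_ne_zero, one_pow,
      mul_one]
  · rw [map_smul, ← Module.End.mul_apply, ← pow_succ', h.G_pow, pow_zero, pow_zero, one_smul]
    congr 1
    have h1 : (q⁻¹ ^ i) ^ (m + 1) = 1 := by
      rw [← pow_mul, mul_comm, pow_mul, h.prim.inv.pow_eq_one, one_pow]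
    rw [pow_succ] at h1
    rw [eq_comm, ← mul_one (q ^ i), ← h1]
    rw [← mul_assoc, mul_comm _ ((q⁻¹ ^ i) ^ m), mul_assoc]
    rw [show q ^ i * q⁻¹ ^ i = 1 by rw [← mul_pow, mul_inv_cancel₀ h.q_ne_zero, one_pow], mul_one]

theorem proj_mem_ker {a : H} (ha : rc f a = 0) (i : ℕ) :
    rc f (∑ s ∈ Finset.range p, (q⁻¹ ^ i) ^ s • (rc χ.toLinearMap ^ s) a) = 0 := by
  rw [map_sum]
  exact Finset.sum_eq_zero fun s _ => by rw [map_smul, h.G_pow_mem_ker ha, smul_zero]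

theorem q_pow_mul_q_pow (i : ℕ) : q ^ i * q ^ ((p - 1) * i) = 1 := by
  rw [← pow_add, show i + (p - 1) * i = p * i by
    rw [add_comm, ← Nat.succ_mul, Nat.succ_eq_add_one, Nat.sub_add_cancel h.prime.pos],
    pow_mul, h.prim.pow_eq_one, one_pow]

theorem g_pow_mul_g_pow (i : ℕ) : g ^ i * g ^ ((p - 1) * i) = 1 := by
  rw [← pow_add, show i + (p - 1) * i = p * i by
    rw [add_comm, ← Nat.succ_mul, Nat.succ_eq_add_one, Nat.sub_add_cancel h.prime.pos],
    pow_mul, h.g_pow, one_pow]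

theorem g_pow_mul_g_pow' (i : ℕ) : g ^ ((p - 1) * i) * g ^ i = 1 := by
  rw [← pow_add, add_comm, pow_add, h.g_pow_mul_g_pow]

theorem eigen_mul_mem_inv {a : H} (ha : rc f a = 0) {i : ℕ} (hi : rc χ.toLinearMap a = q ^ i • a) :
    a * g ^ ((p - 1) * i) ∈ inv χ f := by
  refine ⟨h.mul_mem_ker ha (h.X_g_pow _), ?_⟩
  rw [h.G_mul, hi, h.G_g_pow, smul_mul_smul_comm, h.q_pow_mul_q_pow, one_smul]

theorem mul_eigen_mem_inv {a : H} (ha : rc f a = 0) {i : ℕ} (hi : rc χ.toLinearMap a = q ^ i • a) :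
    g ^ ((p - 1) * i) * a ∈ inv χ f := by
  refine ⟨h.mul_mem_ker (h.X_g_pow _) ha, ?_⟩
  rw [h.G_mul, hi, h.G_g_pow, smul_mul_smul_comm, mul_comm, h.q_pow_mul_q_pow, one_smul]

theorem exists_eq_sum_mul_g [CharZero k] {a : H} (ha : rc f a = 0) :
    ∃ r : ℕ → H, (∀ i, r i ∈ inv χ f) ∧ a = ∑ i ∈ Finset.range p, r i * g ^ i := by
  refine ⟨fun i => ((p : k)⁻¹ • ∑ s ∈ Finset.range p, (q⁻¹ ^ i) ^ s • (rc χ.toLinearMap ^ s) a) *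
    g ^ ((p - 1) * i), fun i => h.eigen_mul_mem_inv ?_ ?_, ?_⟩
  · rw [map_smul, h.proj_mem_ker ha, smul_zero]
  · rw [map_smul, h.G_proj, smul_comm]
  · conv_lhs => rw [h.sum_pow_smul_G (a := a)]
    exact Finset.sum_congr rfl fun i _ => by rw [mul_assoc, h.g_pow_mul_g_pow', mul_one]

theorem exists_eq_sum_g_mul [CharZero k] {a : H} (ha : rc f a = 0) :
    ∃ r : ℕ → H, (∀ i, r i ∈ inv χ f) ∧ a = ∑ i ∈ Finset.range p, g ^ i * r i := by
  refine ⟨fun i => g ^ ((p - 1) * i) *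
    ((p : k)⁻¹ • ∑ s ∈ Finset.range p, (q⁻¹ ^ i) ^ s • (rc χ.toLinearMap ^ s) a),
    fun i => h.mul_eigen_mem_inv ?_ ?_, ?_⟩
  · rw [map_smul, h.proj_mem_ker ha, smul_zero]
  · rw [map_smul, h.G_proj, smul_comm]
  · conv_lhs => rw [h.sum_pow_smul_G (a := a)]
    exact Finset.sum_congr rfl fun i _ => by rw [← mul_assoc, h.g_pow_mul_g_pow, one_mul]

theorem G_pow_eigen {a : H} {c : k} (ha : rc χ.toLinearMap a = c • a) (s : ℕ) :
    (rc χ.toLinearMap ^ s) a = c ^ s • a := by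
  induction s with
  | zero => simp
  | succ s ih => rw [pow_succ', Module.End.mul_apply, ih, map_smul, ha, smul_smul, ← pow_succ]

theorem inv_mul_g {r : H} (hr : r ∈ inv χ f) (i : ℕ) :
    rc χ.toLinearMap (r * g ^ i) = q ^ i • (r * g ^ i) := by
  rw [h.G_mul, hr.2, h.G_g_pow, mul_smul_comm]

/-- Eigenvectors of `rc χ` for distinct powers of `q` are independent. -/
theorem eigen_independent {v : Fin p → H} (hv : ∀ i, rc χ.toLinearMap (v i) = q ^ (i : ℕ) • v i)
    (h0 : ∑ i, v i = 0) (i : Fin p) : v i = 0 := by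
  have hinj : Function.Injective fun i : Fin p => q ^ (i : ℕ) := fun i j hij =>
    Fin.ext (h.prim.pow_inj i.2 j.2 hij)
  have h1 := Matrix.det_vandermonde_ne_zero_iff.2 hinj
  by_contra hvi
  obtain ⟨φ, hφ⟩ : ∃ φ : H →ₗ[k] k, φ (v i) ≠ 0 := by
    by_contra! hcon
    exact hvi (eq_of_forall_dual (k := k) fun φ => by rw [hcon, map_zero])
  have h2 : Matrix.vecMul (fun i => φ (v i)) (Matrix.vandermonde fun i : Fin p => q ^ (i : ℕ)) = 0 := by
    funext s
    have h3 := congr_arg (fun w => φ ((rc χ.toLinearMap ^ (s : ℕ)) w)) h0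
    simp only [map_sum, map_zero, h.G_pow_eigen (hv _), map_smul, smul_eq_mul] at h3
    simp only [Matrix.vecMul, dotProduct, Matrix.vandermonde_apply, Pi.zero_apply]
    rw [← h3]
    exact Finset.sum_congr rfl fun j _ => mul_comm _ _
  have h4 := Matrix.eq_zero_of_vecMul_eq_zero h1 h2
  exact hφ (congr_fun h4 i)

theorem mul_g_pow_injective (i : ℕ) {r : H} (hr : r * g ^ i = 0) : r = 0 := by
  rw [← mul_one r, ← h.g_pow_mul_g_pow i, ← mul_assoc, hr, zero_mul]

theorem finrank_ker_le : Module.finrank k (LinearMap.ker (rc f)) ≤ p ^ 2 := by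
  have := h.finiteDimensional
  have h1 := h.taftFun.mul_finrank_ker_le
  rw [h.finrank_eq, pow_succ' p 2] at h1
  exact Nat.le_of_mul_le_mul_left h1 h.prime.pos

theorem finrank_inv_le : Module.finrank k (inv χ f) ≤ p := by
  have := h.finiteDimensional
  let J : (Fin p → inv χ f) →ₗ[k] H :=
    { toFun := fun r => ∑ i, (r i : H) * g ^ (i : ℕ)
      map_add' := fun r s => by simp [add_mul, Finset.sum_add_distrib]
      map_smul' := fun c r => by simp [Finset.smul_sum] }
  have hJ : Function.Injective J := by
    rw [← LinearMap.ker_eq_bot, LinearMap.ker_eq_bot']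
    intro r hr
    funext i
    exact Subtype.ext (h.mul_g_pow_injective i
      (h.eigen_independent (fun i => h.inv_mul_g (r i).2 i) hr i))
  have h1 : Module.finrank k (Fin p → inv χ f) ≤ p ^ 2 := by
    refine le_trans ?_ h.finrank_ker_le
    rw [← LinearMap.finrank_range_of_inj hJ]
    refine Submodule.finrank_mono ?_
    rintro _ ⟨r, rfl⟩
    show rc f (∑ i, (r i : H) * g ^ (i : ℕ)) = 0
    rw [map_sum]
    exact Finset.sum_eq_zero fun i _ => h.mul_mem_ker (r i).2.1 (h.X_g_pow _)
  rw [Module.finrank_pi_fintype] at h1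
  simp only [Finset.sum_const, Finset.card_univ, Fintype.card_fin, smul_eq_mul, sq] at h1
  exact Nat.le_of_mul_le_mul_left h1 h.prime.pos

theorem top_of_left [CharZero k] {U : Submodule k H}
    (hU : ∀ i j, ∀ r ∈ inv χ f, x ^ j * (g ^ i * r) ∈ U) : U = ⊤ := by
  refine taylor_top h.taftFun.rc_pow_zero (M := fun j z => x ^ j * z)
    (fun j hj y hy => h.exists_left hj y hy) fun j _ z hz => ?_
  obtain ⟨r, hr, rfl⟩ := h.exists_eq_sum_g_mul hz
  rw [Finset.mul_sum]
  exact sum_mem fun i _ => hU _ _ _ (hr i)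

theorem top_of_right [CharZero k] {U : Submodule k H}
    (hU : ∀ i j, ∀ r ∈ inv χ f, r * g ^ i * x ^ j ∈ U) : U = ⊤ := by
  refine taylor_top h.taftFun.rc_pow_zero (M := fun j z => z * x ^ j)
    (fun j hj y hy => h.exists_right hj y hy) fun j _ z hz => ?_
  obtain ⟨r, hr, rfl⟩ := h.exists_eq_sum_mul_g hz
  rw [Finset.sum_mul]
  exact sum_mem fun i _ => hU _ _ _ (hr i)

/-- Left multiples of a left ideal of the invariants exhaust `H` only if the ideal is large. -/
theorem le_finrank_of_one_mem [CharZero k] (hxp : x ^ p = 0) {N : Submodule k H}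
    (hmul : ∀ r ∈ inv χ f, ∀ n ∈ N, r * n ∈ N) {W : Submodule k H}
    (hW : W = Submodule.span k {y | ∃ (a : H), ∃ n ∈ N, y = a * n}) (h1 : (1 : H) ∈ W) :
    p ≤ Module.finrank k N := by
  have := h.finiteDimensional
  let J : (Fin p × Fin p → N) →ₗ[k] H :=
    { toFun := fun r => ∑ i, x ^ (i.2 : ℕ) * (g ^ (i.1 : ℕ) * (r i : H))
      map_add' := fun r s => by simp [mul_add, Finset.sum_add_distrib]
      map_smul' := fun c r => by simp [Finset.smul_sum] }
  have hmono : ∀ i j, ∀ n ∈ N, x ^ j * (g ^ i * n) ∈ LinearMap.range J := by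
    intro i j n hn
    by_cases hj : j < p
    · classical
      refine ⟨Pi.single (⟨i % p, Nat.mod_lt _ h.prime.pos⟩, ⟨j, hj⟩) ⟨n, hn⟩, ?_⟩
      show ∑ i, x ^ (i.2 : ℕ) * (g ^ (i.1 : ℕ) * ((Pi.single _ _ : Fin p × Fin p → N) i : H)) = _
      rw [Finset.sum_eq_single (⟨i % p, Nat.mod_lt _ h.prime.pos⟩, ⟨j, hj⟩)]
      · simp [← pow_eq_pow_mod i h.g_pow]
      · intro b _ hb
        rw [Pi.single_eq_of_ne hb]; simp
      · simp
    · rw [← Nat.sub_add_cancel (not_lt.1 hj), pow_add, hxp, mul_zero, zero_mul]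
      exact zero_mem _
  have hWJ : W ≤ LinearMap.range J := by
    rw [hW, Submodule.span_le]
    rintro _ ⟨a, n, hn, rfl⟩
    have : (LinearMap.range J).comap (LinearMap.mulRight k n) = ⊤ := by
      refine h.top_of_left fun i j r hr => ?_
      rw [Submodule.mem_comap, LinearMap.mulRight_apply, mul_assoc, mul_assoc]
      exact hmono _ _ _ (hmul r hr n hn)
    have h2 : a ∈ (LinearMap.range J).comap (LinearMap.mulRight k n) := by rw [this]; trivial
    exact h2
  have hWtop : W = ⊤ := by
    rw [eq_top_iff]
    intro b _
    have h2 : ∀ w ∈ W, b * w ∈ W := by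
      intro w hw
      rw [hW] at hw ⊢
      induction hw using Submodule.span_induction with
      | zero => simp
      | add v w _ _ hv hw => rw [mul_add]; exact add_mem hv hw
      | smul c v _ hv => rw [mul_smul_comm]; exact Submodule.smul_mem _ _ hv
      | mem v hv =>
        obtain ⟨a, n, hn, rfl⟩ := hv
        exact Submodule.subset_span ⟨b * a, n, hn, by rw [mul_assoc]⟩
    simpa using h2 1 h1
  have h3 : Function.Surjective J := by
    rw [← LinearMap.range_eq_top, eq_top_iff, ← hWtop]; exact hWJ
  have h4 := LinearMap.finrank_le_finrank_of_surjective h3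
  rw [h.finrank_eq, Module.finrank_pi_fintype] at h4
  simp only [Finset.sum_const, Finset.card_univ, Fintype.card_prod, Fintype.card_fin, smul_eq_mul,
    pow_succ, pow_zero, one_mul] at h4
  exact Nat.le_of_mul_le_mul_left h4 (Nat.mul_pos h.prime.pos h.prime.pos)

theorem eq_inv_of_one_mem [CharZero k] (hxp : x ^ p = 0) {N : Submodule k H}
    (hN : N ≤ inv χ f) (hmul : ∀ r ∈ inv χ f, ∀ n ∈ N, r * n ∈ N) {W : Submodule k H}
    (hW : W = Submodule.span k {y | ∃ (a : H), ∃ n ∈ N, y = a * n}) (h1 : (1 : H) ∈ W) :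
    N = inv χ f :=
  have := h.finiteDimensional
  Submodule.eq_of_le_of_finrank_le hN
    (h.finrank_inv_le.trans (h.le_finrank_of_one_mem hxp hmul hW h1))

theorem finrank_inv [CharZero k] (hxp : x ^ p = 0) : Module.finrank k (inv χ f) = p :=
  le_antisymm h.finrank_inv_le (h.le_finrank_of_one_mem hxp
    (fun _ hr _ hn => h.mul_mem_inv hr hn) rfl (Submodule.subset_span ⟨1, 1, h.one_mem_inv, by simp⟩))

end TaftPair

end Pair

end HopfFour

namespace HopfFour

section Grouplike

variable {k : Type*} [Field k] {H : Type*} [Ring H] [HopfAlgebra k H]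

theorem finrank_eq_one_of_mem {D : Submodule k H}
    (hD : HopfClass.IsSimpleSubcoalgWrt k (HopfClass.comulL k H) D) {g : H} (hg : IsGL k g)
    (hgD : g ∈ D) : Module.finrank k D = 1 := by
  have hg0 : g ≠ 0 := by
    rintro rfl
    have := hg.2
    simp at this
  have : Submodule.span k {g} = D := by
    refine eq_of_isSimple hD ?_ ?_ ?_ ?_
    · intro φ v hv
      obtain ⟨c, rfl⟩ := Submodule.mem_span_singleton.1 hv
      rw [map_smul, hg.lc, smul_smul]
      exact Submodule.mem_span_singleton.2 ⟨_, rfl⟩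
    · intro φ v hv
      obtain ⟨c, rfl⟩ := Submodule.mem_span_singleton.1 hv
      rw [map_smul, hg.rc, smul_smul]
      exact Submodule.mem_span_singleton.2 ⟨_, rfl⟩
    · rwa [Submodule.span_singleton_le_iff_mem]
    · simpa using hg0
  rw [← this, finrank_span_singleton hg0]

/-- A nonzero left coideal spanned by grouplike elements contains one of them. -/
theorem exists_isGL_mem {D : Submodule k H} (hD : IsLC D) {v : H} (hv : v ∈ D) (hv0 : v ≠ 0)
    (hs : v ∈ Submodule.span k {g : H | IsGL k g}) : ∃ g, IsGL k g ∧ g ∈ D := by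
  classical
  have hli : LinearIndependent k fun g : {g : H | IsGL k g} => (g : H) := by
    have h1 : LinearIndepOn k id {g : H | IsGroupLikeElem k g} := linearIndepOn_isGroupLikeElem
    exact LinearIndependent.comp h1 (fun g : {g : H | IsGL k g} =>
      (⟨g.1, g.2.2, g.2.1⟩ : {g : H | IsGroupLikeElem k g}))
      (fun a b h => Subtype.ext
        (congrArg (fun z : {g : H | IsGroupLikeElem k g} => (z : H)) h))
  have hs' : v ∈ Submodule.span k (Set.range fun g : {g : H | IsGL k g} => (g : H)) := by
    simpa using hs
  obtain ⟨c, rfl⟩ := (Finsupp.mem_span_range_iff_exists_finsupp).1 hs'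
  have hc : c ≠ 0 := by rintro rfl; simp at hv0
  obtain ⟨g, hg⟩ := Finsupp.ne_iff.1 hc
  obtain ⟨φ, hφ⟩ := LinearMap.exists_extend
    ((Finsupp.lapply g : ({g : H | IsGL k g} →₀ k) →ₗ[k] k) ∘ₗ hli.repr)
  have key : ∀ g' : {g : H | IsGL k g}, φ (g' : H) = if g' = g then 1 else 0 := by
    intro g'
    have h2 := LinearMap.congr_fun hφ ⟨(g' : H), Submodule.subset_span ⟨g', rfl⟩⟩
    simp only [LinearMap.comp_apply, Submodule.subtype_apply] at h2
    rw [h2, show hli.repr ⟨(g' : H), Submodule.subset_span ⟨g', rfl⟩⟩ = Finsupp.single g' 1 from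
      hli.repr_eq_single g' _ rfl]
    simp [Finsupp.single_apply]
  refine ⟨g, g.2, ?_⟩
  have h3 := hD φ _ hv
  rw [Finsupp.sum, map_sum] at h3
  have h4 : ∀ g' ∈ c.support, lc φ (c g' • (g' : H)) = if g' = g then c g • (g : H) else 0 := by
    intro g' _
    rw [map_smul, IsGL.lc g'.2, key]
    split_ifs with h
    · rw [h, one_smul]
    · simp
  rw [Finset.sum_congr rfl h4] at h3
  simp only [Finset.sum_ite_eq', Finsupp.mem_support_iff, Finsupp.zero_apply] at h3 hg
  rw [if_pos hg] at h3
  exact (Submodule.smul_mem_iff D hg).1 h3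

end Grouplike

section Pointed

variable {k : Type*} [Field k] {H : Type*} [Ring H] [HopfAlgebra k H] {q : k} {g x : H}

/-- A nonzero subcoalgebra inside the span of the monomials `g ^ i * x ^ j` contains a grouplike
element. -/
theorem exists_isGL_mem_of_le_span (hq : q ≠ 0) (hg : IsGL k g)
    (hx : Coalgebra.comul (R := k) x = x ⊗ₜ[k] (1 : H) + g ⊗ₜ[k] x) (hgx : g * x = q • (x * g))
    {D : Submodule k H} (hl : IsLC D) (hr : IsRC D) (h0 : D ≠ ⊥)
    (hle : D ≤ Submodule.span k (Set.range fun a : ℕ × ℕ => g ^ a.1 * x ^ a.2)) :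
    ∃ g', IsGL k g' ∧ g' ∈ D := by
  have hcomm : ∀ j, ∃ c : k, x ^ j * g = c • (g * x ^ j) := by
    intro j
    induction j with
    | zero => exact ⟨1, by simp⟩
    | succ j ih =>
      obtain ⟨c, hc⟩ := ih
      refine ⟨q⁻¹ * c, ?_⟩
      have : x * g = q⁻¹ • (g * x) := by rw [hgx, inv_smul_smul₀ hq]
      rw [pow_succ', mul_assoc, hc, mul_smul_comm, ← mul_assoc, this, smul_mul_assoc, smul_smul,
        mul_comm c, mul_assoc]
  set F : ℕ → Submodule k H := fun m => Submodule.span k {y | ∃ i j, j < m ∧ y = g ^ i * x ^ j}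
  have hFmono : Monotone F := fun m n hmn => Submodule.span_mono (by
    rintro y ⟨i, j, h, e⟩
    exact ⟨i, j, by omega, e⟩)
  have hmem : ∀ i j m, j < m → g ^ i * x ^ j ∈ F m := fun i j m h =>
    Submodule.subset_span ⟨i, j, h, rfl⟩
  have hFx : ∀ m, ∀ y ∈ F m, y * x ∈ F (m + 1) := by
    intro m y hy
    induction hy using Submodule.span_induction with
    | mem y hy =>
      obtain ⟨i, j, hj, rfl⟩ := hy
      rw [mul_assoc, ← pow_succ]
      exact hmem _ _ _ (by omega)
    | zero => simp
    | add y z _ _ h1 h2 => rw [add_mul]; exact add_mem h1 h2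
    | smul c y _ h1 => rw [smul_mul_assoc]; exact Submodule.smul_mem _ _ h1
  have hFg : ∀ m, ∀ y ∈ F m, y * g ∈ F m := by
    intro m y hy
    induction hy using Submodule.span_induction with
    | mem y hy =>
      obtain ⟨i, j, hj, rfl⟩ := hy
      obtain ⟨c, hc⟩ := hcomm j
      rw [mul_assoc, hc, mul_smul_comm, ← mul_assoc, ← pow_succ]
      exact Submodule.smul_mem _ _ (hmem _ _ _ hj)
    | zero => simp
    | add y z _ _ h1 h2 => rw [add_mul]; exact add_mem h1 h2
    | smul c y _ h1 => rw [smul_mul_assoc]; exact Submodule.smul_mem _ _ h1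
  have hstep : ∀ (φ : H →ₗ[k] k) i j, rc φ (g ^ i * x ^ (j + 1)) =
      rc φ (g ^ i * x ^ j) * x + rc (φ ∘ₗ LinearMap.mulRight k x) (g ^ i * x ^ j) * g := by
    intro φ i j
    rw [pow_succ, ← mul_assoc, rc_mul_skew hx]
  have hrc : ∀ j i (φ : H →ₗ[k] k), rc φ (g ^ i * x ^ j) ∈ F (j + 1) := by
    intro j
    induction j with
    | zero =>
      intro i φ
      rw [pow_zero, mul_one, (hg.pow i).rc]
      exact Submodule.smul_mem _ _ (by simpa using hmem i 0 1 one_pos)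
    | succ j ih =>
      intro i φ
      rw [hstep]
      exact add_mem (hFx _ _ (ih i φ)) (hFmono (by omega) (hFg _ _ (ih i _)))
  have hrc0 : ∀ j i (φ : H →ₗ[k] k), (∀ i, φ (g ^ i) = 0) → rc φ (g ^ i * x ^ j) ∈ F j := by
    intro j
    induction j with
    | zero =>
      intro i φ hφ
      rw [pow_zero, mul_one, (hg.pow i).rc, hφ, zero_smul]
      exact zero_mem _
    | succ j ih =>
      intro i φ hφ
      rw [hstep]
      exact add_mem (hFx _ _ (ih i φ hφ)) (hFg _ _ (hrc j i _))
  have hrcF : ∀ m (φ : H →ₗ[k] k), (∀ i, φ (g ^ i) = 0) → ∀ v ∈ F (m + 1), rc φ v ∈ F m := by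
    intro m φ hφ v hv
    induction hv using Submodule.span_induction with
    | mem y hy =>
      obtain ⟨i, j, hj, rfl⟩ := hy
      exact hFmono (by omega) (hrc0 j i φ hφ)
    | zero => simp
    | add y z _ _ h1 h2 => rw [map_add]; exact add_mem h1 h2
    | smul c y _ h1 => rw [map_smul]; exact Submodule.smul_mem _ _ h1
  have hF1 : F 1 ≤ Submodule.span k (Set.range fun i : ℕ => g ^ i) := by
    refine Submodule.span_mono ?_
    rintro y ⟨i, j, hj, rfl⟩
    obtain rfl : j = 0 := by omega
    exact ⟨i, by simp⟩
  have key : ∀ m, ∀ v ∈ D, v ≠ 0 → v ∈ F m →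
      ∃ w ∈ D, w ≠ 0 ∧ w ∈ Submodule.span k (Set.range fun i : ℕ => g ^ i) := by
    intro m
    induction m with
    | zero =>
      intro v _ hv0 hv
      have : F 0 = ⊥ := by
        rw [eq_bot_iff]
        refine Submodule.span_le.2 ?_
        rintro y ⟨i, j, hj, _⟩
        omega
      rw [this] at hv
      exact absurd hv hv0
    | succ m ih =>
      intro v hvD hv0 hv
      by_cases hE : v ∈ Submodule.span k (Set.range fun i : ℕ => g ^ i)
      · exact ⟨v, hvD, hv0, hE⟩
      · obtain ⟨φ, hφ, hφ'⟩ := Submodule.exists_le_ker_of_notMem hE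
        have hφi : ∀ i, φ (g ^ i) = 0 := fun i => hφ' (Submodule.subset_span ⟨i, rfl⟩)
        refine ih (rc φ v) (hr φ v hvD) ?_ (hrcF m φ hφi v hv)
        intro h
        apply hφ
        rw [← counit_rc, h, map_zero]
  obtain ⟨v, hvD, hv0⟩ := Submodule.exists_mem_ne_zero_of_ne_bot h0
  have hvF : ∃ m, v ∈ F m := by
    have := hle hvD
    clear hvD hv0
    induction this using Submodule.span_induction with
    | mem y hy =>
      obtain ⟨a, rfl⟩ := hy
      exact ⟨a.2 + 1, hmem _ _ _ (by omega)⟩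
    | zero => exact ⟨0, zero_mem _⟩
    | add y z _ _ h1 h2 =>
      obtain ⟨m1, h1⟩ := h1
      obtain ⟨m2, h2⟩ := h2
      exact ⟨m1 + m2, add_mem
        (hFmono (by omega) h1)
        (hFmono (by omega) h2)⟩
    | smul c y _ h1 =>
      obtain ⟨m1, h1⟩ := h1
      exact ⟨m1, Submodule.smul_mem _ _ h1⟩
  obtain ⟨m, hm⟩ := hvF
  obtain ⟨w, hwD, hw0, hw⟩ := key m v hvD hv0 hm
  refine exists_isGL_mem hl hwD hw0 (Submodule.span_mono ?_ hw)
  rintro _ ⟨i, rfl⟩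
  exact hg.pow i

theorem isSubcoalg_adjoin (hg : IsGL k g)
    (hx : Coalgebra.comul (R := k) x = x ⊗ₜ[k] (1 : H) + g ⊗ₜ[k] x) :
    HopfClass.IsSubcoalgWrt k (HopfClass.comulL k H)
      (Subalgebra.toSubmodule (Algebra.adjoin k {g, x})) := by
  set T := Algebra.adjoin k {g, x}
  have hgT : g ∈ T := Algebra.subset_adjoin (by simp)
  have hxT : x ∈ T := Algebra.subset_adjoin (by simp)
  have h1 : T ≤ ((Algebra.TensorProduct.map T.val T.val).range).comap
      (Bialgebra.comulAlgHom k H) := by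
    refine Algebra.adjoin_le ?_
    rintro y (rfl | rfl)
    · exact ⟨(⟨y, hgT⟩ : T) ⊗ₜ[k] (⟨y, hgT⟩ : T), by simpa using hg.1.symm⟩
    · exact ⟨(⟨y, hxT⟩ : T) ⊗ₜ[k] (1 : T) + (⟨g, hgT⟩ : T) ⊗ₜ[k] (⟨y, hxT⟩ : T),
        by simpa using hx.symm⟩
  intro y hy
  obtain ⟨t, ht⟩ := h1 hy
  exact ⟨t, ht⟩

theorem exists_taftPair [CharZero k] {p : ℕ} (hp : p.Prime) (hdim : Module.finrank k H = p ^ 3)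
    {q' : k} {T : Subalgebra k H} (hT : HopfClass.IsTaftSubalgebra k p q' T)
    (hq : IsPrimitiveRoot q p)
    {χ : H →ₐ[k] k} {f : H →ₗ[k] k} (h : TaftFun p q χ f) {D : Submodule k H}
    (hD : HopfClass.IsSimpleSubcoalgWrt k (HopfClass.comulL k H) D)
    (hD1 : Module.finrank k D ≠ 1) : ∃ g x : H, TaftPair p q g x χ f ∧ x ^ p = 0 := by
  obtain ⟨hq', hTdim, g, x, hg0, hx, hgp, hxp, hgx, hadj⟩ := hT
  have hg : IsGL k g := isGL_of_comul hg0.1 hg0.2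
  have hfd : FiniteDimensional k H :=
    Module.finite_of_finrank_pos (by rw [hdim]; exact pow_pos hp.pos 3)
  have hq0 : q ≠ 0 := hq.ne_zero hp.ne_zero
  have hq0' : q' ≠ 0 := hq'.ne_zero hp.ne_zero
  have hfg : f g = 0 := by
    have h1 : ∀ n : ℕ, (rc f ^ n) g = (f g) ^ n • g := by
      intro n
      induction n with
      | zero => simp
      | succ n ih =>
        rw [pow_succ', Module.End.mul_apply, ih, map_smul, hg.rc, smul_smul, pow_succ]
    have h2 := h1 p
    rw [h.rc_pow_zero, LinearMap.zero_apply, eq_comm, smul_eq_zero] at h2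
    exact eq_zero_of_pow_eq_zero (h2.resolve_right hg0.1)
  have hχg : χ g ≠ 0 := by
    intro h0
    have := congrArg χ hgp
    rw [map_pow, h0, zero_pow hp.ne_zero, map_one] at this
    exact zero_ne_one this
  have hχx : χ x = 0 := by
    have h1 := congrArg χ hgx
    rw [map_smul, map_mul, map_mul, smul_eq_mul, mul_comm (χ x), ← mul_assoc] at h1
    by_contra h0
    have h2 : χ g = q' * χ g := mul_right_cancel₀ h0 h1
    exact hq'.ne_one hp.one_lt (mul_right_cancel₀ hχg (by rw [one_mul]; exact h2.symm))
  have hrx : ∀ φ : H →ₗ[k] k, rc φ x = φ 1 • x + φ x • g := rc_skew hx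
  by_cases hfx : f x = 0
  · exfalso
    have hgk : rc f g = 0 := by rw [hg.rc, hfg, zero_smul]
    have hxk : rc f x = 0 := by rw [hrx, h.map_one, hfx]; simp
    let K : Subalgebra k H :=
      { carrier := {a | rc f a = 0}
        mul_mem' := by
          intro a b ha hb
          rw [Set.mem_ofPred_eq] at ha hb ⊢
          rw [h.rc_mul, ha, hb]; simp
        add_mem' := by
          intro a b ha hb
          rw [Set.mem_ofPred_eq] at ha hb ⊢
          rw [map_add, ha, hb, add_zero]
        algebraMap_mem' := by
          intro c
          rw [Set.mem_ofPred_eq, Algebra.algebraMap_eq_smul_one, map_smul, rc_one, h.map_one]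
          simp }
    have hTK : T ≤ K := by
      rw [← hadj]
      refine Algebra.adjoin_le ?_
      rintro y (rfl | rfl)
      · exact hgk
      · exact hxk
    have hle : Subalgebra.toSubmodule T ≤ LinearMap.ker (rc f) := fun y hy => hTK hy
    have hker : Module.finrank k (LinearMap.ker (rc f)) ≤ p ^ 2 := by
      have := h.mul_finrank_ker_le
      rw [hdim, pow_succ' p 2] at this
      exact Nat.le_of_mul_le_mul_left this hp.pos
    have heq : Subalgebra.toSubmodule T = LinearMap.ker (rc f) := by
      refine Submodule.eq_of_le_of_finrank_le hle ?_
      rw [show Module.finrank k (Subalgebra.toSubmodule T) = p ^ 2 from hTdim]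
      exact hker
    have hDl := isLC_of_isSubcoalg hD.1
    have hDr := isRC_of_isSubcoalg hD.1
    have hTs := isSubcoalg_adjoin hg hx
    rw [hadj] at hTs
    have hTl := isLC_of_isSubcoalg hTs
    have hTr := isRC_of_isSubcoalg hTs
    have hne : D ⊓ Subalgebra.toSubmodule T ≠ ⊥ := by
      obtain ⟨v, hvD, hv0⟩ := Submodule.exists_mem_ne_zero_of_ne_bot hD.2.1
      have hn : ∃ n, (rc f ^ n) v = 0 := ⟨p, by rw [h.rc_pow_zero]; rfl⟩
      classical
      have h1 := Nat.find_spec hn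
      have h2 : Nat.find hn ≠ 0 := by
        intro h0
        rw [h0, pow_zero] at h1
        exact hv0 h1
      obtain ⟨m, hm⟩ := Nat.exists_eq_succ_of_ne_zero h2
      have h3 : (rc f ^ m) v ≠ 0 := Nat.find_min hn (by omega)
      have h4 : ∀ n, (rc f ^ n) v ∈ D := by
        intro n
        induction n with
        | zero => simpa using hvD
        | succ n ih =>
          rw [pow_succ', Module.End.mul_apply]
          exact hDr f _ ih
      intro hb
      have h5 : (rc f ^ m) v ∈ D ⊓ Subalgebra.toSubmodule T := by
        refine ⟨h4 m, ?_⟩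
        rw [SetLike.mem_coe, heq, LinearMap.mem_ker, ← Module.End.mul_apply, ← pow_succ',
          ← Nat.succ_eq_add_one, ← hm, h1]
      rw [hb] at h5
      exact h3 h5
    have hDT : D ⊓ Subalgebra.toSubmodule T = D :=
      eq_of_isSimple hD (fun φ v hv => ⟨hDl φ v hv.1, hTl φ v hv.2⟩)
        (fun φ v hv => ⟨hDr φ v hv.1, hTr φ v hv.2⟩) inf_le_left hne
    have hDT' : D ≤ Subalgebra.toSubmodule T := by rw [← hDT]; exact inf_le_right
    obtain ⟨g', hg', hgD⟩ := exists_isGL_mem_of_le_span hq0' hg hx hgx hDl hDr hD.2.1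
      (hDT'.trans (by rw [← hadj]; exact adjoin_le_span hq0' hgx))
    exact hD1 (finrank_eq_one_of_mem hD hg' hgD)
  · have e1 : χ g * f x = q' * f x := by
      have h1 := congrArg f hgx
      rw [map_smul, h.map_mul, h.map_mul, hfg, hχx, hg.2] at h1
      simpa using h1
    have e2 : f x * χ g = q * f x := by
      have h1 := LinearMap.congr_fun h.conv_comm x
      rw [LinearMap.smul_apply, conv_apply, conv_apply, hrx, hrx, h.map_one] at h1
      simpa [hχx, hfg] using h1
    have e3 : χ g = q := mul_right_cancel₀ hfx (by rw [mul_comm, e2])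
    have e4 : q' = q := mul_right_cancel₀ hfx (by rw [← e1, e3])
    subst e4
    refine ⟨g, (f x)⁻¹ • x, ⟨hp, hq, h, hg, ?_, hgp, ?_, ?_, hfg, e3, ?_, hdim⟩, ?_⟩
    · rw [map_smul, hx, smul_add, smul_tmul', tmul_smul]
    · rw [mul_smul_comm, hgx, smul_mul_assoc, smul_comm]
    · simp [hfx]
    · simp [hχx]
    · rw [smul_pow, hxp, smul_zero]

end Pointed

end HopfFour

namespace HopfFour

section General

variable {k : Type*} [Field k] {H : Type*} [Ring H] [HopfAlgebra k H]

open HopfAlgebra (antipode)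

theorem exists_corep_of_isLC [FiniteDimensional k H] {R : Submodule k H} (hlc : IsLC (k := k) R) :
    ∃ (b : Fin (Module.finrank k R) → H) (u : Matrix _ _ H), LinearIndependent k b ∧
      Submodule.span k (Set.range b) = R ∧ IsCorep k u ∧
      (∀ i, Coalgebra.comul (R := k) (b i) = ∑ j, u i j ⊗ₜ[k] b j) ∧
      (∀ (φ : H →ₗ[k] k) i, lc φ (b i) = ∑ j, φ (u i j) • b j) ∧
      ∀ i, ∑ j, Coalgebra.counit (R := k) (b j) • u i j = b i := by
  let b := Module.finBasis k R
  have hli : LinearIndependent k (fun i => (b i : H)) :=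
    b.linearIndependent.map' R.subtype (Submodule.ker_subtype R)
  have hsp : Submodule.span k (Set.range fun i => (b i : H)) = R := by
    have := congr_arg (Submodule.map R.subtype) b.span_eq
    rw [Submodule.map_span, Submodule.map_top, Submodule.range_subtype, ← Set.range_comp] at this
    exact this
  obtain ⟨u, h1, h2, h3, h4⟩ := exists_corep hli (fun φ i => by rw [hsp]; exact hlc φ _ (b i).2)
  exact ⟨_, u, hli, hsp, h1, h2, h3, h4⟩

/-- The right annihilator of a relative integral is a left coideal. -/
theorem apply_mul_lc_eq_zero [FiniteDimensional k H] {R : Submodule k H}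
    (hmul : ∀ r ∈ R, ∀ s ∈ R, r * s ∈ R) (hlc : IsLC (k := k) R) {ℓ : H →ₗ[k] k} {a : H}
    (hl : ∀ r ∈ R, rc ℓ r = ℓ r • a) {s : H} (hs : s ∈ R) (h0 : ∀ r ∈ R, ℓ (r * s) = 0)
    (φ : H →ₗ[k] k) : ∀ r ∈ R, ℓ (r * lc φ s) = 0 := by
  obtain ⟨b, u, -, hb, hu, hc, -, -⟩ := exists_corep_of_isLC hlc
  have hbR : ∀ i, b i ∈ R := fun i => by rw [← hb]; exact Submodule.subset_span ⟨i, rfl⟩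
  have h1 : ∀ l, ∑ j, u l j * rc (ℓ ∘ₗ LinearMap.mulLeft k (b j)) s = 0 := by
    intro l
    rw [← rc_mul_left (hc l) ℓ s, hl _ (hmul _ (hbR l) _ hs), h0 _ (hbR l), zero_smul]
  have h2 : ∀ i, rc (ℓ ∘ₗ LinearMap.mulLeft k (b i)) s = 0 := by
    intro i
    have h3 : ∑ l, antipode k (u i l) * ∑ j, u l j * rc (ℓ ∘ₗ LinearMap.mulLeft k (b j)) s = 0 := by
      simp [h1]
    simp only [Finset.mul_sum, ← mul_assoc] at h3
    rw [Finset.sum_comm] at h3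
    simp only [← Finset.sum_mul, hu.sum_antipode_mul] at h3
    simpa using h3
  intro r hr
  rw [← hb] at hr
  induction hr using Submodule.span_induction with
  | mem y hy =>
    obtain ⟨i, rfl⟩ := hy
    have h3 := apply_rc φ (ℓ ∘ₗ LinearMap.mulLeft k (b i)) s
    rw [h2, map_zero] at h3
    exact h3.symm
  | zero => simp
  | add y z _ _ h1 h2 => rw [add_mul, map_add, h1, h2, add_zero]
  | smul c y _ h1 => rw [smul_mul_assoc, map_smul, h1, smul_zero]

theorem rc_antipode_sq [FiniteDimensional k H] (φ : H →ₗ[k] k) (a : H) :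
    rc φ (antipode k (antipode k a)) =
      antipode k (antipode k (rc (φ ∘ₗ antipode k ∘ₗ antipode k) a)) := by
  refine corep_induction (k := k) (P := fun a => rc φ (antipode k (antipode k a)) =
      antipode k (antipode k (rc (φ ∘ₗ antipode k ∘ₗ antipode k) a))) (by simp)
      (fun x y hx hy => by simp [hx, hy]) (fun c x hx => by simp [hx]) (fun n u hu i j => ?_) a
  have := hu.antipode_sq.rc φ i j
  simp only [Matrix.of_apply] at this
  rw [this, hu.rc, map_sum, map_sum]
  simp

theorem lc_antipode_sq [FiniteDimensional k H] (φ : H →ₗ[k] k) (a : H) :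
    lc φ (antipode k (antipode k a)) =
      antipode k (antipode k (lc (φ ∘ₗ antipode k ∘ₗ antipode k) a)) := by
  refine corep_induction (k := k) (P := fun a => lc φ (antipode k (antipode k a)) =
      antipode k (antipode k (lc (φ ∘ₗ antipode k ∘ₗ antipode k) a))) (by simp)
      (fun x y hx hy => by simp [hx, hy]) (fun c x hx => by simp [hx]) (fun n u hu i j => ?_) a
  have := hu.antipode_sq.lc φ i j
  simp only [Matrix.of_apply] at this
  rw [this, hu.lc, map_sum, map_sum]
  simp

theorem rc_eq_zero_of_isLC {R : Submodule k H} (hlc : IsLC (k := k) R) {ψ : H →ₗ[k] k}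
    (hψ : ∀ r ∈ R, ψ r = 0) {r : H} (hr : r ∈ R) : rc ψ r = 0 := by
  refine eq_of_forall_dual (k := k) fun θ => ?_
  rw [apply_rc, hψ _ (hlc θ r hr), map_zero]

theorem isLC_span_mul {N : Submodule k H} (hN : IsLC N) :
    IsLC (Submodule.span k {y | ∃ (a : H), ∃ n ∈ N, y = a * n}) := by
  intro φ v hv
  induction hv using Submodule.span_induction with
  | mem y hy =>
    obtain ⟨a, n, hn, rfl⟩ := hy
    obtain ⟨s, hs⟩ := exists_comul (k := k) a
    rw [lc_mul_left hs]
    exact sum_mem fun i _ => Submodule.subset_span ⟨_, _, hN _ n hn, rfl⟩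
  | zero => simp
  | add y z _ _ h1 h2 => rw [map_add]; exact add_mem h1 h2
  | smul c y _ h1 => rw [map_smul]; exact Submodule.smul_mem _ _ h1

end General

namespace TaftPair

variable {k : Type*} [Field k] {H : Type*} [Ring H] [HopfAlgebra k H]
  {p : ℕ} {q : k} {g x : H} {χ : H →ₐ[k] k} {f : H →ₗ[k] k} (h : TaftPair p q g x χ f)

open HopfAlgebra (antipode)

include h

theorem f_antipode_sq (a : H) : f (antipode k (antipode k a)) = q⁻¹ * f a :=
  have := h.finiteDimensional
  h.taftFun.antipode_sq h.q_ne_zero a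

theorem χ_antipode_sq (a : H) : χ (antipode k (antipode k a)) = χ a :=
  have := h.finiteDimensional
  algHom_antipode_antipode χ a

theorem X_antipode_sq (a : H) : rc f (antipode k (antipode k a)) =
    q⁻¹ • antipode k (antipode k (rc f a)) := by
  have := h.finiteDimensional
  rw [rc_antipode_sq, show f ∘ₗ antipode k ∘ₗ antipode k = q⁻¹ • f from
    LinearMap.ext h.f_antipode_sq, rc_smul, map_smul, map_smul]

theorem G_antipode_sq (a : H) : rc χ.toLinearMap (antipode k (antipode k a)) =
    antipode k (antipode k (rc χ.toLinearMap a)) := by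
  have := h.finiteDimensional
  rw [rc_antipode_sq, show χ.toLinearMap ∘ₗ antipode k ∘ₗ antipode k = χ.toLinearMap from
    LinearMap.ext h.χ_antipode_sq]

theorem antipode_sq_mem_inv {a : H} (ha : a ∈ inv χ f) :
    antipode k (antipode k a) ∈ inv χ f :=
  ⟨by rw [h.X_antipode_sq, ha.1]; simp, by rw [h.G_antipode_sq, ha.2]⟩

theorem rc_mul_monomial : ∀ (j i : ℕ) (φ : H →ₗ[k] k)
    (_ : ∀ m < j, ∀ i, ∀ r ∈ inv χ f, φ (r * g ^ i * x ^ m) = 0), ∀ r ∈ inv χ f,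
    rc φ (r * g ^ i * x ^ j) =
      rc (φ ∘ₗ LinearMap.mulRight k (x ^ j) ∘ₗ LinearMap.mulRight k (g ^ i)) r * g ^ (i + j) := by
  intro j
  induction j with
  | zero =>
    intro i φ _ r _
    rw [pow_zero, mul_one, (h.gl.pow i).rc_mul', add_zero]
    congr 2
    ext; simp
  | succ j ih =>
    intro i φ hφ r hr
    rw [pow_succ, ← mul_assoc, rc_mul_skew h.comul_x,
      ih i φ (fun m hm => hφ m (by omega)) r hr,
      rc_eq_zero_of_isLC h.isLC_inv (fun s hs => by simpa using hφ j (by omega) i s hs) hr,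
      zero_mul, zero_mul, zero_add,
      ih i _ (fun m hm i' r' hr' => by
        have := hφ (m + 1) (by omega) i' r' hr'
        rw [pow_succ, ← mul_assoc] at this
        simpa using this) r hr, mul_assoc, ← pow_succ, add_assoc]
    congr 2
    simp [LinearMap.mulRight_mul, LinearMap.comp_assoc]

theorem g_pow_eq_one_of_mem_inv {m : ℕ} (hm : g ^ m ∈ inv χ f) : g ^ m = 1 := by
  have h1 : rc χ.toLinearMap (g ^ m) = g ^ m := hm.2
  rw [h.G_g_pow] at h1
  have h2 := congrArg (Coalgebra.counit (R := k)) h1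
  rw [map_smul, (h.gl.pow m).2, smul_eq_mul, mul_one, h.prim.pow_eq_one_iff_dvd] at h2
  obtain ⟨c, rfl⟩ := h2
  rw [pow_mul, h.g_pow, one_pow]

/-- The coinvariants carry a normalised nondegenerate integral whose dual integral has nonzero
counit. -/
theorem exists_inv_integral [CharZero k] [IsAlgClosed k] (hodd : Odd p) (hxp : x ^ p = 0)
    {y : H} (hy : y ∈ inv χ f) (hSy : antipode k (antipode k y) = y)
    (hli : LinearIndependent k ![1, y]) :
    ∃ (ℓ : H →ₗ[k] k) (Λ : H), ℓ 1 = 1 ∧ (∀ r ∈ inv χ f, rc ℓ r = ℓ r • 1) ∧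
      (∀ s ∈ inv χ f, (∀ r ∈ inv χ f, ℓ (r * s) = 0) → s = 0) ∧
      Λ ∈ inv χ f ∧ (∀ r ∈ inv χ f, r * Λ = Coalgebra.counit (R := k) r • Λ) ∧
      (∀ r ∈ inv χ f, ℓ (r * Λ) = Coalgebra.counit (R := k) r) ∧
      Coalgebra.counit (R := k) Λ ≠ 0 := by
  have hfd := h.finiteDimensional
  obtain ⟨lam, hlam0, hlam⟩ := exists_isLeftInt k H
  have hex : ∃ j, ∃ i, ∃ r ∈ inv χ f, lam (r * g ^ i * x ^ j) ≠ 0 := by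
    by_contra! hall
    have : LinearMap.ker lam = ⊤ := h.top_of_right fun i j r hr => hall j i r hr
    exact hlam0 (LinearMap.ker_eq_top.1 this)
  classical
  have hmin : ∀ m < Nat.find hex, ∀ i, ∀ r ∈ inv χ f, lam (r * g ^ i * x ^ m) = 0 := by
    intro m hm i r hr
    by_contra hne
    exact Nat.find_min hex hm ⟨i, r, hr, hne⟩
  obtain ⟨i, r₀, hr₀, hne⟩ := Nat.find_spec hex
  set j := Nat.find hex
  set ℓ : H →ₗ[k] k := lam ∘ₗ LinearMap.mulRight k (x ^ j) ∘ₗ LinearMap.mulRight k (g ^ i) with hℓ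
  have hℓr : ∀ r, ℓ r = lam (r * g ^ i * x ^ j) := fun r => by simp [hℓ]
  set a := g ^ ((p - 1) * (i + j)) with ha_def
  have ha : IsGL k a := h.gl.pow _
  have hl : ∀ r ∈ inv χ f, rc ℓ r = ℓ r • a := by
    intro r hr
    have h1 := h.rc_mul_monomial j i lam hmin r hr
    rw [hlam, ← hℓr] at h1
    have h2 := congrArg (· * g ^ ((p - 1) * (i + j))) h1
    simp only [mul_assoc, h.g_pow_mul_g_pow, mul_one, smul_mul_assoc, one_mul] at h2
    exact h2.symm
  have hmul : ∀ r ∈ inv χ f, ∀ s ∈ inv χ f, r * s ∈ inv χ f := fun r hr s hs => h.mul_mem_inv hr hs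
  have hnd : ∀ s ∈ inv χ f, (∀ r ∈ inv χ f, ℓ (r * s) = 0) → s = 0 := by
    let N : Submodule k H :=
      { carrier := {s | s ∈ inv χ f ∧ ∀ r ∈ inv χ f, ℓ (r * s) = 0}
        zero_mem' := ⟨zero_mem _, by simp⟩
        add_mem' := fun {s t} hs ht => ⟨add_mem hs.1 ht.1, fun r hr => by
          rw [mul_add, map_add, hs.2 r hr, ht.2 r hr, add_zero]⟩
        smul_mem' := fun c s hs => ⟨Submodule.smul_mem _ _ hs.1, fun r hr => by
          rw [mul_smul_comm, map_smul, hs.2 r hr, smul_zero]⟩ }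
    have hNR : N ≤ inv χ f := fun s hs => hs.1
    have hNmul : ∀ r ∈ inv χ f, ∀ n ∈ N, r * n ∈ N := fun r hr n hn =>
      ⟨h.mul_mem_inv hr hn.1, fun s hs => by
        rw [← mul_assoc]; exact hn.2 _ (h.mul_mem_inv hs hr)⟩
    have hNlc : IsLC N := fun φ s hs =>
      ⟨h.isLC_inv φ s hs.1, apply_mul_lc_eq_zero hmul h.isLC_inv hl hs.1 hs.2 φ⟩
    have hNbot : N = ⊥ := by
      by_contra hN0
      have h1 := one_mem_of_isLC (isLC_span_mul hNlc) (by
        intro hb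
        refine hN0 (eq_bot_iff.2 fun n hn => ?_)
        rw [← hb]
        exact Submodule.subset_span ⟨1, n, hn, (one_mul n).symm⟩) (by
        intro b v hv
        induction hv using Submodule.span_induction with
        | zero => simp
        | add v w _ _ hv hw => rw [mul_add]; exact add_mem hv hw
        | smul c v _ hv => rw [mul_smul_comm]; exact Submodule.smul_mem _ _ hv
        | mem v hv =>
          obtain ⟨a, n, hn, rfl⟩ := hv
          exact Submodule.subset_span ⟨b * a, n, hn, by rw [mul_assoc]⟩)
      have h2 := h.eq_inv_of_one_mem hxp hNR hNmul rfl h1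
      have h3 : (1 : H) ∈ N := by rw [h2]; exact h.one_mem_inv
      exact hne (by rw [← hℓr, ← mul_one r₀]; exact h3.2 r₀ hr₀)
    intro s hs h0
    have : s ∈ N := ⟨hs, h0⟩
    rw [hNbot] at this
    exact this
  obtain ⟨Λ, hΛ, hΛ1, hΛ2, hΛ3, hΛ4⟩ := exists_integral_trace h.one_mem_inv hmul h.isLC_inv
    (fun r hr => h.antipode_sq_mem_inv hr) ha hl hnd
  let θ : inv χ f →ₗ[k] inv χ f :=
    (antipode k ∘ₗ antipode k).restrict fun r hr => h.antipode_sq_mem_inv hr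
  have hθ : ∀ r, (θ r : H) = antipode k (antipode k (r : H)) := fun _ => rfl
  obtain ⟨t, ht⟩ := exists_antipode_pow_eq_one h.prime h.finrank_eq
  have hθpow : ∀ m (r : inv χ f), ((θ ^ m) r : H) = ((antipode k (A := H)) ^ (2 * m)) (r : H) := by
    intro m
    induction m with
    | zero => simp
    | succ m ih =>
      intro r
      rw [pow_succ', Module.End.mul_apply, hθ, ih, show 2 * (m + 1) = (2 * m + 1) + 1 by ring,
        pow_succ', pow_succ']
      rfl
  have htr : LinearMap.trace k (inv χ f) θ ≠ 0 := by
    refine trace_ne_zero_of_pow_eq_one (t := t) h.prime hodd (h.finrank_inv hxp)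
      (x := ⟨1, h.one_mem_inv⟩) (y := ⟨y, hy⟩) ?_ (Subtype.ext (by rw [hθ]; simp))
      (Subtype.ext (by rw [hθ]; exact hSy)) ?_
    · ext r
      rw [hθpow, ← mul_assoc, show 2 * 2 = 4 from rfl, ht]
      simp
    · refine LinearIndependent.of_comp (inv χ f).subtype ?_
      convert hli using 1
      ext i
      fin_cases i <;> rfl
  rw [hΛ4 1 θ (by simp [hθ]), one_mul] at htr
  have hε : Coalgebra.counit (R := k) Λ ≠ 0 := left_ne_zero_of_mul htr
  have ha1 : a = 1 := h.g_pow_eq_one_of_mem_inv (hΛ3 hε)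
  rw [ha1] at htr
  have hℓ1 : ℓ 1 ≠ 0 := right_ne_zero_of_mul htr
  refine ⟨(ℓ 1)⁻¹ • ℓ, ℓ 1 • Λ, by simp [hℓ1], ?_, ?_, Submodule.smul_mem _ _ hΛ, ?_, ?_, ?_⟩
  · intro r hr
    rw [rc_smul, hl r hr, ha1, LinearMap.smul_apply, smul_assoc]
  · intro s hs h0
    refine hnd s hs fun r hr => ?_
    have := h0 r hr
    rw [LinearMap.smul_apply, smul_eq_mul] at this
    exact (mul_eq_zero.1 this).resolve_left (inv_ne_zero hℓ1)
  · intro r hr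
    rw [mul_smul_comm, hΛ1 r hr, smul_comm]
  · intro r hr
    rw [mul_smul_comm, map_smul, LinearMap.smul_apply, hΛ2 r hr]
    simp [hℓ1]
  · rw [map_smul, smul_eq_mul]
    exact mul_ne_zero hℓ1 hε

end TaftPair

end HopfFour

namespace HopfFour

section DualAlgebra

variable {k : Type*} [Field k] {C : Type*} [AddCommGroup C] [Module k C] [Coalgebra k C]

/-- The algebra of operators `v ↦ v₁ φ(v₂)` on a right coideal `D`; it is the dual algebra of `D`
when `D` is a subcoalgebra. -/
noncomputable def dualAlg {D : Submodule k C} (hr : IsRC (k := k) D) : Subalgebra k (Module.End k D) where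
  carrier := {a | ∃ φ : C →ₗ[k] k, a = (rc φ).restrict (hr φ)}
  mul_mem' := by
    rintro _ _ ⟨φ, rfl⟩ ⟨ψ, rfl⟩
    exact ⟨conv φ ψ, LinearMap.ext fun v => Subtype.ext (rc_rc φ ψ v)⟩
  one_mem' := ⟨Coalgebra.counit, LinearMap.ext fun v => Subtype.ext (by simp)⟩
  add_mem' := by
    rintro _ _ ⟨φ, rfl⟩ ⟨ψ, rfl⟩
    exact ⟨φ + ψ, LinearMap.ext fun v => Subtype.ext (rc_add φ ψ v).symm⟩
  zero_mem' := ⟨0, LinearMap.ext fun v => Subtype.ext (by simp)⟩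
  algebraMap_mem' c := ⟨c • Coalgebra.counit, LinearMap.ext fun v => Subtype.ext (by
    simp [rc_smul, Algebra.algebraMap_eq_smul_one])⟩

variable {D : Submodule k C} (hr : IsRC (k := k) D)

/-- The projection from the full dual onto the dual algebra of a right coideal. -/
noncomputable def toDualAlg : (C →ₗ[k] k) →ₗ[k] dualAlg hr where
  toFun φ := ⟨(rc φ).restrict (hr φ), φ, rfl⟩
  map_add' φ ψ := Subtype.ext (LinearMap.ext fun v => Subtype.ext (rc_add φ ψ v))
  map_smul' c φ := Subtype.ext (LinearMap.ext fun v => Subtype.ext (rc_smul c φ v))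

theorem toDualAlg_apply (φ : C →ₗ[k] k) (v : D) :
    (((toDualAlg hr φ : dualAlg hr) : Module.End k D) v : C) = rc φ v := rfl

theorem toDualAlg_surjective : Function.Surjective (toDualAlg hr) := by
  rintro ⟨_, φ, rfl⟩
  exact ⟨φ, rfl⟩

theorem toDualAlg_conv (φ ψ : C →ₗ[k] k) :
    toDualAlg hr (conv φ ψ) = toDualAlg hr φ * toDualAlg hr ψ :=
  Subtype.ext (LinearMap.ext fun v => Subtype.ext (rc_rc φ ψ v).symm)

theorem toDualAlg_counit : toDualAlg hr (Coalgebra.counit : C →ₗ[k] k) = 1 :=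
  Subtype.ext (LinearMap.ext fun v => Subtype.ext (by
    rw [toDualAlg_apply]; simp))

theorem toDualAlg_eq_zero_iff (hl : IsLC (k := k) D) (φ : C →ₗ[k] k) :
    toDualAlg hr φ = 0 ↔ ∀ v ∈ D, φ v = 0 := by
  constructor
  · intro h v hv
    have h1 : rc φ v = 0 := by
      rw [← toDualAlg_apply hr φ ⟨v, hv⟩, h]; rfl
    have := congr_arg (Coalgebra.counit (R := k)) h1
    simpa using this
  · intro h
    refine Subtype.ext (LinearMap.ext fun v => Subtype.ext ?_)
    rw [toDualAlg_apply]
    refine eq_of_forall_dual (k := k) fun ψ => ?_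
    rw [apply_rc, h _ (hl ψ _ v.2)]
    simp

theorem exists_corep_of_algHom [FiniteDimensional k C] (hl : IsLC (k := k) D) {ι : Type*} [Fintype ι]
    [DecidableEq ι] (Φ : dualAlg hr →ₐ[k] Matrix ι ι k) :
    ∃ e : Matrix ι ι C, IsCorep k e ∧ (∀ i j, e i j ∈ D) ∧
      ∀ φ i j, φ (e i j) = Φ (toDualAlg hr φ) i j := by
  let e : Matrix ι ι C := Matrix.of fun i j => (Module.evalEquiv k C).symm
    ((LinearMap.proj j ∘ₗ LinearMap.proj (φ := fun _ : ι => ι → k) i) ∘ₗ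
      (Φ.toLinearMap : _ →ₗ[k] (ι → ι → k)) ∘ₗ toDualAlg hr)
  have he : ∀ (φ : C →ₗ[k] k) i j, φ (e i j) = Φ (toDualAlg hr φ) i j := by
    intro φ i j
    exact Module.apply_evalEquiv_symm_apply k C φ _
  refine ⟨e, ⟨fun i j => ?_, fun i j => ?_⟩, fun i j => ?_, he⟩
  · rw [comul_eq_iff_lc]
    intro φ
    refine eq_of_forall_dual (k := k) fun ψ => ?_
    rw [← apply_rc, ← conv_apply, he, toDualAlg_conv, _root_.map_mul, Matrix.mul_apply, map_sum]
    exact Finset.sum_congr rfl fun l _ => by rw [map_smul, smul_eq_mul, he, he]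
  · rw [he, toDualAlg_counit, map_one, Matrix.one_apply]
  · by_contra hc
    obtain ⟨φ, h1, h2⟩ := Submodule.exists_le_ker_of_notMem hc
    refine h1 ?_
    rw [he, (toDualAlg_eq_zero_iff hr hl φ).2 fun v hv => h2 hv]
    simp

theorem isSimpleRing_dualAlg [FiniteDimensional k C] (hl : IsLC (k := k) D) (h0 : D ≠ ⊥)
    (hsimp : ∀ E : Submodule k C, IsLC E → IsRC E → E ≤ D → E ≠ ⊥ → E = D) :
    IsSimpleRing (dualAlg hr) := by
  have : Nontrivial D := (Submodule.nontrivial_iff_ne_bot).2 h0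
  refine IsSimpleRing.of_eq_bot_or_eq_top fun I => ?_
  let W : Submodule k (Module.Dual k C) :=
    { carrier := {φ | toDualAlg hr φ ∈ I}
      add_mem' := fun {a b} ha hb => by
        rw [Set.mem_ofPred_eq] at *
        rw [map_add]; exact I.add_mem ha hb
      zero_mem' := by
        rw [Set.mem_ofPred_eq, map_zero]; exact I.zero_mem
      smul_mem' := fun c x hx => by
        rw [Set.mem_ofPred_eq] at *
        rw [map_smul, ← one_mul (toDualAlg hr x), ← smul_mul_assoc]
        exact I.mul_mem_left _ _ hx }
  have hW : ∀ φ, φ ∈ W ↔ toDualAlg hr φ ∈ I := fun φ => Iff.rfl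
  have hmem : ∀ v, v ∈ W.dualCoannihilator ↔ ∀ φ, toDualAlg hr φ ∈ I → φ v = 0 := fun v =>
    Submodule.mem_dualCoannihilator v
  have hle : W.dualCoannihilator ≤ D := by
    intro v hv
    by_contra hc
    obtain ⟨φ, h1, h2⟩ := Submodule.exists_le_ker_of_notMem hc
    refine h1 ((hmem v).1 hv φ ?_)
    rw [(toDualAlg_eq_zero_iff hr hl φ).2 fun v hv => h2 hv]
    exact I.zero_mem
  by_cases hb : W.dualCoannihilator = ⊥
  · right
    have h2 : W = ⊤ := by
      rw [← Subspace.dualCoannihilator_dualAnnihilator_eq (W := W), hb,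
        Submodule.dualAnnihilator_bot]
    rw [← TwoSidedIdeal.one_mem_iff, ← toDualAlg_counit hr, ← hW, h2]
    trivial
  · left
    have hE := hsimp _ (fun ψ v hv => (hmem _).2 fun φ hφ => ?_)
      (fun ψ v hv => (hmem _).2 fun φ hφ => ?_) hle hb
    · refine le_bot_iff.1 fun x hx => ?_
      obtain ⟨φ, rfl⟩ := toDualAlg_surjective hr x
      rw [TwoSidedIdeal.mem_bot, toDualAlg_eq_zero_iff hr hl]
      intro v hv
      rw [← hE] at hv
      exact (hmem v).1 hv φ hx
    · rw [← apply_rc, ← conv_apply]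
      refine (hmem v).1 hv _ ?_
      rw [toDualAlg_conv]
      exact I.mul_mem_left _ _ hφ
    · rw [← conv_apply]
      refine (hmem v).1 hv _ ?_
      rw [toDualAlg_conv]
      exact I.mul_mem_right _ _ hφ

theorem exists_corep_of_algEquiv [FiniteDimensional k C] (hl : IsLC (k := k) D) {ι : Type*}
    [Fintype ι] [DecidableEq ι] (Φ : dualAlg hr ≃ₐ[k] Matrix ι ι k) :
    ∃ e : Matrix ι ι C, IsCorep k e ∧ (∀ φ i j, φ (e i j) = Φ (toDualAlg hr φ) i j) ∧
      LinearIndependent k (fun i : ι × ι => e i.1 i.2) ∧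
      Submodule.span k (Set.range fun i : ι × ι => e i.1 i.2) = D := by
  obtain ⟨e, h1, h2, h3⟩ := exists_corep_of_algHom hr hl Φ.toAlgHom
  refine ⟨e, h1, h3, ?_, ?_⟩
  · rw [Fintype.linearIndependent_iff]
    rintro c hc ⟨i, j⟩
    obtain ⟨φ, hφ⟩ := toDualAlg_surjective hr (Φ.symm (Matrix.single i j 1))
    have h4 : ∀ a b, φ (e a b) = (Matrix.single i j (1 : k)) a b := by
      intro a b
      rw [h3, hφ]
      simp
    have h5 := congr_arg φ hc
    rw [map_sum, map_zero, Finset.sum_eq_single (i, j)] at h5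
    · simpa [h4] using h5
    · rintro ⟨a, b⟩ - hab
      rw [map_smul, h4, Matrix.single_apply_of_ne, smul_zero]
      rintro ⟨rfl, rfl⟩
      exact hab rfl
    · simp
  · refine le_antisymm (Submodule.span_le.2 ?_) fun v hv => ?_
    · rintro _ ⟨i, rfl⟩
      exact h2 _ _
    · by_contra hc
      obtain ⟨φ, h4, h5⟩ := Submodule.exists_le_ker_of_notMem hc
      refine h4 ((toDualAlg_eq_zero_iff hr hl φ).1 ?_ v hv)
      apply Φ.injective
      rw [map_zero]
      ext a b
      have := h3 φ a b
      rw [← AlgEquiv.coe_toAlgHom] 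
      exact this.symm.trans (h5 (Submodule.subset_span ⟨(a, b), rfl⟩))

end DualAlgebra

end HopfFour

namespace HopfFour

section LinAlg

variable {k : Type*} [Field k]

theorem exists_triangular_basis [IsAlgClosed k] [CharZero k] {V : Type*} [AddCommGroup V] [Module k V]
    (hV : Module.finrank k V = 2) {c F : Module.End k V} {p : ℕ} (hp : 0 < p) (hc : c ^ p = 1)
    {a : k} (ha : a ≠ 1) (hcF : c * F = a • (F * c)) (hF : F ^ p = 0) :
    ∃ (b : Module.Basis (Fin 2) k V) (c₀ c₁ β : k), c (b 0) = c₀ • b 0 ∧ c (b 1) = c₁ • b 1 ∧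
      F (b 0) = 0 ∧ F (b 1) = β • b 0 ∧ c₀ ^ p = 1 ∧ c₁ ^ p = 1 := by
  have hfd : FiniteDimensional k V := Module.finite_of_finrank_pos (by omega)
  have hnt : Nontrivial V := Module.nontrivial_of_finrank_pos (R := k) (by omega)
  have hss : c.IsSemisimple := by
    refine Module.End.isSemisimple_of_squarefree_aeval_eq_zero
      (p := (Polynomial.X ^ p - Polynomial.C (1 : k))) ?_ (by simp [hc])
    refine (Polynomial.separable_X_pow_sub_C (1 : k) ?_ one_ne_zero).squarefree
    exact_mod_cast hp.ne'
  have heig : ∀ {v : V} {μ : k}, v ≠ 0 → c v = μ • v → μ ^ p = 1 := by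
    intro v μ hv h
    have h1 : ∀ n : ℕ, (c ^ n) v = μ ^ n • v := by
      intro n
      induction n with
      | zero => simp
      | succ n ih => rw [pow_succ', Module.End.mul_apply, ih, map_smul, h, smul_smul, pow_succ]
    have h2 := h1 p
    rw [hc, Module.End.one_apply] at h2
    have h3 : (μ ^ p - 1) • v = 0 := by rw [sub_smul, ← h2, one_smul, sub_self]
    exact sub_eq_zero.1 ((smul_eq_zero.1 h3).resolve_right hv)
  have hker : LinearMap.ker F ≠ ⊥ := by
    intro h
    have h1 : Function.Injective ((F ^ p : Module.End k V)) := by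
      rw [Module.End.coe_pow]
      exact Function.Injective.iterate (LinearMap.ker_eq_bot.1 h) _
    obtain ⟨v, hv⟩ := exists_ne (0 : V)
    exact hv (h1 (by rw [hF]; simp))
  have hinv : ∀ v ∈ LinearMap.ker F, c v ∈ LinearMap.ker F := by
    intro v hv
    have h1 : c (F v) = a • F (c v) := congr_arg (fun T : Module.End k V => T v) hcF
    rw [LinearMap.mem_ker] at hv ⊢
    rw [hv, map_zero] at h1
    rcases smul_eq_zero.1 h1.symm with h2 | h2
    · have h3 : F = 0 := by
        have h4 : c ^ p * F = 0 := by
          rw [← Nat.sub_add_cancel hp, pow_succ, mul_assoc, hcF, h2]; simp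
        rwa [hc, one_mul] at h4
      simp [h3]
    · exact h2
  have hnt' : Nontrivial (LinearMap.ker F) := Submodule.nontrivial_iff_ne_bot.2 hker
  obtain ⟨c₀, hc₀⟩ := Module.End.exists_eigenvalue (c.restrict hinv)
  obtain ⟨⟨v₀, hv₀F⟩, hv₀⟩ := hc₀.exists_hasEigenvector
  have hcv₀ : c v₀ = c₀ • v₀ := congr_arg Subtype.val hv₀.apply_eq_smul
  have hv₀0 : v₀ ≠ 0 := fun h => hv₀.2 (Subtype.ext h)
  rw [Module.End.isSemisimple_iff] at hss
  obtain ⟨W, hW, hcompl⟩ := hss (k ∙ v₀) (by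
    rw [Module.End.mem_invtSubmodule]
    intro w hw
    obtain ⟨t, rfl⟩ := Submodule.mem_span_singleton.1 hw
    rw [Submodule.mem_comap, map_smul, hcv₀]
    exact Submodule.smul_mem _ _ (Submodule.smul_mem _ _ (Submodule.mem_span_singleton_self _)))
  have hWd : Module.finrank k W = 1 := by
    have := Submodule.finrank_add_eq_of_isCompl hcompl
    rw [finrank_span_singleton hv₀0] at this
    omega
  obtain ⟨⟨v₁, hv₁W⟩, hv₁0, hv₁⟩ := finrank_eq_one_iff'.1 hWd
  obtain ⟨c₁, hc₁⟩ := hv₁ ⟨c v₁, hW hv₁W⟩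
  have hcv₁ : c v₁ = c₁ • v₁ := (congr_arg Subtype.val hc₁).symm
  have hv₁0' : v₁ ≠ 0 := fun h => hv₁0 (Subtype.ext h)
  have hli : LinearIndependent k ![v₀, v₁] := by
    rw [LinearIndependent.pair_iff' hv₀0]
    rintro t rfl
    exact hv₁0' (Submodule.disjoint_def.1 hcompl.disjoint _
      (Submodule.smul_mem _ _ (Submodule.mem_span_singleton_self _)) hv₁W)
  let b := basisOfLinearIndependentOfCardEqFinrank hli (by simp [hV])
  have hb0 : b 0 = v₀ := by simp [b]
  have hb1 : b 1 = v₁ := by simp [b]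
  have hsum : F v₁ = b.repr (F v₁) 0 • v₀ + b.repr (F v₁) 1 • v₁ := by
    conv_lhs => rw [← b.sum_repr (F v₁)]
    rw [Fin.sum_univ_two, hb0, hb1]
  have h1 : c (F v₁) = a • F (c v₁) := congr_arg (fun T : Module.End k V => T v₁) hcF
  have hγ : b.repr (F v₁) 1 = 0 := by
    have h2 := congr_arg (fun z => b.repr z 1) h1
    have e0 : b.repr v₀ 1 = 0 := by rw [← hb0]; simp
    have e1 : b.repr v₁ 1 = 1 := by rw [← hb1]; simp
    simp only [hcv₁, map_smul, Finsupp.smul_apply, smul_eq_mul] at h2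
    rw [hsum] at h2
    simp only [map_add, map_smul, hcv₀, hcv₁, Finsupp.add_apply, Finsupp.smul_apply, smul_eq_mul,
      e0, e1] at h2
    have hc₁0 : c₁ ≠ 0 := by
      rintro rfl
      have := heig hv₁0' hcv₁
      rw [zero_pow hp.ne'] at this
      exact zero_ne_one this
    have h3 : (1 - a) * (c₁ * b.repr (F v₁) 1) = 0 := by linear_combination h2
    rcases mul_eq_zero.1 h3 with h4 | h4
    · exact absurd (sub_eq_zero.1 h4).symm ha
    · exact (mul_eq_zero.1 h4).resolve_left hc₁0
  refine ⟨b, c₀, c₁, b.repr (F v₁) 0, ?_, ?_, ?_, ?_, heig hv₀0 hcv₀, heig hv₁0' hcv₁⟩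
  · rw [hb0, hcv₀]
  · rw [hb1, hcv₁]
  · rw [hb0]; exact hv₀F
  · rw [hb0, hb1]; conv_lhs => rw [hsum, hγ, zero_smul, add_zero]

end LinAlg

section SimpleCoalgebra

variable {k : Type*} [Field k] {C : Type*} [AddCommGroup C] [Module k C] [Coalgebra k C]

theorem toDualAlg_pow {D : Submodule k C}
    (hr : IsRC (k := k) D) (φ : C →ₗ[k] k) (n : ℕ) (v : D) :
    ((((toDualAlg hr φ) ^ n : dualAlg hr) : Module.End k D) v : C) = (rc φ ^ n) v := by
  induction n with
  | zero => simp
  | succ n ih =>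
    rw [pow_succ', pow_succ', Module.End.mul_apply, ← ih]
    rfl

theorem exists_corep_of_isSimple [IsAlgClosed k] [CharZero k] [FiniteDimensional k C] {p : ℕ}
    {q : k} {χ f : C →ₗ[k] k} (hp : 0 < p) (hq : q ≠ 1) (hχ : rc χ ^ p = 1) (hf : rc f ^ p = 0)
    (hχf : conv χ f = q • conv f χ) {D : Submodule k C}
    (hD : HopfClass.IsSimpleSubcoalgWrt k (HopfClass.comulL k C) D)
    (hD4 : Module.finrank k D = 4) :
    ∃ (e : Matrix (Fin 2) (Fin 2) C) (c₀ c₁ β : k), IsCorep k e ∧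
      LinearIndependent k (fun i : Fin 2 × Fin 2 => e i.1 i.2) ∧
      c₀ ^ p = 1 ∧ c₁ ^ p = 1 ∧
      (∀ i j, χ (e i j) = Matrix.of ![![c₀, 0], ![0, c₁]] i j) ∧
      (∀ i j, f (e i j) = Matrix.of ![![0, β], ![0, 0]] i j) := by
  have hl : IsLC D := isLC_of_isSubcoalg hD.1
  have hr : IsRC D := isRC_of_isSubcoalg hD.1
  have := isSimpleRing_dualAlg hr hl hD.2.1 fun E h1 h2 h3 h4 => eq_of_isSimple hD h1 h2 h3 h4
  obtain ⟨n, _, ⟨Φ⟩⟩ := IsSimpleRing.exists_algEquiv_matrix_of_isAlgClosed k (dualAlg hr)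
  have hn : n = 2 := by
    obtain ⟨e, -, -, h3, h4⟩ := exists_corep_of_algEquiv hr hl Φ
    have h5 := finrank_span_eq_card h3
    rw [h4, hD4, Fintype.card_prod, Fintype.card_fin] at h5
    nlinarith
  subst hn
  let Ψ : dualAlg hr ≃ₐ[k] Module.End k (Fin 2 → k) := Φ.trans Matrix.toLinAlgEquiv'
  have hc : (toDualAlg hr χ) ^ p = 1 := by
    refine Subtype.ext (LinearMap.ext fun v => Subtype.ext ?_)
    rw [toDualAlg_pow, hχ]
    rfl
  have hF : (toDualAlg hr f) ^ p = 0 := by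
    refine Subtype.ext (LinearMap.ext fun v => Subtype.ext ?_)
    rw [toDualAlg_pow, hf]
    rfl
  have hcF : toDualAlg hr χ * toDualAlg hr f =
      q • (toDualAlg hr f * toDualAlg hr χ) := by
    rw [← toDualAlg_conv, ← toDualAlg_conv, hχf, map_smul]
  obtain ⟨b, c₀, c₁, β, h1, h2, h3, h4, h5, h6⟩ := exists_triangular_basis (k := k)
    (V := Fin 2 → k) (by simp) (c := Ψ (toDualAlg hr χ)) (F := Ψ (toDualAlg hr f))
    hp (by rw [← map_pow, hc, map_one]) hq
    (by rw [← _root_.map_mul, hcF, map_smul, _root_.map_mul]) (by rw [← map_pow, hF, map_zero])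
  obtain ⟨e, h7, h8, h9, -⟩ := exists_corep_of_algEquiv hr hl
    (Ψ.trans (LinearMap.toMatrixAlgEquiv b))
  refine ⟨e, c₀, c₁, β, h7, h9, h5, h6, fun i j => ?_, fun i j => ?_⟩
  · have := h8 χ i j
    rw [AlgEquiv.trans_apply, LinearMap.toMatrixAlgEquiv_apply] at this
    refine this.trans ?_
    fin_cases i <;> fin_cases j <;> simp [h1, h2]
  · have := h8 f i j
    rw [AlgEquiv.trans_apply, LinearMap.toMatrixAlgEquiv_apply] at this
    refine this.trans ?_
    fin_cases i <;> fin_cases j <;> simp [h3, h4]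

end SimpleCoalgebra

section NormalForm

variable {k : Type*} [Field k] {H : Type*} [Ring H] [HopfAlgebra k H]
variable {p : ℕ} {q : k} {g x : H} {χ : H →ₐ[k] k} {f : H →ₗ[k] k}

/-- A simple `2 × 2` matrix coalgebra on which the character `χ` and the skew derivation `f` are
in normal form. -/
structure TaftCorep (χ : H →ₐ[k] k) (f : H →ₗ[k] k) (ζ β : k) (e : Matrix (Fin 2) (Fin 2) H) :
    Prop where
  corep : IsCorep k e
  linearIndependent : LinearIndependent k (fun i : Fin 2 × Fin 2 => e i.1 i.2)
  χ_00 : χ (e 0 0) = 1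
  χ_01 : χ (e 0 1) = 0
  χ_10 : χ (e 1 0) = 0
  χ_11 : χ (e 1 1) = ζ
  f_00 : f (e 0 0) = 0
  f_01 : f (e 0 1) = β
  f_10 : f (e 1 0) = 0
  f_11 : f (e 1 1) = 0

open HopfAlgebra (antipode)

theorem exists_dual_vanishing {e : Matrix (Fin 2) (Fin 2) H} (he : IsCorep k e)
    (hli : LinearIndependent k (fun i : Fin 2 × Fin 2 => e i.1 i.2)) :
    ∃ φ : H →ₗ[k] k, φ 1 = 1 ∧ ∀ a b, φ (e a b) = 0 := by
  have hnot : (1 : H) ∉ Submodule.span k (Set.range fun i : Fin 2 × Fin 2 => e i.1 i.2) := by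
    intro hmem
    obtain ⟨d, hd⟩ := exists_dual_family hli
    obtain ⟨c, hc⟩ := (Submodule.mem_span_range_iff_exists_fun k).1 hmem
    have hc0 : ∃ i, c i ≠ 0 := by
      by_contra! hall
      have h1 := congr_arg (Coalgebra.counit (R := k)) hc
      simp [hall] at h1
    have hde : ∀ a b i j, d (a, b) (e i j) = if a = i ∧ b = j then 1 else 0 := by
      intro a b i j
      simpa using hd (a, b) (i, j)
    have hd' : ∀ i, d i 1 = c i := by
      intro i
      rw [← hc, map_sum, Finset.sum_eq_single i]
      · simp [hd]
      · intro j _ hj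
        simp [hd, hj.symm]
      · simp
    have key : ∀ a b i j, c (a, b) * c (i, j) = if i = b then c (a, j) else 0 := by
      intro a b i j
      have h2 : d (i, j) (lc (d (a, b)) 1) = c (a, b) * c (i, j) := by
        rw [lc_one, map_smul, hd', hd', smul_eq_mul]
      rw [← h2]
      conv_lhs => rw [← hc]
      rw [map_sum, map_sum, Fintype.sum_prod_type]
      simp only [map_smul, he.lc, map_sum, hde, smul_eq_mul]
      fin_cases a <;> fin_cases b <;> fin_cases i <;> fin_cases j <;> simp [Fin.sum_univ_two]
    obtain ⟨⟨a, j⟩, haj⟩ := hc0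
    have h3 := key a (1 - a) (1 - a) j
    rw [if_pos rfl] at h3
    have h4 := key a (1 - a) a j
    have hne : a ≠ 1 - a := by fin_cases a <;> decide
    rw [if_neg hne, mul_eq_zero] at h4
    rcases h4 with h4 | h4
    · rw [h4, zero_mul] at h3
      exact haj h3.symm
    · exact haj h4
  obtain ⟨φ, h1, h2⟩ := Submodule.exists_le_ker_of_notMem hnot
  refine ⟨(φ 1)⁻¹ • φ, by simp [h1], fun a b => ?_⟩
  have : φ (e a b) = 0 := h2 (Submodule.subset_span ⟨(a, b), rfl⟩)
  simp [this]

theorem exists_dual_vanishing_of_forall {ι : Type*} [Fintype ι] [DecidableEq ι]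
    {u : ℕ → Matrix ι ι H} (hu : ∀ i, IsCorep k (u i))
    (h1 : ∀ i, ∃ φ : H →ₗ[k] k, φ 1 = 1 ∧ ∀ a b, φ (u i a b) = 0) (m : ℕ) :
    ∃ φ : H →ₗ[k] k, φ 1 = 1 ∧ ∀ i < m, ∀ a b, φ (u i a b) = 0 := by
  induction m with
  | zero =>
    obtain ⟨φ, h, -⟩ := h1 0
    exact ⟨φ, h, by simp⟩
  | succ m ih =>
    obtain ⟨φ, h2, h3⟩ := ih
    obtain ⟨ψ, h4, h5⟩ := h1 m
    refine ⟨conv φ ψ, by simp [conv_apply, rc_one, h2, h4], fun i hi a b => ?_⟩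
    rw [conv_apply, (hu i).rc, map_sum]
    refine Finset.sum_eq_zero fun l _ => ?_
    rcases Nat.lt_succ_iff_lt_or_eq.1 hi with hi | rfl
    · simp [h3 i hi]
    · simp [h5]

namespace TaftCorep

variable {ζ β : k} {e : Matrix (Fin 2) (Fin 2) H}

theorem mem_inv (he : TaftCorep χ f ζ β e) (i : Fin 2) : e i 0 ∈ inv χ f := by
  constructor
  · rw [he.corep.rc, Fin.sum_univ_two, he.f_00, he.f_10]; simp
  · rw [he.corep.rc, Fin.sum_univ_two]
    simp only [AlgHom.toLinearMap_apply, he.χ_00, he.χ_10]; simp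

end TaftCorep

namespace TaftPair

theorem exists_integral [IsAlgClosed k] [CharZero k] (h : TaftPair p q g x χ f) (hodd : Odd p)
    (hxp : x ^ p = 0) {ζ β : k} {e : Matrix (Fin 2) (Fin 2) H} (he : TaftCorep χ f ζ β e) :
    ∃ (ℓ : H →ₗ[k] k) (Λ : H), ℓ 1 = 1 ∧ (∀ r ∈ inv χ f, rc ℓ r = ℓ r • 1) ∧
      (∀ s ∈ inv χ f, (∀ r ∈ inv χ f, ℓ (r * s) = 0) → s = 0) ∧
      Λ ∈ inv χ f ∧ (∀ r ∈ inv χ f, r * Λ = Coalgebra.counit (R := k) r • Λ) ∧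
      (∀ r ∈ inv χ f, ℓ (r * Λ) = Coalgebra.counit (R := k) r) ∧
      Coalgebra.counit (R := k) Λ ≠ 0 := by
  have hfd := h.finiteDimensional
  obtain ⟨s, hs⟩ := exists_antipode_pow_eq_one (k := k) (H := H) h.prime h.finrank_eq
  let S2 : Module.End k H := (antipode k : Module.End k H) ^ 2
  have hS2 : ∀ a, S2 a = antipode k (antipode k a) := fun a => by simp [S2, pow_two]
  have hpos : 0 < 2 * p ^ s := by have := pow_pos h.prime.pos s; omega
  have hpow : S2 ^ (2 * p ^ s) = 1 := by
    rw [← pow_mul, ← hs]; congr 1; ring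
  have hinj : ∀ i : ℕ, LinearMap.ker (S2 ^ i) = ⊥ := by
    intro i
    refine LinearMap.ker_eq_bot.2 ?_
    rw [Module.End.coe_pow]
    refine Function.Injective.iterate ?_ i
    intro a b hab
    have h1 : (S2 ^ (2 * p ^ s)) a = (S2 ^ (2 * p ^ s)) b := by
      rw [← Nat.sub_add_cancel hpos, pow_succ, Module.End.mul_apply, Module.End.mul_apply, hab]
    rwa [hpow] at h1
  have hcorep : ∀ i : ℕ, IsCorep k (e.map (S2 ^ i)) := by
    intro i
    induction i with
    | zero => exact he.corep
    | succ i ih =>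
      have h1 := ih.antipode_sq
      convert h1 using 1
      ext a b
      simp [pow_succ', hS2]
  obtain ⟨φ, hφ1, hφ⟩ := exists_dual_vanishing_of_forall hcorep (fun i =>
    exists_dual_vanishing (hcorep i) (he.linearIndependent.map' _ (hinj i))) (2 * p ^ s)
  have hmem : ∀ i : ℕ, (S2 ^ i) (e 0 0) ∈ inv χ f := by
    intro i
    induction i with
    | zero => simpa using he.mem_inv 0
    | succ i ih =>
      rw [pow_succ', Module.End.mul_apply, hS2]
      exact h.antipode_sq_mem_inv ih
  have hε : ∀ i : ℕ, Coalgebra.counit (R := k) ((S2 ^ i) (e 0 0)) = 1 := by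
    intro i
    have := (hcorep i).counit_apply 0 0
    simpa using this
  refine h.exists_inv_integral hodd hxp
    (y := ∑ i ∈ Finset.range (2 * p ^ s), (S2 ^ i) (e 0 0))
    (Submodule.sum_mem _ fun i _ => hmem i) ?_ ?_
  · rw [← hS2, map_sum]
    have h2 : ∀ i, S2 ((S2 ^ i) (e 0 0)) = (S2 ^ (i + 1)) (e 0 0) := fun i => by
      rw [pow_succ', Module.End.mul_apply]
    simp only [h2]
    have h3 := Finset.sum_range_succ (fun i => (S2 ^ i) (e 0 0)) (2 * p ^ s)
    rw [Finset.sum_range_succ', hpow, pow_zero] at h3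
    exact add_right_cancel h3
  · have h10 : (1 : H) ≠ 0 := fun h => by simpa [h] using hφ1
    rw [LinearIndependent.pair_iff' h10]
    intro a ha
    have h4 := congr_arg φ ha
    rw [map_smul, hφ1, map_sum, Finset.sum_eq_zero (f := fun i => φ ((S2 ^ i) (e 0 0)))
      fun i hi => hφ i (Finset.mem_range.1 hi) 0 0] at h4
    have h5 := congr_arg (Coalgebra.counit (R := k)) ha
    rw [map_sum, Finset.sum_congr rfl fun i _ => hε i] at h5
    have ha0 : a = 0 := by simpa using h4
    rw [ha0] at h5
    simp only [zero_smul, map_zero, Finset.sum_const, Finset.card_range, nsmul_eq_mul, mul_one] at h5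
    exact hpos.ne' (by exact_mod_cast h5.symm)

theorem exists_taftCorep [IsAlgClosed k] [CharZero k] (h : TaftPair p q g x χ f)
    {D : Submodule k H}
    (hD : HopfClass.IsSimpleSubcoalgWrt k (HopfClass.comulL k H) D)
    (hD4 : Module.finrank k D = 4) :
    ∃ (ζ β : k) (e : Matrix (Fin 2) (Fin 2) H), ζ ^ p = 1 ∧ TaftCorep χ f ζ β e := by
  have hfd := h.finiteDimensional
  obtain ⟨e, c₀, c₁, β, h1, h2, h3, h4, h5, h6⟩ :=
    exists_corep_of_isSimple (χ := χ.toLinearMap) h.prime.pos (h.prim.ne_one h.prime.one_lt)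
      h.taftFun.rc_pow h.taftFun.rc_pow_zero h.taftFun.conv_comm hD hD4
  have hppos := h.prime.pos
  have : NeZero p := ⟨hppos.ne'⟩
  obtain ⟨t, ht, rfl⟩ := h.prim.eq_pow_of_pow_eq_one h3
  have h5' : ∀ i j, χ (e i j) = Matrix.of ![![q ^ t, 0], ![0, c₁]] i j := h5
  have hgu : IsUnit (g ^ (p - t)) := (IsUnit.of_pow_eq_one h.g_pow hppos.ne').pow _
  have hχ : ∀ a, χ (a * g ^ (p - t)) = χ a * q ^ (p - t) := by
    intro a; rw [_root_.map_mul, map_pow, h.χ_g]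
  have hf : ∀ a, f (a * g ^ (p - t)) = f a := by
    intro a
    have h7 : f (g ^ (p - t)) = 0 := by
      have := congr_arg (Coalgebra.counit (R := k)) (h.X_g_pow (p - t))
      simpa using this
    rw [h.taftFun.map_mul, h7, ((h.gl.pow _)).2]
    simp
  refine ⟨c₁ * q ^ (p - t), β, Matrix.of fun i j => e i j * g ^ (p - t), ?_,
    ⟨h1.mul_gl (h.gl.pow _), ?_, ?_, ?_, ?_, ?_, ?_, ?_, ?_, ?_⟩⟩
  · rw [mul_pow, h4, ← pow_mul, mul_comm (p - t), pow_mul, h.prim.pow_eq_one, one_pow, one_mul]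
  · have := h2.map' (LinearMap.mulRight k (g ^ (p - t)))
      (LinearMap.ker_eq_bot.2 fun a b hab => hgu.mul_left_injective hab)
    exact this
  all_goals simp only [Matrix.of_apply, hχ, hf, h5', h6]
  · simp [← pow_add, Nat.add_sub_cancel' ht.le, h.prim.pow_eq_one]
  all_goals simp

end TaftPair

end NormalForm

end HopfFour

namespace HopfFour

open HopfAlgebra (antipode)

variable {k : Type*} [Field k] {H : Type*} [Ring H] [HopfAlgebra k H]
variable {p : ℕ} {q : k} {g x : H} {χ : H →ₐ[k] k} {f : H →ₗ[k] k}
variable {ζ β : k} {e : Matrix (Fin 2) (Fin 2) H}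

namespace TaftCorep

theorem χ_antipode (he : TaftCorep χ f ζ β e) (hζ : ζ ≠ 0) :
    χ (antipode k (e 0 0)) = 1 ∧ χ (antipode k (e 0 1)) = 0 ∧ χ (antipode k (e 1 0)) = 0 ∧
      χ (antipode k (e 1 1)) = ζ⁻¹ := by
  have h1 := fun i j => congr_arg χ (he.corep.sum_antipode_mul i j)
  simp only [Fin.sum_univ_two, map_add, _root_.map_mul] at h1
  have h00 := h1 0 0
  have h01 := h1 0 1
  have h10 := h1 1 0
  have h11 := h1 1 1
  simp only [he.χ_00, he.χ_01, he.χ_10, he.χ_11, mul_one, mul_zero, add_zero, zero_add] at *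
  simp [hζ] at h00 h01 h10 h11
  exact ⟨h00, h01, h10, eq_inv_of_mul_eq_one_left h11⟩

theorem f_antipode (he : TaftCorep χ f ζ β e) (hζ : ζ ≠ 0) (hf : TaftFun p q χ f) :
    f (antipode k (e 0 0)) = 0 ∧ f (antipode k (e 0 1)) = -β ∧ f (antipode k (e 1 0)) = 0 ∧
      f (antipode k (e 1 1)) = 0 := by
  obtain ⟨h1, h2, h3, h4⟩ := he.χ_antipode hζ
  have key : ∀ i j, f (antipode k (e i j)) = -∑ l, f (e l j) * χ (antipode k (e i l)) := by
    intro i j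
    have h5 := LinearMap.congr_fun hf.comp_antipode (e i j)
    rw [LinearMap.comp_apply] at h5
    rw [h5, LinearMap.neg_apply, conv_apply, he.corep.rc, map_sum]
    simp
  simp [key, Fin.sum_univ_two, he.f_00, he.f_01, he.f_10, he.f_11, h1, h3]

theorem ne_zero (he : TaftCorep χ f ζ β e) (i j : Fin 2) : e i j ≠ 0 :=
  he.linearIndependent.ne_zero (i, j)

theorem mul_eq_one (hf : TaftFun p q χ f) (he : TaftCorep χ f ζ β e) (hβ : β ≠ 0) :
    q * ζ = 1 := by
  have h1 := LinearMap.congr_fun hf.conv_comm (e 0 1)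
  rw [LinearMap.smul_apply, conv_apply, conv_apply, he.corep.rc, he.corep.rc] at h1
  simp [Fin.sum_univ_two, he.χ_00, he.χ_01, he.χ_11, he.f_01, he.f_11] at h1
  exact mul_right_cancel₀ hβ (by linear_combination -h1)

end TaftCorep

namespace TaftPair

/-- The square of the antipode is diagonal on a skew four-dimensional simple subcoalgebra. -/
theorem antipode_sq_eq [IsAlgClosed k] [CharZero k] (h : TaftPair p q g x χ f) (hodd : Odd p)
    (hxp : x ^ p = 0) (he : TaftCorep χ f ζ β e) (hβ : β ≠ 0) :
    antipode k (antipode k (e 0 0)) = e 0 0 ∧ antipode k (antipode k (e 1 1)) = e 1 1 ∧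
      antipode k (antipode k (e 1 0)) = q • e 1 0 ∧
      antipode k (antipode k (e 0 1)) = q⁻¹ • e 0 1 := by
  have hfd := h.finiteDimensional
  have hqζ := he.mul_eq_one h.taftFun hβ
  have hζ : ζ ≠ 0 := right_ne_zero_of_mul_eq_one hqζ
  have hζ' : ζ⁻¹ = q := (eq_inv_of_mul_eq_one_left hqζ).symm
  obtain ⟨c1, c2, c3, c4⟩ := he.χ_antipode hζ
  obtain ⟨d1, d2, d3, d4⟩ := he.f_antipode hζ h.taftFun
  obtain ⟨ℓ, Λ, hℓ1, hℓ, -⟩ := h.exists_integral hodd hxp he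
  let s : Matrix (Fin 2) (Fin 2) H := Matrix.of fun i j => antipode k (e j i)
  have hs : IsCorep k s := he.corep.antipode
  let m : Fin 2 → Fin 2 → H := fun a c => s a 0 * e c 0 + ζ • (s a 1 * e c 1)
  have hG : ∀ a, rc χ.toLinearMap (s a 0) = s a 0 ∧ rc χ.toLinearMap (s a 1) = ζ⁻¹ • s a 1 := by
    intro a
    rw [hs.rc, hs.rc]
    simp [Fin.sum_univ_two, s, c1, c2, c3, c4]
  have hX : ∀ a, rc f (s a 0) = -β • s a 1 ∧ rc f (s a 1) = 0 := by
    intro a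
    rw [hs.rc, hs.rc]
    simp [Fin.sum_univ_two, s, d1, d2, d3, d4]
  have hGe : ∀ c, rc χ.toLinearMap (e c 0) = e c 0 ∧ rc χ.toLinearMap (e c 1) = ζ • e c 1 := by
    intro a
    rw [he.corep.rc, he.corep.rc]
    simp [Fin.sum_univ_two, he.χ_00, he.χ_01, he.χ_10, he.χ_11]
  have hXe : ∀ c, rc f (e c 0) = 0 ∧ rc f (e c 1) = β • e c 0 := by
    intro a
    rw [he.corep.rc, he.corep.rc]
    simp [Fin.sum_univ_two, he.f_00, he.f_01, he.f_10, he.f_11]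
  have hm : ∀ a c, m a c ∈ inv χ f := by
    intro a c
    constructor
    · simp only [m, map_add, map_smul, h.X_mul, (hX a).1, (hX a).2, (hXe c).1, (hXe c).2,
        (hG a).1, (hG a).2, mul_zero, zero_mul, add_zero, zero_add, smul_mul_assoc, mul_smul_comm,
        smul_smul]
      rw [← add_smul, show -β + ζ * (β * ζ⁻¹) = 0 by field_simp; ring, zero_smul]
    · simp only [m, map_add, map_smul, h.G_mul, (hG a).1, (hG a).2, (hGe c).1, (hGe c).2,
        smul_mul_assoc, mul_smul_comm, smul_smul]
      congr 2
      field_simp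
  let L : Fin 2 → Fin 2 → k := fun a c => ℓ (m a c)
  have hL1 : ∀ a c, ∑ b, ∑ d, L b d • (s a b * e c d) = L a c • (1 : H) := by
    intro a c
    rw [← hℓ _ (hm a c)]
    have h1 := fun j => (hs.mul he.corep).rc ℓ (a, c) j
    simp only [Matrix.of_apply] at h1
    simp only [m, map_add, map_smul]
    rw [h1 (0, 0), h1 (1, 1)]
    simp only [Fintype.sum_prod_type, L, m, Fin.sum_univ_two, map_add, map_smul, smul_add, add_smul,
      smul_smul, smul_eq_mul, Fin.isValue, mul_comm ζ]
    abel_nf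
  have hL2 : ∀ c f, ∑ d, L f d • e c d = ∑ a, L a c • antipode k (antipode k (e a f)) := by
    intro c f
    have h1 : ∀ b, ∑ a, antipode k (antipode k (e a f)) * s a b = if b = f then 1 else 0 := by
      intro b
      have h2 := congr_arg (antipode k) (he.corep.sum_mul_antipode b f)
      simp only [map_sum, HopfAlgebra.antipode_mul_antidistrib] at h2
      simp only [s, Matrix.of_apply]
      rw [h2]
      split_ifs <;> simp [HopfAlgebra.antipode_one]
    have h3 := congr_arg₂ (· + ·)
      (congr_arg (antipode k (antipode k (e 0 f)) * ·) (hL1 0 c))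
      (congr_arg (antipode k (antipode k (e 1 f)) * ·) (hL1 1 c))
    have h10 := h1 0
    have h11 := h1 1
    simp only [Fin.sum_univ_two, mul_add, mul_smul_comm, mul_one, ← mul_assoc] at h3 h10 h11 ⊢
    rw [← h3]
    have h4 : L f 0 • e c 0 + L f 1 • e c 1 =
        ∑ b : Fin 2, ((if b = f then (1 : H) else 0) * (L b 0 • e c 0 + L b 1 • e c 1)) := by
      simp
    rw [h4, Fin.sum_univ_two, ← h10, ← h11]
    simp only [add_mul, mul_add, mul_smul_comm, smul_add]
    abel
  have hζ1 : ζ ≠ 1 := by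
    rintro rfl
    exact h.prim.ne_one h.prime.one_lt (by simpa using hqζ)
  have h01 : L 0 1 = 0 := by
    have h1 := congr_arg χ (hL2 1 0)
    simp only [map_add, map_smul, algHom_antipode_antipode, Fin.sum_univ_two, smul_eq_mul, he.χ_00,
      he.χ_10, he.χ_11] at h1
    have : L 0 1 * (ζ - 1) = 0 := by linear_combination h1
    exact (mul_eq_zero.1 this).resolve_right (sub_ne_zero.2 hζ1)
  have h10 : L 1 0 = 0 := by
    have h1 := congr_arg χ (hL2 0 1)
    simp only [map_add, map_smul, algHom_antipode_antipode, Fin.sum_univ_two, smul_eq_mul, he.χ_00,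
      he.χ_01, he.χ_11] at h1
    have : L 1 0 * (ζ - 1) = 0 := by linear_combination -h1
    exact (mul_eq_zero.1 this).resolve_right (sub_ne_zero.2 hζ1)
  have hL3 : ∀ c b, L b b • e c b = L c c • antipode k (antipode k (e c b)) := by
    intro c b
    have h1 := hL2 c b
    rw [Fin.sum_univ_two, Fin.sum_univ_two] at h1
    fin_cases c <;> fin_cases b <;> simpa [h01, h10] using h1
  have htr : L 0 0 + L 1 1 = 1 + ζ := by
    have h1 : m 0 0 + m 1 1 = (1 + ζ) • (1 : H) := by
      have h2 := he.corep.sum_antipode_mul 0 0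
      have h3 := he.corep.sum_antipode_mul 1 1
      rw [Fin.sum_univ_two, if_pos rfl] at h2 h3
      rw [add_smul, one_smul]
      nth_rw 1 [← h2]
      rw [← h3]
      simp only [m, s, Matrix.of_apply]
      module
    have h2 := congr_arg ℓ h1
    rw [map_add, map_smul, hℓ1] at h2
    simpa using h2
  have hζ2 : 1 + ζ ≠ 0 := by
    intro h0
    have h1 : ζ = -1 := by linear_combination h0
    have h2 : ζ ^ p = 1 := by
      have := congr_arg (· ^ p) hqζ
      simpa [mul_pow, h.prim.pow_eq_one] using this
    rw [h1, hodd.neg_one_pow] at h2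
    norm_num at h2
  have hL0 : L 0 0 ≠ 0 := by
    intro h0
    have h1 := hL3 0 1
    rw [h0, zero_smul] at h1
    have h2 : L 1 1 = 0 := (smul_eq_zero.1 h1).resolve_right (he.ne_zero 0 1)
    exact hζ2 (by rw [← htr, h0, h2, add_zero])
  have hL1' : L 1 1 ≠ 0 := by
    intro h0
    have h1 := hL3 1 0
    rw [h0, zero_smul] at h1
    exact hL0 ((smul_eq_zero.1 h1).resolve_right (he.ne_zero 1 0))
  have hS : ∀ c b, antipode k (antipode k (e c b)) = ((L c c)⁻¹ * L b b) • e c b := by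
    intro c b
    rw [mul_smul, hL3, smul_smul, inv_mul_cancel₀, one_smul]
    fin_cases c <;> assumption
  have hratio : (L 0 0)⁻¹ * L 1 1 = q⁻¹ := by
    have h1 := h.taftFun.antipode_sq h.q_ne_zero (e 0 1)
    rw [hS, map_smul, he.f_01, smul_eq_mul] at h1
    exact mul_right_cancel₀ hβ h1
  refine ⟨?_, ?_, ?_, ?_⟩
  · rw [hS, inv_mul_cancel₀ hL0, one_smul]
  · rw [hS, inv_mul_cancel₀ hL1', one_smul]
  · rw [hS, ← (inv_inj.2 hratio).trans (inv_inv q), mul_inv, inv_inv, mul_comm]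
  · rw [hS, hratio]

end TaftPair
end HopfFour

namespace HopfFour

open HopfAlgebra (antipode)

variable {k : Type*} [Field k] {H : Type*} [Ring H] [HopfAlgebra k H]

/-- A sequence of two-dimensional corepresentations whose first columns quasi-commute. -/
structure LetterSeq (p : ℕ) (χ : H →ₐ[k] k) (f : H →ₗ[k] k) (ζ τ : k)
    (z : ℕ → Matrix (Fin 2) (Fin 2) H) (v b σ σ' : ℕ → k) : Prop where
  corep : ∀ i, IsCorep k (z i)
  χ_00 : ∀ i, χ (z i 0 0) = v i
  χ_01 : ∀ i, χ (z i 0 1) = 0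
  χ_10 : ∀ i, χ (z i 1 0) = 0
  χ_11 : ∀ i, χ (z i 1 1) = ζ * v i
  f_00 : ∀ i, f (z i 0 0) = 0
  f_01 : ∀ i, f (z i 0 1) = b i
  f_10 : ∀ i, f (z i 1 0) = 0
  f_11 : ∀ i, f (z i 1 1) = 0
  v_ne_zero : ∀ i, v i ≠ 0
  b_ne_zero : ∀ i, b i ≠ 0
  b_succ : ∀ i, b (i + 1) = -b i
  rel : ∀ i, z i 0 0 * z (i + 1) 1 0 = σ i • (z i 1 0 * z (i + 1) 0 0)
  rel' : ∀ i, z i 1 0 * z (i + 1) 1 1 = σ' i • (z i 1 1 * z (i + 1) 1 0)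
  mul_σ : ∀ i, σ i * σ' i = τ
  v_mul_σ : ∀ i, v i * σ i = -τ
  left_inv : ∀ i u, z i 1 0 * u = 0 → z i 1 1 * u = 0 → u = 0
  right_inv : ∀ i u, u * z i 0 0 = 0 → u * z i 1 0 = 0 → u = 0
  ne_zero : ∀ i, z i 1 0 ≠ 0
  prim : IsPrimitiveRoot ζ p
  prim' : IsPrimitiveRoot τ p
  map_mul : ∀ a b, f (a * b) = f a * Coalgebra.counit (R := k) b + χ a * f b

/-- The product of the entries with row index `j` in the first column. -/
def word (z : ℕ → Matrix (Fin 2) (Fin 2) H) (j : Fin 2) (i n : ℕ) : H :=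
  ((List.range n).map fun l => z (i + l) j 0).prod

section word

variable (z : ℕ → Matrix (Fin 2) (Fin 2) H) (j : Fin 2) (i n : ℕ)

@[simp] theorem word_zero : word z j i 0 = 1 := rfl

theorem word_succ : word z j i (n + 1) = z i j 0 * word z j (i + 1) n := by
  simp only [word, List.range_succ_eq_map, List.map_cons, List.prod_cons, List.map_map, add_zero]
  congr 3
  ext l : 1
  simp [Nat.add_assoc, Nat.add_comm 1]

theorem word_succ' : word z j i (n + 1) = word z j i n * z (i + n) j 0 := by
  simp [word, List.range_succ]

end word

namespace LetterSeq

variable {p : ℕ} {χ : H →ₐ[k] k} {f : H →ₗ[k] k} {ζ τ : k}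
  {z : ℕ → Matrix (Fin 2) (Fin 2) H} {v b σ σ' : ℕ → k}
  [FiniteDimensional k H] (h : LetterSeq p χ f ζ τ z v b σ σ')
include h

theorem rc_χ (i : ℕ) (l : Fin 2) : rc χ.toLinearMap (z i l 0) = v i • z i l 0 := by
  rw [(h.corep i).rc]; simp [Fin.sum_univ_two, h.χ_00, h.χ_10]

theorem rc_χ' (i : ℕ) (l : Fin 2) : rc χ.toLinearMap (z i l 1) = (ζ * v i) • z i l 1 := by
  rw [(h.corep i).rc]; simp [Fin.sum_univ_two, h.χ_01, h.χ_11]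

theorem rc_f (i : ℕ) (l : Fin 2) : rc f (z i l 0) = 0 := by
  rw [(h.corep i).rc]; simp [Fin.sum_univ_two, h.f_00, h.f_10]

theorem lc_χ_0 (i : ℕ) : lc χ.toLinearMap (z i 0 0) = v i • z i 0 0 := by
  rw [(h.corep i).lc]; simp [Fin.sum_univ_two, h.χ_00, h.χ_01]

theorem lc_χ_1 (i : ℕ) : lc χ.toLinearMap (z i 1 0) = (ζ * v i) • z i 1 0 := by
  rw [(h.corep i).lc]; simp [Fin.sum_univ_two, h.χ_10, h.χ_11]

theorem lc_f_0 (i : ℕ) : lc f (z i 0 0) = b i • z i 1 0 := by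
  rw [(h.corep i).lc]; simp [Fin.sum_univ_two, h.f_00, h.f_01]

theorem lc_f_1 (i : ℕ) : lc f (z i 1 0) = 0 := by
  rw [(h.corep i).lc]; simp [Fin.sum_univ_two, h.f_10, h.f_11]

theorem lc_f_mul (a c : H) :
    lc f (a * c) = lc f a * c + lc χ.toLinearMap a * lc f c := by
  obtain ⟨s, e⟩ := exists_comul (k := k) a
  have : ∀ z : H, f ∘ₗ LinearMap.mulLeft k z = f z • Coalgebra.counit + χ z • f := by
    intro z; ext y; simp [h.map_mul]
  rw [lc_mul_left e, lc_of_comul e, lc_of_comul e, Finset.sum_mul, Finset.sum_mul,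
    ← Finset.sum_add_distrib]
  refine Finset.sum_congr rfl fun i _ => ?_
  rw [this, lc_add, lc_smul, lc_smul, lc_counit, mul_add]
  simp

theorem map_one : f 1 = 0 := by simpa using h.map_mul 1 1

theorem lc_f_word_zero (n i : ℕ) : lc f (word z 0 i (n + 1)) =
    (b i * ∑ l ∈ Finset.range (n + 1), τ ^ l) • (z i 1 0 * word z 0 (i + 1) n) := by
  induction n generalizing i with
  | zero => simp [word_succ, h.lc_f_0]
  | succ n ih =>
    rw [word_succ, h.lc_f_mul, ih, h.lc_f_0, h.lc_χ_0, Finset.sum_range_succ' _ (n + 1)]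
    simp only [pow_succ', ← Finset.mul_sum]
    have h2 : z i 0 0 * (z (i + 1) 1 0 * word z 0 (i + 1 + 1) n) =
        σ i • (z i 1 0 * word z 0 (i + 1) (n + 1)) := by
      rw [← mul_assoc, h.rel, smul_mul_assoc, mul_assoc, ← word_succ]
    rw [smul_mul_smul_comm, h2, smul_smul, smul_mul_assoc, ← add_smul, h.b_succ, pow_zero]
    congr 1
    linear_combination -(b i * ∑ l ∈ Finset.range (n + 1), τ ^ l) * h.v_mul_σ i

theorem lc_f_word_one (n i : ℕ) : lc f (word z 1 i n) = 0 := by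
  induction n generalizing i with
  | zero => simp [lc_one, h.map_one]
  | succ n ih => rw [word_succ, h.lc_f_mul, ih, h.lc_f_1]; simp

theorem lc_χ_word_one (n i : ℕ) : lc χ.toLinearMap (word z 1 i n) =
    (ζ ^ n * ∏ l ∈ Finset.range n, v (i + l)) • word z 1 i n := by
  induction n with
  | zero => simp [lc_one]
  | succ n ih =>
    rw [word_succ', lc_algHom_mul, ih, h.lc_χ_1, smul_mul_smul_comm, Finset.prod_range_succ]
    congr 1
    ring

theorem rc_χ_word_one (n i : ℕ) : rc χ.toLinearMap (word z 1 i n) =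
    (∏ l ∈ Finset.range n, v (i + l)) • word z 1 i n := by
  induction n with
  | zero => simp [rc_one]
  | succ n ih =>
    rw [word_succ', rc_algHom_mul, ih, h.rc_χ, smul_mul_smul_comm, Finset.prod_range_succ]

theorem rc_f_word_one (n i : ℕ) : rc f (word z 1 i n) = 0 := by
  induction n generalizing i with
  | zero => simp [rc_one, h.map_one]
  | succ n ih => rw [word_succ, rc_mul_of_skew h.map_mul, ih, h.rc_f]; simp

theorem prod_ne_zero (n i : ℕ) : ∏ l ∈ Finset.range n, v (i + l) ≠ 0 :=
  Finset.prod_ne_zero_iff.2 fun _ _ => h.v_ne_zero _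

theorem word_mul_eq_zero (n : ℕ) (hn : n + 1 < p) (i j : ℕ)
    (h0 : word z 1 i j * word z 0 (i + j) (n + 1) = 0) :
    word z 1 i (j + n) * z (i + (j + n)) 0 0 = 0 := by
  induction n generalizing j with
  | zero => simpa [word_succ] using h0
  | succ n ih =>
    have h1 := congr_arg (lc f) h0
    rw [h.lc_f_mul, h.lc_f_word_one, zero_mul, zero_add, h.lc_f_word_zero, h.lc_χ_word_one,
      map_zero, smul_mul_smul_comm, ← mul_assoc (word z 1 i j), ← word_succ'] at h1
    have h2 := (smul_eq_zero.1 h1).resolve_left (mul_ne_zero (mul_ne_zero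
      (pow_ne_zero _ (h.prim.ne_zero (by omega))) (h.prod_ne_zero _ _))
      (mul_ne_zero (h.b_ne_zero _) (quantum_sum_ne_zero h.prim' (by omega) (by omega))))
    have h3 := ih (by omega) (j + 1) h2
    rwa [Nat.add_assoc j 1 n, Nat.add_comm 1 n] at h3

theorem rc_word_one (n i : ℕ) (φ : H →ₗ[k] k) :
    ∃ r ∈ Submodule.span k {a : H | ∃ l, 2 ≤ l ∧ l ≤ n + 1 ∧ rc χ.toLinearMap a =
        (ζ ^ l * ∏ l ∈ Finset.range (n + 1), v (i + l)) • a},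
      rc φ (word z 1 i (n + 1)) = φ (word z 0 i (n + 1)) • word z 1 i (n + 1) +
        ((∑ l ∈ Finset.range (n + 1), τ ^ l) * φ (z i 1 0 * word z 0 (i + 1) n)) •
          (z i 1 1 * word z 1 (i + 1) n) + r := by
  induction n generalizing i φ with
  | zero =>
    refine ⟨0, Submodule.zero_mem _, ?_⟩
    simp [word_succ, (h.corep i).rc, Fin.sum_univ_two]
  | succ n ih =>
    have h1 := rc_mul_left ((h.corep i).comul_apply 1 0) φ (word z 1 (i + 1) (n + 1))
    rw [Fin.sum_univ_two] at h1
    obtain ⟨r₀, hr₀, e₀⟩ := ih (i + 1) (φ ∘ₗ LinearMap.mulLeft k (z i 0 0))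
    obtain ⟨r₁, hr₁, e₁⟩ := ih (i + 1) (φ ∘ₗ LinearMap.mulLeft k (z i 1 0))
    have hprod : ∏ l ∈ Finset.range (n + 1 + 1), v (i + l) =
        v i * ∏ l ∈ Finset.range (n + 1), v (i + 1 + l) := by
      rw [Finset.prod_range_succ', add_zero, mul_comm]
      congr 1
      exact Finset.prod_congr rfl fun l _ => by congr 1; omega
    refine ⟨z i 1 0 * r₀ + (((∑ l ∈ Finset.range (n + 1), τ ^ l) *
      φ (z i 1 0 * (z (i + 1) 1 0 * word z 0 (i + 1 + 1) n))) •
        (z i 1 1 * (z (i + 1) 1 1 * word z 1 (i + 1 + 1) n)) + z i 1 1 * r₁), ?_, ?_⟩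
    · refine Submodule.add_mem _ ?_ (Submodule.add_mem _ (Submodule.smul_mem _ _ ?_) ?_)
      · rw [← LinearMap.mulLeft_apply k, ← Submodule.mem_comap]
        refine (Submodule.span_le.2 ?_ : Submodule.span k _ ≤ _) hr₀
        · rintro a ⟨l, hl, hl', ha⟩
          refine Submodule.subset_span ⟨l, hl, by omega, ?_⟩
          rw [LinearMap.mulLeft_apply, rc_algHom_mul, h.rc_χ, ha, smul_mul_smul_comm, hprod]
          congr 1
          ring
      · refine Submodule.subset_span ⟨2, le_rfl, by omega, ?_⟩
        rw [rc_algHom_mul, rc_algHom_mul, h.rc_χ', h.rc_χ', h.rc_χ_word_one, smul_mul_smul_comm,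
          smul_mul_smul_comm, hprod, Finset.prod_range_succ']
        congr 1
        have : ∏ l ∈ Finset.range n, v (i + 1 + 1 + l) = ∏ l ∈ Finset.range n, v (i + 1 + (l + 1)) :=
          Finset.prod_congr rfl fun l _ => by congr 1; omega
        rw [this, add_zero]
        ring
      · rw [← LinearMap.mulLeft_apply k, ← Submodule.mem_comap]
        refine (Submodule.span_le.2 ?_ : Submodule.span k _ ≤ _) hr₁
        · rintro a ⟨l, hl, hl', ha⟩
          refine Submodule.subset_span ⟨l + 1, by omega, by omega, ?_⟩
          rw [LinearMap.mulLeft_apply, rc_algHom_mul, h.rc_χ', ha, smul_mul_smul_comm, hprod]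
          congr 1
          ring
    · have h2 : z i 0 0 * (z (i + 1) 1 0 * word z 0 (i + 1 + 1) n) =
          σ i • (z i 1 0 * word z 0 (i + 1) (n + 1)) := by
        rw [← mul_assoc, h.rel, smul_mul_assoc, mul_assoc, ← word_succ]
      have h3 : z i 1 0 * (z (i + 1) 1 1 * word z 1 (i + 1 + 1) n) =
          σ' i • (z i 1 1 * word z 1 (i + 1) (n + 1)) := by
        rw [← mul_assoc, h.rel', smul_mul_assoc, mul_assoc, ← word_succ]
      rw [word_succ, h1, e₀, e₁]
      simp only [LinearMap.comp_apply, LinearMap.mulLeft_apply, mul_add, mul_smul_comm, h2, h3,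
        ← word_succ, map_smul]
      rw [Finset.sum_range_succ' _ (n + 1)]
      simp only [pow_succ', ← Finset.mul_sum, pow_zero, ← h.mul_σ i]
      module

theorem word_one_ne_zero [Nontrivial H] (n i : ℕ) (hn : n < p) : word z 1 i n ≠ 0 := by
  induction n generalizing i with
  | zero => simp
  | succ n ih =>
    intro h0
    have key : ∀ φ : H →ₗ[k] k, φ (z i 1 0 * word z 0 (i + 1) n) = 0 ∨
        z i 1 1 * word z 1 (i + 1) n = 0 := by
      intro φ
      obtain ⟨r, hr, e⟩ := h.rc_word_one n i φ
      rw [h0, map_zero, smul_zero, zero_add] at e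
      have hV : ∏ l ∈ Finset.range (n + 1), v (i + l) ≠ 0 := h.prod_ne_zero _ _
      set V := ∏ l ∈ Finset.range (n + 1), v (i + l) with hVdef
      have h1 : z i 1 1 * word z 1 (i + 1) n ∈ Module.End.eigenspace (rc χ.toLinearMap) (ζ * V) := by
        rw [Module.End.mem_eigenspace_iff, rc_algHom_mul, h.rc_χ', h.rc_χ_word_one,
          smul_mul_smul_comm, hVdef, Finset.prod_range_succ']
        congr 1
        have : ∏ l ∈ Finset.range n, v (i + 1 + l) = ∏ l ∈ Finset.range n, v (i + (l + 1)) :=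
          Finset.prod_congr rfl fun l _ => by congr 1; omega
        rw [this, add_zero]
        ring
      have h2 : r ∈ ⨆ (μ) (_ : μ ≠ ζ * V), Module.End.eigenspace (rc χ.toLinearMap) μ := by
        refine (Submodule.span_le.2 ?_ : Submodule.span k _ ≤ _) hr
        rintro a ⟨l, hl, hl', ha⟩
        refine Submodule.mem_iSup_of_mem (ζ ^ l * V) (Submodule.mem_iSup_of_mem ?_
          (Module.End.mem_eigenspace_iff.2 ha))
        intro h3
        have h4 : ζ ^ l = ζ ^ 1 := by rw [pow_one]; exact mul_right_cancel₀ hV h3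
        have := h.prim.pow_inj (by omega) (by omega) h4
        omega
      have h3 := (Module.End.eigenspaces_iSupIndep (rc χ.toLinearMap)) (ζ * V)
      have h4 : r ∈ Module.End.eigenspace (rc χ.toLinearMap) (ζ * V) := by
        rw [eq_neg_of_add_eq_zero_right e.symm]
        exact Submodule.neg_mem _ (Submodule.smul_mem _ _ h1)
      have h5 := Submodule.disjoint_def.1 h3 r h4 h2
      rw [h5, add_zero] at e
      rcases smul_eq_zero.1 e.symm with h6 | h6
      · left
        exact (mul_eq_zero.1 h6).resolve_left (quantum_sum_ne_zero h.prim' (by omega) hn)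
      · exact Or.inr h6
    by_cases h1 : z i 1 1 * word z 1 (i + 1) n = 0
    · exact ih (i + 1) (by omega) (h.left_inv i _ (by rwa [← word_succ]) h1)
    · have h2 : z i 1 0 * word z 0 (i + 1) n = 0 :=
        eq_of_forall_dual (k := k) fun φ => by rw [(key φ).resolve_right h1, map_zero]
      refine ih i (by omega) (h.right_inv (i + n) _ ?_ (by rwa [← word_succ']))
      cases n with
      | zero => exact absurd (by simpa using h2) (h.ne_zero i)
      | succ n =>
        have h3 := h.word_mul_eq_zero n (by omega) i 1 (by simpa [word_succ] using h2)
        rwa [Nat.add_comm 1 n] at h3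

end LetterSeq

end HopfFour

namespace HopfFour

open HopfAlgebra (antipode)

theorem IsCorep.submatrix_equiv {k : Type*} [Field k] {C : Type*} [AddCommGroup C] [Module k C]
    [Coalgebra k C] {ι κ : Type*} [Fintype ι] [DecidableEq ι] [Fintype κ] [DecidableEq κ]
    {u : Matrix ι ι C} (hu : IsCorep k u) (s : κ ≃ ι) : IsCorep k (u.submatrix s s) where
  comul_apply i j := by
    rw [Matrix.submatrix_apply, hu.comul_apply, ← s.sum_comp]
    rfl
  counit_apply i j := by
    rw [Matrix.submatrix_apply, hu.counit_apply]
    simp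

variable {k : Type*} [Field k] {H : Type*} [Ring H] [HopfAlgebra k H]

variable (k) in
/-- The dual of a two-dimensional corepresentation, with the basis reversed. -/
noncomputable def revDual (e : Matrix (Fin 2) (Fin 2) H) : Matrix (Fin 2) (Fin 2) H :=
  (Matrix.of fun i j => antipode k (e j i)).submatrix Fin.revPerm Fin.revPerm

section revDual

variable (e : Matrix (Fin 2) (Fin 2) H)

@[simp] theorem revDual_00 : revDual k e 0 0 = antipode k (e 1 1) := rfl
@[simp] theorem revDual_01 : revDual k e 0 1 = antipode k (e 0 1) := rfl
@[simp] theorem revDual_10 : revDual k e 1 0 = antipode k (e 1 0) := rfl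
@[simp] theorem revDual_11 : revDual k e 1 1 = antipode k (e 0 0) := rfl

end revDual

variable {p : ℕ} {q : k} {g x : H} {χ : H →ₐ[k] k} {f : H →ₗ[k] k}
variable {ζ β : k} {e : Matrix (Fin 2) (Fin 2) H}

theorem TaftPair.letterSeq [IsAlgClosed k] [CharZero k] (h : TaftPair p q g x χ f) (hodd : Odd p)
    (hxp : x ^ p = 0) (he : TaftCorep χ f ζ β e) (hβ : β ≠ 0) :
    LetterSeq p χ f ζ q (fun i => if Even i then e else revDual k e)
      (fun i => if Even i then 1 else q) (fun i => if Even i then β else -β)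
      (fun i => if Even i then -q else -1) (fun i => if Even i then -1 else -q) := by
  have hq := h.q_ne_zero
  have hqζ := he.mul_eq_one h.taftFun hβ
  have hζ : ζ ≠ 0 := right_ne_zero_of_mul_eq_one hqζ
  have hζ' : ζ⁻¹ = q := (eq_inv_of_mul_eq_one_left hqζ).symm
  obtain ⟨a1, a2, a3, a4⟩ := he.χ_antipode hζ
  obtain ⟨b1, b2, b3, b4⟩ := he.f_antipode hζ h.taftFun
  obtain ⟨c1, c2, c3, c4⟩ := h.antipode_sq_eq hodd hxp he hβ
  have m := fun i j => he.corep.sum_mul_antipode i j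
  have n := fun i j => he.corep.sum_antipode_mul i j
  simp only [Fin.sum_univ_two] at m n
  have m' := fun i j => congr_arg (antipode k) (m i j)
  have n' := fun i j => congr_arg (antipode k) (n i j)
  simp only [map_add, HopfAlgebra.antipode_mul_antidistrib] at m' n'
  have m00 := m 0 0
  have m10 := m 1 0
  have n10 := n 1 0
  have n11 := n 1 1
  have m00' := m' 0 0
  have m10' := m' 1 0
  have n10' := n' 1 0
  have n11' := n' 1 1
  simp only [c1, c2, c3, one_ne_zero, if_true, if_false, map_zero, HopfAlgebra.antipode_one,
    smul_mul_assoc, mul_smul_comm] at m00 m10 n10 n11 m00' m10' n10' n11'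
  have hpar : ∀ i : ℕ, (Even i ∧ ¬ Even (i + 1)) ∨ (¬ Even i ∧ Even (i + 1)) := fun i => by
    by_cases hi : Even i <;> simp [hi, Nat.even_add_one]
  refine ⟨fun i => ?_, fun i => ?_, fun i => ?_, fun i => ?_, fun i => ?_, fun i => ?_, fun i => ?_,
    fun i => ?_, fun i => ?_, fun i => ?_, fun i => ?_, fun i => ?_, fun i => ?_, fun i => ?_,
    fun i => ?_, fun i => ?_, fun i u h1 h2 => ?_, fun i u h1 h2 => ?_, fun i => ?_, ?_, h.prim,
    h.taftFun.map_mul⟩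
  case refine_20 => rw [← inv_inv ζ, hζ']; exact h.prim.inv
  all_goals rcases hpar i with ⟨hi, hi'⟩ | ⟨hi, hi'⟩
  all_goals try simp only [hi, if_true, if_false, revDual_00, revDual_10,
    revDual_11] at h1 h2
  all_goals try simp only [hi, hi', if_true, if_false, revDual_00, revDual_01, revDual_10, revDual_11,
    he.χ_00, he.χ_01, he.χ_10, he.χ_11, he.f_00, he.f_01, he.f_10, he.f_11, a1, a2, a3, a4,
    b1, b2, b3, b4, hζ', mul_one, neg_neg, one_mul, neg_neg, mul_neg, hqζ, mul_comm ζ,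
    neg_smul, one_smul, ne_eq, neg_eq_zero, one_ne_zero, not_false_iff, hβ, hq, he.ne_zero]
  · exact he.corep
  · exact he.corep.antipode.submatrix_equiv _
  · exact eq_neg_of_add_eq_zero_left m10'
  · exact eq_neg_of_add_eq_zero_right n10
  · exact eq_neg_of_add_eq_zero_left m10
  · exact eq_neg_of_add_eq_zero_right n10'
  · ring
  · rw [← one_mul u, ← n11', add_mul, smul_mul_assoc, mul_assoc, mul_assoc, h1, h2]; simp
  · rw [← one_mul u, ← m00, add_mul, mul_assoc, mul_assoc, h1, h2]; simp
  · rw [← mul_one u, ← m00', mul_add, mul_smul_comm, ← mul_assoc, ← mul_assoc, h1, h2]; simp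
  · rw [← mul_one u, ← n11, mul_add, ← mul_assoc, ← mul_assoc, h1, h2]; simp
  · intro h0
    rw [h0, map_zero] at c3
    exact he.ne_zero 1 0 ((smul_eq_zero.1 c3.symm).resolve_left hq)

theorem TaftPair.taftCorep_eq_zero [IsAlgClosed k] [CharZero k] (h : TaftPair p q g x χ f)
    (hodd : Odd p) (hxp : x ^ p = 0) (he : TaftCorep χ f ζ β e) : β = 0 := by
  by_contra hβ
  have hL := h.letterSeq hodd hxp he hβ
  have hfin := h.finiteDimensional
  have hnt : Nontrivial H := ⟨_, _, he.ne_zero 0 0⟩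
  set z : ℕ → Matrix (Fin 2) (Fin 2) H := fun i => if Even i then e else revDual k e with hz
  have hw : ∀ n, ∃ i : ℕ, ∏ l ∈ Finset.range n, (if Even (0 + l) then 1 else q) = q ^ i := by
    intro n
    induction n with
    | zero => exact ⟨0, by simp⟩
    | succ n ih =>
      obtain ⟨i, hi⟩ := ih
      rw [Finset.prod_range_succ, hi]
      split_ifs
      · exact ⟨i, mul_one _⟩
      · exact ⟨i + 1, (pow_succ _ _).symm⟩
  choose w hw using hw
  have hGg : ∀ i, IsGL k (g ^ i) := fun i => h.gl.pow i
  let r : ℕ → H := fun n => word z 1 0 n * g ^ ((p - 1) * w n)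
  have hr : ∀ n, r n ∈ inv χ f := fun n => h.eigen_mul_mem_inv
    (hL.rc_f_word_one n 0) (by rw [hL.rc_χ_word_one, hw])
  have hlc : ∀ n, lc χ.toLinearMap (r n) = ζ ^ n • r n := by
    intro n
    have : χ.toLinearMap (g ^ ((p - 1) * w n)) = q ^ ((p - 1) * w n) := by simp [h.χ_g]
    rw [lc_algHom_mul, hL.lc_χ_word_one, hw, (hGg _).lc, this, smul_mul_smul_comm, mul_assoc,
      h.q_pow_mul_q_pow, mul_one]
  have hr0 : ∀ n < p, r n ≠ 0 := by
    intro n hn h0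
    refine hL.word_one_ne_zero n 0 hn ?_
    rw [← mul_one (word z 1 0 n), ← h.g_pow_mul_g_pow' (w n), ← mul_assoc]
    change r n * _ = 0
    rw [h0, zero_mul]
  have hli : LinearIndependent k fun n : Fin p => r n :=
    Module.End.eigenvectors_linearIndependent' (lc χ.toLinearMap) (fun n : Fin p => ζ ^ (n : ℕ))
      (fun a b hab => Fin.ext (hL.prim.pow_inj a.2 b.2 hab)) _
      fun n => Module.End.hasEigenvector_iff.2
        ⟨Module.End.mem_eigenspace_iff.2 (hlc n), hr0 n n.2⟩
  have hspan : Submodule.span k (Set.range fun n : Fin p => r n) = inv χ f := by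
    refine Submodule.eq_of_le_of_finrank_le (Submodule.span_le.2 ?_) ?_
    · rintro _ ⟨n, rfl⟩; exact hr n
    · rw [h.finrank_inv hxp, finrank_span_eq_card hli, Fintype.card_fin]
  have h00 : e 0 0 ∈ Submodule.span k (Set.range fun n : Fin p => r n) := by
    rw [hspan]; exact he.mem_inv 0
  obtain ⟨c, hc⟩ := (Submodule.mem_span_range_iff_exists_fun k).1 h00
  have hlc0 : lc χ.toLinearMap (e 0 0) = e 0 0 := by
    rw [he.corep.lc, Fin.sum_univ_two]
    simp [he.χ_00, he.χ_01]
  have hc0 : ∀ n : Fin p, (n : ℕ) ≠ 0 → c n = 0 := by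
    intro n hn
    have h1 := hlc0
    rw [← hc, map_sum, ← sub_eq_zero, ← Finset.sum_sub_distrib] at h1
    have h2 := Fintype.linearIndependent_iff.1 hli (fun n => c n * ζ ^ (n : ℕ) - c n) (by
      rw [← h1]
      refine Finset.sum_congr rfl fun n _ => ?_
      rw [map_smul, hlc]
      module) n
    have h3 : c n * (ζ ^ (n : ℕ) - 1) = 0 := by rw [← h2]; ring
    refine (mul_eq_zero.1 h3).resolve_right fun h4 => ?_
    exact hL.prim.pow_ne_one_of_pos_of_lt hn n.2 (sub_eq_zero.1 h4)
  have hp : 0 < p := h.prime.pos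
  have h1 : e 0 0 = c ⟨0, hp⟩ • r 0 := by
    rw [← hc]
    refine Finset.sum_eq_single (⟨0, hp⟩ : Fin p) (fun b _ hb => ?_) (by simp)
    rw [hc0 b fun h0 => hb (Fin.ext h0), zero_smul]
  have hw0 : r 0 = g ^ ((p - 1) * w 0) := by simp [r]
  have hr1 : r 0 = 1 := by
    have h2 := h.g_pow_eq_one_of_mem_inv (m := (p - 1) * w 0) (by rw [← hw0]; exact hr 0)
    rw [hw0, h2]
  obtain ⟨φ, hφ1, hφ⟩ := exists_dual_vanishing he.corep he.linearIndependent
  have h2 := congr_arg φ h1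
  rw [hφ, map_smul, hr1, hφ1, smul_eq_mul, mul_one] at h2
  exact he.ne_zero 0 0 (by rw [h1, ← h2, zero_smul])

end HopfFour

namespace HopfFour

open HopfAlgebra (antipode)

section Pullback

variable {k : Type*} [Field k] {H : Type*} [Ring H] [HopfAlgebra k H]
variable {A : Type*} [Ring A] [Algebra k A]

theorem map_injective {ι : A →ₗ[k] H} (hι : Function.Injective ι) :
    Function.Injective (TensorProduct.map ι ι) :=
  TensorProduct.map_injective_of_flat_flat ι ι hι hι

theorem map_map_injective {ι : A →ₗ[k] H} (hι : Function.Injective ι) :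
    Function.Injective (TensorProduct.map ι (TensorProduct.map ι ι)) :=
  TensorProduct.map_injective_of_flat_flat _ _ hι (map_injective hι)

/-- The coalgebra structure pulled back along an injective map. -/
@[reducible]
noncomputable def coalgebraPullback (ι : A →ₐ[k] H) (hι : Function.Injective ι)
    (δ : A →ₗ[k] A ⊗[k] A)
    (hδ : ∀ a, TensorProduct.map ι.toLinearMap ι.toLinearMap (δ a) =
      Coalgebra.comul (R := k) (ι a)) : Coalgebra k A where
  comul := δ
  counit := Coalgebra.counit ∘ₗ ι.toLinearMap
  coassoc := by
    ext a
    apply map_map_injective (ι := ι.toLinearMap) hι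
    have h1 : ∀ t : A ⊗[k] A, TensorProduct.map ι.toLinearMap
        (TensorProduct.map ι.toLinearMap ι.toLinearMap)
          (TensorProduct.assoc k A A A (δ.rTensor A t)) =
        TensorProduct.assoc k H H H (Coalgebra.comul.rTensor H
          (TensorProduct.map ι.toLinearMap ι.toLinearMap t)) := by
      intro t
      induction t with
      | zero => simp
      | add x y hx hy => simp only [map_add, hx, hy]
      | tmul x y =>
        rw [LinearMap.rTensor_tmul, TensorProduct.map_tmul, LinearMap.rTensor_tmul,
          AlgHom.toLinearMap_apply, ← hδ, TensorProduct.map_map_assoc,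
          TensorProduct.map_tmul]
    have h2 : ∀ t : A ⊗[k] A, TensorProduct.map ι.toLinearMap
        (TensorProduct.map ι.toLinearMap ι.toLinearMap) (δ.lTensor A t) =
        Coalgebra.comul.lTensor H (TensorProduct.map ι.toLinearMap ι.toLinearMap t) := by
      intro t
      induction t with
      | zero => simp
      | add x y hx hy => simp only [map_add, hx, hy]
      | tmul x y => simp [hδ]
    simp only [LinearMap.comp_apply, LinearEquiv.coe_coe]
    rw [h1, h2, hδ, Coalgebra.coassoc_apply]
  rTensor_counit_comp_comul := by
    ext a
    have h1 : ∀ t : A ⊗[k] A, ι.toLinearMap.lTensor k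
        ((Coalgebra.counit ∘ₗ ι.toLinearMap).rTensor A t) =
        Coalgebra.counit.rTensor H (TensorProduct.map ι.toLinearMap ι.toLinearMap t) := by
      intro t
      induction t with
      | zero => simp
      | add x y hx hy => simp only [map_add, hx, hy]
      | tmul x y => simp
    have h2 : Function.Injective (ι.toLinearMap.lTensor k) :=
      Module.Flat.lTensor_preserves_injective_linearMap _ hι
    apply h2
    simp only [LinearMap.comp_apply]
    rw [h1, hδ, Coalgebra.rTensor_counit_comul]
    simp
  lTensor_counit_comp_comul := by
    ext a
    have h1 : ∀ t : A ⊗[k] A, ι.toLinearMap.rTensor k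
        ((Coalgebra.counit ∘ₗ ι.toLinearMap).lTensor A t) =
        Coalgebra.counit.lTensor H (TensorProduct.map ι.toLinearMap ι.toLinearMap t) := by
      intro t
      induction t with
      | zero => simp
      | add x y hx hy => simp only [map_add, hx, hy]
      | tmul x y => simp
    have h2 : Function.Injective (ι.toLinearMap.rTensor k) :=
      Module.Flat.rTensor_preserves_injective_linearMap _ hι
    apply h2
    simp only [LinearMap.comp_apply]
    rw [h1, hδ, Coalgebra.lTensor_counit_comul]
    simp

/-- The bialgebra structure pulled back along an injective algebra map. -/
@[reducible]
noncomputable def bialgebraPullback (ι : A →ₐ[k] H) (hι : Function.Injective ι)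
    (δ : A →ₗ[k] A ⊗[k] A)
    (hδ : ∀ a, TensorProduct.map ι.toLinearMap ι.toLinearMap (δ a) =
      Coalgebra.comul (R := k) (ι a)) : Bialgebra k A :=
  letI := coalgebraPullback ι hι δ hδ
  have hmap : ∀ t, TensorProduct.map ι.toLinearMap ι.toLinearMap t =
    Algebra.TensorProduct.map ι ι t := fun t => rfl
  Bialgebra.mk' k A
    (by change Coalgebra.counit (R := k) (ι 1) = 1; simp)
    (by intro a b
        change Coalgebra.counit (R := k) (ι (a * b)) =
          Coalgebra.counit (R := k) (ι a) * Coalgebra.counit (R := k) (ι b)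
        simp)
    (by change δ 1 = 1
        apply map_injective (ι := ι.toLinearMap) hι
        rw [hδ, hmap]; simp)
    (by intro a b
        change δ (a * b) = δ a * δ b
        apply map_injective (ι := ι.toLinearMap) hι
        rw [hδ, hmap, map_mul ι, Bialgebra.comul_mul, ← hδ, ← hδ, hmap, hmap, map_mul])

/-- The Hopf algebra structure pulled back along an injective algebra map. -/
@[reducible]
noncomputable def hopfPullback (ι : A →ₐ[k] H) (hι : Function.Injective ι)
    (δ : A →ₗ[k] A ⊗[k] A)
    (hδ : ∀ a, TensorProduct.map ι.toLinearMap ι.toLinearMap (δ a) =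
      Coalgebra.comul (R := k) (ι a)) (σ : A →ₗ[k] A) (hσ : ∀ a, ι (σ a) = antipode k (ι a)) :
    HopfAlgebra k A :=
  { bialgebraPullback ι hι δ hδ with
    antipode := σ
    mul_antipode_rTensor_comul := by
      ext a
      apply hι
      have h1 : ∀ t : A ⊗[k] A, ι (LinearMap.mul' k A (σ.rTensor A t)) =
          LinearMap.mul' k H ((antipode k).rTensor H
            (TensorProduct.map ι.toLinearMap ι.toLinearMap t)) := by
        intro t
        induction t with
        | zero => simp
        | add x y hx hy => simp only [map_add, hx, hy]
        | tmul x y => simp [hσ]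
      change ι (LinearMap.mul' k A (σ.rTensor A (δ a))) =
        ι (algebraMap k A (Coalgebra.counit (R := k) (ι a)))
      rw [h1, hδ, HopfAlgebra.mul_antipode_rTensor_comul_apply, AlgHom.commutes]
    mul_antipode_lTensor_comul := by
      ext a
      apply hι
      have h1 : ∀ t : A ⊗[k] A, ι (LinearMap.mul' k A (σ.lTensor A t)) =
          LinearMap.mul' k H ((antipode k).lTensor H
            (TensorProduct.map ι.toLinearMap ι.toLinearMap t)) := by
        intro t
        induction t with
        | zero => simp
        | add x y hx hy => simp only [map_add, hx, hy]
        | tmul x y => simp [hσ]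
      change ι (LinearMap.mul' k A (σ.lTensor A (δ a))) =
        ι (algebraMap k A (Coalgebra.counit (R := k) (ι a)))
      rw [h1, hδ, HopfAlgebra.mul_antipode_lTensor_comul_apply, AlgHom.commutes] }

end Pullback

section Subalgebra

universe u

variable {k : Type*} [Field k] {H : Type u} [Ring H] [HopfAlgebra k H]

theorem exists_hopfAlgebra (A : Subalgebra k H) (hl : IsLC (Subalgebra.toSubmodule A))
    (hr : IsRC (Subalgebra.toSubmodule A)) (hS : ∀ a ∈ A, antipode k a ∈ A) :
    ∃ (B : Type u) (_ : Ring B) (_ : HopfAlgebra k B) (i : B →ₐc[k] H),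
      Function.Injective i ∧ ∀ h, h ∈ A ↔ ∃ b, i b = h := by
  have hι : Function.Injective A.val := Subtype.val_injective
  have hsub : ∀ a : A, Coalgebra.comul (R := k) (a : H) ∈
      LinearMap.range (TensorProduct.map A.val.toLinearMap A.val.toLinearMap) :=
    fun a => isSubcoalg_of_isLC_isRC hl hr a a.2
  let E := LinearEquiv.ofInjective _ (map_injective (ι := A.val.toLinearMap) hι)
  let δ : A →ₗ[k] A ⊗[k] A := E.symm.toLinearMap ∘ₗ
    (Coalgebra.comul ∘ₗ A.val.toLinearMap).codRestrict _ hsub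
  have hδ : ∀ a, TensorProduct.map A.val.toLinearMap A.val.toLinearMap (δ a) =
      Coalgebra.comul (R := k) (A.val a) := by
    intro a
    have h1 := congr_arg Subtype.val (E.apply_symm_apply
      ((Coalgebra.comul ∘ₗ A.val.toLinearMap).codRestrict _ hsub a))
    exact h1
  let σ : A →ₗ[k] A := ((antipode k) ∘ₗ A.val.toLinearMap).codRestrict
    (Subalgebra.toSubmodule A) fun a => hS a a.2
  let inst := hopfPullback A.val hι δ hδ σ fun a => rfl
  refine ⟨A, inferInstance, inst, BialgHom.ofAlgHom A.val ?_ ?_, hι, fun h =>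
    ⟨fun hh => ⟨⟨h, hh⟩, rfl⟩, ?_⟩⟩
  · ext a; rfl
  · ext a; exact hδ a
  · rintro ⟨b, rfl⟩; exact b.2

variable {p : ℕ} {q : k} {χ : H →ₐ[k] k} {f : H →ₗ[k] k}

/-- The largest subcoalgebra on which `f` vanishes; it is a Hopf subalgebra when `f` is
skew-primitive. -/
def TaftFun.vanishing (h : TaftFun p q χ f) : Subalgebra k H where
  carrier := {a | ∃ D : Submodule k H, IsLC D ∧ IsRC D ∧ a ∈ D ∧ ∀ d ∈ D, f d = 0}
  mul_mem' := by
    rintro a b ⟨D, hDl, hDr, ha, hD⟩ ⟨E, hEl, hEr, hb, hE⟩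
    refine ⟨D * E, ?_, ?_, Submodule.mul_mem_mul ha hb, ?_⟩
    · intro φ v hv
      induction hv using Submodule.mul_induction_on' with
      | mem_mul_mem m hm n hn =>
        obtain ⟨s, hs⟩ := exists_comul_of_isSubcoalg (isSubcoalg_of_isLC_isRC hDl hDr) hm
        rw [lc_mul_left hs]
        exact sum_mem fun i _ => Submodule.mul_mem_mul i.2.2 (hEl _ n hn)
      | add x _ y _ hx hy => rw [map_add]; exact add_mem hx hy
    · intro φ v hv
      induction hv using Submodule.mul_induction_on' with
      | mem_mul_mem m hm n hn =>
        obtain ⟨s, hs⟩ := exists_comul_of_isSubcoalg (isSubcoalg_of_isLC_isRC hDl hDr) hm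
        rw [rc_mul_left hs]
        exact sum_mem fun i _ => Submodule.mul_mem_mul i.1.2 (hEr _ n hn)
      | add x _ y _ hx hy => rw [map_add]; exact add_mem hx hy
    · intro d hd
      induction hd using Submodule.mul_induction_on' with
      | mem_mul_mem m hm n hn => rw [h.map_mul, hD m hm, hE n hn]; simp
      | add x _ y _ hx hy => rw [map_add, hx, hy, add_zero]
  add_mem' := by
    rintro a b ⟨D, hDl, hDr, ha, hD⟩ ⟨E, hEl, hEr, hb, hE⟩
    refine ⟨D ⊔ E, ?_, ?_, add_mem (Submodule.mem_sup_left ha) (Submodule.mem_sup_right hb), ?_⟩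
    · intro φ v hv
      obtain ⟨x, hx, y, hy, rfl⟩ := Submodule.mem_sup.1 hv
      rw [map_add]
      exact Submodule.add_mem_sup (hDl _ x hx) (hEl _ y hy)
    · intro φ v hv
      obtain ⟨x, hx, y, hy, rfl⟩ := Submodule.mem_sup.1 hv
      rw [map_add]
      exact Submodule.add_mem_sup (hDr _ x hx) (hEr _ y hy)
    · intro d hd
      obtain ⟨x, hx, y, hy, rfl⟩ := Submodule.mem_sup.1 hd
      rw [map_add, hD x hx, hE y hy, add_zero]
  algebraMap_mem' := by
    intro c
    refine ⟨Submodule.span k {1}, ?_, ?_, ?_, ?_⟩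
    · intro φ v hv
      obtain ⟨c, rfl⟩ := Submodule.mem_span_singleton.1 hv
      rw [map_smul, lc_one]
      exact Submodule.smul_mem _ _ (Submodule.smul_mem _ _ (Submodule.mem_span_singleton_self _))
    · intro φ v hv
      obtain ⟨c, rfl⟩ := Submodule.mem_span_singleton.1 hv
      rw [map_smul, rc_one]
      exact Submodule.smul_mem _ _ (Submodule.smul_mem _ _ (Submodule.mem_span_singleton_self _))
    · rw [Algebra.algebraMap_eq_smul_one]
      exact Submodule.smul_mem _ _ (Submodule.mem_span_singleton_self _)
    · intro d hd
      obtain ⟨c, rfl⟩ := Submodule.mem_span_singleton.1 hd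
      rw [map_smul, h.map_one, smul_zero]

variable [FiniteDimensional k H]

theorem rc_antipode (φ : H →ₗ[k] k) (a : H) :
    rc φ (antipode k a) = antipode k (lc (φ ∘ₗ antipode k) a) := by
  refine corep_induction (k := k) (P := fun a => rc φ (antipode k a) =
      antipode k (lc (φ ∘ₗ antipode k) a)) (by simp)
      (fun x y hx hy => by simp [hx, hy]) (fun c x hx => by simp [hx]) (fun n u hu i j => ?_) a
  have := hu.antipode.rc φ j i
  simp only [Matrix.of_apply] at this
  rw [this, hu.lc]
  simp

theorem lc_antipode (φ : H →ₗ[k] k) (a : H) :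
    lc φ (antipode k a) = antipode k (rc (φ ∘ₗ antipode k) a) := by
  refine corep_induction (k := k) (P := fun a => lc φ (antipode k a) =
      antipode k (rc (φ ∘ₗ antipode k) a)) (by simp)
      (fun x y hx hy => by simp [hx, hy]) (fun c x hx => by simp [hx]) (fun n u hu i j => ?_) a
  have := hu.antipode.lc φ j i
  simp only [Matrix.of_apply] at this
  rw [this, hu.rc]
  simp

theorem TaftFun.antipode_mem_vanishing (h : TaftFun p q χ f) {a : H} (ha : a ∈ h.vanishing) :
    antipode k a ∈ h.vanishing := by
  obtain ⟨D, hDl, hDr, ha, hD⟩ := ha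
  refine ⟨D.map (antipode k), ?_, ?_, ⟨a, ha, rfl⟩, ?_⟩
  · rintro φ _ ⟨d, hd, rfl⟩
    exact ⟨_, hDr (φ ∘ₗ antipode k) d hd, (lc_antipode _ _).symm⟩
  · rintro φ _ ⟨d, hd, rfl⟩
    exact ⟨_, hDl (φ ∘ₗ antipode k) d hd, (rc_antipode _ _).symm⟩
  · rintro _ ⟨d, hd, rfl⟩
    have h1 := LinearMap.congr_fun h.comp_antipode d
    rw [LinearMap.comp_apply] at h1
    rw [h1, LinearMap.neg_apply, conv_apply', hD _ (hDl _ d hd)]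
    simp

theorem TaftFun.exists_hopf_vanishing (h : TaftFun p q χ f) :
    ∃ (B : Type u) (_ : Ring B) (_ : HopfAlgebra k B) (i : B →ₐc[k] H),
      Function.Injective i ∧ (∀ b, rc f (i b) = 0) ∧
      ∀ D : Submodule k H, IsLC D → IsRC D → (∀ d ∈ D, f d = 0) → ∀ d ∈ D, ∃ b, i b = d := by
  obtain ⟨B, i1, i2, i, hi, hA⟩ := exists_hopfAlgebra h.vanishing
    (fun φ v ⟨D, hDl, hDr, hv, hD⟩ => ⟨D, hDl, hDr, hDl φ v hv, hD⟩)
    (fun φ v ⟨D, hDl, hDr, hv, hD⟩ => ⟨D, hDl, hDr, hDr φ v hv, hD⟩)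
    (fun a ha => h.antipode_mem_vanishing ha)
  refine ⟨B, i1, i2, i, hi, fun b => ?_, fun D hDl hDr hD d hd =>
    (hA d).1 ⟨D, hDl, hDr, hd, hD⟩⟩
  obtain ⟨D, hDl, hDr, hb, hD⟩ := (hA (i b)).2 ⟨b, rfl⟩
  refine eq_of_forall_dual (k := k) fun φ => ?_
  rw [apply_rc, hD _ (hDl _ _ hb), map_zero]

end Subalgebra

end HopfFour

namespace HopfFour

open HopfAlgebra (antipode)

namespace TaftPair

variable {k : Type*} [Field k] {H : Type*} [Ring H] [HopfAlgebra k H]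

/-- The averaging operator of the functional `χ` over its first `p` powers. -/
noncomputable def avg (p : ℕ) (χ : H →ₐ[k] k) : H →ₗ[k] H :=
  (p : k)⁻¹ • ∑ i ∈ Finset.range p, rc χ.toLinearMap ^ i

theorem avg_apply (p : ℕ) (χ : H →ₐ[k] k) (a : H) :
    avg p χ a = (p : k)⁻¹ • ∑ i ∈ Finset.range p, (rc χ.toLinearMap ^ i) a := by
  simp [avg]

theorem rc_pow_lc (χ φ : H →ₗ[k] k) (i : ℕ) (a : H) :
    (rc χ ^ i) (lc φ a) = lc φ ((rc χ ^ i) a) := by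
  induction i with
  | zero => rfl
  | succ i ih => rw [pow_succ', Module.End.mul_apply, ih, rc_lc, Module.End.mul_apply]

theorem avg_lc (p : ℕ) (χ : H →ₐ[k] k) (φ : H →ₗ[k] k) (a : H) :
    avg p χ (lc φ a) = lc φ (avg p χ a) := by
  simp only [avg_apply, rc_pow_lc, map_smul, map_sum]

variable [CharZero k]
variable {p : ℕ} {q : k} {g x : H} {χ : H →ₐ[k] k} {f : H →ₗ[k] k}
  (h : TaftPair p q g x χ f)
include h

theorem natCast_ne_zero : (p : k) ≠ 0 := Nat.cast_ne_zero.2 h.prime.ne_zero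

theorem avg_of_fixed {a : H} (ha : rc χ.toLinearMap a = a) : avg p χ a = a := by
  rw [avg_apply, Finset.sum_congr rfl fun i _ =>
    (h.G_pow_eigen (c := 1) (by rw [ha, one_smul]) i).trans (by rw [one_pow, one_smul])]
  rw [Finset.sum_const, Finset.card_range, ← Nat.cast_smul_eq_nsmul k, smul_smul,
    inv_mul_cancel₀ h.natCast_ne_zero, one_smul]

theorem avg_of_eigen {a : H} {i : ℕ} (ha : rc χ.toLinearMap a = q ^ i • a) (hi : q ^ i ≠ 1) :
    avg p χ a = 0 := by
  rw [avg_apply, Finset.sum_congr rfl fun s _ => h.G_pow_eigen ha s, ← Finset.sum_smul]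
  have h1 : (∑ s ∈ Finset.range p, (q ^ i) ^ s) * (q ^ i - 1) = 0 := by
    rw [geom_sum_mul, ← pow_mul, mul_comm, pow_mul, h.prim.pow_eq_one, one_pow, sub_self]
  rw [(mul_eq_zero.1 h1).resolve_right (sub_ne_zero.2 hi), zero_smul, smul_zero]

theorem G_avg (a : H) : rc χ.toLinearMap (avg p χ a) = avg p χ a := by
  have h1 := h.G_proj 0 a
  simp only [pow_zero, one_pow, one_smul] at h1
  rw [avg_apply, map_smul, h1]

theorem avg_mem_inv {a : H} (ha : rc f a = 0) : avg p χ a ∈ inv χ f := by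
  refine ⟨?_, h.G_avg a⟩
  rw [avg_apply, map_smul, map_sum,
    Finset.sum_eq_zero fun s _ => h.G_pow_mem_ker ha s, smul_zero]

theorem G_pow_mul (i : ℕ) (a b : H) : (rc χ.toLinearMap ^ i) (a * b) =
    (rc χ.toLinearMap ^ i) a * (rc χ.toLinearMap ^ i) b := by
  induction i with
  | zero => rfl
  | succ i ih =>
    simp only [pow_succ', Module.End.mul_apply]
    rw [ih, h.G_mul]

theorem avg_mul {r : H} (hr : r ∈ inv χ f) (a : H) : avg p χ (r * a) = r * avg p χ a := by
  rw [avg_apply, avg_apply, mul_smul_comm, Finset.mul_sum]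
  congr 1
  refine Finset.sum_congr rfl fun i _ => ?_
  rw [h.G_pow_mul, h.G_pow_eigen (c := 1) (by rw [hr.2, one_smul]), one_pow, one_smul]

theorem g_mem_ker (i : ℕ) : g ^ i ∈ LinearMap.ker (rc f) := h.X_g_pow i

theorem nondeg_avg {ℓ : H →ₗ[k] k}
    (hnd : ∀ s ∈ inv χ f, (∀ r ∈ inv χ f, ℓ (r * s) = 0) → s = 0) {s : H} (hs : rc f s = 0)
    (h0 : ∀ r, rc f r = 0 → ℓ (avg p χ (r * s)) = 0) : s = 0 := by
  obtain ⟨t, ht, rfl⟩ := h.exists_eq_sum_g_mul hs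
  refine Finset.sum_eq_zero fun j hj => ?_
  suffices t j = 0 by rw [this, mul_zero]
  refine hnd _ (ht j) fun r hr => ?_
  have h1 := h0 (r * g ^ ((p - 1) * j)) (h.mul_mem_ker hr.1 (h.X_g_pow _))
  rw [Finset.mul_sum, map_sum, map_sum, Finset.sum_eq_single j] at h1
  · rwa [mul_assoc, ← mul_assoc _ (g ^ j), h.g_pow_mul_g_pow', one_mul,
      h.avg_of_fixed (h.mul_mem_inv hr (ht j)).2] at h1
  · intro i hi hij
    rw [h.avg_of_eigen (i := (p - 1) * j + i), map_zero]
    · rw [mul_assoc, ← mul_assoc _ (g ^ i), ← pow_add, ← mul_assoc, h.G_mul, h.inv_mul_g hr,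
        (ht i).2, smul_mul_assoc]
    · intro h2
      apply hij
      have h3 := h.q_pow_mul_q_pow j
      rw [pow_add, mul_comm, ← h3] at h2
      exact h.prim.pow_inj (Finset.mem_range.1 hi) (Finset.mem_range.1 hj)
        (mul_right_cancel₀ (pow_ne_zero _ h.q_ne_zero) h2)
  · intro hj'; exact absurd hj hj'

theorem exists_ker_trace {ℓ : H →ₗ[k] k} {Λ : H} (h1 : ℓ 1 = 1)
    (hl : ∀ r ∈ inv χ f, rc ℓ r = ℓ r • 1)
    (hnd : ∀ s ∈ inv χ f, (∀ r ∈ inv χ f, ℓ (r * s) = 0) → s = 0) (hΛ : Λ ∈ inv χ f)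
    (hΛℓ : ∀ r ∈ inv χ f, ℓ (r * Λ) = Coalgebra.counit (R := k) r)
    (hΛε : Coalgebra.counit (R := k) Λ ≠ 0) :
    ∃ (ℓ' : H →ₗ[k] k) (c : k), ℓ' 1 = 1 ∧ c ≠ 0 ∧ (∀ r, rc f r = 0 → rc ℓ' r = ℓ' r • 1) ∧
      ∀ s (F : LinearMap.ker (rc f) →ₗ[k] LinearMap.ker (rc f)),
        (∀ r, (F r : H) = s * antipode k (antipode k (r : H))) →
        LinearMap.trace k _ F = c * ℓ' s := by
  have hfd := h.finiteDimensional
  have hrc : ∀ r, rc f r = 0 → rc (ℓ ∘ₗ avg p χ) r = ℓ (avg p χ r) • (1 : H) := by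
    intro r hr
    refine eq_of_forall_dual (k := k) fun φ => ?_
    rw [apply_rc, LinearMap.comp_apply, avg_lc, ← apply_rc, hl _ (h.avg_mem_inv hr)]
  obtain ⟨Λ', hΛ', hintg, hℓ', -, htr⟩ := exists_integral_trace (R := LinearMap.ker (rc f))
    (ℓ := ℓ ∘ₗ avg p χ) (a := (1 : H)) h.X_one
    (fun r hr s hs => h.mul_mem_ker hr hs) h.isLC_ker
    (fun r hr => by
      rw [LinearMap.mem_ker] at hr ⊢
      rw [h.X_antipode_sq, hr]; simp) IsGL.one hrc
    (fun s hs h0 => h.nondeg_avg hnd hs h0)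
  refine ⟨ℓ ∘ₗ avg p χ, Coalgebra.counit (R := k) Λ', ?_, ?_, hrc, fun s F hF => ?_⟩
  · rw [LinearMap.comp_apply, h.avg_of_fixed h.G_one, h1]
  · have h2 : avg p χ Λ' = Λ := by
      refine sub_eq_zero.1 (hnd _ (sub_mem (h.avg_mem_inv hΛ') hΛ) fun r hr => ?_)
      have h3 := hℓ' r hr.1
      rw [LinearMap.comp_apply, h.avg_mul hr] at h3
      rw [mul_sub, map_sub, h3, hΛℓ r hr, sub_self]
    have h3 : ∀ i ∈ Finset.range p, i ≠ 0 →
        Coalgebra.counit (R := k) ((rc χ.toLinearMap ^ i) Λ') = 0 := by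
      intro i hi h0
      have h4 := hintg g (by simpa using h.g_mem_ker 1)
      rw [h.gl.2, one_smul] at h4
      have h5 := congr_arg (fun y => Coalgebra.counit (R := k) ((rc χ.toLinearMap ^ i) y)) h4
      rw [h.G_pow_mul, h.G_pow_eigen (a := g) (c := q) (by simpa using h.G_g_pow 1),
        Bialgebra.counit_mul, map_smul, h.gl.2, smul_eq_mul, mul_one] at h5
      by_contra h6
      exact h0 (h.prim.pow_inj (Finset.mem_range.1 hi) h.prime.pos
        (by rw [pow_zero]; exact mul_right_cancel₀ h6 (h5.trans (one_mul _).symm)))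
    intro h4
    apply hΛε
    rw [← h2, avg_apply, map_smul, map_sum, Finset.sum_eq_zero fun i hi => ?_, smul_zero]
    by_cases hi0 : i = 0
    · subst hi0; exact h4
    · exact h3 i hi hi0
  · have := htr s F hF
    rwa [mul_one] at this

end TaftPair

end HopfFour

namespace HopfFour

open HopfAlgebra (antipode)

variable {k : Type*} [Field k] {H : Type*} [Ring H] [HopfAlgebra k H]
variable {B : Type*} [Ring B] [HopfAlgebra k B]

theorem IsCorep.map {ι : Type*} [Fintype ι] [DecidableEq ι] {u : Matrix ι ι B}
    (hu : IsCorep k u) (i : B →ₐc[k] H) : IsCorep k (u.map i) := by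
  constructor
  · intro a b
    rw [Matrix.map_apply, ← CoalgHomClass.map_comp_comul_apply, hu.comul_apply]
    simp
  · intro a b
    rw [Matrix.map_apply, CoalgHomClass.counit_comp_apply, hu.counit_apply]

theorem map_antipode [FiniteDimensional k B] (i : B →ₐc[k] H) (b : B) :
    i (antipode k b) = antipode k (i b) := by
  refine corep_induction (k := k) (P := fun b => i (antipode k b) = antipode k (i b)) (by simp)
      (fun x y hx hy => by simp [hx, hy]) (fun c x hx => by simp [hx]) (fun n u hu a b => ?_) b
  have hv := hu.map i
  have h1 : (Matrix.of fun a b => i (antipode k (u a b))) * u.map i = 1 := by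
    ext a b
    have h2 := congr_arg i (hu.sum_antipode_mul a b)
    rw [map_sum] at h2
    rw [Matrix.mul_apply, Matrix.one_apply]
    simp only [Matrix.of_apply, Matrix.map_apply, ← map_mul]
    rw [h2]
    split_ifs <;> simp
  have h3 : u.map i * (Matrix.of fun a b => antipode k (u.map i a b)) = 1 := by
    ext a b
    rw [Matrix.mul_apply, Matrix.one_apply]
    simpa using hv.sum_mul_antipode a b
  have h4 := left_inv_eq_right_inv h1 h3
  exact congr_fun (congr_fun h4 a) b

/-- A normalised integral on `B` together with an integral in `B` of nonzero counit. -/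
structure IsBisemisimple (ℓ : B →ₗ[k] k) (Λ : B) : Prop where
  map_one : ℓ 1 = 1
  isLeftInt : IsLeftInt ℓ
  mul_eq : ∀ b, b * Λ = Coalgebra.counit (R := k) b • Λ
  apply_mul : ∀ b, ℓ (b * Λ) = Coalgebra.counit (R := k) b
  counit_ne_zero : Coalgebra.counit (R := k) Λ ≠ 0
  trace_eq : ∀ s (F : B →ₗ[k] B), (∀ r, F r = s * antipode k (antipode k r)) →
    LinearMap.trace k B F = Coalgebra.counit (R := k) Λ * ℓ s

variable {p : ℕ} {q : k} {g x : H} {χ : H →ₐ[k] k} {f : H →ₗ[k] k}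

theorem TaftPair.exists_isBisemisimple [CharZero k] [IsAlgClosed k] [FiniteDimensional k B]
    (h : TaftPair p q g x χ f)
    {i : B →ₐc[k] H} (hi : Function.Injective i) (hB : ∀ b, rc f (i b) = 0)
    {ℓ' : H →ₗ[k] k} {c : k} (h1 : ℓ' 1 = 1) (hc : c ≠ 0)
    (hl : ∀ r, rc f r = 0 → rc ℓ' r = ℓ' r • 1)
    (htr : ∀ s (F : LinearMap.ker (rc f) →ₗ[k] LinearMap.ker (rc f)),
        (∀ r, (F r : H) = s * antipode k (antipode k (r : H))) →
        LinearMap.trace k _ F = c * ℓ' s) :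
    ∃ (ℓ : B →ₗ[k] k) (Λ : B), IsBisemisimple ℓ Λ := by
  have hfd := h.finiteDimensional
  have hℓ : IsLeftInt (ℓ' ∘ₗ (i : B →ₗc[k] H).toLinearMap) := by
    intro b
    apply hi
    rw [map_rc_comp, hl _ (hB b), map_smul, _root_.map_one]
    rfl
  set ℓ : B →ₗ[k] k := ℓ' ∘ₗ (i : B →ₗc[k] H).toLinearMap with hℓd
  have hℓi : ∀ b, ℓ b = ℓ' (i b) := fun b => rfl
  have hℓ1 : ℓ 1 = 1 := by rw [hℓi, _root_.map_one, h1]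
  have hℓ0 : ℓ ≠ 0 := by rintro h0; rw [h0] at hℓ1; exact one_ne_zero hℓ1.symm
  obtain ⟨Λ, -, hintg, hℓΛ, -, htr'⟩ := exists_integral_trace (R := (⊤ : Submodule k B))
    (ℓ := ℓ) (a := (1 : B)) trivial (fun _ _ _ _ => trivial) (fun _ _ _ => trivial)
    (fun _ _ => trivial) IsGL.one (fun r _ => hℓ r)
    (fun s _ h0 => hℓ.nondeg hℓ0 fun r => h0 r trivial)
  refine ⟨ℓ, Λ, hℓ1, hℓ, fun b => hintg b trivial, fun b => hℓΛ b trivial, ?_, fun s F hF => ?_⟩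
  · intro h0
    obtain ⟨s, hs⟩ := exists_antipode_pow_eq_one h.prime h.finrank_eq
    have hSn : ∀ (n : ℕ) (b : B), i ((antipode k ^ n) b) = (antipode k ^ n) (i b) := by
      intro n b
      induction n with
      | zero => rfl
      | succ n ih => rw [pow_succ', Module.End.mul_apply, map_antipode, ih, pow_succ', Module.End.mul_apply]
    have hεn : ∀ (n : ℕ) (b : B), Coalgebra.counit (R := k) ((antipode k ^ n) b) =
        Coalgebra.counit (R := k) b := by
      intro n b
      induction n with
      | zero => rfl
      | succ n ih => rw [pow_succ', Module.End.mul_apply, HopfAlgebra.counit_antipode, ih]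
    obtain ⟨m, hm⟩ : ∃ m, 4 * p ^ s = m + 2 := ⟨4 * p ^ s - 2, by
      have := pow_pos h.prime.pos s; omega⟩
    have hΛ2 : antipode k (antipode k ((antipode k ^ m) Λ)) = Λ := by
      apply hi
      have h2 : antipode k (antipode k ((antipode k ^ m) Λ)) = (antipode k ^ (m + 2)) Λ := by
        rw [pow_succ', pow_succ']; rfl
      rw [h2, hSn, ← hm, hs]; rfl
    have hsq : Λ * antipode k (antipode k Λ) = 0 := by
      have h2 : antipode k (antipode k ((antipode k ^ m) Λ * Λ)) = 0 := by
        rw [hintg _ trivial, hεn, h0]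
        simp
      rwa [HopfAlgebra.antipode_mul_antidistrib, HopfAlgebra.antipode_mul_antidistrib, hΛ2] at h2
    have hmem : ∀ r ∈ LinearMap.ker (rc f),
        i Λ * antipode k (antipode k r) ∈ LinearMap.ker (rc f) := by
      intro r hr
      refine h.mul_mem_ker (hB Λ) ?_
      rw [h.X_antipode_sq, LinearMap.mem_ker.1 hr, map_zero, map_zero, smul_zero]
    let F : LinearMap.ker (rc f) →ₗ[k] LinearMap.ker (rc f) :=
      ((LinearMap.mulLeft k (i Λ)) ∘ₗ antipode k ∘ₗ antipode k).restrict hmem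
    have hF : F ^ 2 = 0 := by
      ext r
      rw [pow_two]
      change i Λ * antipode k (antipode k (i Λ * antipode k (antipode k (r : H)))) = 0
      rw [HopfAlgebra.antipode_mul_antidistrib, HopfAlgebra.antipode_mul_antidistrib,
        ← map_antipode, ← map_antipode, ← mul_assoc, ← map_mul, hsq, map_zero, zero_mul]
    have h3 := (LinearMap.isNilpotent_trace_of_isNilpotent ⟨2, hF⟩ :
      IsNilpotent (LinearMap.trace k _ F)).eq_zero
    rw [htr (i Λ) F fun r => rfl, ← hℓi] at h3
    have h4 := hℓΛ 1 trivial
    rw [one_mul, (mul_eq_zero.1 h3).resolve_left hc] at h4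
    simp at h4
  · have h2 := htr' s ((Submodule.topEquiv (R := k) (M := B)).symm.conj F) fun r => by
      rw [← hF]; rfl
    rwa [LinearMap.trace_conj', mul_one] at h2

end HopfFour

namespace HopfFour

open HopfAlgebra (antipode)

variable {k : Type*} [Field k] {B : Type*} [Ring B] [HopfAlgebra k B]

section Trace

variable {V : Type*} [AddCommGroup V] [Module k V] [FiniteDimensional k V]

theorem exists_trace_eq_natCast {P : V →ₗ[k] V} (hP : P * P = P) :
    ∃ m : ℕ, LinearMap.trace k V P = m :=
  ⟨_, ((LinearMap.isProj_range_iff_isIdempotentElem P).2 hP).trace⟩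

theorem eq_zero_of_trace_eq_zero [CharZero k] {P : V →ₗ[k] V} (hP : P * P = P)
    (h : LinearMap.trace k V P = 0) : P = 0 := by
  have h1 := ((LinearMap.isProj_range_iff_isIdempotentElem P).2 hP).trace
  rw [h, eq_comm, Nat.cast_eq_zero, Submodule.finrank_eq_zero, LinearMap.range_eq_bot] at h1
  exact h1

theorem exists_trace_eq_intCast [CharZero k] {F : V →ₗ[k] V} (hF : F * F * F = F) :
    ∃ m : ℤ, LinearMap.trace k V F = m := by
  have h2 : (2 : k) ≠ 0 := two_ne_zero
  have h4 : F * F * (F * F) = F * F := by rw [← mul_assoc, hF]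
  have h3 : F * (F * F) = F := by rw [← mul_assoc, hF]
  obtain ⟨a, ha⟩ := exists_trace_eq_natCast (P := (2⁻¹ : k) • (F * F + F)) (by
    rw [smul_mul_smul_comm, add_mul, mul_add, mul_add, h4, hF, h3, mul_smul,
      show F * F + F + (F + F * F) = (2 : k) • (F * F + F) by module, smul_smul 2⁻¹ 2,
      inv_mul_cancel₀ h2, one_smul])
  obtain ⟨b, hb⟩ := exists_trace_eq_natCast (P := (2⁻¹ : k) • (F * F - F)) (by
    rw [smul_mul_smul_comm, sub_mul, mul_sub, mul_sub, h4, hF, h3, mul_smul,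
      show F * F - F - (F - F * F) = (2 : k) • (F * F - F) by module, smul_smul 2⁻¹ 2,
      inv_mul_cancel₀ h2, one_smul])
  refine ⟨a - b, ?_⟩
  push_cast
  rw [← ha, ← hb, ← map_sub]
  congr 1
  rw [← smul_sub, show F * F + F - (F * F - F) = (2 : k) • F by module, smul_smul,
    inv_mul_cancel₀ h2, one_smul]

theorem eq_one_of_trace_eq_mul [CharZero k] {U : V →ₗ[k] V} (hU : U * U = 1) (h1 : U ≠ -1) {m : ℤ}
    (hm : m ≠ 0) (h : LinearMap.trace k V U = Module.finrank k V * m) : U = 1 := by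
  have h2 : (2 : k) ≠ 0 := two_ne_zero
  have hP : ((2⁻¹ : k) • (1 + U)) * ((2⁻¹ : k) • (1 + U)) = (2⁻¹ : k) • (1 + U) := by
    rw [smul_mul_smul_comm, add_mul, mul_add, mul_add, hU, mul_smul, one_mul, one_mul, mul_one,
      show 1 + U + (U + 1) = (2 : k) • (1 + U) by module, smul_smul 2⁻¹ 2,
      inv_mul_cancel₀ h2, one_smul]
  have hN : ((2⁻¹ : k) • (1 - U)) * ((2⁻¹ : k) • (1 - U)) = (2⁻¹ : k) • (1 - U) := by
    rw [smul_mul_smul_comm, sub_mul, mul_sub, mul_sub, hU, mul_smul, one_mul, one_mul, mul_one,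
      show 1 - U - (U - 1) = (2 : k) • (1 - U) by module, smul_smul 2⁻¹ 2,
      inv_mul_cancel₀ h2, one_smul]
  obtain ⟨a, ha⟩ := exists_trace_eq_natCast hP
  obtain ⟨b, hb⟩ := exists_trace_eq_natCast hN
  have hab : (a : k) + b = Module.finrank k V := by
    rw [← ha, ← hb, ← map_add, ← smul_add, show (1 : V →ₗ[k] V) + U + (1 - U) = (2 : k) • 1 by
      module, smul_smul, inv_mul_cancel₀ h2, one_smul, LinearMap.trace_one]
  have hab' : (a : k) - b = Module.finrank k V * m := by
    rw [← ha, ← hb, ← map_sub, ← smul_sub, show (1 : V →ₗ[k] V) + U - (1 - U) = (2 : k) • U by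
      module, smul_smul, inv_mul_cancel₀ h2, one_smul, h]
  have e1 : (a : ℤ) + b = Module.finrank k V := by exact_mod_cast hab
  have e2 : (a : ℤ) - b = Module.finrank k V * m := by exact_mod_cast hab'
  rcases lt_or_gt_of_ne hm with hm | hm
  · have ha0 : a = 0 := by nlinarith
    rw [ha0, Nat.cast_zero] at ha
    have h3 := eq_zero_of_trace_eq_zero hP ha
    rw [smul_eq_zero, inv_eq_zero, or_iff_right h2] at h3
    exact absurd (eq_neg_of_add_eq_zero_right h3) h1
  · have hb0 : b = 0 := by nlinarith
    rw [hb0, Nat.cast_zero] at hb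
    have h3 := eq_zero_of_trace_eq_zero hN hb
    rw [smul_eq_zero, inv_eq_zero, or_iff_right h2] at h3
    exact (sub_eq_zero.1 h3).symm

end Trace

section RegularCharacter

variable (k B) in
theorem exists_regular_character [FiniteDimensional k B] :
    ∃ (n : ℕ) (u : Matrix (Fin n) (Fin n) B), IsCorep k u ∧ n = Module.finrank k B ∧
      ∀ φ : B →ₗ[k] k, φ (∑ i, u i i) = LinearMap.trace k B (lc φ) := by
  obtain ⟨u, hu, -, hlc, -⟩ := exists_corep_of_basis (Module.finBasis k B)
  refine ⟨_, u, hu, rfl, fun φ => ?_⟩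
  rw [map_sum, LinearMap.trace_eq_matrix_trace k (Module.finBasis k B), Matrix.trace]
  refine Finset.sum_congr rfl fun i _ => ?_
  rw [Matrix.diag_apply, LinearMap.toMatrix_apply, hlc, map_sum, Finset.sum_apply']
  simp [Finsupp.single_apply]

theorem IsCorep.rc_sum_diag {ι : Type*} [Fintype ι] [DecidableEq ι] {u : Matrix ι ι B}
    (hu : IsCorep k u) (φ : B →ₗ[k] k) : HopfFour.rc φ (∑ i, u i i) = HopfFour.lc φ (∑ i, u i i) := by
  simp only [map_sum, hu.rc, hu.lc]
  rw [Finset.sum_comm]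

theorem lc_comp_mulRight [FiniteDimensional k B] {ι : Type*} {s : Finset ι} {y : B} {z w : ι → B}
    (e : Coalgebra.comul (R := k) y = ∑ i ∈ s, z i ⊗ₜ[k] w i) (φ : B →ₗ[k] k) (b : B) :
    lc (φ ∘ₗ LinearMap.mulRight k y) b =
      ∑ i ∈ s, lc φ (b * z i) * antipode k (w i) := by
  have h1 : ∀ y : B, lc (φ ∘ₗ LinearMap.mulRight k y) b =
      (LinearMap.mul' k B ∘ₗ TensorProduct.map (lc φ ∘ₗ LinearMap.mulLeft k b) (antipode k))
        (Coalgebra.comul y) := by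
    have h0 : ∀ y y' : B, φ ∘ₗ LinearMap.mulRight k (y + y') =
        φ ∘ₗ LinearMap.mulRight k y + φ ∘ₗ LinearMap.mulRight k y' := by
      intro y y'; ext; simp [mul_add]
    have h0' : ∀ (c : k) (y : B), φ ∘ₗ LinearMap.mulRight k (c • y) =
        c • (φ ∘ₗ LinearMap.mulRight k y) := by
      intro y y'; ext; simp
    intro y
    refine corep_induction (k := k) (P := fun y => lc (φ ∘ₗ LinearMap.mulRight k y) b =
      (LinearMap.mul' k B ∘ₗ TensorProduct.map (lc φ ∘ₗ LinearMap.mulLeft k b) (antipode k))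
        (Coalgebra.comul y)) ?_ ?_ ?_ ?_ y
    · simp
    · intro y y' h h'
      rw [h0, lc_add, h, h', map_add, map_add]
    · intro c y h
      rw [h0', lc_smul, h, map_smul, map_smul]
    · intro n u hu i j
      rw [hu.comul_apply, map_sum]
      simp only [LinearMap.comp_apply, TensorProduct.map_tmul, LinearMap.mul'_apply,
        LinearMap.mulLeft_apply]
      simp_rw [lc_mul_right (hu.comul_apply i _), Finset.sum_mul]
      rw [Finset.sum_comm]
      simp_rw [mul_assoc, ← Finset.mul_sum, hu.sum_mul_antipode]
      simp
  rw [h1, e, map_sum]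
  simp

theorem regular_character_mul [FiniteDimensional k B] {X : B}
    (hX : ∀ φ : B →ₗ[k] k, φ X = LinearMap.trace k B (lc φ)) {ι : Type*} {s : Finset ι} {y : B}
    {z w : ι → B} (e : Coalgebra.comul (R := k) y = ∑ i ∈ s, z i ⊗ₜ[k] w i)
    (hy : ∑ i ∈ s, antipode k (w i) * z i = Coalgebra.counit (R := k) y • 1) :
    X * y = Coalgebra.counit (R := k) y • X := by
  refine eq_of_forall_dual (k := k) fun φ => ?_
  have h1 : lc (φ ∘ₗ LinearMap.mulRight k y) =
      ∑ i ∈ s, LinearMap.mulRight k (antipode k (w i)) ∘ₗ (lc φ ∘ₗ LinearMap.mulRight k (z i)) := by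
    ext b
    rw [lc_comp_mulRight e]
    simp
  have h2 := hX (φ ∘ₗ LinearMap.mulRight k y)
  rw [h1, map_sum] at h2
  rw [Finset.sum_congr rfl fun i _ => LinearMap.trace_comp_comm' _ _, ← map_sum] at h2
  have h3 : ∑ i ∈ s, (lc φ ∘ₗ LinearMap.mulRight k (z i)) ∘ₗ
      LinearMap.mulRight k (antipode k (w i)) = Coalgebra.counit (R := k) y • lc φ := by
    ext b
    simp only [LinearMap.sum_apply, LinearMap.comp_apply, LinearMap.mulRight_apply, mul_assoc,
      LinearMap.smul_apply]
    rw [← map_sum, ← Finset.mul_sum, hy]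
    simp
  rw [h3, map_smul, ← hX] at h2
  rw [map_smul, ← h2]
  rfl

end RegularCharacter

namespace IsBisemisimple

variable {ℓ : B →ₗ[k] k} {Λ : B}

theorem ne_zero (hb : IsBisemisimple ℓ Λ) : ℓ ≠ 0 := by
  rintro h0
  have := hb.map_one
  rw [h0] at this
  exact zero_ne_one this

theorem apply_Λ (hb : IsBisemisimple ℓ Λ) : ℓ Λ = 1 := by
  simpa using hb.apply_mul 1

variable [FiniteDimensional k B]

theorem Λ_mul (hb : IsBisemisimple ℓ Λ) (y : B) : Λ * y = Coalgebra.counit (R := k) y • Λ := by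
  have h1 : Λ * y = ℓ (Λ * y) • Λ := by
    rw [← sub_eq_zero]
    refine hb.isLeftInt.nondeg hb.ne_zero fun b => ?_
    rw [mul_sub, map_sub, ← mul_assoc, hb.mul_eq, mul_smul_comm, hb.mul_eq, smul_mul_assoc,
      map_smul, map_smul, map_smul, hb.apply_Λ]
    simp [mul_comm]
  have h2 := congr_arg (Coalgebra.counit (R := k)) h1
  rw [Bialgebra.counit_mul, map_smul, smul_eq_mul, mul_comm] at h2
  rw [h1, ← mul_right_cancel₀ hb.counit_ne_zero h2]

theorem antipode_four (hb : IsBisemisimple ℓ Λ) (r : B) :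
    antipode k (antipode k (antipode k (antipode k r))) = r := by
  obtain ⟨η, a, ha, hla, hη, hS⟩ := radford hb.isLeftInt hb.ne_zero
  have ha1 : a = 1 := by
    have h1 := hla 1
    rw [hb.map_one, one_smul, lc_one, hb.map_one, one_smul] at h1
    exact h1.symm
  have h2 := hS (Bialgebra.counitAlgHom k B) (fun h => by
    have h3 := hη h Λ
    rw [hb.apply_mul, hb.Λ_mul, map_smul, hb.apply_Λ] at h3
    simpa using h3) r
  have h4 : (Bialgebra.counitAlgHom k B).toLinearMap = Coalgebra.counit := rfl
  rw [h4, rc_counit, lc_counit, ha1] at h2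
  simpa using h2

theorem lc_apply (hb : IsBisemisimple ℓ Λ) (h : B) : lc ℓ h = ℓ h • 1 := by
  obtain ⟨a, ha, hla⟩ := hb.isLeftInt.exists_distinguished hb.ne_zero
  have h1 := hla 1
  rw [hb.map_one, one_smul, lc_one, hb.map_one, one_smul] at h1
  rw [hla, ← h1]

theorem antipode_two [CharZero k] (hb : IsBisemisimple ℓ Λ) (r : B) :
    antipode k (antipode k r) = r := by
  obtain ⟨n, u, hu, hn, hX⟩ := exists_regular_character k B
  set X := ∑ i, u i i with hXd
  have hεX : Coalgebra.counit (R := k) X = n := by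
    rw [hXd, map_sum]
    simp [hu.counit_apply]
  have hn0 : (n : k) ≠ 0 := by
    intro h0
    rw [Nat.cast_eq_zero] at h0
    rw [h0, eq_comm, Module.finrank_zero_iff] at hn
    have h1 := hb.map_one
    rw [Subsingleton.elim (1 : B) 0, map_zero] at h1
    exact zero_ne_one h1
  have hℓX : ℓ X = 1 := by
    have h1 : lc ℓ = ℓ.smulRight (1 : B) := by ext h; exact hb.lc_apply h
    rw [hX, h1, LinearMap.trace_smulRight, hb.map_one]
  have hXX : X * X = (n : k) • X := by
    rw [← hεX]
    refine regular_character_mul hX (s := Finset.univ)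
      (z := fun i : Fin n × Fin n => u i.1 i.2) (w := fun i => u i.2 i.1) ?_ ?_
    · rw [hXd, map_sum, Fintype.sum_prod_type]
      simp_rw [hu.comul_apply]
    · rw [Fintype.sum_prod_type_right, hεX]
      simp_rw [hu.sum_antipode_mul]
      simp [Nat.cast_smul_eq_nsmul]
  have hSX : antipode k (antipode k X) = X := by
    refine eq_of_forall_dual (k := k) fun φ => ?_
    have h1 : φ (antipode k (antipode k X)) = (φ ∘ₗ antipode k ∘ₗ antipode k) X := rfl
    rw [h1, hX, hX]
    have h2 : lc (φ ∘ₗ antipode k ∘ₗ antipode k) =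
        (antipode k ∘ₗ antipode k) ∘ₗ (lc φ ∘ₗ antipode k ∘ₗ antipode k) := by
      ext b
      simp only [LinearMap.comp_apply]
      rw [lc_antipode_sq, hb.antipode_four]
    have h3 : (lc φ ∘ₗ antipode k ∘ₗ antipode k) ∘ₗ (antipode k ∘ₗ antipode k) = lc φ := by
      ext b
      simp [hb.antipode_four]
    rw [h2, LinearMap.trace_comp_comm', h3]
  let U : B →ₗ[k] B := antipode k ∘ₗ antipode k
  have hUU : U * U = 1 := by ext b; exact hb.antipode_four b
  let F : B →ₗ[k] B := LinearMap.mulLeft k ((n : k)⁻¹ • X) ∘ₗ U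
  have hS2 : ∀ a b : B, antipode k (antipode k (a * b)) =
      antipode k (antipode k a) * antipode k (antipode k b) := by
    intro a b
    rw [HopfAlgebra.antipode_mul_antidistrib, HopfAlgebra.antipode_mul_antidistrib]
  have hFF : ∀ b, F (F b) = (n : k)⁻¹ • (X * b) := by
    intro b
    simp only [F, U, LinearMap.comp_apply, LinearMap.mulLeft_apply, hS2, map_smul, hSX,
      hb.antipode_four]
    rw [← mul_assoc, smul_mul_smul_comm, hXX, smul_smul, mul_assoc, inv_mul_cancel₀ hn0, mul_one,
      smul_mul_assoc]
  have hF : F * F * F = F := by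
    ext b
    change F (F (F b)) = _
    rw [hFF]
    simp only [F, U, LinearMap.comp_apply, LinearMap.mulLeft_apply, smul_mul_assoc, mul_smul_comm]
    rw [← mul_assoc, hXX, smul_mul_assoc, smul_smul _ (n : k), inv_mul_cancel₀ hn0, one_smul]
  obtain ⟨m, hm⟩ := exists_trace_eq_intCast hF
  rw [hb.trace_eq _ F fun r => rfl, map_smul, hℓX, smul_eq_mul, mul_one] at hm
  have hU : LinearMap.trace k B U = Module.finrank k B * m := by
    rw [hb.trace_eq 1 U fun r => (one_mul _).symm, hb.map_one, ← hm, ← hn]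
    field_simp
  have hm0 : m ≠ 0 := by
    rintro rfl
    rw [Int.cast_zero, mul_eq_zero, inv_eq_zero, or_iff_left hn0] at hm
    exact hb.counit_ne_zero hm
  have h1 : U ≠ -1 := by
    intro h1
    have h2 := LinearMap.congr_fun h1 1
    simp only [U, LinearMap.comp_apply, HopfAlgebra.antipode_one, LinearMap.neg_apply,
      Module.End.one_apply] at h2
    have h3 := congr_arg ℓ h2
    rw [map_neg, hb.map_one] at h3
    have : (2 : k) = 0 := by linear_combination h3
    exact two_ne_zero this
  exact LinearMap.congr_fun (eq_one_of_trace_eq_mul hUU h1 hm0 hU) r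

end IsBisemisimple

end HopfFour

namespace HopfFour

open HopfAlgebra (antipode)

theorem isSemisimpleRing_of_isNilpotent {k R : Type*} [Field k] [Ring R] [Algebra k R]
    [FiniteDimensional k R] (h : ∀ a : R, (∀ b, IsNilpotent (b * a)) → a = 0) :
    IsSemisimpleRing R := by
  have : IsArtinianRing R := isArtinian_of_tower k inferInstance
  rw [IsArtinianRing.isSemisimpleRing_iff_jacobson, eq_bot_iff]
  intro a ha
  obtain ⟨m, hm⟩ := IsSemiprimaryRing.isNilpotent (R := R)
  refine h a fun b => ⟨m, ?_⟩
  have h3 := Ideal.pow_mem_pow (Ideal.mul_mem_left _ b ha) m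
  rw [hm] at h3
  exact h3

section Coalgebra

variable {k : Type*} [Field k] {C : Type*} [AddCommGroup C] [Module k C] [Coalgebra k C]

theorem isLC_top : IsLC (k := k) (⊤ : Submodule k C) := fun _ _ _ => trivial

theorem isRC_top : IsRC (k := k) (⊤ : Submodule k C) := fun _ _ _ => trivial

variable [FiniteDimensional k C]

theorem isSemisimpleRing_dualAlg_top
    (hnd : ∀ φ : C →ₗ[k] k, (∀ ψ, IsNilpotent (rc (conv ψ φ))) → φ = 0) :
    IsSemisimpleRing (dualAlg (isRC_top (k := k) (C := C))) := by
  refine isSemisimpleRing_of_isNilpotent (k := k) fun a ha => ?_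
  obtain ⟨φ, rfl⟩ := toDualAlg_surjective isRC_top a
  have h1 : φ = 0 := by
    refine hnd φ fun ψ => ?_
    obtain ⟨m, hm⟩ := ha (toDualAlg isRC_top ψ)
    rw [← toDualAlg_conv] at hm
    refine ⟨m, ?_⟩
    have h5 : ∀ (i : ℕ) (v : (⊤ : Submodule k C)),
        ((((toDualAlg isRC_top (conv ψ φ)) ^ i : dualAlg (isRC_top (k := k) (C := C))) :
          Module.End k (⊤ : Submodule k C)) v : C) = ((rc (conv ψ φ)) ^ i) v := by
      intro i
      induction i with
      | zero => intro v; rfl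
      | succ i ih =>
        intro v
        rw [pow_succ, pow_succ, Module.End.mul_apply, ← toDualAlg_apply isRC_top, ← ih]
        rfl
    ext v
    have h6 := h5 m ⟨v, trivial⟩
    rw [hm] at h6
    exact h6.symm
  rw [h1, map_zero]

/-- The matrix entries of a family of matrix corepresentations form a basis of the coalgebra. -/
structure IsPeterWeyl {n : ℕ} {d : Fin n → ℕ} (e : ∀ i, Matrix (Fin (d i)) (Fin (d i)) C) :
    Prop where
  pos : ∀ i, 0 < d i
  corep : ∀ i, IsCorep k (e i)
  linearIndependent : LinearIndependent k
    fun s : Σ i, Fin (d i) × Fin (d i) => e s.1 s.2.1 s.2.2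
  span_eq : Submodule.span k (Set.range
    fun s : Σ i, Fin (d i) × Fin (d i) => e s.1 s.2.1 s.2.2) = ⊤

theorem exists_isPeterWeyl [IsAlgClosed k]
    (hss : IsSemisimpleRing (dualAlg (isRC_top (k := k) (C := C)))) :
    ∃ (n : ℕ) (d : Fin n → ℕ) (e : ∀ i, Matrix (Fin (d i)) (Fin (d i)) C),
      IsPeterWeyl (k := k) e := by
  obtain ⟨n, d, hd, ⟨Ψ⟩⟩ := IsSemisimpleRing.exists_algEquiv_pi_matrix_of_isAlgClosed k
    (dualAlg (isRC_top (k := k) (C := C)))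
  have h1 := fun i => exists_corep_of_algHom isRC_top isLC_top
    ((Pi.evalAlgHom k (fun i => Matrix (Fin (d i)) (Fin (d i)) k) i).comp Ψ.toAlgHom)
  choose e he _ hφ using h1
  have hφ' : ∀ (φ : C →ₗ[k] k) i j l, φ (e i j l) = Ψ (toDualAlg isRC_top φ) i j l :=
    fun φ i j l => hφ i φ j l
  refine ⟨n, d, e, fun i => Nat.pos_of_ne_zero (hd i).out, he, ?_, ?_⟩
  · rw [Fintype.linearIndependent_iff]
    intro c hc s
    classical
    obtain ⟨φ, hφs⟩ := toDualAlg_surjective isRC_top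
      (Ψ.symm (fun i => Matrix.of fun j l => if s = ⟨i, (j, l)⟩ then 1 else 0))
    have h2 := congr_arg φ hc
    rw [map_sum, map_zero] at h2
    simp_rw [map_smul, hφ', hφs, AlgEquiv.apply_symm_apply] at h2
    simpa using h2
  · by_contra hne
    obtain ⟨v, hv⟩ : ∃ v, v ∉ Submodule.span k (Set.range
        fun s : Σ i, Fin (d i) × Fin (d i) => e s.1 s.2.1 s.2.2) := by
      by_contra! hall
      exact hne (eq_top_iff.2 fun v _ => hall v)
    obtain ⟨φ, hφv, hφ0⟩ := Submodule.exists_le_ker_of_notMem hv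
    apply hφv
    have h3 : Ψ (toDualAlg isRC_top φ) = 0 := by
      funext i
      ext j l
      rw [← hφ']
      exact hφ0 (Submodule.subset_span ⟨⟨i, (j, l)⟩, rfl⟩)
    rw [map_eq_zero_iff _ Ψ.injective, toDualAlg_eq_zero_iff isRC_top isLC_top] at h3
    exact h3 v trivial

end Coalgebra

end HopfFour

namespace HopfFour

open HopfAlgebra (antipode)

section Coalgebra

variable {k : Type*} [Field k] {C : Type*} [AddCommGroup C] [Module k C] [Coalgebra k C]
  {n : ℕ} {d : Fin n → ℕ} {e : ∀ i, Matrix (Fin (d i)) (Fin (d i)) C}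

theorem IsPeterWeyl.exists_eq_sum_trace (he : IsPeterWeyl (k := k) e) {x : C}
    (hx : ∀ φ : C →ₗ[k] k, rc φ x = lc φ x) : ∃ c : Fin n → k, x = ∑ i, c i • ∑ j, e i j j := by
  obtain ⟨φ, hφ⟩ := exists_dual_family he.linearIndependent
  have h1 : ∀ i a b c l y, φ ⟨i, (a, b)⟩ (rc (φ ⟨i, (c, l)⟩) y) =
      if b = c then φ ⟨i, (a, l)⟩ y else 0 := by
    intro i a b c l y
    have h2 : conv (φ ⟨i, (a, b)⟩) (φ ⟨i, (c, l)⟩) =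
        (if b = c then φ ⟨i, (a, l)⟩ else 0 : C →ₗ[k] k) := by
      refine LinearMap.ext_on he.span_eq ?_
      rintro _ ⟨⟨i', j, m⟩, rfl⟩
      have h3 : ∀ (i : Fin n) (a b : Fin (d i)) (i' : Fin n) (j m : Fin (d i')),
          φ ⟨i, (a, b)⟩ (e i' j m) = if (⟨i, (a, b)⟩ : Σ i, Fin (d i) × Fin (d i)) = ⟨i', (j, m)⟩
            then 1 else 0 := fun i a b i' j m => hφ ⟨i, (a, b)⟩ ⟨i', (j, m)⟩
      rw [conv_apply]
      simp only
      rw [(he.corep i').rc, map_sum]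
      simp_rw [map_smul, h3]
      by_cases hi : i = i'
      · subst hi
        by_cases hbc : b = c
        · subst hbc
          rw [if_pos rfl, h3, Finset.sum_eq_single b]
          · simp [Prod.ext_iff, ← ite_and, and_comm]
          · intro t _ ht; simp [Prod.ext_iff, ht.symm]
          · simp
        · rw [if_neg hbc]
          refine Finset.sum_eq_zero fun t _ => ?_
          by_cases hct : c = t
          · have : ¬ b = t := fun h => hbc (h.trans hct.symm)
            simp [Prod.ext_iff, this]
          · simp [Prod.ext_iff, hct]
      · split_ifs <;> simp [hi, h3]
    have h4 := LinearMap.congr_fun h2 y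
    rw [conv_apply] at h4
    rw [h4]
    split_ifs <;> rfl
  have h5 : ∀ i a b l, φ ⟨i, (a, l)⟩ x = if l = a then φ ⟨i, (b, b)⟩ x else 0 := by
    intro i a b l
    have h6 := h1 i a b b l x
    rw [hx, ← apply_rc, h1, if_pos rfl] at h6
    exact h6.symm
  refine ⟨fun i => φ ⟨i, (⟨0, he.pos i⟩, ⟨0, he.pos i⟩)⟩ x, ?_⟩
  have h7 := sum_dual_family hφ (v := x) (by rw [he.span_eq]; trivial)
  rw [Fintype.sum_sigma] at h7
  conv_lhs => rw [← h7]
  refine Finset.sum_congr rfl fun i _ => ?_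
  rw [Fintype.sum_prod_type, Finset.smul_sum]
  refine Finset.sum_congr rfl fun j _ => ?_
  simp_rw [h5 i j ⟨0, he.pos i⟩]
  simp

end Coalgebra

section Character

variable {k : Type*} [Field k] {B : Type*} [Ring B] [HopfAlgebra k B]

variable (k) in
/-- `x` is the character of a matrix corepresentation. -/
def IsChar (x : B) : Prop :=
  ∃ (ι : Type) (_ : Fintype ι) (_ : DecidableEq ι) (u : Matrix ι ι B),
    IsCorep k u ∧ x = ∑ i, u i i

theorem IsChar.one : IsChar k (1 : B) :=
  ⟨Unit, inferInstance, inferInstance, Matrix.of fun _ _ => 1,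
    ⟨fun i j => by simpa using (IsGL.one (k := k) (H := B)).1, fun i j => by simp⟩, by simp⟩

theorem IsChar.mul {x y : B} (hx : IsChar k x) (hy : IsChar k y) : IsChar k (x * y) := by
  obtain ⟨ι, _, _, u, hu, rfl⟩ := hx
  obtain ⟨κ, _, _, v, hv, rfl⟩ := hy
  refine ⟨ι × κ, inferInstance, inferInstance, _, hu.mul hv, ?_⟩
  rw [Fintype.sum_prod_type, Finset.sum_mul_sum]
  rfl

theorem IsChar.pow {x : B} (hx : IsChar k x) (n : ℕ) : IsChar k (x ^ n) := by
  induction n with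
  | zero => rw [pow_zero]; exact IsChar.one
  | succ n ih => rw [pow_succ]; exact ih.mul hx

theorem IsChar.antipode {x : B} (hx : IsChar k x) : IsChar k (antipode k x) := by
  obtain ⟨ι, _, _, u, hu, rfl⟩ := hx
  exact ⟨ι, inferInstance, inferInstance, _, hu.antipode, by simp⟩

theorem IsChar.map {H : Type*} [Ring H] [HopfAlgebra k H] {x : B} (hx : IsChar k x)
    (i : B →ₐc[k] H) : IsChar k (i x) := by
  obtain ⟨ι, _, _, u, hu, rfl⟩ := hx
  exact ⟨ι, inferInstance, inferInstance, _, hu.map i, by simp⟩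

theorem IsChar.rc_eq_lc {x : B} (hx : IsChar k x) (φ : B →ₗ[k] k) : rc φ x = lc φ x := by
  obtain ⟨ι, _, _, u, hu, rfl⟩ := hx
  exact hu.rc_sum_diag φ

theorem exists_trace_eq_natCast_of_mul_self {ι : Type*} [Fintype ι] [DecidableEq ι]
    {W : Matrix ι ι k} (h : W * W = W) : ∃ m : ℕ, W.trace = m := by
  obtain ⟨m, hm⟩ := exists_trace_eq_natCast (P := W.toLin') (by
    rw [Module.End.mul_eq_comp, ← Matrix.toLin'_mul, h])
  exact ⟨m, by rw [← hm, Matrix.trace_toLin'_eq]⟩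

theorem IsChar.exists_trL_eq [CharZero k] [FiniteDimensional k B] [Nontrivial B] {x : B}
    (hx : IsChar k x) : ∃ m : ℕ, trL (k := k) x = Module.finrank k B * m := by
  obtain ⟨ι, _, _, u, hu, rfl⟩ := hx
  have hn : (Module.finrank k B : k) ≠ 0 := Nat.cast_ne_zero.2 Module.finrank_pos.ne'
  obtain ⟨m, hm⟩ := exists_trace_eq_natCast_of_mul_self
    (W := Matrix.of fun i j => (Module.finrank k B : k)⁻¹ * trL (k := k) (u i j)) (by
      ext i j
      have h1 := hu.trL i j
      rw [Matrix.mul_apply]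
      simp only [Matrix.of_apply]
      rw [Finset.sum_congr rfl fun l _ => mul_mul_mul_comm _ _ _ _, ← Finset.mul_sum, h1]
      field_simp)
  refine ⟨m, ?_⟩
  rw [← hm, map_sum, Matrix.trace, Finset.mul_sum]
  refine Finset.sum_congr rfl fun i _ => ?_
  rw [Matrix.diag_apply, Matrix.of_apply, mul_inv_cancel_left₀ hn]

theorem IsChar.exists_apply_eq {ℓ : B →ₗ[k] k} (hl : IsLeftInt ℓ) (h1 : ℓ 1 = 1) {x : B}
    (hx : IsChar k x) : ∃ m : ℕ, ℓ x = m := by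
  obtain ⟨ι, _, _, u, hu, rfl⟩ := hx
  obtain ⟨m, hm⟩ := exists_trace_eq_natCast_of_mul_self (W := Matrix.of fun i j => ℓ (u i j)) (by
      ext i j
      have h2 := congr_arg ℓ (hl (u i j))
      rw [hu.rc, map_sum, map_smul, h1] at h2
      simp only [map_smul, smul_eq_mul, mul_one] at h2
      rw [Matrix.mul_apply]
      simp only [Matrix.of_apply]
      rw [← h2]
      exact Finset.sum_congr rfl fun _ _ => mul_comm _ _)
  exact ⟨m, by rw [← hm, map_sum]; rfl⟩

end Character

end HopfFour

namespace HopfFour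

open HopfAlgebra (antipode)

namespace IsBisemisimple

variable {k : Type*} [Field k] {B : Type*} [Ring B] [HopfAlgebra k B]
  [FiniteDimensional k B] [CharZero k] {ℓ : B →ₗ[k] k} {Λ : B}

theorem nontrivial (hb : IsBisemisimple ℓ Λ) : Nontrivial B := by
  refine ⟨1, 0, fun h => ?_⟩
  have h1 := hb.map_one
  rw [h, map_zero] at h1
  exact zero_ne_one h1

theorem finrank_ne_zero (hb : IsBisemisimple ℓ Λ) : (Module.finrank k B : k) ≠ 0 := by
  have := hb.nontrivial
  exact Nat.cast_ne_zero.2 Module.finrank_pos.ne'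

theorem counit_Λ (hb : IsBisemisimple ℓ Λ) :
    Coalgebra.counit (R := k) Λ = Module.finrank k B := by
  have h1 := hb.trace_eq 1 1 fun r => by rw [hb.antipode_two, one_mul]; rfl
  rw [hb.map_one, mul_one, LinearMap.trace_one] at h1
  exact h1.symm

theorem trL_eq (hb : IsBisemisimple ℓ Λ) (a : B) :
    trL (k := k) a = Module.finrank k B * ℓ a := by
  rw [← hb.counit_Λ, trL_apply]
  exact hb.trace_eq a _ fun r => by rw [hb.antipode_two]; rfl

theorem apply_mul_comm (hb : IsBisemisimple ℓ Λ) (a b : B) : ℓ (a * b) = ℓ (b * a) := by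
  refine mul_left_cancel₀ hb.finrank_ne_zero ?_
  rw [← hb.trL_eq, ← hb.trL_eq, trL_apply, trL_apply, LinearMap.mulLeft_mul, LinearMap.mulLeft_mul,
    LinearMap.trace_comp_comm']

theorem apply_antipode (hb : IsBisemisimple ℓ Λ) (a : B) : ℓ (antipode k a) = ℓ a := by
  have h1 : IsLeftInt (ℓ ∘ₗ antipode k) := by
    intro h
    have h2 := congr_arg (antipode k) (lc_antipode ℓ h)
    rw [hb.antipode_two, hb.lc_apply, map_smul, HopfAlgebra.antipode_one] at h2
    rw [← h2]
    rfl
  obtain ⟨c, hc⟩ := hb.isLeftInt.unique hb.ne_zero h1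
  have h3 := LinearMap.congr_fun hc 1
  have h4 := LinearMap.congr_fun hc a
  simp only [LinearMap.comp_apply, HopfAlgebra.antipode_one, LinearMap.smul_apply, hb.map_one,
    smul_eq_mul, mul_one] at h3 h4
  rw [h4, ← h3, one_mul]

theorem antipode_Λ (hb : IsBisemisimple ℓ Λ) : antipode k Λ = Λ := by
  have h1 : Λ * antipode k Λ = Coalgebra.counit (R := k) Λ • Λ := by
    rw [hb.Λ_mul, HopfAlgebra.counit_antipode]
  have h2 : Λ * antipode k Λ = Coalgebra.counit (R := k) Λ • antipode k Λ := by
    conv_lhs => rw [← hb.antipode_two Λ]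
    rw [hb.antipode_two, ← hb.antipode_two (Λ * _), HopfAlgebra.antipode_mul_antidistrib,
      hb.antipode_two, hb.Λ_mul, HopfAlgebra.counit_antipode, map_smul]
  rw [h1] at h2
  exact (smul_right_injective B hb.counit_ne_zero h2).symm

theorem apply_Λ_eq_trace (hb : IsBisemisimple ℓ Λ) (φ : B →ₗ[k] k) :
    φ Λ = LinearMap.trace k B (lc φ) := by
  obtain ⟨n, u, hu, hn, hX⟩ := exists_regular_character k B
  rw [← hX]
  congr 1
  have h1 : ∀ y, (∑ i, u i i) * y = Coalgebra.counit (R := k) y • ∑ i, u i i := by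
    intro y
    obtain ⟨s, hs⟩ := exists_comul (k := k) y
    refine regular_character_mul hX hs ?_
    rw [← hb.antipode_two (∑ i ∈ s, antipode k i.2 * i.1), map_sum]
    simp_rw [HopfAlgebra.antipode_mul_antidistrib, hb.antipode_two]
    have h2 := HopfAlgebra.mul_antipode_rTensor_comul_apply (R := k) y
    rw [hs] at h2
    simp only [map_sum, LinearMap.rTensor_tmul, LinearMap.mul'_apply] at h2
    rw [h2, Algebra.algebraMap_eq_smul_one, map_smul, HopfAlgebra.antipode_one]
  have h2 := h1 Λ
  rw [hb.mul_eq, map_sum] at h2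
  simp only [hu.counit_apply, if_true, Finset.sum_const, Finset.card_univ, Fintype.card_fin,
    nsmul_eq_mul, mul_one] at h2
  rw [hb.counit_Λ, ← hn] at h2
  exact smul_right_injective B (hn ▸ hb.finrank_ne_zero) h2

theorem eq_zero_of_rc_Λ (hb : IsBisemisimple ℓ Λ) {φ : B →ₗ[k] k} (h : rc φ Λ = 0) : φ = 0 := by
  obtain ⟨x, rfl⟩ := hb.isLeftInt.exists_mulLeft hb.ne_zero φ
  rw [hb.isLeftInt.rc_mulLeft] at h
  have h1 : ℓ ∘ₗ LinearMap.mulRight k Λ = Coalgebra.counit := by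
    ext b
    exact hb.apply_mul b
  rw [h1, rc_counit] at h
  have h2 := congr_arg (antipode k) h
  rw [hb.antipode_two, map_zero] at h2
  ext b
  simp [h2]

theorem exists_isPeterWeyl [IsAlgClosed k] (hb : IsBisemisimple ℓ Λ) :
    ∃ (n : ℕ) (d : Fin n → ℕ) (e : ∀ i, Matrix (Fin (d i)) (Fin (d i)) B),
      IsPeterWeyl (k := k) e := by
  refine HopfFour.exists_isPeterWeyl (isSemisimpleRing_dualAlg_top fun φ hφ => ?_)
  refine hb.eq_zero_of_rc_Λ (eq_of_forall_dual (k := k) fun ψ => ?_)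
  rw [← conv_apply, map_zero, ← hb.antipode_Λ]
  change ((conv ψ φ) ∘ₗ antipode k) Λ = 0
  rw [hb.apply_Λ_eq_trace]
  have h1 : lc ((conv ψ φ) ∘ₗ antipode k) =
      antipode k ∘ₗ (rc (conv ψ φ) ∘ₗ antipode k) := by
    ext b
    have h2 := congr_arg (antipode k) (rc_antipode (conv ψ φ) b)
    rw [hb.antipode_two] at h2
    exact h2.symm
  have h3 : (rc (conv ψ φ) ∘ₗ antipode k) ∘ₗ antipode k = rc (conv ψ φ) := by
    ext b
    simp [hb.antipode_two]
  rw [h1, LinearMap.trace_comp_comm', h3]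
  exact (LinearMap.isNilpotent_trace_of_isNilpotent (hφ ψ)).eq_zero

end IsBisemisimple

section Orthogonality

variable {k : Type*} [Field k] {B : Type*} [Ring B] [HopfAlgebra k B]
  {ι κ : Type*} [Fintype ι] [DecidableEq ι] [Fintype κ] [DecidableEq κ]

theorem IsLeftInt.sum_apply_smul {ℓ : B →ₗ[k] k} (hl : IsLeftInt ℓ) {e : Matrix ι ι B}
    (he : IsCorep k e) {f : Matrix κ κ B} (hf : IsCorep k f) (i b : ι) (c t : κ) :
    ∑ l, ℓ (e l b * antipode k (f c t)) • e i l =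
      ∑ j, ℓ (e i b * antipode k (f c j)) • f j t := by
  have h1 : ∀ j, ∑ m, (∑ l, ℓ (e l b * antipode k (f c m)) • e i l) * antipode k (f m j) =
      ℓ (e i b * antipode k (f c j)) • 1 := by
    intro j
    have h2 := (he.mul hf.antipode).rc ℓ (i, j) (b, c)
    simp only [Matrix.of_apply] at h2
    rw [hl, Fintype.sum_prod_type_right] at h2
    rw [h2]
    simp_rw [Finset.sum_mul, smul_mul_assoc]
  have h3 : ∑ j, (∑ m, (∑ l, ℓ (e l b * antipode k (f c m)) • e i l) * antipode k (f m j)) *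
      f j t = ∑ j, ℓ (e i b * antipode k (f c j)) • f j t := by
    refine Finset.sum_congr rfl fun j _ => ?_
    rw [h1, smul_mul_assoc, one_mul]
  rw [← h3]
  simp_rw [Finset.sum_mul (Finset.univ : Finset κ), mul_assoc]
  rw [Finset.sum_comm]
  simp_rw [← Finset.mul_sum, hf.sum_antipode_mul]
  simp [mul_ite]

theorem IsBisemisimple.apply_char_self [FiniteDimensional k B] [CharZero k] {ℓ : B →ₗ[k] k} {Λ : B}
    (hb : IsBisemisimple ℓ Λ) [Nonempty ι] {e : Matrix ι ι B} (he : IsCorep k e)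
    (hi : LinearIndependent k fun s : ι × ι => e s.1 s.2) :
    ℓ ((∑ i, e i i) * antipode k (∑ i, e i i)) = 1 := by
  obtain ⟨φ, hφ⟩ := exists_dual_family hi
  have hφ' : ∀ a b i j, φ (a, b) (e i j) = if a = i ∧ b = j then 1 else 0 := by
    intro a b i j
    have := hφ (a, b) (i, j)
    simpa [Prod.ext_iff] using this
  have h1 : ∀ i b c t l, ℓ (e l b * antipode k (e c t)) =
      if l = t then ℓ (e i b * antipode k (e c i)) else 0 := by
    intro i b c t l
    have h2 := congr_arg (φ (i, l)) (hb.isLeftInt.sum_apply_smul he he i b c t)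
    simp only [map_sum, map_smul, hφ', smul_eq_mul, mul_ite, mul_one, mul_zero, true_and] at h2
    simpa [ite_and] using h2
  have hcard : (Fintype.card ι : k) ≠ 0 := Nat.cast_ne_zero.2 Fintype.card_ne_zero
  have h3 : ∀ i l, ℓ (e i l * antipode k (e l i)) = (Fintype.card ι : k)⁻¹ := by
    intro i l
    have h4 := congr_arg ℓ (he.sum_antipode_mul l l)
    rw [if_pos rfl, hb.map_one, map_sum] at h4
    simp_rw [hb.apply_mul_comm (antipode k _)] at h4
    rw [Finset.sum_congr rfl fun j _ => (h1 i l l j j).trans (if_pos rfl), Finset.sum_const,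
      Finset.card_univ, nsmul_eq_mul] at h4
    exact eq_inv_of_mul_eq_one_right h4
  obtain ⟨i₀⟩ := ‹Nonempty ι›
  rw [map_sum (antipode k), Finset.sum_mul_sum, map_sum]
  simp_rw [map_sum]
  have h5 : ∀ i j, ℓ (e i i * antipode k (e j j)) = if i = j then (Fintype.card ι : k)⁻¹ else 0 := by
    intro i j
    rw [h1 i₀]
    split_ifs with h
    · subst h; exact h3 _ _
    · rfl
  simp_rw [h5]
  simp [hcard]

theorem IsBisemisimple.apply_char_ne [FiniteDimensional k B] [CharZero k] {ℓ : B →ₗ[k] k} {Λ : B}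
    (hb : IsBisemisimple ℓ Λ) {n : ℕ} {d : Fin n → ℕ} {e : ∀ i, Matrix (Fin (d i)) (Fin (d i)) B}
    (he : IsPeterWeyl (k := k) e) {i j : Fin n} (hij : i ≠ j) :
    ℓ ((∑ a, e i a a) * antipode k (∑ a, e j a a)) = 0 := by
  obtain ⟨φ, hφ⟩ := exists_dual_family he.linearIndependent
  have hφ' : ∀ (i : Fin n) (a b : Fin (d i)) (i' : Fin n) (j m : Fin (d i')),
      φ ⟨i, (a, b)⟩ (e i' j m) = if (⟨i, (a, b)⟩ : Σ i, Fin (d i) × Fin (d i)) = ⟨i', (j, m)⟩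
        then 1 else 0 := fun i a b i' j m => hφ ⟨i, (a, b)⟩ ⟨i', (j, m)⟩
  rw [map_sum (antipode k), Finset.sum_mul_sum, map_sum]
  simp_rw [map_sum]
  refine Finset.sum_eq_zero fun a _ => Finset.sum_eq_zero fun b _ => ?_
  have h2 := congr_arg (φ ⟨i, (a, a)⟩)
    (hb.isLeftInt.sum_apply_smul (he.corep i) (he.corep j) a a b b)
  simp only [map_sum, map_smul, hφ', smul_eq_mul, mul_ite, mul_one, mul_zero] at h2
  simpa [Prod.ext_iff, hij] using h2

end Orthogonality

end HopfFour

namespace HopfFour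

open HopfAlgebra (antipode)

theorem aeval_mul_of_mul_eq {R ι : Type*} [Ring R] [Fintype ι] [DecidableEq ι] {N : Matrix ι ι ℤ}
    {h : R} {v : ι → R} (hN : ∀ i, h * v i = ∑ m, N m i • v m) (P : Polynomial ℤ) (i : ι) :
    Polynomial.aeval h P * v i = ∑ m, (Polynomial.aeval N P) m i • v m := by
  induction P using Polynomial.induction_on' generalizing i with
  | add P Q hP hQ => simp [add_mul, hP, hQ, add_smul, Finset.sum_add_distrib]
  | monomial n a =>
    have h1 : ∀ (n : ℕ) i, h ^ n * v i = ∑ m, (N ^ n) m i • v m := by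
      intro n
      induction n with
      | zero => intro i; simp [Matrix.one_apply]
      | succ n ih =>
        intro i
        rw [pow_succ, mul_assoc, hN, Finset.mul_sum]
        simp_rw [mul_smul_comm, ih, Finset.smul_sum, smul_smul]
        rw [Finset.sum_comm]
        refine Finset.sum_congr rfl fun m _ => ?_
        rw [pow_succ, Matrix.mul_apply, Finset.sum_smul]
        exact Finset.sum_congr rfl fun l _ => by rw [mul_comm]
    rw [Polynomial.aeval_monomial, Polynomial.aeval_monomial, mul_assoc, h1, Finset.mul_sum]
    refine Finset.sum_congr rfl fun m _ => ?_
    rw [← Algebra.smul_def, ← Algebra.smul_def, Matrix.smul_apply, smul_smul, smul_eq_mul]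

variable {k : Type*} [Field k] {B : Type*} [Ring B] [HopfAlgebra k B]
  [FiniteDimensional k B] [CharZero k] {ℓ : B →ₗ[k] k} {Λ : B}

theorem IsBisemisimple.exists_fusion [IsAlgClosed k] (hb : IsBisemisimple ℓ Λ) {x : B}
    (hx : IsChar k x) : ∃ (n : ℕ) (A : Matrix (Fin n) (Fin n) ℤ),
      Polynomial.aeval (x * antipode k x) (A * A.transpose).charpoly = 0 := by
  obtain ⟨n, d, e, he⟩ := hb.exists_isPeterWeyl
  set v : Fin n → B := fun i => ∑ a, e i a a with hv
  have hv' : ∀ i, IsChar k (v i) := fun i =>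
    ⟨Fin (d i), inferInstance, inferInstance, e i, he.corep i, rfl⟩
  have horth : ∀ i j, ℓ (v i * antipode k (v j)) = if i = j then 1 else 0 := by
    intro i j
    split_ifs with hij
    · subst hij
      have : Nonempty (Fin (d i)) := ⟨⟨0, he.pos i⟩⟩
      refine hb.apply_char_self (he.corep i) ?_
      have := he.linearIndependent.comp (fun s : Fin (d i) × Fin (d i) => ⟨i, s⟩)
        (fun a b hab => by simpa using hab)
      exact this
    · exact hb.apply_char_ne he hij
  have hexp : ∀ y : B, IsChar k y → y = ∑ l, ℓ (y * antipode k (v l)) • v l := by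
    intro y hy
    obtain ⟨c, hc⟩ := he.exists_eq_sum_trace hy.rc_eq_lc
    have h1 : ∀ l, ℓ (y * antipode k (v l)) = c l := by
      intro l
      rw [hc, Finset.sum_mul, map_sum]
      simp_rw [smul_mul_assoc, map_smul]
      have h2 : ∀ i, ℓ ((∑ j, e i j j) * antipode k (v l)) = if i = l then 1 else 0 :=
        fun i => horth i l
      simp_rw [h2]
      simp
    simp_rw [h1]
    exact hc
  have hM : ∀ l i, ∃ m : ℕ, ℓ (x * v i * antipode k (v l)) = m := fun l i =>
    ((hx.mul (hv' i)).mul (hv' l).antipode).exists_apply_eq hb.isLeftInt hb.map_one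
  choose M hM using hM
  refine ⟨n, Matrix.of fun l i => (M l i : ℤ), ?_⟩
  set A : Matrix (Fin n) (Fin n) ℤ := Matrix.of fun l i => (M l i : ℤ) with hA
  have h1 : ∀ i, x * v i = ∑ l, A l i • v l := by
    intro i
    rw [hexp _ (hx.mul (hv' i))]
    refine Finset.sum_congr rfl fun l _ => ?_
    rw [hM, hA, Matrix.of_apply, Nat.cast_smul_eq_nsmul, natCast_zsmul]
  have h2 : ∀ i, antipode k x * v i = ∑ l, A i l • v l := by
    intro i
    rw [hexp _ (hx.antipode.mul (hv' i))]
    refine Finset.sum_congr rfl fun l _ => ?_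
    have h3 : ℓ (antipode k x * v i * antipode k (v l)) = M i l := by
      rw [← hM, ← hb.apply_antipode, HopfAlgebra.antipode_mul_antidistrib,
        HopfAlgebra.antipode_mul_antidistrib, hb.antipode_two, hb.antipode_two, ← mul_assoc,
        hb.apply_mul_comm, ← mul_assoc]
    rw [h3, hA, Matrix.of_apply, Nat.cast_smul_eq_nsmul, natCast_zsmul]
  have h4 : ∀ i, x * antipode k x * v i = ∑ m, (A * A.transpose) m i • v m := by
    intro i
    rw [mul_assoc, h2, Finset.mul_sum]
    simp_rw [mul_smul_comm, h1, Finset.smul_sum, smul_smul]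
    rw [Finset.sum_comm]
    refine Finset.sum_congr rfl fun m _ => ?_
    rw [Matrix.mul_apply, Finset.sum_smul]
    exact Finset.sum_congr rfl fun l _ => by rw [Matrix.transpose_apply, mul_comm]
  have h5 := hexp 1 IsChar.one
  rw [← mul_one (Polynomial.aeval _ _), h5, Finset.mul_sum]
  refine Finset.sum_eq_zero fun i _ => ?_
  rw [mul_smul_comm, aeval_mul_of_mul_eq h4, Matrix.aeval_self_charpoly]
  simp

end HopfFour

namespace HopfFour

section Eigenvalues

variable {k V : Type*} [Field k] [AddCommGroup V] [Module k V] [FiniteDimensional k V]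

theorem trace_pow_restrict_maxGenEigenspace (L : Module.End k V) (μ : k)
    (i : ℕ) (h : ∀ v ∈ L.maxGenEigenspace μ, (L ^ i) v ∈ L.maxGenEigenspace μ) :
    LinearMap.trace k _ ((L ^ i).restrict h) =
      Module.finrank k (L.maxGenEigenspace μ) * μ ^ i := by
  have h0 : ∀ v ∈ L.maxGenEigenspace μ, L v ∈ L.maxGenEigenspace μ :=
    L.mapsTo_maxGenEigenspace_of_comm (Commute.refl L) μ
  have hn : IsNilpotent (L.restrict h0 - algebraMap k _ μ) :=
    L.isNilpotent_restrict_maxGenEigenspace_sub_algebraMap μ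
  rw [← Module.End.pow_restrict i h0 h]
  induction i with
  | zero => simp
  | succ i ih =>
    rw [pow_succ, Module.End.mul_eq_comp,
      LinearMap.trace_comp_eq_mul_of_commute_of_isNilpotent μ
        ((Commute.refl (L.restrict h0)).pow_left i) hn,
      ih (Module.End.pow_apply_mem_of_forall_mem i h0), pow_succ]
    ring

theorem exists_eigenvalue_family [IsAlgClosed k] [CharZero k] (L : Module.End k V) :
    ∃ lam : Fin (Module.finrank k V) → k,
      (∀ i : ℕ, LinearMap.trace k V (L ^ i) = ∑ j, lam j ^ i) ∧
      ∀ μ : k, L.HasEigenvalue μ ↔ ∃ j, lam j = μ := by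
  classical
  have hds : DirectSum.IsInternal fun μ => L.maxGenEigenspace μ :=
    DirectSum.isInternal_submodule_of_iSupIndep_of_iSup_eq_top
      L.independent_maxGenEigenspace L.iSup_maxGenEigenspace_eq_top
  have hfin : {μ | L.maxGenEigenspace μ ≠ ⊥}.Finite :=
    WellFoundedGT.finite_ne_bot_of_iSupIndep L.independent_maxGenEigenspace
  let ι := Σ μ : hfin.toFinset, Fin (Module.finrank k (L.maxGenEigenspace μ.1))
  have h1 : ∀ i : ℕ, LinearMap.trace k V (L ^ i) = ∑ s : ι, (s.1 : k) ^ i := by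
    intro i
    have hmaps : ∀ μ, Set.MapsTo (L ^ i) (L.maxGenEigenspace μ) (L.maxGenEigenspace μ) :=
      fun μ => L.mapsTo_maxGenEigenspace_of_comm ((Commute.refl L).pow_right i) μ
    rw [LinearMap.trace_eq_sum_trace_restrict' hds hfin hmaps, Fintype.sum_sigma,
      ← Finset.sum_coe_sort]
    refine Finset.sum_congr rfl fun μ _ => ?_
    have := trace_pow_restrict_maxGenEigenspace L μ.1 i (hmaps μ.1)
    rw [this]
    simp
  have hcard : Fintype.card ι = Module.finrank k V := by
    have := h1 0
    simp only [pow_zero, LinearMap.trace_one, Finset.sum_const, Finset.card_univ,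
      nsmul_eq_mul, mul_one] at this
    exact_mod_cast this.symm
  let e := Fintype.equivFinOfCardEq hcard
  refine ⟨fun j => (e.symm j).1, fun i => ?_, fun μ => ?_⟩
  · rw [h1, ← e.symm.sum_comp]
  · have h2 : L.HasEigenvalue μ ↔ L.maxGenEigenspace μ ≠ ⊥ := by
      refine ⟨fun h hb => h ?_, fun h hb => h ?_⟩
      · rw [eq_bot_iff, ← hb]
        exact Module.End.eigenspace_le_maxGenEigenspace
      · rw [eq_bot_iff]
        have h4 : L.eigenspace μ = ⊥ := hb
        rw [Module.End.eigenspace_def, LinearMap.ker_eq_bot] at h4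
        intro v hv
        obtain ⟨n, hn⟩ := (L.mem_maxGenEigenspace μ v).1 hv
        have h5 : Function.Injective ((L - μ • (1 : Module.End k V)) ^ n) := by
          rw [Module.End.coe_pow]
          exact Function.Injective.iterate (by simpa using h4) n
        exact h5 (hn.trans (map_zero _).symm)
    rw [h2]
    constructor
    · intro h
      have h3 : 0 < Module.finrank k (L.maxGenEigenspace μ) :=
        Nat.pos_of_ne_zero fun h0 => h (Submodule.finrank_eq_zero.1 h0)
      refine ⟨e ⟨⟨μ, by simpa using h⟩, ⟨0, h3⟩⟩, by simp⟩
    · rintro ⟨j, rfl⟩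
      exact hfin.mem_toFinset.1 (e.symm j).1.2

end Eigenvalues

section Newton

variable {k : Type*} [Field k] [CharZero k]

theorem exists_int_esymm {n : ℕ} {lam : Fin n → k} (hintg : ∀ j, IsIntegral ℤ (lam j))
    {c : ℤ} {m : ℕ → ℤ} (hm : ∀ i, ∑ j, lam j ^ i = c * m i) :
    ∃ a : ℕ → ℤ, ∀ i, MvPolynomial.aeval lam (MvPolynomial.esymm (Fin n) k i) = a i ∧
      c ∣ i * a i := by
  suffices h : ∀ i, ∃ a : ℤ, MvPolynomial.aeval lam (MvPolynomial.esymm (Fin n) k i) = a ∧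
      c ∣ i * a by
    choose a ha using h
    exact ⟨a, ha⟩
  intro i
  induction i using Nat.strong_induction_on with
  | _ i ih =>
  rcases Nat.eq_zero_or_pos i with rfl | hi
  · exact ⟨1, by simp [MvPolynomial.esymm_zero], by simp⟩
  have h1 : ∃ b : ℤ, (i : k) * MvPolynomial.aeval lam (MvPolynomial.esymm (Fin n) k i) =
      ((c * b : ℤ) : k) := by
    have h2 := congrArg (MvPolynomial.aeval lam) (MvPolynomial.mul_esymm_eq_sum (Fin n) k i)
    simp only [map_mul, map_natCast, map_pow, map_neg, map_one, map_sum] at h2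
    have h3 : ∀ l, MvPolynomial.aeval lam (MvPolynomial.psum (Fin n) k l) =
        ((c * m l : ℤ) : k) := by
      intro l
      simp [MvPolynomial.psum, hm]
    rw [h2]
    have h4 : ∀ l < i, ∃ b : ℤ,
        MvPolynomial.aeval lam (MvPolynomial.esymm (Fin n) k l) = b :=
      fun l hl => ⟨_, (ih l hl).choose_spec.1⟩
    choose! b hb using h4
    refine ⟨(-1) ^ (i + 1) * ∑ x ∈ Finset.HasAntidiagonal.antidiagonal i with x.1 < i,
      (-1) ^ x.1 * b x.1 * m x.2, ?_⟩
    rw [Finset.mul_sum, Finset.mul_sum, Finset.mul_sum]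
    push_cast
    refine Finset.sum_congr rfl fun x hx => ?_
    rw [hb _ (Finset.mem_filter.1 hx).2, h3]
    push_cast
    ring
  obtain ⟨b, hb⟩ := h1
  have hik : (i : k) ≠ 0 := by exact_mod_cast hi.ne'
  have h5 : IsIntegral ℤ (MvPolynomial.aeval lam (MvPolynomial.esymm (Fin n) k i)) := by
    simp only [MvPolynomial.esymm, map_sum, map_prod, MvPolynomial.aeval_X]
    exact IsIntegral.sum _ fun s _ => IsIntegral.prod _ fun j _ => hintg j
  have h6 : MvPolynomial.aeval lam (MvPolynomial.esymm (Fin n) k i) =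
      algebraMap ℚ k ((c * b : ℤ) / (i : ℚ)) := by
    rw [map_div₀, map_natCast, map_intCast, ← hb, mul_div_cancel_left₀ _ hik]
  rw [h6, isIntegral_algebraMap_iff (algebraMap ℚ k).injective,
    IsIntegrallyClosed.isIntegral_iff] at h5
  obtain ⟨a, ha⟩ := h5
  have h7 : MvPolynomial.aeval lam (MvPolynomial.esymm (Fin n) k i) = (a : k) := by
    rw [h6, ← ha]
    simp
  refine ⟨a, h7, b, ?_⟩
  rw [h7] at hb
  exact_mod_cast hb

theorem prod_sub_eq_sum_esymm {n : ℕ} (lam : Fin n → k) (t : k) :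
    ∏ j, (t - lam j) = ∑ i ∈ Finset.range (n + 1),
      (-1) ^ i * (MvPolynomial.aeval lam (MvPolynomial.esymm (Fin n) k i) * t ^ (n - i)) := by
  have h := congrArg (Polynomial.eval t)
    (Multiset.prod_X_sub_X_eq_sum_esymm (Finset.univ.val.map lam))
  rw [Multiset.map_map] at h
  simp only [MvPolynomial.aeval_esymm_eq_multiset_esymm]
  have h2 : (Multiset.map ((fun t => Polynomial.X - Polynomial.C t) ∘ lam)
      Finset.univ.val).prod = ∏ j, (Polynomial.X - Polynomial.C (lam j)) := rfl
  rw [h2, Polynomial.eval_prod] at h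
  simpa [Polynomial.eval_finsetSum] using h

theorem ne_zero_of_apply_four_eq_zero {n p N : ℕ} (hn : n = p ^ N) (hp : p.Prime) (hodd : Odd p)
    {lam : Fin n → k} (hintg : ∀ j, IsIntegral ℤ (lam j)) {m : ℕ → ℤ}
    (hm : ∀ i, ∑ j, lam j ^ i = n * m i) (h4 : ∃ j, lam j = 4) (j : Fin n) :
    lam j ≠ 0 := by
  subst hn
  intro hj
  obtain ⟨a, ha⟩ := exists_int_esymm (c := ((p ^ N : ℕ) : ℤ)) hintg
    (by simpa using hm)
  have hdvd : ∀ i, 0 < i → i < p ^ N → (p : ℤ) ∣ a i := by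
    intro i hi0 hi
    by_contra hpa
    have h1 : IsCoprime ((p ^ N : ℕ) : ℤ) (a i) := by
      push_cast
      refine IsCoprime.pow_left ?_
      rwa [Prime.coprime_iff_not_dvd (Nat.prime_iff_prime_int.1 hp)]
    have h2 : ((p ^ N : ℕ) : ℤ) ∣ i := h1.dvd_of_dvd_mul_right (ha i).2
    exact absurd (Nat.le_of_dvd hi0 (Int.natCast_dvd_natCast.1 h2)) (not_le.2 hi)
  have hlast : a (p ^ N) = 0 := by
    have h1 := prod_sub_eq_sum_esymm lam 0
    rw [Finset.prod_eq_zero (Finset.mem_univ j) (by rw [hj, sub_zero]),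
      Finset.sum_range_succ, Finset.sum_eq_zero, (ha _).1] at h1
    · simpa using h1
    · intro i hi
      rw [zero_pow (Nat.sub_ne_zero_of_lt (Finset.mem_range.1 hi))]
      simp
  obtain ⟨l, hl⟩ := h4
  have h0 : a 0 = 1 := by
    have := (ha 0).1
    rw [MvPolynomial.esymm_zero, map_one] at this
    exact_mod_cast this.symm
  have h5 : (∑ i ∈ Finset.range (p ^ N + 1), (-1) ^ i * (a i * 4 ^ (p ^ N - i)) : ℤ) = 0 := by
    have h1 := prod_sub_eq_sum_esymm lam 4
    rw [Finset.prod_eq_zero (Finset.mem_univ l) (by rw [hl, sub_self])] at h1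
    simp_rw [fun i => (ha i).1] at h1
    exact_mod_cast h1.symm
  have hpos : 0 < p ^ N := pow_pos hp.pos N
  rw [Finset.sum_range_succ, hlast, Finset.sum_range_eq_add_Ico _ hpos, h0] at h5
  have h6 : (p : ℤ) ∣ ∑ i ∈ Finset.Ico 1 (p ^ N), (-1) ^ i * (a i * 4 ^ (p ^ N - i)) := by
    refine Finset.dvd_sum fun i hi => ?_
    obtain ⟨hi1, hi2⟩ := Finset.mem_Ico.1 hi
    exact ((hdvd i hi1 hi2).mul_right _).mul_left _
  have h7 : (p : ℤ) ∣ 4 ^ p ^ N := by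
    have h8 : (4 : ℤ) ^ p ^ N =
        -∑ i ∈ Finset.Ico 1 (p ^ N), (-1) ^ i * (a i * 4 ^ (p ^ N - i)) := by
      simp only [pow_zero, one_mul, Nat.sub_zero, zero_mul, mul_zero, add_zero] at h5
      linarith
    rw [h8]
    exact h6.neg_right
  have h9 : p ∣ 4 := by
    have := (Nat.prime_iff_prime_int.1 hp).dvd_of_dvd_pow h7
    exact_mod_cast this
  have h10 : p = 2 := (Nat.prime_dvd_prime_iff_eq hp Nat.prime_two).1
    (hp.dvd_of_dvd_pow (show p ∣ 2 ^ 2 from h9))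
  rw [h10] at hodd
  exact absurd hodd (by decide)

end Newton

section Positivity

theorem eq_one_of_sum_eq_card {ι : Type*} [Fintype ι] {z : ι → ℝ} (hz : ∀ j, 0 < z j)
    (hs : ∑ j, z j = Fintype.card ι) (hp : 1 ≤ ∏ j, z j) (j : ι) : z j = 1 := by
  by_contra hj
  have h1 : ∑ i, Real.log (z i) < ∑ i, (z i - 1) :=
    Finset.sum_lt_sum (fun i _ => Real.log_le_sub_one_of_pos (hz i))
      ⟨j, Finset.mem_univ j, Real.log_lt_sub_one_of_pos (hz j) hj⟩
  rw [← Real.log_prod (fun i _ => (hz i).ne'), Finset.sum_sub_distrib, hs] at h1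
  simp only [Finset.sum_const, Finset.card_univ, nsmul_eq_mul, mul_one, sub_self] at h1
  exact absurd (Real.log_nonneg hp) (not_le.2 h1)

open ComplexOrder in
theorem exists_nonneg_of_aeval_charpoly_eq_zero {n : ℕ} (A : Matrix (Fin n) (Fin n) ℤ) {z : ℂ}
    (hz : Polynomial.aeval z (A * A.transpose).charpoly = 0) : ∃ r : ℝ, 0 ≤ r ∧ (r : ℂ) = z := by
  set M : Matrix (Fin n) (Fin n) ℂ := A.map (Int.castRingHom ℂ) with hM
  have h1 : (M * M.conjTranspose) = (A * A.transpose).map (Int.castRingHom ℂ) := by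
    ext i j
    simp [hM, Matrix.mul_apply]
  have hpsd := Matrix.posSemidef_self_mul_conjTranspose M
  have h2 : z ∈ (M * M.conjTranspose).charpoly.roots := by
    rw [Polynomial.mem_roots (Matrix.charpoly_monic _).ne_zero, h1, Matrix.charpoly_map,
      Polynomial.IsRoot, Polynomial.eval_map]
    exact hz
  rw [hpsd.1.roots_charpoly_eq_eigenvalues] at h2
  simp only [Multiset.mem_map, Finset.mem_val, Finset.mem_univ, true_and] at h2
  obtain ⟨i, hi⟩ := h2
  exact ⟨_, hpsd.eigenvalues_nonneg i, hi⟩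

theorem eq_one_of_aeval_charpoly_eq_zero {k : Type*} [Field k] [CharZero k] {ι : Type*}
    [Fintype ι] {n : ℕ} (A : Matrix (Fin n) (Fin n) ℤ) {lam : ι → k}
    (hlam : ∀ j, Polynomial.aeval (lam j) (A * A.transpose).charpoly = 0)
    (h0 : ∀ j, lam j ≠ 0) (hs : ∑ j, lam j = Fintype.card ι) {a : ℤ} (ha : ∏ j, lam j = a)
    (j : ι) : lam j = 1 := by
  have hintg : ∀ j, IsAlgebraic ℚ (lam j) := fun j =>
    IsIntegral.isAlgebraic (IsIntegral.tower_top (R := ℤ) ⟨_, Matrix.charpoly_monic _, hlam j⟩)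
  let K := algebraicClosure ℚ k
  let mu : ι → K := fun j => ⟨lam j, mem_algebraicClosure_iff.2 (hintg j)⟩
  have : Algebra.IsAlgebraic ℚ K := algebraicClosure.isAlgebraic ℚ k
  let φ : K →ₐ[ℚ] ℂ := IsAlgClosed.lift
  have hφ : Function.Injective φ := (φ : K →+* ℂ).injective
  have hK : Function.Injective (algebraMap K k) := (algebraMap K k).injective
  have hmu : ∀ j, (mu j : k) = lam j := fun _ => rfl
  have h1 : ∀ j, Polynomial.aeval (φ (mu j)) (A * A.transpose).charpoly = 0 := by
    intro j
    have h2 : Polynomial.aeval (mu j) (A * A.transpose).charpoly = 0 := by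
      apply Subtype.val_injective
      have := Polynomial.aeval_algebraMap_apply k (mu j) (A * A.transpose).charpoly
      exact this.symm.trans (hlam j)
    have h3 := Polynomial.aeval_algHom_apply (φ.restrictScalars ℤ) (mu j)
      (A * A.transpose).charpoly
    rw [h2, map_zero] at h3
    exact h3
  choose r hr0 hr using fun j => exists_nonneg_of_aeval_charpoly_eq_zero A (h1 j)
  have hmu0 : ∀ j, mu j ≠ 0 := fun j h => h0 j (by rw [← hmu, h]; rfl)
  have hrpos : ∀ j, 0 < r j := fun j => lt_of_le_of_ne (hr0 j) fun h =>
    hmu0 j (hφ (by rw [← hr, ← h]; simp))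
  have hsum : ∑ j, r j = Fintype.card ι := by
    have h2 : ∑ j, mu j = Fintype.card ι := by
      apply hK
      rw [map_sum, map_natCast]
      exact hs
    have h3 := congrArg φ h2
    simp_rw [map_sum, ← hr, map_natCast] at h3
    exact_mod_cast h3
  have hprod : ∏ j, r j = a := by
    have h2 : ∏ j, mu j = a := by
      apply hK
      rw [map_prod, map_intCast]
      exact ha
    have h3 := congrArg φ h2
    simp_rw [map_prod, ← hr, map_intCast] at h3
    exact_mod_cast h3
  have ha1 : 1 ≤ a := by
    have : (0 : ℝ) < a := hprod ▸ Finset.prod_pos fun j _ => hrpos j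
    exact_mod_cast this
  have h4 := eq_one_of_sum_eq_card hrpos hsum (by rw [hprod]; exact_mod_cast ha1) j
  have h5 : mu j = 1 := hφ (by rw [← hr, h4]; simp)
  rw [← hmu, h5]
  rfl

end Positivity

end HopfFour

namespace HopfFour

open HopfAlgebra (antipode)

theorem aeval_eq_zero_of_hasEigenvalue {k A : Type*} [Field k] [Ring A] [Algebra k A] {h : A}
    {P : Polynomial ℤ} (hP : Polynomial.aeval h P = 0) {μ : k}
    (hμ : Module.End.HasEigenvalue (LinearMap.mulLeft k h) μ) : Polynomial.aeval μ P = 0 := by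
  obtain ⟨v, hv⟩ := hμ.exists_hasEigenvector
  have h1 := Module.End.aeval_apply_of_hasEigenvector (p := P.map (algebraMap ℤ k)) hv
  have h2 : Polynomial.aeval (Algebra.lmul k A h) (P.map (algebraMap ℤ k)) = 0 := by
    rw [Polynomial.aeval_algHom_apply, Polynomial.aeval_map_algebraMap, hP, map_zero]
  have h3 : Algebra.lmul k A h = LinearMap.mulLeft k h := rfl
  rw [← h3, h2, LinearMap.zero_apply, eq_comm, smul_eq_zero] at h1
  have h4 := h1.resolve_right hv.2
  rwa [Polynomial.eval_map_algebraMap] at h4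

theorem hasEigenvalue_mulLeft {k A : Type*} [Field k] [Ring A] [Algebra k A] {h v : A} {μ : k}
    (hv : h * v = μ • v) (h0 : v ≠ 0) : Module.End.HasEigenvalue (LinearMap.mulLeft k h) μ :=
  Module.End.hasEigenvalue_of_hasEigenvector
    (Module.End.hasEigenvector_iff.2 ⟨Module.End.mem_eigenspace_iff.2 hv, h0⟩)

variable {k : Type*} [Field k] {H : Type*} [Ring H] [HopfAlgebra k H]
variable {B : Type*} [Ring B] [HopfAlgebra k B]

theorem IsCorep.of_map {ι : Type*} [Fintype ι] [DecidableEq ι] {u : Matrix ι ι B}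
    {i : B →ₐc[k] H} (hi : Function.Injective i) (hu : IsCorep k (u.map i)) : IsCorep k u := by
  refine ⟨fun a b => ?_, fun a b => ?_⟩
  · have hinj : Function.Injective (TensorProduct.map (i : B →ₗc[k] H).toLinearMap
        (i : B →ₗc[k] H).toLinearMap) :=
      TensorProduct.map_injective_of_flat_flat _ _ hi hi
    apply hinj
    have h1 := hu.comul_apply a b
    have h2 := CoalgHomClass.map_comp_comul_apply i (u a b)
    refine h2.trans (h1.trans ?_)
    simp [map_sum]
  · have h1 := hu.counit_apply a b
    rw [← h1, Matrix.map_apply]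
    simp

variable [IsAlgClosed k] [CharZero k] [FiniteDimensional k H]

theorem exists_eigenvalue_family_of_isChar [FiniteDimensional k B] [Nontrivial B] {h : B}
    (hh : IsChar k h) :
    ∃ (lam : Fin (Module.finrank k B) → k) (m : ℕ → ℤ),
      (∀ i, ∑ j, lam j ^ i = Module.finrank k B * m i) ∧
      (∀ i, trL (k := k) (h ^ i) = ∑ j, lam j ^ i) ∧
      ∀ μ, Module.End.HasEigenvalue (LinearMap.mulLeft k h) μ ↔ ∃ j, lam j = μ := by
  obtain ⟨lam, h1, h2⟩ := exists_eigenvalue_family (LinearMap.mulLeft k h)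
  choose m hm using fun i => (hh.pow i).exists_trL_eq
  have h3 : ∀ i, trL (k := k) (h ^ i) = ∑ j, lam j ^ i := fun i => by
    rw [← h1, LinearMap.pow_mulLeft, trL_apply]
  exact ⟨lam, fun i => (m i : ℤ), fun i => by rw [← h3, hm]; simp, h3, h2⟩

theorem IsBisemisimple.not_linearIndependent_corep [FiniteDimensional k B]
    {ℓ : B →ₗ[k] k} {Λ : B} (hb : IsBisemisimple ℓ Λ) {p N : ℕ} (hp : p.Prime) (hodd : Odd p)
    (hdim : Module.finrank k H = p ^ N) {i : B →ₐc[k] H} (hi : Function.Injective i)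
    {u : Matrix (Fin 2) (Fin 2) B} (hu : IsCorep k u) :
    ¬ LinearIndependent k fun s : Fin 2 × Fin 2 => u s.1 s.2 := by
  intro hli
  have hB := hb.nontrivial
  have hH : Nontrivial H := hi.nontrivial
  have hχ : IsChar k (∑ a, u a a) := ⟨Fin 2, inferInstance, inferInstance, u, hu, rfl⟩
  obtain ⟨n, A, hA⟩ := hb.exists_fusion hχ
  have hℓ := hb.apply_char_self hu hli
  have hε : Coalgebra.counit (R := k) ((∑ a, u a a) * antipode k (∑ a, u a a)) = 4 := by
    rw [Bialgebra.counit_mul, HopfAlgebra.counit_antipode, map_sum]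
    simp_rw [hu.counit_apply]
    simp
    norm_num
  have hh : IsChar k ((∑ a, u a a) * antipode k (∑ a, u a a)) := hχ.mul hχ.antipode
  set h := (∑ a, u a a) * antipode k (∑ a, u a a)
  have hΛ : Λ ≠ 0 := fun h0 => hb.counit_ne_zero (by rw [h0, map_zero])
  have hiΛ : i Λ ≠ 0 := fun h0 => hΛ (hi (by rw [h0, map_zero]))
  have hmul : h * Λ = (4 : k) • Λ := by rw [hb.mul_eq, hε]
  have himul : i h * i Λ = (4 : k) • i Λ := by rw [← _root_.map_mul, hmul, map_smul]
  have hiA : Polynomial.aeval (i h) (A * A.transpose).charpoly = 0 := by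
    have := Polynomial.aeval_algHom_apply ((i : B →ₐ[k] H).restrictScalars ℤ) h
      (A * A.transpose).charpoly
    rw [hA, map_zero] at this
    exact this
  obtain ⟨mu, m, hm1, -, hm3⟩ := exists_eigenvalue_family_of_isChar (hh.map i)
  obtain ⟨lam, m', hl1, hl2, hl3⟩ := exists_eigenvalue_family_of_isChar hh
  have hmu : ∀ j, mu j ≠ 0 := ne_zero_of_apply_four_eq_zero hdim hp hodd
    (fun j => ⟨_, Matrix.charpoly_monic _,
      aeval_eq_zero_of_hasEigenvalue hiA ((hm3 _).2 ⟨j, rfl⟩)⟩) hm1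
    ((hm3 4).1 (hasEigenvalue_mulLeft himul hiΛ))
  have hlA : ∀ j, Polynomial.aeval (lam j) (A * A.transpose).charpoly = 0 := fun j =>
    aeval_eq_zero_of_hasEigenvalue hA ((hl3 _).2 ⟨j, rfl⟩)
  have hlam : ∀ j, lam j ≠ 0 := by
    intro j hj
    obtain ⟨v, hv⟩ := ((hl3 0).2 ⟨j, hj⟩).exists_hasEigenvector
    have h1 : h * v = (0 : k) • v := Module.End.mem_eigenspace_iff.1 hv.1
    obtain ⟨j', hj'⟩ := (hm3 0).1 (hasEigenvalue_mulLeft (v := i v)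
      (by rw [← _root_.map_mul, h1, map_smul]) fun h0 => hv.2 (hi (by rw [h0, map_zero])))
    exact hmu j' hj'
  obtain ⟨a, ha⟩ := exists_int_esymm (c := (Module.finrank k B : ℤ))
    (fun j => (⟨_, Matrix.charpoly_monic _, hlA j⟩ : IsIntegral ℤ (lam j))) (by simpa using hl1)
  have hprod : ∏ j, lam j = a (Module.finrank k B) := by
    rw [← (ha _).1]
    simp only [MvPolynomial.esymm, map_sum, map_prod, MvPolynomial.aeval_X]
    have : Finset.powersetCard (Module.finrank k B)
        (Finset.univ : Finset (Fin (Module.finrank k B))) = {Finset.univ} := by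
      simpa using Finset.powersetCard_self (Finset.univ : Finset (Fin (Module.finrank k B)))
    rw [this, Finset.sum_singleton]
  have hsum : ∑ j, lam j = Fintype.card (Fin (Module.finrank k B)) := by
    have h1 := hl2 1
    rw [pow_one, hb.trL_eq, hℓ, mul_one] at h1
    simpa using h1.symm
  obtain ⟨j, hj⟩ := (hl3 4).1 (hasEigenvalue_mulLeft hmul hΛ)
  have h1 := eq_one_of_aeval_charpoly_eq_zero A hlA hlam hsum hprod j
  rw [hj] at h1
  norm_num at h1

theorem TaftPair.not_exists_isSimple {k : Type*} [Field k] [IsAlgClosed k] [CharZero k]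
    {H : Type*} [Ring H] [HopfAlgebra k H] {p : ℕ} {q : k} {g x : H} {χ : H →ₐ[k] k}
    {f : H →ₗ[k] k} (h : TaftPair p q g x χ f) (hodd : Odd p) (hxp : x ^ p = 0)
    {D : Submodule k H} (hD : HopfClass.IsSimpleSubcoalgWrt k (HopfClass.comulL k H) D) :
    Module.finrank k D ≠ 4 := by
  intro hD4
  have hfd := h.finiteDimensional
  obtain ⟨ζ, β, e, -, he⟩ := h.exists_taftCorep hD hD4
  have hβ := h.taftCorep_eq_zero hodd hxp he
  obtain ⟨ℓ₀, Λ₀, a1, a2, a3, a4, -, a6, a7⟩ := h.exists_integral hodd hxp he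
  obtain ⟨ℓ', c, b1, b2, b3, b4⟩ := h.exists_ker_trace a1 a2 a3 a4 a6 a7
  obtain ⟨B, i1, i2, i, hi, hB, hmem⟩ := h.taftFun.exists_hopf_vanishing
  have hBfd : FiniteDimensional k B :=
    Module.Finite.of_injective (i : B →ₗc[k] H).toLinearMap hi
  obtain ⟨ℓ, Λ, hb⟩ := h.exists_isBisemisimple hi hB b1 b2 b3 b4
  have hspan : ∀ (a b : Fin 2), e a b ∈
      Submodule.span k (Set.range fun s : Fin 2 × Fin 2 => e s.1 s.2) :=
    fun a b => Submodule.subset_span ⟨(a, b), rfl⟩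
  have hE : ∀ a b, ∃ y, i y = e a b := by
    intro a b
    refine hmem (Submodule.span k (Set.range fun s : Fin 2 × Fin 2 => e s.1 s.2)) ?_ ?_ ?_ _
      (hspan a b)
    · intro φ v hv
      induction hv using Submodule.span_induction with
      | mem v hv =>
        obtain ⟨s, rfl⟩ := hv
        simp only [he.corep.lc]
        exact sum_mem fun l _ => Submodule.smul_mem _ _ (hspan _ _)
      | zero => simp
      | add v w _ _ hv hw => rw [map_add]; exact add_mem hv hw
      | smul c v _ hv => rw [map_smul]; exact Submodule.smul_mem _ _ hv
    · intro φ v hv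
      induction hv using Submodule.span_induction with
      | mem v hv =>
        obtain ⟨s, rfl⟩ := hv
        simp only [he.corep.rc]
        exact sum_mem fun l _ => Submodule.smul_mem _ _ (hspan _ _)
      | zero => simp
      | add v w _ _ hv hw => rw [map_add]; exact add_mem hv hw
      | smul c v _ hv => rw [map_smul]; exact Submodule.smul_mem _ _ hv
    · have h1 : Submodule.span k (Set.range fun s : Fin 2 × Fin 2 => e s.1 s.2) ≤
          LinearMap.ker f := by
        rw [Submodule.span_le]
        rintro _ ⟨⟨s, t⟩, rfl⟩
        have h2 : ∀ s t, f (e s t) = 0 := by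
          simp [Fin.forall_fin_two, he.f_00, he.f_01, he.f_10, he.f_11, hβ]
        exact h2 s t
      exact fun d hd => h1 hd
  choose u hu using hE
  have hu' : (Matrix.of u).map i = e := by ext a b; exact hu a b
  have hcorep : IsCorep k (Matrix.of u) := IsCorep.of_map hi (by rw [hu']; exact he.corep)
  refine hb.not_linearIndependent_corep h.prime hodd h.finrank_eq hi hcorep ?_
  refine LinearIndependent.of_comp (i : B →ₗc[k] H).toLinearMap ?_
  convert he.linearIndependent using 2 with s
  exact hu s.1 s.2

end HopfFour

open HopfClass in
/-- Let `p` be an odd prime and `H` a nonsemisimple, nonpointed, non-copointed Hopf algebra of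
dimension `p³` that contains a sub-Hopf algebra `T` isomorphic to a Taft algebra `T_{q′}` of
dimension `p²` and admits a surjective Hopf algebra map `π : H → T_q` onto a Taft algebra of
dimension `p²`. Then `H` contains no simple subcoalgebra of dimension 4. -/
theorem no_simple_four_dim_subcoalgebra
    (k : Type*) [Field k] [IsAlgClosed k] [CharZero k]
    (H : Type*) [Ring H] [HopfAlgebra k H] [FiniteDimensional k H]
    (p : ℕ) (hp : p.Prime) (hodd : Odd p)
    (hdim : Module.finrank k H = p ^ 3)
    (hnss : ¬ IsSemisimpleRing H) (hnp : ¬ IsPointed k H) (hncop : ¬ IsCopointed k H)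
    (q' : k) (T : Subalgebra k H) (hT : IsTaftSubalgebra k p q' T)
    (q : k) (B : Type*) [Ring B] [HopfAlgebra k B]
    (hB : IsTaftAlgebra k p q B)
    (π : H →ₐc[k] B) (hsurj : Function.Surjective π) :
    ¬ ∃ D : Submodule k H, IsSimpleSubcoalgWrt k (comulL k H) D ∧
      Module.finrank k ↥D = 4 := by
  rintro ⟨D, hD, hD4⟩
  obtain ⟨hq, hBdim, g₀, x₀, hg, hx, hgp, hxp, hgx, hadj⟩ := hB
  obtain ⟨χ, f, hf⟩ := HopfFour.exists_taftFun_self hp hq hBdim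
    (HopfFour.isGL_of_comul hg.1 hg.2) hx hgp hxp hgx hadj
  obtain ⟨g, x, h, hx0⟩ := HopfFour.exists_taftPair hp hdim hT hq (hf.comp π hsurj) hD
    (by rw [hD4]; norm_num)
  exact h.not_exists_isSimple hodd hx0 hD hD4
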